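/- The fifth group cohomology H^5(Γ_0(18), ℂ) has dimension 9 as a ℂ-vector space. -/

import Mathlib

/-- The congruence subgroup `Γ₀(N) ⊆ SL(4, ℤ)` consisting of matrices whose last row is
congruent to `(0,0,0,*)` modulo `N`, i.e. whose first three entries of the last row are
divisible by `N`. -/
def Gamma0 (N : ℕ) : Subgroup (Matrix.SpecialLinearGroup (Fin 4) ℤ) where
  carrier := {A | ∀ j : Fin 4, j ≠ 3 → (N : ℤ) ∣ A.1 3 j}
  one_mem' := by
    intro j hj
    simp [Matrix.one_apply_ne' hj]
  mul_mem' := by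
    intro A B hA hB j hj
    show (N : ℤ) ∣ (A.1 * B.1) 3 j
    rw [Matrix.mul_apply]
    refine Finset.dvd_sum fun k _ => ?_
    by_cases hk : k = 3
    · subst hk
      exact (hB j hj).mul_left _
    · exact (hA k hk).mul_right _
  inv_mem' := by
    intro A hA j hj
    have hAB : (A.1 : Matrix (Fin 4) (Fin 4) ℤ) * (A⁻¹).1 = 1 := by
      rw [← Matrix.SpecialLinearGroup.coe_mul, mul_inv_cancel,
        Matrix.SpecialLinearGroup.coe_one]
    set f : ℤ →+* ZMod N := Int.castRingHom (ZMod N) with hf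
    have hab : (A.1.map f) * ((A⁻¹).1.map f) = 1 := by
      rw [← Matrix.map_mul, hAB, Matrix.map_one f f.map_zero f.map_one]
    have ha0 : ∀ k : Fin 4, k ≠ 3 → (A.1.map f) 3 k = 0 := by
      intro k hk
      have := hA k hk
      simpa [Matrix.map_apply, hf, ZMod.intCast_zmod_eq_zero_iff_dvd] using this
    have hsum : ∀ i, ∑ k, (A.1.map f) 3 k * ((A⁻¹).1.map f) k i
        = (1 : Matrix (Fin 4) (Fin 4) (ZMod N)) 3 i := by
      intro i
      rw [← Matrix.mul_apply, hab]
    have hsum' : ∀ i, (A.1.map f) 3 3 * ((A⁻¹).1.map f) 3 i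
        = (1 : Matrix (Fin 4) (Fin 4) (ZMod N)) 3 i := by
      intro i
      have h := hsum i
      rw [Fin.sum_univ_four, ha0 0 (by decide), ha0 1 (by decide),
        ha0 2 (by decide), zero_mul, zero_mul, zero_mul, zero_add, zero_add,
        zero_add] at h
      exact h
    have hunit : (A.1.map f) 3 3 * ((A⁻¹).1.map f) 3 3 = 1 := by
      simpa [Matrix.one_apply] using hsum' 3
    have hzero : (A.1.map f) 3 3 * ((A⁻¹).1.map f) 3 j = 0 := by
      simpa [Matrix.one_apply_ne' hj] using hsum' j
    have hb : ((A⁻¹).1.map f) 3 j = 0 := by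
      calc ((A⁻¹).1.map f) 3 j
          = ((A.1.map f) 3 3 * ((A⁻¹).1.map f) 3 3) * ((A⁻¹).1.map f) 3 j := by
            rw [hunit, one_mul]
        _ = ((A⁻¹).1.map f) 3 3 * ((A.1.map f) 3 3 * ((A⁻¹).1.map f) 3 j) := by ring
        _ = 0 := by rw [hzero, mul_zero]
    show (N : ℤ) ∣ (A⁻¹).1 3 j
    rw [← ZMod.intCast_zmod_eq_zero_iff_dvd]
    simpa [Matrix.map_apply, hf] using hb

namespace Voronoi

/-- Local combinatorial description of a Voronoi domain: its minimal vectors are arranged in `B`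
blocks of size `n`, and its facets are obtained by omitting one vector from each block. -/
structure Chart {L : Type*} (Q : AddSubgroup (L → ℤ)) (Φ : Set (L → ℤ)) (φ : L → ℤ) where
  B : ℕ
  n : ℕ
  r : Fin B → Fin n → L
  r_inj : ∀ b j b' j', r b j = r b' j' → b = b' ∧ j = j'
  mem : ∀ x, φ x = 2 ↔ ∃ b j, r b j = x
  bal : ∀ q ∈ Q, ∀ b b', ∑ j, q (r b j) = ∑ j, q (r b' j)
  perfect : ∀ q ∈ Q, (∀ b j, q (r b j) = 0) → q = 0
  card : B * (n - 1) = 9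
  e : (Fin B → Fin n) → L → ℤ
  e_mem : ∀ s, e s ∈ Q
  e_form : ∀ s, φ + e s ∈ Φ
  e_val : ∀ s b j, e s (r b j) = if s b = j then 2 else 0

/-- A family of integral forms, regarded as functions on lines, with Voronoi neighbours given by
charts, and a linear order used for the Morse-theoretic contraction. -/
structure VoronoiData (L A : Type*) [AddCommGroup A] [LinearOrder A] [IsOrderedAddMonoid A] where
  Q : AddSubgroup (L → ℤ)
  Φ : Set (L → ℤ)
  Φ_sub : Φ ⊆ Q
  R : Set (L → ℤ)
  R_sub : R ⊆ Q
  R_nonneg : ∀ w ∈ R, ∀ x, 0 ≤ w x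
  α : (L → ℤ) →+ A
  α_inj : ∀ q ∈ Q, α q = 0 → q = 0
  R_pos : ∀ w ∈ R, 0 < α w
  two_le : ∀ φ ∈ Φ, ∀ ψ ∈ Φ, ∀ x, φ x = 2 → 2 ≤ ψ x
  wf : WellFounded fun φ ψ : Φ => α φ < α ψ
  fin : ∀ S : Set L, (∀ w ∈ R, ∃ x ∈ S, w x ≠ 0) → {φ | φ ∈ Φ ∧ ∀ x ∈ S, φ x = 2}.Finite
  nonempty : Φ.Nonempty
  chart : ∀ φ ∈ Φ, Nonempty (Chart Q Φ φ)
  D : (Fin 9 → L) → L → ℤ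
  D_mem : ∀ v, D v ∈ Q
  D_self : ∀ v i, D v (v i) = 0
  D_perm : ∀ v (σ : Equiv.Perm (Fin 9)) x, D (v ∘ σ) x = (Equiv.Perm.sign σ : ℤ) * D v x
  D_swap : ∀ (u : Fin 8 → L) a b, D (Fin.cons a u : Fin 9 → L) b = - D (Fin.cons b u : Fin 9 → L) a
  D_ne : ∀ φ ∈ Φ, ∀ c : Chart Q Φ φ, ∀ s : Fin c.B → Fin c.n, ∀ v : Fin 9 → L, Function.Injective v →
    (∀ i, ∃ b j, j ≠ s b ∧ c.r b j = v i) → D v ≠ 0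

namespace Chart

variable {L : Type*} {Q : AddSubgroup (L → ℤ)} {Φ : Set (L → ℤ)} {φ : L → ℤ} (c : Chart Q Φ φ)

lemma B_pos : 0 < c.B := by
  have := c.card
  rcases Nat.eq_zero_or_pos c.B with h | h
  · simp [h] at this
  · exact h

lemma two_le_n : 2 ≤ c.n := by
  have := c.card
  by_contra h
  have : c.n - 1 = 0 := by omega
  simp_all

lemma ext_r {q q' : L → ℤ} (hq : q ∈ Q) (hq' : q' ∈ Q) (h : ∀ b j, q (c.r b j) = q' (c.r b j)) :
    q = q' := by
  have := c.perfect (q - q') (Q.sub_mem hq hq') (fun b j => by simp [h])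
  exact sub_eq_zero.1 this

/-- The total weight of a form on any block. -/
def weight (q : L → ℤ) : ℤ := ∑ j, q (c.r ⟨0, c.B_pos⟩ j)

lemma weight_eq {q : L → ℤ} (hq : q ∈ Q) (b) : ∑ j, q (c.r b j) = c.weight q := c.bal q hq _ _

lemma e_comb {q : L → ℤ} (hq : q ∈ Q) :
    (2 * c.weight q ^ (c.B - 1)) • q = ∑ s : Fin c.B → Fin c.n, (∏ b, q (c.r b (s b))) • c.e s := by
  refine c.ext_r (Q.zsmul_mem hq _) (Q.sum_mem fun s _ => Q.zsmul_mem (c.e_mem s) _) fun b j => ?_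
  simp only [Pi.smul_apply, Finset.sum_apply, c.e_val, smul_eq_mul]
  have key := Finset.prod_univ_sum (fun _ : Fin c.B => (Finset.univ : Finset (Fin c.n)))
    (fun b' i => if b' = b then (if i = j then q (c.r b i) * 2 else 0) else q (c.r b' i))
  rw [Fintype.piFinset_univ] at key
  have h2 : ∀ s : Fin c.B → Fin c.n, (∏ b', if b' = b then
      (if s b' = j then q (c.r b (s b')) * 2 else 0) else q (c.r b' (s b')))
      = (∏ b', q (c.r b' (s b'))) * if s b = j then 2 else 0 := by
    intro s
    rw [← Finset.mul_prod_erase _ _ (Finset.mem_univ b),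
      ← Finset.mul_prod_erase _ (fun b' => q (c.r b' (s b'))) (Finset.mem_univ b)]
    rw [Finset.prod_congr rfl (g := fun b' => q (c.r b' (s b')))
      (fun x hx => by rw [if_neg (Finset.ne_of_mem_erase hx)])]
    split_ifs <;> (simp_all; try ring)
  rw [← Finset.sum_congr rfl (fun s _ => h2 s), ← key,
    ← Finset.mul_prod_erase _ _ (Finset.mem_univ b)]
  rw [Finset.prod_congr rfl (g := fun b' => c.weight q)
      (fun x hx => by simp only [if_neg (Finset.ne_of_mem_erase hx)]; exact c.weight_eq hq x)]
  simp
  ring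

lemma weight_pos {q : L → ℤ} (hq : q ∈ Q) (h0 : ∀ b j, 0 ≤ q (c.r b j)) (hne : q ≠ 0) :
    0 < c.weight q := by
  by_contra hcon
  apply hne
  refine c.perfect q hq fun b j => ?_
  have h1 := c.weight_eq hq b
  have h2 := Finset.single_le_sum (f := fun j => q (c.r b j)) (fun j _ => h0 b j)
    (Finset.mem_univ j)
  have := h0 b j
  omega

lemma exists_pos {q : L → ℤ} (hq : q ∈ Q) (h0 : ∀ b j, 0 ≤ q (c.r b j)) (hne : q ≠ 0) :
    ∃ s : Fin c.B → Fin c.n, ∀ b, 0 < q (c.r b (s b)) := by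
  have hT := c.weight_pos hq h0 hne
  have : ∀ b, ∃ j, 0 < q (c.r b j) := by
    intro b
    by_contra! h
    have h1 := c.weight_eq hq b
    have : ∑ j, q (c.r b j) ≤ 0 := Finset.sum_nonpos fun j _ => h j
    omega
  choose s hs using this
  exact ⟨s, hs⟩

variable {A : Type*} [AddCommGroup A] [LinearOrder A] [IsOrderedAddMonoid A] (α : (L → ℤ) →+ A)

lemma le_zero {q : L → ℤ} (hq : q ∈ Q) (h0 : ∀ b j, 0 ≤ q (c.r b j))
    (hs : ∀ s : Fin c.B → Fin c.n, (∀ b, 0 < q (c.r b (s b))) → α (c.e s) ≤ 0) : α q ≤ 0 := by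
  by_cases hne : q = 0
  · simp [hne]
  have hT := c.weight_pos hq h0 hne
  have h := congrArg α (c.e_comb hq)
  rw [map_zsmul, map_sum] at h
  have h1 : ∑ s : Fin c.B → Fin c.n, α ((∏ b, q (c.r b (s b))) • c.e s) ≤ 0 := by
    refine Finset.sum_nonpos fun s _ => ?_
    rw [map_zsmul]
    by_cases hp : ∀ b, 0 < q (c.r b (s b))
    · exact smul_nonpos_of_nonneg_of_nonpos (Finset.prod_nonneg fun b _ => h0 _ _) (hs s hp)
    · push Not at hp
      obtain ⟨b, hb⟩ := hp
      rw [Finset.prod_eq_zero (Finset.mem_univ b) (le_antisymm hb (h0 _ _)), zero_smul]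
  rw [← h] at h1
  by_contra hcon
  push Not at hcon
  exact absurd h1 (not_le.2 (smul_pos (by positivity) hcon))

lemma zero_le {q : L → ℤ} (hq : q ∈ Q) (h0 : ∀ b j, 0 ≤ q (c.r b j))
    (hs : ∀ s : Fin c.B → Fin c.n, (∀ b, 0 < q (c.r b (s b))) → 0 ≤ α (c.e s)) : 0 ≤ α q := by
  have := c.le_zero (-α) hq h0 (fun s h => by simpa using hs s h)
  simpa using this

lemma e_ne (s) : c.e s ≠ 0 := by
  intro h
  have := c.e_val s ⟨0, c.B_pos⟩ (s ⟨0, c.B_pos⟩)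
  simp [h] at this

lemma e_update_sub (s t : Fin c.B → Fin c.n) (b i) :
    c.e s - c.e (Function.update s b i) = c.e (Function.update t b (s b)) -
      c.e (Function.update t b i) := by
  refine c.ext_r (Q.sub_mem (c.e_mem _) (c.e_mem _)) (Q.sub_mem (c.e_mem _) (c.e_mem _)) ?_
  intro b' j
  simp only [Pi.sub_apply, c.e_val]
  by_cases h : b' = b
  · subst h; simp
  · simp [Function.update_of_ne h]

/-- A facet with smallest `α`-slope. -/
lemma exists_base : ∃ t : Fin c.B → Fin c.n,
    ∀ s b, α (c.e (Function.update s b (t b))) ≤ α (c.e s) := by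
  have : Nonempty (Fin c.B → Fin c.n) := ⟨fun _ => ⟨0, by have := c.two_le_n; omega⟩⟩
  obtain ⟨t, ht⟩ := Finite.exists_min (fun s => α (c.e s))
  refine ⟨t, fun s b => ?_⟩
  have h := congrArg α (c.e_update_sub s t b (t b))
  rw [Function.update_eq_self, map_sub, map_sub] at h
  have := ht (Function.update t b (s b))
  rw [← sub_nonneg, h]
  exact sub_nonneg.2 this

/-- `s` avoids `S` when the facet `s` contains the lines of `S`. -/
def Avoid (s : Fin c.B → Fin c.n) (S : Set L) : Prop := ∀ b, c.r b (s b) ∉ S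

lemma mem_form_of_avoid {S : Set L} {s} (hs : c.Avoid s S) (hS : ∀ x ∈ S, φ x = 2) :
    ∀ x ∈ S, (φ + c.e s) x = 2 := by
  intro x hx
  obtain ⟨b, j, rfl⟩ := (c.mem x).1 (hS x hx)
  have : s b ≠ j := fun h => hs b (h ▸ hx)
  simp [c.e_val, this, hS _ hx]

lemma facet_card (s : Fin c.B → Fin c.n) : Fintype.card (Σ b, {j // j ≠ s b}) = 9 := by
  rw [← c.card]
  simp [Fintype.card_subtype_compl]

lemma facet_injective (s : Fin c.B → Fin c.n) :
    Function.Injective fun p : Σ b, {j // j ≠ s b} => c.r p.1 p.2 := by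
  rintro ⟨b, j, hj⟩ ⟨b', j', hj'⟩ h
  obtain ⟨rfl, rfl⟩ := c.r_inj _ _ _ _ h
  rfl

end Chart

namespace VoronoiData

variable {L A : Type*} [AddCommGroup A] [LinearOrder A] [IsOrderedAddMonoid A]
  (V : VoronoiData L A)

/-- No rank one form of the family vanishes on `S`. -/
def Spans (S : Set L) : Prop := ∀ w ∈ V.R, ∃ x ∈ S, w x ≠ 0

lemma Spans.mono {S T : Set L} (h : V.Spans S) (hST : S ⊆ T) : V.Spans T := fun w hw =>
  let ⟨x, hx, hx'⟩ := h w hw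
  ⟨x, hST hx, hx'⟩

/-- `S` consists of minimal vectors of `φ`. -/
def Mins (φ : L → ℤ) (S : Set L) : Prop := ∀ x ∈ S, φ x = 2

/-- Spanning sets of minimal vectors which are common to two forms. -/
def Cell (S : Set L) : Prop :=
  V.Spans S ∧ ∃ φ ∈ V.Φ, ∃ ψ ∈ V.Φ, φ ≠ ψ ∧ Mins φ S ∧ Mins ψ S

lemma Cell.subset {S T : Set L} (h : V.Cell T) (hST : S ⊆ T) (hS : V.Spans S) : V.Cell S := by
  obtain ⟨_, φ, hφ, ψ, hψ, hne, h1, h2⟩ := h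
  exact ⟨hS, φ, hφ, ψ, hψ, hne, fun x hx => h1 x (hST hx), fun x hx => h2 x (hST hx)⟩

/-- No form having `S` among its minimal vectors is above `φ`. -/
def Low (φ : L → ℤ) (S : Set L) : Prop := ∀ ψ ∈ V.Φ, Mins ψ S → V.α ψ ≤ V.α φ

lemma α_injOn {φ ψ : L → ℤ} (hφ : φ ∈ V.Φ) (hψ : ψ ∈ V.Φ) (h : V.α φ = V.α ψ) : φ = ψ := by
  have := V.α_inj (φ - ψ) (V.Q.sub_mem (V.Φ_sub hφ) (V.Φ_sub hψ)) (by rw [map_sub, h, sub_self])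
  exact sub_eq_zero.1 this

lemma α_e_ne {φ} (c : Chart V.Q V.Φ φ) (s) : V.α (c.e s) ≠ 0 :=
  fun h => c.e_ne s (V.α_inj _ (c.e_mem s) h)

section

variable {V} {φ : L → ℤ} (hφ : φ ∈ V.Φ) (c : Chart V.Q V.Φ φ)
include hφ

lemma sub_nonneg_r {ψ} (hψ : ψ ∈ V.Φ) (b j) : 0 ≤ (ψ - φ) (c.r b j) := by
  have h1 : φ (c.r b j) = 2 := (c.mem _).2 ⟨b, j, rfl⟩
  have := V.two_le φ hφ ψ hψ _ h1
  simp only [Pi.sub_apply]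
  omega

omit hφ in
lemma avoid_of_pos {ψ} {S : Set L} (hS : Mins φ S) (hS' : Mins ψ S) {s}
    (hs : ∀ b, 0 < (ψ - φ) (c.r b (s b))) : c.Avoid s S := by
  intro b hb
  have := hs b
  simp [hS _ hb, hS' _ hb] at this

lemma low_iff {S : Set L} (hS : Mins φ S) :
    V.Low φ S ↔ ∀ s, c.Avoid s S → V.α (c.e s) < 0 := by
  constructor
  · intro h s hs
    have := h _ (c.e_form s) (c.mem_form_of_avoid hs hS)
    rw [map_add] at this
    refine lt_of_le_of_ne (by simpa using this) (V.α_e_ne c s)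
  · intro h ψ hψ hψS
    have := c.le_zero V.α (V.Q.sub_mem (V.Φ_sub hψ) (V.Φ_sub hφ))
      (sub_nonneg_r hφ c hψ) (fun s hs => (h s (avoid_of_pos c hS hψS hs)).le)
    rw [map_sub] at this
    simpa using this

omit hφ in
lemma spans_of_low {S : Set L} (h : ∀ s, c.Avoid s S → V.α (c.e s) < 0) : V.Spans S := by
  intro w hw
  by_contra! hcon
  have := c.le_zero V.α (V.R_sub hw) (fun b j => V.R_nonneg w hw _) (fun s hs => (h s
    (fun b hb => by have := hs b; rw [hcon _ hb] at this; exact lt_irrefl _ this)).le)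
  exact absurd (V.R_pos w hw) (not_lt.2 this)

lemma cell_iff {S : Set L} (hS : Mins φ S) : V.Cell S ↔ V.Spans S ∧ ∃ s, c.Avoid s S := by
  constructor
  · rintro ⟨h, ψ, hψ, ψ', hψ', hne, h1, h2⟩
    refine ⟨h, ?_⟩
    obtain ⟨χ, hχ, hχφ, hχS⟩ : ∃ χ ∈ V.Φ, χ ≠ φ ∧ Mins χ S := by
      by_cases h : ψ = φ
      · exact ⟨ψ', hψ', fun h' => hne (h.trans h'.symm), h2⟩
      · exact ⟨ψ, hψ, h, h1⟩
    obtain ⟨s, hs⟩ := c.exists_pos (V.Q.sub_mem (V.Φ_sub hχ) (V.Φ_sub hφ))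
      (sub_nonneg_r hφ c hχ) (sub_ne_zero.2 hχφ)
    exact ⟨s, avoid_of_pos c hS hχS hs⟩
  · rintro ⟨h, s, hs⟩
    refine ⟨h, φ, hφ, φ + c.e s, c.e_form s, ?_, hS, c.mem_form_of_avoid hs hS⟩
    intro h
    exact c.e_ne s (by simpa using h)

end

end VoronoiData

end Voronoi

namespace Voronoi

open Equiv

section Alternating

variable {L : Type*}

/-- Alternating functions of tuples. -/
def Alt {m : ℕ} (f : (Fin m → L) → ℂ) : Prop :=
  ∀ v (σ : Perm (Fin m)), f (v ∘ σ) = (Perm.sign σ : ℤ) * f v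

lemma Alt.swap {m : ℕ} {f : (Fin m → L) → ℂ} (hf : Alt f) (v) {i j : Fin m} (h : i ≠ j) :
    f (v ∘ Equiv.swap i j) = - f v := by
  rw [hf, Perm.sign_swap h]; simp

lemma Alt.eq_zero {m : ℕ} {f : (Fin m → L) → ℂ} (hf : Alt f) {v : Fin m → L}
    (h : ¬ Function.Injective v) : f v = 0 := by
  simp only [Function.Injective, not_forall] at h
  obtain ⟨i, j, hij, hne⟩ := h
  have h1 := hf.swap v hne
  have h2 : v ∘ Equiv.swap i j = v := by
    funext k
    simp only [Function.comp_apply, Equiv.swap_apply_def]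
    split_ifs with h h' <;> simp_all
  rw [h2] at h1
  exact self_eq_neg.1 h1

lemma alt_of_adjacent {m : ℕ} {f : (Fin (m + 1) → L) → ℂ}
    (hf : ∀ v (k : Fin m), f (v ∘ Equiv.swap k.castSucc k.succ) = - f v) : Alt f := by
  intro v σ
  have hσ : σ ∈ Submonoid.closure (Set.range fun i : Fin m => Equiv.swap i.castSucc i.succ) := by
    rw [Perm.mclosure_swap_castSucc_succ]; trivial
  induction hσ using Submonoid.closure_induction generalizing v with
  | mem x hx =>
    obtain ⟨k, rfl⟩ := hx
    rw [hf, Perm.sign_swap (by simp [Fin.ext_iff])]; simp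
  | one => simp
  | mul x y _ _ hx hy =>
    rw [Perm.coe_mul, ← Function.comp_assoc, hy, hx, Perm.sign_mul]
    push_cast
    ring

/-- The simplicial boundary of a function of tuples, evaluated at a longer tuple. -/
def bd {m : ℕ} (f : (Fin m → L) → ℂ) (v : Fin (m + 1) → L) : ℂ :=
  ∑ i : Fin (m + 1), (-1) ^ (i : ℕ) * f (v ∘ i.succAbove)

lemma bd_add {m : ℕ} (f g : (Fin m → L) → ℂ) (v) : bd (f + g) v = bd f v + bd g v := by
  simp [bd, mul_add, Finset.sum_add_distrib]

lemma bd_smul {m : ℕ} (a : ℂ) (f : (Fin m → L) → ℂ) (v) : bd (a • f) v = a * bd f v := by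
  simp only [bd, Pi.smul_apply, smul_eq_mul, Finset.mul_sum]
  exact Finset.sum_congr rfl fun i _ => by ring

lemma bd_cons {m : ℕ} (f : (Fin (m + 1) → L) → ℂ) (d : L) (u : Fin (m + 1) → L) :
    bd f (Fin.cons d u : Fin (m + 2) → L) =
      f u - bd (fun w => f (Fin.cons d w : Fin (m + 1) → L)) u := by
  rw [bd, Fin.sum_univ_succ, bd, sub_eq_add_neg, ← Finset.sum_neg_distrib]
  congr 1
  · simp [Fin.succAbove_zero, Function.comp_def]
  · refine Finset.sum_congr rfl fun i _ => ?_
    have : (Fin.cons d u : Fin (m + 2) → L) ∘ i.succ.succAbove =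
        (Fin.cons d (u ∘ i.succAbove) : Fin (m + 1) → L) := by
      funext k
      refine Fin.cases ?_ (fun k => ?_) k <;> simp
    rw [this]
    simp [pow_succ]

lemma swap_succAbove {m : ℕ} (k x : Fin m) :
    Equiv.swap k.castSucc k.succ (k.succ.succAbove x) = k.castSucc.succAbove x := by
  simp only [Fin.succAbove, Equiv.swap_apply_def, Fin.ext_iff, Fin.lt_def]
  split_ifs <;> simp_all <;> omega

lemma bd_alt {m : ℕ} {f : (Fin m → L) → ℂ} (hf : Alt f) : Alt (bd f) := by
  refine alt_of_adjacent fun v k => ?_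
  set τ := Equiv.swap k.castSucc k.succ with hτ
  have hne : k.castSucc ≠ k.succ := by simp [Fin.ext_iff]
  rw [bd, ← Equiv.sum_comp τ, bd, ← Finset.sum_neg_distrib]
  refine Finset.sum_congr rfl fun i _ => ?_
  by_cases h1 : i = k.castSucc
  · subst h1
    have h : (v ∘ τ) ∘ (τ k.castSucc).succAbove = v ∘ k.castSucc.succAbove := by
      funext x
      simp only [Function.comp_apply, hτ, Equiv.swap_apply_left, swap_succAbove]
    rw [h, hτ, Equiv.swap_apply_left]
    simp [pow_succ]
  by_cases h2 : i = k.succ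
  · subst h2
    have h : (v ∘ τ) ∘ (τ k.succ).succAbove = v ∘ k.succ.succAbove := by
      funext x
      simp only [Function.comp_apply, hτ, Equiv.swap_apply_right]
      rw [← swap_succAbove, Equiv.swap_apply_self]
    rw [h, hτ, Equiv.swap_apply_right]
    simp [pow_succ]
  · have hi : τ i = i := Equiv.swap_apply_of_ne_of_ne h1 h2
    obtain ⟨a, ha⟩ := Fin.exists_succAbove_eq (Ne.symm h1)
    obtain ⟨b, hb⟩ := Fin.exists_succAbove_eq (Ne.symm h2)
    have hab : a ≠ b := by rintro rfl; exact hne (ha.symm.trans hb)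
    have : (v ∘ τ) ∘ i.succAbove = (v ∘ i.succAbove) ∘ Equiv.swap a b := by
      funext x
      simp only [Function.comp_apply, hτ, ← ha, ← hb]
      rw [(Fin.succAbove_right_injective).swap_apply]
    rw [hi, this, hf.swap _ hab]
    ring

lemma bd_bd {m : ℕ} (f : (Fin m → L) → ℂ) (v) : bd (bd f) v = 0 := by
  induction m with
  | zero =>
    simp [bd, Fin.sum_univ_succ, Subsingleton.elim _ (Fin.elim0 : Fin 0 → L)]
  | succ m ih =>
    obtain ⟨d, u, rfl⟩ : ∃ d u, v = (Fin.cons d u : Fin (m + 3) → L) :=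
      ⟨v 0, Fin.tail v, (Fin.cons_self_tail v).symm⟩
    rw [bd_cons]
    have : (fun w => bd f (Fin.cons d w : Fin (m + 2) → L)) =
        f + (-1 : ℂ) • bd (fun w => f (Fin.cons d w : Fin (m + 1) → L)) := by
      funext w
      rw [bd_cons]
      simp [sub_eq_add_neg]
    rw [this, bd_add, bd_smul, ih]
    ring

end Alternating

namespace VoronoiData

variable {L A : Type*} [AddCommGroup A] [LinearOrder A] [IsOrderedAddMonoid A]
  (V : VoronoiData L A)

/-- Alternating finitely supported functions on cells with `m` lines. -/
def chains (m : ℕ) : Submodule ℂ ((Fin m → L) → ℂ) where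
  carrier := {f | Alt f ∧ f.support.Finite ∧ ∀ v, f v ≠ 0 → V.Cell (Set.range v)}
  zero_mem' := ⟨fun v σ => by simp, by simp, fun v h => absurd rfl h⟩
  add_mem' := by
    rintro f g ⟨h1, h2, h3⟩ ⟨h1', h2', h3'⟩
    refine ⟨fun v σ => ?_, (h2.union h2').subset (Function.support_add f g), fun v hv => ?_⟩
    · simp only [Pi.add_apply, h1 v σ, h1' v σ, mul_add]
    · by_cases h : f v = 0
      · exact h3' v (by simpa [h] using hv)
      · exact h3 v h
  smul_mem' := by
    rintro a f ⟨h1, h2, h3⟩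
    refine ⟨fun v σ => ?_, h2.subset (Function.support_const_smul_subset a f), fun v hv => ?_⟩
    · simp only [Pi.smul_apply, smul_eq_mul, h1 v σ]; ring
    · exact h3 v (by simp at hv; exact hv.2)

/-- Restriction of the boundary to cells. -/
noncomputable def cbd {m : ℕ} (f : (Fin m → L) → ℂ) (v : Fin (m + 1) → L) : ℂ :=
  open Classical in if V.Cell (Set.range v) then bd f v else 0

lemma cbd_alt {m : ℕ} {f : (Fin m → L) → ℂ} (hf : Alt f) : Alt (V.cbd f) := by
  intro v σ
  have : Set.range (v ∘ σ) = Set.range v := σ.surjective.range_comp v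
  rw [cbd, cbd, this, bd_alt hf v σ]
  split_ifs <;> simp

lemma range_face {m : ℕ} (v : Fin (m + 1) → L) (i : Fin (m + 1)) : Set.range (v ∘ i.succAbove) ⊆ Set.range v :=
  Set.range_comp_subset_range _ _

lemma cbd_support_finite {m : ℕ} {f : (Fin m → L) → ℂ} (hf : f ∈ V.chains m) :
    (V.cbd f).support.Finite := by
  have hM : ∀ S : Set L, V.Spans S → {x | ∃ φ ∈ V.Φ, Mins φ S ∧ φ x = 2}.Finite := by
    intro S hS
    have := (V.fin S hS).biUnion (t := fun φ => {x | φ ∈ V.Φ ∧ φ x = 2}) (fun φ hφ => by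
      obtain ⟨c⟩ := V.chart φ hφ.1
      refine (Set.finite_range (fun p : Fin c.B × Fin c.n => c.r p.1 p.2)).subset ?_
      rintro x ⟨_, hx⟩
      obtain ⟨b, j, h⟩ := (c.mem x).1 hx
      exact ⟨(b, j), h⟩)
    refine this.subset ?_
    rintro x ⟨φ, hφ, h, hx⟩
    simp only [Set.mem_iUnion]
    exact ⟨φ, ⟨hφ, h⟩, hφ, hx⟩
  have key : (⋃ u ∈ f.support, {v : Fin (m + 1) → L | ∀ i, v i ∈
      {x | ∃ φ ∈ V.Φ, Mins φ (Set.range u) ∧ φ x = 2}}).Finite := by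
    refine hf.2.1.biUnion fun u hu => ?_
    have := hM _ (hf.2.2 u hu).1
    exact (Set.Finite.pi (t := fun _ : Fin (m + 1) => _) (fun _ => this)).subset
      (fun v hv => by simpa [Set.mem_pi] using hv)
  refine key.subset fun v hv => ?_
  rw [Function.mem_support, cbd] at hv
  split_ifs at hv with hc
  · obtain ⟨i, _, hi⟩ := Finset.exists_ne_zero_of_sum_ne_zero hv
    obtain ⟨_, φ, hφ, _, _, _, h, _⟩ := hc
    simp only [Set.mem_iUnion]
    refine ⟨v ∘ i.succAbove, right_ne_zero_of_mul hi, fun j => ?_⟩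
    exact ⟨φ, hφ, fun x hx => h x (range_face v i hx), h _ ⟨j, rfl⟩⟩
  · exact absurd rfl hv

lemma cbd_mem {m : ℕ} {f : (Fin m → L) → ℂ} (hf : f ∈ V.chains m) : V.cbd f ∈ V.chains (m + 1) :=
  ⟨V.cbd_alt hf.1, V.cbd_support_finite hf, fun v hv => by
    rw [cbd] at hv
    split_ifs at hv with h
    · exact h
    · exact absurd rfl hv⟩

lemma cbd_cbd {m : ℕ} {f : (Fin m → L) → ℂ} (hf : ∀ v, f v ≠ 0 → V.Cell (Set.range v)) :
    V.cbd (V.cbd f) = 0 := by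
  funext v
  rw [cbd]
  split_ifs with hv
  · change bd (V.cbd f) v = 0
    rw [← bd_bd f v]
    refine Finset.sum_congr rfl fun i _ => ?_
    rw [cbd]
    split_ifs with hi
    · rfl
    · congr 1
      refine (Finset.sum_eq_zero fun j _ => ?_).symm
      by_contra h
      have h1 := hf _ (right_ne_zero_of_mul h)
      exact hi (hv.subset V (range_face v i) (h1.1.mono V (range_face _ j)))
  · rfl

lemma cbd_add {m : ℕ} (f g : (Fin m → L) → ℂ) : V.cbd (f + g) = V.cbd f + V.cbd g := by
  funext v
  simp only [cbd, bd_add, Pi.add_apply]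
  split_ifs <;> simp

lemma cbd_smul {m : ℕ} (a : ℂ) (f : (Fin m → L) → ℂ) : V.cbd (a • f) = a • V.cbd f := by
  funext v
  simp only [cbd, bd_smul, Pi.smul_apply]
  split_ifs <;> simp

lemma cbd_sub {m : ℕ} (f g : (Fin m → L) → ℂ) : V.cbd (f - g) = V.cbd f - V.cbd g := by
  have : f - g = f + (-1 : ℂ) • g := by rw [neg_one_smul, sub_eq_add_neg]
  rw [this, cbd_add, cbd_smul, neg_one_smul, sub_eq_add_neg]

end VoronoiData

lemma Alt.cons {L : Type*} {m : ℕ} {f : (Fin (m + 1) → L) → ℂ} (hf : Alt f) (d : L) :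
    Alt fun w : Fin m → L => f (Fin.cons d w : Fin (m + 1) → L) := by
  intro v σ
  have : (Fin.cons d (v ∘ σ) : Fin (m + 1) → L) =
      (Fin.cons d v : Fin (m + 1) → L) ∘ (Perm.decomposeFin.symm (0, σ)) := by
    funext k
    refine Fin.cases ?_ (fun k => ?_) k <;> simp
  simp only [this]
  rw [hf]
  simp

namespace VoronoiData

variable {L A : Type*} [AddCommGroup A] [LinearOrder A] [IsOrderedAddMonoid A]
  {V : VoronoiData L A}

lemma Low.mono {φ : L → ℤ} {S T : Set L} (h : V.Low φ S) (hST : S ⊆ T) : V.Low φ T :=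
  fun ψ hψ hT => h ψ hψ fun x hx => hT x (hST hx)

lemma contract_step {m : ℕ} {φ : L → ℤ} (hφ : φ ∈ V.Φ) (c : Chart V.Q V.Φ φ)
    {t : Fin c.B → Fin c.n}
    (ht : ∀ s b, V.α (c.e (Function.update s b (t b))) ≤ V.α (c.e s)) (b : Fin c.B)
    (K : Finset (Fin c.B)) {z : (Fin (m + 1) → L) → ℂ} (hz : z ∈ V.chains (m + 1))
    (hcyc : V.cbd z = 0) (hlow : ∀ v, z v ≠ 0 → V.Low φ (Set.range v))
    (hK : ∀ v, z v ≠ 0 → Mins φ (Set.range v) → ∀ b ∈ K, ∀ j ≠ t b, c.r b j ∈ Set.range v) :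
    ∃ y ∈ V.chains m, (∀ v, (z - V.cbd y) v ≠ 0 → V.Low φ (Set.range v)) ∧
      ∀ v, (z - V.cbd y) v ≠ 0 → Mins φ (Set.range v) →
        ∀ b' ∈ insert b K, ∀ j ≠ t b', c.r b' j ∈ Set.range v := by
  classical
  set d := c.r b (t b) with hd
  have hdφ : φ d = 2 := (c.mem d).2 ⟨_, _, rfl⟩
  let y : (Fin m → L) → ℂ := fun w => if Mins φ (Set.range w) ∧ V.Cell (Set.range w) then
    z (Fin.cons d w : Fin (m + 1) → L) else 0
  have hcons : ∀ {k : ℕ} {w : Fin k → L}, Mins φ (Set.range w) →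
      Mins φ (Set.range (Fin.cons d w : Fin (k + 1) → L)) := by
    intro k w hw x hx
    rw [Fin.range_cons] at hx
    rcases hx with rfl | hx
    · exact hdφ
    · exact hw x hx
  have key1 : ∀ w : Fin m → L, Mins φ (Set.range w) → z (Fin.cons d w : Fin (m + 1) → L) ≠ 0 →
      V.Low φ (Set.range w) ∧ V.Cell (Set.range w) := by
    intro w hw hne
    have hc := hz.2.2 _ hne
    have hl := (low_iff hφ c (hcons hw)).1 (hlow _ hne)
    obtain ⟨s₀, hs₀⟩ := ((cell_iff hφ c (hcons hw)).1 hc).2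
    rw [Fin.range_cons] at hl hs₀
    have hav : ∀ s, c.Avoid s (Set.range w) → V.α (c.e s) < 0 := by
      intro s hs
      by_cases hsb : s b = t b
      · have h1 : c.Avoid (Function.update s b (s₀ b)) (insert d (Set.range w)) := by
          intro b'
          by_cases hb : b' = b
          · subst hb; simpa using hs₀ b'
          · rw [Function.update_of_ne hb]
            rintro (h | h)
            · exact hb (c.r_inj _ _ _ _ h).1
            · exact hs b' h
        have h2 := ht (Function.update s b (s₀ b)) b
        rw [Function.update_idem, ← hsb, Function.update_eq_self] at h2
        exact h2.trans_lt (hl _ h1)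
      · refine hl s fun b' => ?_
        rintro (h | h)
        · obtain ⟨rfl, h⟩ := c.r_inj _ _ _ _ h
          exact hsb h
        · exact hs b' h
    refine ⟨(low_iff hφ c hw).2 hav, ?_⟩
    refine hc.subset V ?_ (spans_of_low c hav)
    rw [Fin.range_cons]
    exact Set.subset_insert _ _
  have hy0 : ∀ w, Mins φ (Set.range w) → y w = z (Fin.cons d w : Fin (m + 1) → L) := by
    intro w hw
    by_cases h : z (Fin.cons d w : Fin (m + 1) → L) = 0
    · simp [y, h]
    · simp [y, hw, (key1 w hw h).2]
  have hyne : ∀ w, y w ≠ 0 → Mins φ (Set.range w) ∧ V.Cell (Set.range w) ∧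
      z (Fin.cons d w : Fin (m + 1) → L) ≠ 0 := by
    intro w hw
    simp only [y] at hw
    split_ifs at hw with h
    · exact ⟨h.1, h.2, hw⟩
    · exact absurd rfl hw
  have hy : y ∈ V.chains m := by
    refine ⟨fun v σ => ?_, ?_, fun v hv => (hyne v hv).2.1⟩
    · have h : Set.range (v ∘ σ) = Set.range v := σ.surjective.range_comp v
      simp only [y]
      rw [h, show z (Fin.cons d (v ∘ σ)) = _ from hz.1.cons d v σ]
      split_ifs <;> simp
    · refine (hz.2.1.preimage (f := fun w : Fin m → L => (Fin.cons d w : Fin (m + 1) → L))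
        (fun w _ w' _ h => (Fin.cons_right_injective (α := fun _ => L) d) h)).subset
        fun v hv => (hyne v hv).2.2
  have hface : ∀ v, V.cbd y v ≠ 0 → ∃ i : Fin (m + 1), y (v ∘ i.succAbove) ≠ 0 := by
    intro v hv
    rw [cbd] at hv
    split_ifs at hv with hc
    · obtain ⟨i, _, hi⟩ := Finset.exists_ne_zero_of_sum_ne_zero hv
      exact ⟨i, right_ne_zero_of_mul hi⟩
    · exact absurd rfl hv
  refine ⟨y, hy, fun v hv => ?_, fun v hv hvφ b' hb' j hj => ?_⟩
  · by_cases h : z v = 0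
    · obtain ⟨i, hi⟩ := hface v (by simpa [h] using hv)
      obtain ⟨h1, _, h3⟩ := hyne _ hi
      exact (key1 _ h1 h3).1.mono (range_face v i)
    · exact hlow v h
  · rcases Finset.mem_insert.1 hb' with rfl | hb'
    · have hcell : V.Cell (Set.range v) := (V.chains (m + 1)).sub_mem hz (V.cbd_mem hy) |>.2.2 v hv
      by_contra hcon
      have hc2 : V.Cell (Set.range (Fin.cons d v : Fin (m + 2) → L)) := by
        obtain ⟨hs1, s, hs2⟩ := (cell_iff hφ c hvφ).1 hcell
        refine (cell_iff hφ c (hcons hvφ)).2 ⟨hs1.mono V ?_, Function.update s b' j, fun b => ?_⟩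
        · rw [Fin.range_cons]; exact Set.subset_insert _ _
        · rw [Fin.range_cons]
          by_cases hb : b = b'
          · subst hb
            rw [Function.update_self]
            rintro (h | h)
            · exact hj (c.r_inj _ _ _ _ h).2
            · exact hcon h
          · rw [Function.update_of_ne hb]
            rintro (h | h)
            · exact hb (c.r_inj _ _ _ _ h).1
            · exact hs2 b h
      have h1 := congrFun hcyc (Fin.cons d v : Fin (m + 2) → L)
      rw [cbd, if_pos hc2, bd_cons] at h1
      apply hv
      rw [Pi.sub_apply, cbd, if_pos hcell]
      rw [← Pi.zero_apply (M := fun _ : Fin (m + 2) → L => ℂ) (Fin.cons d v : Fin (m + 2) → L),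
        ← h1]
      congr 1
      refine Finset.sum_congr rfl fun i _ => ?_
      rw [hy0 _ fun x hx => hvφ x (range_face v i hx)]
    · by_cases h : z v = 0
      · obtain ⟨i, hi⟩ := hface v (by simpa [h] using hv)
        obtain ⟨h1, _, h3⟩ := hyne _ hi
        have := hK _ h3 (hcons h1) b' hb' j hj
        rw [Fin.range_cons] at this
        rcases this with h | h
        · obtain ⟨rfl, h⟩ := c.r_inj _ _ _ _ h
          exact absurd h hj
        · exact range_face v i h
      · exact hK v h hvφ b' hb' j hj

lemma contract {m : ℕ} {φ : L → ℤ} (hφ : φ ∈ V.Φ) {z : (Fin (m + 1) → L) → ℂ}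
    (hz : z ∈ V.chains (m + 1)) (hcyc : V.cbd z = 0)
    (hlow : ∀ v, z v ≠ 0 → V.Low φ (Set.range v)) :
    ∃ y ∈ V.chains m, (∀ v, (z - V.cbd y) v ≠ 0 → V.Low φ (Set.range v)) ∧
      ∃ (c : Chart V.Q V.Φ φ) (t : Fin c.B → Fin c.n),
        ∀ v, (z - V.cbd y) v ≠ 0 → Mins φ (Set.range v) →
          ∀ b, ∀ j ≠ t b, c.r b j ∈ Set.range v := by
  classical
  obtain ⟨c⟩ := V.chart φ hφ
  obtain ⟨t, ht⟩ := c.exists_base V.α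
  suffices h : ∀ K : Finset (Fin c.B), ∃ y ∈ V.chains m,
      (∀ v, (z - V.cbd y) v ≠ 0 → V.Low φ (Set.range v)) ∧
        ∀ v, (z - V.cbd y) v ≠ 0 → Mins φ (Set.range v) →
          ∀ b ∈ K, ∀ j ≠ t b, c.r b j ∈ Set.range v by
    obtain ⟨y, hy, h1, h2⟩ := h Finset.univ
    exact ⟨y, hy, h1, c, t, fun v h h' b => h2 v h h' b (Finset.mem_univ b)⟩
  intro K
  induction K using Finset.induction_on with
  | empty =>
    refine ⟨0, (V.chains m).zero_mem, fun v hv => hlow v ?_, by simp⟩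
    simpa [cbd, bd] using hv
  | insert b K _ ih =>
    obtain ⟨y, hy, h1, h2⟩ := ih
    have hz' := (V.chains (m + 1)).sub_mem hz (V.cbd_mem hy)
    obtain ⟨y', hy', h1', h2'⟩ := contract_step hφ c ht b K hz'
      (by rw [cbd_sub, hcyc, V.cbd_cbd hy.2.2, sub_zero]) h1 h2
    rw [sub_sub, ← cbd_add] at h1' h2'
    exact ⟨y + y', (V.chains m).add_mem hy hy', h1', h2'⟩

lemma facet_le {m : ℕ} {φ : L → ℤ} (c : Chart V.Q V.Φ φ) (t : Fin c.B → Fin c.n) {v : Fin m → L}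
    (h : ∀ b, ∀ j ≠ t b, c.r b j ∈ Set.range v) : 9 ≤ m := by
  have h' : ∀ p : Σ b, {j // j ≠ t b}, ∃ i, v i = c.r p.1 p.2 := fun p => h p.1 p.2 p.2.2
  choose f hf using h'
  have : Function.Injective f := fun p q hpq => c.facet_injective t (by
    simp only [← hf, hpq])
  have := Fintype.card_le_of_injective f this
  rwa [c.facet_card t, Fintype.card_fin] at this

lemma exists_top {m : ℕ} {z : (Fin m → L) → ℂ} (hz : z ∈ V.chains m) (h0 : z ≠ 0) :
    ∃ ψ ∈ V.Φ, ∃ v, z v ≠ 0 ∧ Mins ψ (Set.range v) ∧ ∀ u, z u ≠ 0 → V.Low ψ (Set.range u) := by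
  set F : Set (L → ℤ) := ⋃ v ∈ z.support, {ψ | ψ ∈ V.Φ ∧ ∀ x ∈ Set.range v, ψ x = 2} with hF
  have hFfin : F.Finite := hz.2.1.biUnion fun v hv => V.fin _ (hz.2.2 v hv).1
  have hmem : ∀ ψ, ψ ∈ F ↔ ∃ v, z v ≠ 0 ∧ ψ ∈ V.Φ ∧ Mins ψ (Set.range v) := by
    intro ψ
    simp only [hF, Set.mem_iUnion, exists_prop]
    rfl
  have hFne : F.Nonempty := by
    obtain ⟨v, hv⟩ := Function.ne_iff.1 h0
    obtain ⟨_, ψ, hψ, _, _, _, hm, _⟩ := hz.2.2 v hv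
    exact ⟨ψ, (hmem ψ).2 ⟨v, hv, hψ, hm⟩⟩
  obtain ⟨ψ, hψF, hψ⟩ := hFfin.exists_maximalFor V.α F hFne
  obtain ⟨v, hv, hψΦ, hψv⟩ := (hmem ψ).1 hψF
  refine ⟨ψ, hψΦ, v, hv, hψv, fun u hu χ hχ hχu => ?_⟩
  rcases le_total (V.α χ) (V.α ψ) with h | h
  · exact h
  · exact hψ ((hmem χ).2 ⟨u, hu, hχ, hχu⟩) h

/-- Filling cycles by descent along the forms, given a local vanishing criterion. -/
lemma exists_fill {m : ℕ} (P : ((Fin (m + 1) → L) → ℂ) → Prop)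
    (hP : ∀ z, ∀ y ∈ V.chains m, P z → P (z - V.cbd y))
    (hvan : ∀ z ∈ V.chains (m + 1), P z → ∀ φ ∈ V.Φ, ∀ (c : Chart V.Q V.Φ φ)
      (t : Fin c.B → Fin c.n), (∀ v, z v ≠ 0 → Mins φ (Set.range v) →
          ∀ b, ∀ j ≠ t b, c.r b j ∈ Set.range v) → ∀ v, Mins φ (Set.range v) → z v = 0)
    {z : (Fin (m + 1) → L) → ℂ} (hz : z ∈ V.chains (m + 1)) (hcyc : V.cbd z = 0) (hPz : P z) :
    ∃ y ∈ V.chains m, V.cbd y = z := by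
  have main : ∀ φ : V.Φ, ∀ z ∈ V.chains (m + 1), V.cbd z = 0 → P z →
      (∀ v, z v ≠ 0 → V.Low φ (Set.range v)) → ∃ y ∈ V.chains m, V.cbd y = z := by
    intro φ
    induction φ using V.wf.induction with
    | _ φ ih =>
    intro z hz hcyc hPz hlow
    obtain ⟨y, hy, h1, c, t, h2⟩ := contract φ.2 hz hcyc hlow
    have hz' := (V.chains (m + 1)).sub_mem hz (V.cbd_mem hy)
    have hcyc' : V.cbd (z - V.cbd y) = 0 := by
      rw [cbd_sub, hcyc, V.cbd_cbd hy.2.2, sub_zero]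
    have hP' := hP z y hy hPz
    have h3 := hvan _ hz' hP' φ φ.2 c t h2
    set z' := z - V.cbd y with hz'def
    by_cases h0 : z' = 0
    · exact ⟨y, hy, (sub_eq_zero.1 h0).symm⟩
    obtain ⟨ψ, hψ, v, hv, hψv, htop⟩ := exists_top hz' h0
    obtain ⟨y', hy', h⟩ := ih ⟨ψ, hψ⟩ (lt_of_le_of_ne (h1 v hv ψ hψ hψv) fun h => by
      have := V.α_injOn hψ φ.2 h
      subst this
      exact hv (h3 v hψv)) z' hz' hcyc' hP' htop
    refine ⟨y + y', (V.chains m).add_mem hy hy', ?_⟩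
    rw [cbd_add, h, hz'def]
    abel
  by_cases h0 : z = 0
  · exact ⟨0, (V.chains m).zero_mem, by subst h0; funext v; simp [cbd, bd]⟩
  obtain ⟨ψ, hψ, _, _, _, htop⟩ := exists_top hz h0
  exact main ⟨ψ, hψ⟩ z hz hcyc hPz htop

theorem exact_chains {m : ℕ} (hm : m < 8) {z : (Fin (m + 1) → L) → ℂ}
    (hz : z ∈ V.chains (m + 1)) (hcyc : V.cbd z = 0) : ∃ y ∈ V.chains m, V.cbd y = z := by
  refine exists_fill (fun _ => True) (fun _ _ _ _ => trivial) ?_ hz hcyc trivial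
  intro z _ _ φ _ c t h v hv
  by_contra hne
  have := facet_le c t (h v hne hv)
  omega

end VoronoiData

namespace Chart

variable {L : Type*} {Q : AddSubgroup (L → ℤ)} {Φ : Set (L → ℤ)} {φ : L → ℤ} (c : Chart Q Φ φ)

/-- The tuple `v` enumerates the lines of the facet `s`. -/
def IsFacet (s : Fin c.B → Fin c.n) (v : Fin 9 → L) : Prop :=
  Function.Injective v ∧ ∀ i, ∃ b j, j ≠ s b ∧ c.r b j = v i

variable {c} {s : Fin c.B → Fin c.n} {v : Fin 9 → L}

lemma isFacet_of_subset (h : ∀ b, ∀ j ≠ s b, c.r b j ∈ Set.range v) : c.IsFacet s v := by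
  have h' : ∀ p : Σ b, {j // j ≠ s b}, ∃ i, v i = c.r p.1 p.2 := fun p => h p.1 p.2 p.2.2
  choose f hf using h'
  have hinj : Function.Injective f := fun p q hpq => c.facet_injective s (by
    simp only [← hf, hpq])
  have hb := (Fintype.bijective_iff_injective_and_card f).2
    ⟨hinj, by rw [c.facet_card s, Fintype.card_fin]⟩
  constructor
  · intro i i' hii
    obtain ⟨p, rfl⟩ := hb.2 i
    obtain ⟨p', rfl⟩ := hb.2 i'
    rw [hf, hf] at hii
    rw [c.facet_injective s hii]
  · intro i
    obtain ⟨p, rfl⟩ := hb.2 i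
    exact ⟨p.1, p.2, p.2.2, (hf p).symm⟩

lemma IsFacet.mem_range (h : c.IsFacet s v) {b j} (hj : j ≠ s b) : c.r b j ∈ Set.range v := by
  obtain ⟨h1, h2⟩ := h
  have h' : ∀ i, ∃ p : Σ b, {j // j ≠ s b}, c.r p.1 p.2 = v i := fun i =>
    let ⟨b, j, hj, h⟩ := h2 i
    ⟨⟨b, j, hj⟩, h⟩
  choose f hf using h'
  have hinj : Function.Injective f := fun i i' h => h1 (by rw [← hf, ← hf, h])
  have hb := (Fintype.bijective_iff_injective_and_card f).2
    ⟨hinj, by rw [c.facet_card s, Fintype.card_fin]⟩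
  obtain ⟨i, hi⟩ := hb.2 ⟨b, j, hj⟩
  exact ⟨i, by rw [← hf, hi]⟩

lemma isFacet_of_avoid (hv : Function.Injective v) (hφ : VoronoiData.Mins φ (Set.range v))
    (hs : c.Avoid s (Set.range v)) : c.IsFacet s v := by
  refine ⟨hv, fun i => ?_⟩
  obtain ⟨b, j, h⟩ := (c.mem _).1 (hφ _ ⟨i, rfl⟩)
  exact ⟨b, j, fun h' => hs b ⟨i, by rw [← h, h']⟩, h⟩

lemma IsFacet.avoid (h : c.IsFacet s v) : c.Avoid s (Set.range v) := by
  rintro b ⟨i, hi⟩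
  obtain ⟨b', j, hj, h⟩ := h.2 i
  rw [hi] at h
  obtain ⟨rfl, rfl⟩ := c.r_inj _ _ _ _ h
  exact hj rfl

lemma IsFacet.mins (h : c.IsFacet s v) : VoronoiData.Mins φ (Set.range v) := by
  rintro _ ⟨i, rfl⟩
  obtain ⟨b, j, _, h⟩ := h.2 i
  exact (c.mem _).2 ⟨b, j, h⟩

lemma IsFacet.weight (h : c.IsFacet s v) {q : L → ℤ} (hq : q ∈ Q) (h0 : ∀ i, q (v i) = 0) (b) :
    c.weight q = q (c.r b (s b)) := by
  rw [← c.weight_eq hq b]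
  refine Finset.sum_eq_single _ (fun j _ hj => ?_) (by simp)
  obtain ⟨i, hi⟩ := h.mem_range hj
  rw [← hi, h0]

lemma IsFacet.form (h : c.IsFacet s v) {q : L → ℤ} (hq : q ∈ Q) (h0 : ∀ i, q (v i) = 0) :
    (2 : ℤ) • q = c.weight q • c.e s := by
  refine c.ext_r (Q.zsmul_mem hq _) (Q.zsmul_mem (c.e_mem s) _) fun b j => ?_
  simp only [Pi.smul_apply, c.e_val, smul_eq_mul]
  by_cases hj : s b = j
  · subst hj
    rw [h.weight hq h0 b]
    simp [mul_comm]
  · obtain ⟨i, hi⟩ := h.mem_range (Ne.symm hj)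
    simp [hj, ← hi, h0]

/-- The points of a chart. -/
def pt (c : Chart Q Φ φ) (p : Fin c.B × Fin c.n) : L := c.r p.1 p.2

lemma pt_injective (c : Chart Q Φ φ) : Function.Injective c.pt := by
  rintro ⟨b, j⟩ ⟨b', j'⟩ h
  obtain ⟨rfl, rfl⟩ := c.r_inj _ _ _ _ h
  rfl

lemma finsum_mins (c : Chart Q Φ φ) {q : L → ℤ} (hq : q ∈ Q) :
    ∑ᶠ x ∈ {x | φ x = 2}, q x = c.B * c.weight q := by
  have : {x | φ x = 2} = Set.range c.pt := by
    ext x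
    simp only [Set.mem_ofPred_eq, c.mem, Set.mem_range, Prod.exists]
    rfl
  rw [this, finsum_mem_range c.pt_injective, finsum_eq_sum_of_fintype, Fintype.sum_prod_type]
  simp only [pt]
  rw [Finset.sum_congr rfl (fun b _ => c.weight_eq hq b)]
  simp

end Chart

namespace VoronoiData

variable {L A : Type*} [AddCommGroup A] [LinearOrder A] [IsOrderedAddMonoid A]
  (V : VoronoiData L A)

/-- Orientation of the facet `v` with respect to the form `φ`. -/
noncomputable def Ω (φ : L → ℤ) (v : Fin 9 → L) : ℤ :=
  open Classical in if φ ∈ V.Φ ∧ Mins φ (Set.range v) then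
    Int.sign (∑ᶠ x ∈ {x | φ x = 2}, V.D v x) else 0

variable {V}

lemma Ω_perm (φ v) (σ : Perm (Fin 9)) : V.Ω φ (v ∘ σ) = Perm.sign σ * V.Ω φ v := by
  have : Set.range (v ∘ σ) = Set.range v := σ.surjective.range_comp v
  rw [Ω, Ω, this]
  split_ifs with h
  · obtain ⟨c⟩ := V.chart φ h.1
    rw [c.finsum_mins (V.D_mem _), c.finsum_mins (V.D_mem _)]
    have h2 : V.D (v ∘ σ) = (Perm.sign σ : ℤ) • V.D v := by
      funext x
      simp [V.D_perm]
    rw [h2]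
    rcases Int.units_eq_one_or (Perm.sign σ) with h | h <;> simp [h, Chart.weight, Int.sign_neg]
  · simp

lemma Ω_alt (φ) : Alt fun v => (V.Ω φ v : ℂ) := by
  intro v σ
  simp only [Ω_perm]
  push_cast
  rfl

lemma Ω_eq {φ} (c : Chart V.Q V.Φ φ) (hφ : φ ∈ V.Φ) {v} (hv : Mins φ (Set.range v)) :
    V.Ω φ v = Int.sign (c.weight (V.D v)) := by
  have h := c.B_pos
  rw [Ω, if_pos ⟨hφ, hv⟩, c.finsum_mins (V.D_mem _), Int.sign_mul,
    Int.sign_eq_one_of_pos (by exact_mod_cast h), one_mul]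

lemma mins_of_Ω_ne {φ v} (h : V.Ω φ v ≠ 0) : φ ∈ V.Φ ∧ Mins φ (Set.range v) := by
  rw [Ω] at h
  split_ifs at h with h'
  · exact h'
  · exact absurd rfl h

section facet

variable {φ : L → ℤ} (hφ : φ ∈ V.Φ) {c : Chart V.Q V.Φ φ} {s : Fin c.B → Fin c.n} {v : Fin 9 → L}
  (hv : c.IsFacet s v)
include hφ hv

lemma eq_add_e {ψ} (hψ : ψ ∈ V.Φ) (hψv : Mins ψ (Set.range v)) (hne : ψ ≠ φ) : ψ = φ + c.e s := by
  have hqQ : ψ - φ ∈ V.Q := V.Q.sub_mem (V.Φ_sub hψ) (V.Φ_sub hφ)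
  have h0 : ∀ i, (ψ - φ) (v i) = 0 := fun i => by
    simp [hψv _ ⟨i, rfl⟩, hv.mins _ ⟨i, rfl⟩]
  have h2 := hv.form hqQ h0
  have hT := c.weight_pos hqQ (sub_nonneg_r hφ c hψ) (sub_ne_zero.2 hne)
  set T := c.weight (ψ - φ) with hTdef
  have h2' : ∀ x, 2 * (ψ x - φ x) = T * c.e s x := fun x => by simpa using congrFun h2 x
  set φ' := φ + c.e s with hφ'def
  have hφ' : φ' ∈ V.Φ := c.e_form s
  have hφ'x : ∀ x, φ' x = φ x + c.e s x := fun x => rfl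
  rcases lt_trichotomy T 2 with h | h | h
  · exfalso
    obtain ⟨c'⟩ := V.chart ψ hψ
    refine hne (sub_eq_zero.1 (c'.perfect _ hqQ fun b j => ?_))
    have h3 : ψ (c'.r b j) = 2 := (c'.mem _).2 ⟨b, j, rfl⟩
    have h4 := V.two_le ψ hψ φ hφ _ h3
    have h5 := V.two_le ψ hψ φ' hφ' _ h3
    have h6 := h2' (c'.r b j)
    rw [hφ'x] at h5
    have hT1 : T = 1 := by omega
    rw [hT1] at h6
    simp only [Pi.sub_apply]
    omega
  · funext x
    have := h2' x
    rw [h] at this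
    rw [hφ'x]
    omega
  · exfalso
    obtain ⟨c'⟩ := V.chart φ' hφ'
    refine c.e_ne s (c'.perfect _ (c.e_mem s) fun b j => ?_)
    have h3 : φ' (c'.r b j) = 2 := (c'.mem _).2 ⟨b, j, rfl⟩
    have h4 := V.two_le φ' hφ' φ hφ _ h3
    have h5 := V.two_le φ' hφ' ψ hψ _ h3
    have h6 := h2' (c'.r b j)
    rw [hφ'x] at h3
    nlinarith

lemma weight_D_ne : c.weight (V.D v) ≠ 0 := by
  intro h
  have h2 := hv.form (V.D_mem v) (V.D_self v)
  rw [h, zero_smul] at h2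
  refine V.D_ne φ hφ c s v hv.1 hv.2 ?_
  funext x
  have := congrFun h2 x
  simpa using this

lemma Ω_facet_ne : V.Ω φ v ≠ 0 := by
  rw [Ω_eq c hφ hv.mins, Ne, Int.sign_eq_zero_iff_zero]
  exact weight_D_ne hφ hv

lemma Ω_add_e : V.Ω (φ + c.e s) v = - V.Ω φ v := by
  have hφ' := c.e_form s
  have hm : Mins (φ + c.e s) (Set.range v) := c.mem_form_of_avoid hv.avoid hv.mins
  obtain ⟨c'⟩ := V.chart _ hφ'
  have hne : φ ≠ φ + c.e s := fun h => c.e_ne s (by simpa using h)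
  obtain ⟨s', hs'⟩ := c'.exists_pos (V.Q.sub_mem (V.Φ_sub hφ) (V.Φ_sub hφ'))
    (sub_nonneg_r hφ' c' hφ) (sub_ne_zero.2 hne)
  have hv' : c'.IsFacet s' v := Chart.isFacet_of_avoid hv.1 hm
    (avoid_of_pos c' hm hv.mins hs')
  have h1 := eq_add_e hφ' hv' hφ hv.mins hne
  rw [Ω_eq c' hφ' hm, Ω_eq c hφ hv.mins, ← Int.sign_neg]
  have h2 := hv.form (V.D_mem v) (V.D_self v)
  have h3 := hv'.form (V.D_mem v) (V.D_self v)
  rw [h2] at h3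
  have h4 : c'.e s' = - c.e s := by
    rw [add_assoc] at h1
    have := (left_eq_add.1 h1)
    exact (neg_eq_of_add_eq_zero_right this).symm
  rw [h4] at h3
  have h5 := congrFun h3 (c.r ⟨0, c.B_pos⟩ (s ⟨0, c.B_pos⟩))
  simp only [Pi.smul_apply, Pi.neg_apply, c.e_val, if_true, smul_eq_mul] at h5
  congr 1
  omega

end facet

/-- The last boundary map, from facets to forms. -/
noncomputable def bd₀ (V : VoronoiData L A) (z : (Fin 9 → L) → ℂ) (φ : L → ℤ) : ℂ :=
  ∑ᶠ v, (V.Ω φ v : ℂ) * z v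

lemma bd₀_add {z z' : (Fin 9 → L) → ℂ} (hz : z.support.Finite) (hz' : z'.support.Finite) :
    V.bd₀ (z + z') = V.bd₀ z + V.bd₀ z' := by
  funext φ
  simp only [bd₀, Pi.add_apply, mul_add]
  refine finsum_add_distrib (hz.subset ?_) (hz'.subset ?_) <;>
  exact fun v hv => right_ne_zero_of_mul hv

lemma bd₀_smul (a : ℂ) (z : (Fin 9 → L) → ℂ) : V.bd₀ (a • z) = a • V.bd₀ z := by
  funext φ
  simp only [bd₀, Pi.smul_apply, smul_eq_mul]
  rw [← smul_eq_mul, smul_finsum]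
  exact finsum_congr fun v => by simp only [smul_eq_mul]; ring

lemma bd₀_eq_sum {φ} (c : Chart V.Q V.Φ φ) (z : (Fin 9 → L) → ℂ) :
    V.bd₀ z φ = ∑ w : Fin 9 → Fin c.B × Fin c.n, (V.Ω φ (c.pt ∘ w) : ℂ) * z (c.pt ∘ w) := by
  classical
  have hinj : Function.Injective fun w : Fin 9 → Fin c.B × Fin c.n => c.pt ∘ w :=
    c.pt_injective.comp_left
  rw [← finsum_eq_sum_of_fintype, bd₀]
  rw [← finsum_mem_range (f := fun v => (V.Ω φ v : ℂ) * z v) hinj, finsum_mem_def]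
  refine finsum_congr fun v => ?_
  rw [Set.indicator_apply]
  split_ifs with h
  · rfl
  · by_contra hne
    have h1 := (mins_of_Ω_ne (by simpa using left_ne_zero_of_mul hne)).2
    have : ∀ i, ∃ p, c.pt p = v i := fun i =>
      let ⟨b, j, h⟩ := (c.mem _).1 (h1 (v i) ⟨i, rfl⟩)
      ⟨(b, j), h⟩
    choose w hw using this
    exact h ⟨w, funext hw⟩

end VoronoiData

namespace VoronoiData

variable {L A : Type*} [AddCommGroup A] [LinearOrder A] [IsOrderedAddMonoid A]
  {V : VoronoiData L A}

lemma exists_ne_zero_of_finsum_ne_zero {α M : Type*} [AddCommMonoid M] {f : α → M}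
    (h : ∑ᶠ x, f x ≠ 0) : ∃ x, f x ≠ 0 := by
  by_contra! hf
  exact h (by simp [hf])

lemma finite_bd₀_support {z : (Fin 9 → L) → ℂ} (hz : z ∈ V.chains 9) :
    (V.bd₀ z).support.Finite := by
  refine Set.Finite.subset (hz.2.1.biUnion fun v hv => V.fin _ (hz.2.2 v hv).1) ?_
  intro φ hφ
  obtain ⟨v, hv⟩ := exists_ne_zero_of_finsum_ne_zero (f := fun v => (V.Ω φ v : ℂ) * z v) hφ
  have h1 : V.Ω φ v ≠ 0 := by exact_mod_cast left_ne_zero_of_mul hv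
  simp only [Set.mem_iUnion, exists_prop]
  exact ⟨v, right_ne_zero_of_mul hv, mins_of_Ω_ne h1⟩

lemma mem_of_bd₀_ne {z : (Fin 9 → L) → ℂ} {φ} (h : V.bd₀ z φ ≠ 0) : φ ∈ V.Φ := by
  obtain ⟨v, hv⟩ := exists_ne_zero_of_finsum_ne_zero (f := fun v => (V.Ω φ v : ℂ) * z v) h
  have h1 : V.Ω φ v ≠ 0 := by exact_mod_cast left_ne_zero_of_mul hv
  exact (mins_of_Ω_ne h1).1

lemma exists_facet {v : Fin 9 → L} (hv : Function.Injective v) (hc : V.Cell (Set.range v)) :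
    ∃ φ ∈ V.Φ, ∃ (c : Chart V.Q V.Φ φ) (s : Fin c.B → Fin c.n), c.IsFacet s v := by
  obtain ⟨φ, hφ, _, _, _, hm, _⟩ := hc.2
  obtain ⟨c⟩ := V.chart φ hφ
  obtain ⟨_, s, hs⟩ := (cell_iff hφ c hm).1 hc
  exact ⟨φ, hφ, c, s, Chart.isFacet_of_avoid hv hm hs⟩

lemma finsum_bd₀ {z : (Fin 9 → L) → ℂ} (hz : z ∈ V.chains 9) : ∑ᶠ φ, V.bd₀ z φ = 0 := by
  classical
  have hfin : ∀ v ∈ hz.2.1.toFinset, {φ | φ ∈ V.Φ ∧ ∀ x ∈ Set.range v, φ x = 2}.Finite := by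
    intro v hv
    exact V.fin _ (hz.2.2 v (by simpa using hv)).1
  set F := hz.2.1.toFinset.attach.biUnion fun v => (hfin v v.2).toFinset with hF
  have hFmem : ∀ v, z v ≠ 0 → ∀ φ ∈ V.Φ, Mins φ (Set.range v) → φ ∈ F := by
    intro v hv φ hφ hm
    simp only [hF, Finset.mem_biUnion, Finset.mem_attach, true_and, Set.Finite.mem_toFinset,
      Subtype.exists]
    exact ⟨v, hv, hφ, hm⟩
  have h1 : ∀ φ, V.bd₀ z φ = ∑ v ∈ hz.2.1.toFinset, (V.Ω φ v : ℂ) * z v := by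
    intro φ
    refine finsum_eq_sum_of_support_subset _ fun v hv => ?_
    simpa using right_ne_zero_of_mul hv
  rw [finsum_eq_sum_of_support_subset (s := F)]
  · simp only [h1]
    rw [Finset.sum_comm]
    refine Finset.sum_eq_zero fun v hv => ?_
    have hzv : z v ≠ 0 := by simpa using hv
    rw [← Finset.sum_mul]
    have hinj : Function.Injective v := by
      by_contra h
      exact hzv (hz.1.eq_zero h)
    obtain ⟨φ, hφ, c, s, hs⟩ := exists_facet hinj (hz.2.2 v hzv)
    have hφ' := c.e_form s
    have hm' : Mins (φ + c.e s) (Set.range v) := c.mem_form_of_avoid hs.avoid hs.mins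
    have hne : φ ≠ φ + c.e s := fun h => c.e_ne s (by simpa using h)
    have h2 : ∑ ψ ∈ F, (V.Ω ψ v : ℂ) = ∑ ψ ∈ {φ, φ + c.e s}, (V.Ω ψ v : ℂ) := by
      symm
      refine Finset.sum_subset ?_ ?_
      · intro ψ hψ
        rcases Finset.mem_insert.1 hψ with rfl | hψ
        · exact hFmem v hzv _ hφ hs.mins
        · rw [Finset.mem_singleton.1 hψ]
          exact hFmem v hzv _ hφ' hm'
      · intro ψ _ hψ
        by_contra hcon
        have h3 := mins_of_Ω_ne (V := V) (φ := ψ) (v := v) (by exact_mod_cast hcon)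
        refine hψ ?_
        by_cases h4 : ψ = φ
        · simp [h4]
        · rw [eq_add_e hφ hs h3.1 h3.2 h4]
          simp
    rw [h2, Finset.sum_pair hne, Ω_add_e hφ hs]
    simp
  · intro φ hφ
    obtain ⟨v, hv⟩ := exists_ne_zero_of_finsum_ne_zero (f := fun v => (V.Ω φ v : ℂ) * z v) hφ
    have h3 := mins_of_Ω_ne (V := V) (φ := φ) (v := v)
      (by exact_mod_cast left_ne_zero_of_mul hv)
    exact hFmem v (right_ne_zero_of_mul hv) φ h3.1 h3.2

lemma sum_mul_bd {P : Type*} [Fintype P] {m : ℕ} {g : (Fin (m + 1) → P) → ℂ} (hg : Alt g)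
    (y : (Fin m → P) → ℂ) : ∑ w, g w * bd y w =
      (m + 1) * ∑ u : Fin m → P, (∑ p, g (Fin.cons p u : Fin (m + 1) → P)) * y u := by
  have h1 : ∀ i : Fin (m + 1), ∑ w, g w * ((-1) ^ (i : ℕ) * y (w ∘ i.succAbove)) =
      ∑ w, g w * y (w ∘ Fin.succ) := by
    intro i
    rw [← (Equiv.arrowCongr i.cycleRange.symm (Equiv.refl P)).sum_comp]
    refine Finset.sum_congr rfl fun w _ => ?_
    have h2 : (Equiv.arrowCongr i.cycleRange.symm (Equiv.refl P)) w = w ∘ i.cycleRange := by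
      funext x; simp
    have h3 : (w ∘ i.cycleRange) ∘ i.succAbove = w ∘ Fin.succ := by
      funext x
      simp
    rw [h2, h3, hg, Fin.sign_cycleRange]
    push_cast
    rw [mul_mul_mul_comm, ← mul_assoc, mul_right_comm _ (g w), ← mul_pow]
    simp [mul_comm]
  simp only [bd, Finset.mul_sum]
  rw [Finset.sum_comm]
  rw [Finset.sum_congr rfl (fun i _ => h1 i)]
  rw [Finset.sum_const, Finset.card_univ, Fintype.card_fin, nsmul_eq_mul, ← Finset.mul_sum]
  push_cast
  congr 1
  rw [← (Fin.consEquiv fun _ : Fin (m + 1) => P).sum_comp, Fintype.sum_prod_type_right]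
  refine Finset.sum_congr rfl fun u _ => ?_
  rw [Finset.sum_mul]
  refine Finset.sum_congr rfl fun p _ => ?_
  rfl

/-- The two ways to complete a codimension two face to a facet have opposite orientations. -/
lemma sum_Ω_cons {φ} (hφ : φ ∈ V.Φ) (c : Chart V.Q V.Φ φ) {u : Fin 8 → Fin c.B × Fin c.n}
    (hu : Function.Injective u) (hc : V.Cell (Set.range (c.pt ∘ u))) [DecidablePred V.Cell] :
    ∑ p, (if V.Cell (Set.range (c.pt ∘ (Fin.cons p u : Fin 9 → _))) then
      (V.Ω φ (c.pt ∘ (Fin.cons p u : Fin 9 → _)) : ℂ) else 0) = 0 := by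
  classical
  have hcons : ∀ p, c.pt ∘ (Fin.cons p u : Fin 9 → _) =
      (Fin.cons (c.pt p) (c.pt ∘ u) : Fin 9 → L) := by
    intro p
    funext k
    refine Fin.cases ?_ (fun k => ?_) k <;> simp
  have hmins : ∀ {m : ℕ} (w : Fin m → Fin c.B × Fin c.n), Mins φ (Set.range (c.pt ∘ w)) := by
    rintro m w _ ⟨i, rfl⟩
    exact (c.mem _).2 ⟨_, _, rfl⟩
  have hmem : ∀ {m : ℕ} (w : Fin m → Fin c.B × Fin c.n) (p), c.pt p ∈ Set.range (c.pt ∘ w) ↔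
      p ∈ Set.range w := by
    intro m w p
    rw [Set.range_comp, c.pt_injective.mem_set_image]
  obtain ⟨hspan, s, hs⟩ := (cell_iff hφ c (hmins u)).1 hc
  have hs' : ∀ b, (b, s b) ∉ Set.range u := fun b h => hs b ((hmem u (b, s b)).2 h)
  obtain ⟨b₀, j₀, hj₀, hp₀⟩ : ∃ b j, j ≠ s b ∧ (b, j) ∉ Set.range u := by
    by_contra! h
    have := facet_le (v := c.pt ∘ u) c s (fun b j hj => (hmem u (b, j)).2 (h b j hj))
    omega
  set s₁ := Function.update s b₀ j₀ with hs₁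
  have hinj : ∀ p, p ∉ Set.range u → Function.Injective (c.pt ∘ (Fin.cons p u : Fin 9 → _)) :=
    fun p hp => c.pt_injective.comp (Fin.cons_injective_iff.2 ⟨hp, hu⟩)
  have hf₁ : c.IsFacet s (c.pt ∘ (Fin.cons (b₀, j₀) u : Fin 9 → _)) := by
    refine Chart.isFacet_of_avoid (hinj _ hp₀) (hmins _) fun b => ?_
    have := hmem (Fin.cons (b₀, j₀) u : Fin 9 → _) (b, s b)
    rw [Fin.range_cons] at this
    refine fun h => ?_
    rcases this.1 h with h | h
    · rw [Prod.mk.injEq] at h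
      have hb := h.1
      subst hb
      exact hj₀ h.2.symm
    · exact hs' b h
  have hf₂ : c.IsFacet s₁ (c.pt ∘ (Fin.cons (b₀, s b₀) u : Fin 9 → _)) := by
    refine Chart.isFacet_of_avoid (hinj _ (hs' b₀)) (hmins _) fun b => ?_
    have := hmem (Fin.cons (b₀, s b₀) u : Fin 9 → _) (b, s₁ b)
    rw [Fin.range_cons] at this
    refine fun h => ?_
    by_cases hb : b = b₀
    · subst hb
      simp only [hs₁, Function.update_self] at this h
      rcases this.1 h with h | h
      · exact hj₀ (Prod.mk.injEq _ _ _ _ ▸ h).2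
      · exact hp₀ h
    · simp only [hs₁, Function.update_of_ne hb] at this h
      rcases this.1 h with h | h
      · exact hb (Prod.mk.injEq _ _ _ _ ▸ h).1
      · exact hs' b h
  have hcell : ∀ {t : Fin c.B → Fin c.n} {p}, c.IsFacet t (c.pt ∘ (Fin.cons p u : Fin 9 → _)) →
      V.Cell (Set.range (c.pt ∘ (Fin.cons p u : Fin 9 → _))) := by
    intro t p hp
    refine (cell_iff hφ c (hmins _)).2 ⟨hspan.mono V ?_, t, hp.avoid⟩
    rw [hcons, Fin.range_cons]
    exact Set.subset_insert _ _
  have hne : ((b₀, j₀) : Fin c.B × Fin c.n) ≠ (b₀, s b₀) := fun h =>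
    hj₀ (Prod.mk.injEq _ _ _ _ ▸ h).2
  rw [← Finset.sum_subset (Finset.subset_univ {(b₀, j₀), (b₀, s b₀)}), Finset.sum_pair hne,
    if_pos (hcell hf₁), if_pos (hcell hf₂), Ω_eq c hφ (hmins _), Ω_eq c hφ (hmins _),
    hf₁.weight (V.D_mem _) (V.D_self _) b₀, hf₂.weight (V.D_mem _) (V.D_self _) b₀]
  · rw [hcons, hcons]
    have h1 := V.D_swap (c.pt ∘ u) (c.pt (b₀, j₀)) (c.pt (b₀, s b₀))
    have h2 : c.r b₀ (s₁ b₀) = c.pt (b₀, j₀) := by simp [hs₁, Chart.pt]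
    have h3 : c.r b₀ (s b₀) = c.pt (b₀, s b₀) := rfl
    rw [h2, h3, h1, Int.sign_neg]
    simp
  · intro p _ hp
    split_ifs with hcp
    · by_contra hcon
      have hpu : p ∉ Set.range u := by
        rintro ⟨i, hi⟩
        refine hcon (Alt.eq_zero (Ω_alt φ) fun h => ?_)
        have := @h 0 i.succ (by simp [hi])
        exact Fin.succ_ne_zero i this.symm
      obtain ⟨_, s', hs₂⟩ := (cell_iff hφ c (hmins _)).1 hcp
      have hf := Chart.isFacet_of_avoid (hinj p hpu) (hmins _) hs₂
      have h5 : ∀ q, q ∉ Set.range u → q ≠ p → q.2 = s' q.1 := by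
        intro q hq hqp
        by_contra h
        have := hf.mem_range h
        rw [show c.r q.1 q.2 = c.pt q from rfl, hmem, Fin.range_cons] at this
        rcases this with h | h
        · exact hqp h
        · exact hq h
      have h6 := h5 (b₀, j₀) hp₀ (by rintro rfl; simp at hp)
      have h7 := h5 (b₀, s b₀) (hs' b₀) (by rintro rfl; simp at hp)
      exact hj₀ (h6.trans h7.symm)
    · rfl

lemma bd₀_cbd {y : (Fin 8 → L) → ℂ} (hy : y ∈ V.chains 8) : V.bd₀ (V.cbd y) = 0 := by
  classical
  funext φ
  by_cases hφ : φ ∈ V.Φ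
  swap
  · by_contra h
    exact hφ (mem_of_bd₀_ne h)
  obtain ⟨c⟩ := V.chart φ hφ
  rw [bd₀_eq_sum c]
  set g : (Fin 9 → Fin c.B × Fin c.n) → ℂ := fun w =>
    if V.Cell (Set.range (c.pt ∘ w)) then (V.Ω φ (c.pt ∘ w) : ℂ) else 0 with hg
  have hgalt : Alt g := by
    intro w σ
    have h : Set.range ((c.pt ∘ w) ∘ σ) = Set.range (c.pt ∘ w) := σ.surjective.range_comp _
    simp only [hg, ← Function.comp_assoc, Ω_perm]
    rw [h]
    split_ifs <;> simp
  have h1 : ∀ w : Fin 9 → Fin c.B × Fin c.n, (V.Ω φ (c.pt ∘ w) : ℂ) * V.cbd y (c.pt ∘ w) =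
      g w * bd (fun u => y (c.pt ∘ u)) w := by
    intro w
    simp only [hg, cbd]
    split_ifs
    · rfl
    · simp
  rw [Finset.sum_congr rfl fun w _ => h1 w, sum_mul_bd hgalt]
  refine mul_eq_zero_of_right _ (Finset.sum_eq_zero fun u _ => ?_)
  by_cases hyu : y (c.pt ∘ u) = 0
  · simp [hyu]
  have hu : Function.Injective u := by
    by_contra h
    exact hyu (hy.1.eq_zero fun h' => h h'.of_comp)
  rw [sum_Ω_cons hφ c hu (hy.2.2 _ hyu), zero_mul]

theorem exact_facets {z : (Fin 9 → L) → ℂ} (hz : z ∈ V.chains 9) (hcyc : V.bd₀ z = 0) :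
    ∃ y ∈ V.chains 8, V.cbd y = z := by
  classical
  have hcbd : V.cbd z = 0 := by
    have h10 := V.cbd_mem hz
    funext v
    by_contra hne
    obtain ⟨φ, hφ, _, _, _, hm, _⟩ := (h10.2.2 v hne).2
    obtain ⟨c⟩ := V.chart φ hφ
    obtain ⟨_, s, hs⟩ := (cell_iff hφ c hm).1 (h10.2.2 v hne)
    have hinj : Function.Injective v := by
      by_contra h
      exact hne (h10.1.eq_zero h)
    have : ∀ i, ∃ p : Σ b, {j // j ≠ s b}, c.r p.1 p.2 = v i := fun i =>
      let ⟨b, j, h⟩ := (c.mem _).1 (hm _ ⟨i, rfl⟩)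
      ⟨⟨b, j, fun h' => hs b ⟨i, by rw [← h, h']⟩⟩, h⟩
    choose f hf using this
    have := Fintype.card_le_of_injective f fun i i' h => hinj (by rw [← hf, ← hf, h])
    rw [c.facet_card, Fintype.card_fin] at this
    omega
  refine exists_fill (fun z => z.support.Finite ∧ V.bd₀ z = 0) ?_ ?_ hz hcbd ⟨hz.2.1, hcyc⟩
  · rintro z y hy ⟨hz, h⟩
    have : z - V.cbd y = z + (-1 : ℂ) • V.cbd y := by rw [neg_one_smul, sub_eq_add_neg]
    have hfin : ((-1 : ℂ) • V.cbd y).support.Finite :=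
      (V.cbd_mem hy).2.1.subset (Function.support_const_smul_subset _ _)
    rw [this]
    refine ⟨(hz.union hfin).subset (Function.support_add _ _), ?_⟩
    rw [bd₀_add hz hfin, bd₀_smul, bd₀_cbd hy, h]
    simp
  · rintro z hz ⟨-, h0⟩ φ hφ c t h v hv
    by_contra hne
    have hvf := Chart.isFacet_of_subset (h v hne hv)
    have h1 := congrFun h0 φ
    rw [bd₀_eq_sum c] at h1
    set κ := (V.Ω φ v : ℂ) * z v with hκ
    have hκ0 : κ ≠ 0 := mul_ne_zero (by exact_mod_cast Ω_facet_ne hφ hvf) hne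
    have h2 : ∀ w : Fin 9 → Fin c.B × Fin c.n, (V.Ω φ (c.pt ∘ w) : ℂ) * z (c.pt ∘ w) =
        if z (c.pt ∘ w) ≠ 0 then κ else 0 := by
      intro w
      split_ifs with hw
      · have hwm : Mins φ (Set.range (c.pt ∘ w)) := by
          rintro _ ⟨i, rfl⟩
          exact (c.mem _).2 ⟨_, _, rfl⟩
        have hwf := Chart.isFacet_of_subset (h _ hw hwm)
        have : ∀ i, ∃ i', v i' = (c.pt ∘ w) i := fun i => by
          obtain ⟨b, j, hj, h⟩ := hwf.2 i
          rw [← h]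
          exact hvf.mem_range hj
        choose σ hσ using this
        have hσi : Function.Injective σ := fun i i' h => hwf.1 (by rw [← hσ, ← hσ, h])
        have h3 : c.pt ∘ w = v ∘ (Equiv.ofBijective σ (Finite.injective_iff_bijective.1 hσi)) :=
          funext fun i => (hσ i).symm
        rw [h3, hz.1, Ω_perm, hκ]
        push_cast
        rw [mul_mul_mul_comm]
        rcases Int.units_eq_one_or (Perm.sign (Equiv.ofBijective σ
          (Finite.injective_iff_bijective.1 hσi))) with h | h <;> simp [h]
      · simp [not_not.1 hw]
    rw [Finset.sum_congr rfl fun w _ => h2 w, ← Finset.sum_filter, Finset.sum_const,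
      nsmul_eq_mul] at h1
    have h3 := (mul_eq_zero.1 h1).resolve_right hκ0
    have h4 : ∀ i, ∃ p, c.pt p = v i := fun i =>
      let ⟨b, j, _, h⟩ := hvf.2 i
      ⟨(b, j), h⟩
    choose w hw using h4
    have hw' : c.pt ∘ w = v := funext hw
    have : w ∈ Finset.univ.filter fun w : Fin 9 → Fin c.B × Fin c.n => z (c.pt ∘ w) ≠ 0 := by
      simp [hw', hne]
    rw [Nat.cast_eq_zero, Finset.card_eq_zero] at h3
    rw [h3] at this
    simp at this

end VoronoiData

namespace VoronoiData

variable {L A : Type*} [AddCommGroup A] [LinearOrder A] [IsOrderedAddMonoid A]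
  {V : VoronoiData L A}

open Classical in
/-- The alternating function supported on the reorderings of a tuple. -/
noncomputable def altOf (v₀ v : Fin 9 → L) : ℂ :=
  ∑ σ : Perm (Fin 9), if v = v₀ ∘ σ then (Perm.sign σ : ℂ) else 0

lemma altOf_ne {v₀ v : Fin 9 → L} (h : altOf v₀ v ≠ 0) : ∃ σ : Perm (Fin 9), v = v₀ ∘ σ := by
  obtain ⟨σ, _, hσ⟩ := Finset.exists_ne_zero_of_sum_ne_zero h
  by_contra! h'
  simp [h' σ] at hσ

lemma altOf_alt (v₀ : Fin 9 → L) : Alt (altOf v₀) := by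
  classical
  intro v τ
  rw [altOf, altOf, Finset.mul_sum, ← Equiv.sum_comp (Equiv.mulRight τ)]
  refine Finset.sum_congr rfl fun σ _ => ?_
  have h : v ∘ τ = v₀ ∘ (σ * τ : Perm (Fin 9)) ↔ v = v₀ ∘ σ := by
    rw [Perm.coe_mul, ← Function.comp_assoc]
    exact τ.surjective.injective_comp_right.eq_iff
  simp only [Equiv.coe_mulRight, h]
  split_ifs <;> simp [mul_comm]

lemma altOf_mem {v₀ : Fin 9 → L} (h : V.Cell (Set.range v₀)) : altOf v₀ ∈ V.chains 9 := by
  refine ⟨altOf_alt v₀, ?_, fun v hv => ?_⟩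
  · refine (Set.finite_range fun σ : Perm (Fin 9) => v₀ ∘ σ).subset fun v hv => ?_
    obtain ⟨σ, rfl⟩ := altOf_ne hv
    exact ⟨σ, rfl⟩
  · obtain ⟨σ, rfl⟩ := altOf_ne hv
    rw [σ.surjective.range_comp]
    exact h

lemma bd₀_altOf (v₀ : Fin 9 → L) (φ) :
    V.bd₀ (altOf v₀) φ = Fintype.card (Perm (Fin 9)) * V.Ω φ v₀ := by
  classical
  have h : ∀ v, (V.Ω φ v : ℂ) * altOf v₀ v =
      ∑ σ : Perm (Fin 9), if v = v₀ ∘ σ then (V.Ω φ v₀ : ℂ) else 0 := by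
    intro v
    rw [altOf, Finset.mul_sum]
    refine Finset.sum_congr rfl fun σ _ => ?_
    split_ifs with h
    · rw [h, Ω_perm]
      rcases Int.units_eq_one_or (Perm.sign σ) with h | h <;> simp [h]
    · simp
  rw [bd₀, finsum_congr h, finsum_sum_comm]
  · refine (Finset.sum_congr rfl fun (σ : Perm (Fin 9)) _ =>
      finsum_eq_single _ (v₀ ∘ σ) fun v hv => if_neg hv).trans ?_
    simp
  · intro σ _
    refine (Set.finite_singleton (v₀ ∘ σ)).subset fun v hv => ?_
    by_contra h
    exact hv (if_neg h)

lemma _root_.Voronoi.Chart.exists_facet_tuple {Q Φ} {φ : L → ℤ} (c : Chart Q Φ φ)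
    (s : Fin c.B → Fin c.n) : ∃ v, c.IsFacet s v := by
  have e : Fin 9 ≃ Σ b, {j // j ≠ s b} :=
    Fintype.equivOfCardEq (by rw [c.facet_card, Fintype.card_fin])
  exact ⟨fun i => c.r (e i).1 (e i).2, (c.facet_injective s).comp e.injective,
    fun i => ⟨_, _, (e i).2.2, rfl⟩⟩

lemma exists_bd₀_step {φ} (hφ : φ ∈ V.Φ) (c : Chart V.Q V.Φ φ) {s : Fin c.B → Fin c.n}
    (hs : V.α (c.e s) < 0) [DecidableEq (L → ℤ)] :
    ∃ z ∈ V.chains 9, V.bd₀ z = Pi.single φ 1 - Pi.single (φ + c.e s) 1 := by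
  obtain ⟨v, hv⟩ := c.exists_facet_tuple s
  have hav : ∀ t, c.Avoid t (Set.range v) → t = s := by
    intro t ht
    funext b
    by_contra h
    exact ht b (hv.mem_range h)
  have hcell : V.Cell (Set.range v) := by
    refine (cell_iff hφ c hv.mins).2 ⟨spans_of_low c fun t ht => ?_, s, hv.avoid⟩
    rw [hav t ht]
    exact hs
  have h0 : (Fintype.card (Perm (Fin 9)) * V.Ω φ v : ℂ) ≠ 0 :=
    mul_ne_zero (by simp [Fintype.card_ne_zero]) (by exact_mod_cast Ω_facet_ne hφ hv)
  refine ⟨_, (V.chains 9).smul_mem (Fintype.card (Perm (Fin 9)) * V.Ω φ v : ℂ)⁻¹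
    (altOf_mem hcell), ?_⟩
  have hne : φ + c.e s ≠ φ := by simpa using c.e_ne s
  funext ψ
  rw [bd₀_smul, Pi.smul_apply, bd₀_altOf, smul_eq_mul, Pi.sub_apply]
  by_cases h1 : ψ = φ
  · subst h1
    rw [inv_mul_cancel₀ h0, Pi.single_eq_same, Pi.single_eq_of_ne hne.symm, sub_zero]
  · by_cases h2 : ψ = φ + c.e s
    · subst h2
      rw [Pi.single_eq_same, Pi.single_eq_of_ne hne, Ω_add_e hφ hv]
      push_cast
      rw [mul_neg, mul_neg, inv_mul_cancel₀ h0, zero_sub]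
    · rw [Pi.single_eq_of_ne h1, Pi.single_eq_of_ne h2, sub_zero]
      have : V.Ω ψ v = 0 := by
        by_contra h
        have h3 := mins_of_Ω_ne h
        exact h2 (eq_add_e hφ hv h3.1 h3.2 h1)
      simp [this]

lemma bd₀_sum {ι : Type*} (s : Finset ι) (z : ι → (Fin 9 → L) → ℂ) (hz : ∀ i, z i ∈ V.chains 9) :
    V.bd₀ (∑ i ∈ s, z i) = ∑ i ∈ s, V.bd₀ (z i) := by
  classical
  induction s using Finset.induction_on with
  | empty =>
    funext φ
    simp [bd₀]
  | insert i s hi ih =>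
    rw [Finset.sum_insert hi, Finset.sum_insert hi,
      bd₀_add (hz i).2.1 ((V.chains 9).sum_mem fun i _ => hz i).2.1, ih]

theorem exact_forms {f : (L → ℤ) → ℂ} (hfin : f.support.Finite) (hf : ∀ φ, f φ ≠ 0 → φ ∈ V.Φ)
    (hsum : ∑ᶠ φ, f φ = 0) : ∃ z ∈ V.chains 9, V.bd₀ z = f := by
  classical
  have : Nonempty V.Φ := V.nonempty.to_subtype
  set φ₀ : V.Φ := V.wf.min Set.univ Set.univ_nonempty with hφ₀
  have hmin : ∀ φ : V.Φ, V.α φ₀ ≤ V.α φ := fun φ =>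
    not_lt.1 (V.wf.not_lt_min Set.univ (Set.mem_univ φ))
  have key : ∀ φ : V.Φ, ∃ z ∈ V.chains 9,
      V.bd₀ z = Pi.single (φ : L → ℤ) 1 - Pi.single (φ₀ : L → ℤ) 1 := by
    intro φ
    induction φ using V.wf.induction with
    | _ φ ih =>
    obtain ⟨c⟩ := V.chart φ φ.2
    by_cases h : ∃ s, V.α (c.e s) < 0
    · obtain ⟨s, hs⟩ := h
      obtain ⟨z, hz, h1⟩ := exists_bd₀_step φ.2 c hs
      obtain ⟨z', hz', h2⟩ := ih ⟨_, c.e_form s⟩ (by simpa using hs)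
      refine ⟨z + z', (V.chains 9).add_mem hz hz', ?_⟩
      rw [bd₀_add hz.2.1 hz'.2.1, h1, h2]
      simp
    · push Not at h
      have h1 := c.zero_le V.α (V.Q.sub_mem (V.Φ_sub φ₀.2) (V.Φ_sub φ.2))
        (sub_nonneg_r φ.2 c φ₀.2) fun s _ => h s
      rw [map_sub, sub_nonneg] at h1
      have h2 := V.α_injOn φ.2 φ₀.2 (le_antisymm h1 (hmin φ))
      refine ⟨0, (V.chains 9).zero_mem, ?_⟩
      rw [h2, sub_self]
      funext ψ
      simp [bd₀]
  choose z hz hbd using key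
  have hf' : f = ∑ φ ∈ hfin.toFinset, f φ • (Pi.single φ 1 : (L → ℤ) → ℂ) := by
    funext ψ
    simp only [Finset.sum_apply, Pi.smul_apply, Pi.single_apply, smul_eq_mul, mul_ite, mul_one,
      mul_zero, Finset.sum_ite_eq, Set.Finite.mem_toFinset, Function.mem_support]
    split_ifs with h
    · rfl
    · simpa using h
  have h0 : ∑ φ ∈ hfin.toFinset, f φ = 0 := by
    rw [← hsum, finsum_eq_sum_of_support_subset]
    simp
  refine ⟨∑ φ ∈ hfin.toFinset, f φ • (if h : φ ∈ V.Φ then z ⟨φ, h⟩ else 0),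
    (V.chains 9).sum_mem fun φ _ => (V.chains 9).smul_mem _ ?_, ?_⟩
  · split_ifs
    · exact hz _
    · exact zero_mem _
  · rw [bd₀_sum]
    · conv_rhs => rw [hf']
      have h3 : ∀ φ ∈ hfin.toFinset, V.bd₀ (f φ • (if h : φ ∈ V.Φ then z ⟨φ, h⟩ else 0)) =
          f φ • (Pi.single φ 1 : (L → ℤ) → ℂ) - f φ • Pi.single (φ₀ : L → ℤ) 1 := by
        intro φ hφ
        rw [bd₀_smul, dif_pos (hf φ (by simpa using hφ)), hbd, smul_sub]
      rw [Finset.sum_congr rfl h3, Finset.sum_sub_distrib, ← Finset.sum_smul, h0, zero_smul,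
        sub_zero]
    · intro φ
      refine (V.chains 9).smul_mem _ ?_
      split_ifs
      · exact hz _
      · exact zero_mem _

end VoronoiData

end Voronoi

namespace Voronoi

open CategoryTheory

section Averaging

variable {X G : Type} [Group G] [MulAction G X]

/-- Translation of functions on a `G`-set. -/
def tr (γ : G) : (X → ℂ) →ₗ[ℂ] (X → ℂ) := LinearMap.funLeft ℂ ℂ fun x => γ⁻¹ • x

@[simp] lemma tr_apply (γ : G) (f : X → ℂ) (x : X) : tr γ f x = f (γ⁻¹ • x) := rfl

lemma tr_one (f : X → ℂ) : tr (1 : G) f = f := by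
  funext x
  simp

lemma tr_mul (γ δ : G) (f : X → ℂ) : tr (γ * δ) f = tr γ (tr δ f) := by
  funext x
  simp [mul_smul]

lemma tr_inv_tr (γ : G) (f : X → ℂ) : tr γ⁻¹ (tr γ f) = f := by
  rw [← tr_mul, inv_mul_cancel, tr_one]

lemma tr_tr_inv (γ : G) (f : X → ℂ) : tr γ (tr γ⁻¹ f) = f := by
  rw [← tr_mul, mul_inv_cancel, tr_one]

/-- The representation on a translation invariant space of functions. -/
def trRep (M : Submodule ℂ (X → ℂ)) (hM : ∀ (γ : G), ∀ m ∈ M, tr γ m ∈ M) :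
    Representation ℂ G M where
  toFun γ := (tr γ).restrict (hM γ)
  map_one' := by
    ext m : 2
    exact tr_one (m : X → ℂ)
  map_mul' γ δ := by
    ext m : 2
    exact tr_mul γ δ (m : X → ℂ)

@[simp] lemma trRep_apply (M : Submodule ℂ (X → ℂ)) (hM : ∀ (γ : G), ∀ m ∈ M, tr γ m ∈ M) (γ) (m) :
    (trRep M hM γ m : X → ℂ) = tr γ m := rfl

variable (G) in
open Classical in
/-- A weight function whose translates sum to one on the orbits of `F`. -/
noncomputable def wt (F : Set X) (x : X) : ℂ :=
  if x ∈ F then (Nat.card {γ : G // γ⁻¹ • x ∈ F} : ℂ)⁻¹ else 0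

lemma card_orbit_smul (F : Set X) (δ : G) (x : X) :
    Nat.card {γ : G // γ⁻¹ • (δ • x) ∈ F} = Nat.card {γ : G // γ⁻¹ • x ∈ F} := by
  refine Nat.card_congr ((Equiv.mulLeft δ⁻¹).subtypeEquiv fun γ => ?_)
  simp [mul_smul]

variable (G) in
/-- A subset of a `G`-set with finite stabilizers, whose orbits meet the finite set `F`. -/
structure Proper (S F : Set X) : Prop where
  finite : F.Finite
  smul_mem : ∀ (γ : G), ∀ x ∈ S, γ • x ∈ S
  fin : ∀ x ∈ S, ∀ y, {γ : G | γ⁻¹ • x = y}.Finite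
  cover : ∀ x ∈ S, ∃ γ : G, γ⁻¹ • x ∈ F

namespace Proper

variable {S F : Set X} (h : Proper G S F)
include h

lemma fin_set {x} (hx : x ∈ S) {F' : Set X} (hF : F'.Finite) : {γ : G | γ⁻¹ • x ∈ F'}.Finite := by
  refine (hF.biUnion fun y _ => h.fin x hx y).subset fun γ hγ => ?_
  simp only [Set.mem_iUnion, exists_prop]
  exact ⟨_, hγ, rfl⟩

lemma fin_wt {x} (hx : x ∈ S) : {γ : G | wt G F (γ⁻¹ • x) ≠ 0}.Finite := by
  refine (h.fin_set hx h.finite).subset fun γ hγ => ?_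
  by_contra h
  exact hγ (if_neg h)

lemma sum_wt {x} (hx : x ∈ S) : ∑ᶠ γ : G, wt G F (γ⁻¹ • x) = 1 := by
  have hf := h.fin_set hx h.finite
  have h1 : ∀ γ : G, wt G F (γ⁻¹ • x) = Set.indicator {γ : G | γ⁻¹ • x ∈ F}
      (fun _ => (Nat.card {γ : G // γ⁻¹ • x ∈ F} : ℂ)⁻¹) γ := by
    intro γ
    classical
    rw [wt, card_orbit_smul, Set.indicator_apply]
    simp only [Set.mem_ofPred_eq]
  rw [finsum_congr h1, ← finsum_mem_def, finsum_mem_eq_finite_toFinset_sum _ hf, Finset.sum_const,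
    nsmul_eq_mul, ← Set.ncard_eq_toFinset_card _ hf]
  refine mul_inv_cancel₀ (Nat.cast_ne_zero.2 ?_)
  obtain ⟨γ, hγ⟩ := h.cover x hx
  have : Finite {γ : G // γ⁻¹ • x ∈ F} := hf
  have : Nonempty {γ : G // γ⁻¹ • x ∈ F} := ⟨γ, hγ⟩
  exact (Nat.card_pos (α := {γ : G // γ⁻¹ • x ∈ F})).ne'

lemma fin_tr {m : X → ℂ} (hm : m.support.Finite) (hS : ∀ x, m x ≠ 0 → x ∈ S) :
    {γ : G | wt G F * tr γ⁻¹ m ≠ 0}.Finite := by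
  refine (hm.biUnion fun x hx => h.fin_wt (hS x hx)).subset fun γ hγ => ?_
  obtain ⟨y, hy⟩ := Function.ne_iff.1 hγ
  simp only [Set.mem_iUnion, exists_prop]
  refine ⟨γ • y, ?_, ?_⟩
  · simpa using right_ne_zero_of_mul hy
  · simpa using left_ne_zero_of_mul hy

end Proper

end Averaging

lemma projective_of_average {G M : Type} [Group G] [AddCommGroup M] [Module ℂ M]
    (ρ : Representation ℂ G M) (h : M →ₗ[ℂ] M) (hfin : ∀ m, {γ | h (ρ γ⁻¹ m) ≠ 0}.Finite)
    (hsum : ∀ m, ∑ᶠ γ, ρ γ (h (ρ γ⁻¹ m)) = m) : Projective (Rep.of ρ) where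
  factors {E Y} f e _ := by
    have hsurj : Function.Surjective e.hom.toLinearMap := (Rep.epi_iff_surjective e).1 inferInstance
    obtain ⟨s, hs⟩ := e.hom.toLinearMap.exists_rightInverse_of_surjective
      (LinearMap.range_eq_top.2 hsurj)
    have hs' : ∀ y, e.hom (s y) = y := fun y => LinearMap.congr_fun hs y
    have hfin' : ∀ m, (Function.support fun γ => E.ρ γ (s (f.hom (h (ρ γ⁻¹ m))))).Finite := by
      refine fun m => (hfin m).subset fun γ hγ h0 => hγ ?_
      simp [h0]
    let φ : ρ.IntertwiningMap E.ρ :=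
      { toFun := fun m => ∑ᶠ γ, E.ρ γ (s (f.hom (h (ρ γ⁻¹ m))))
        map_add' := fun m m' => by
          rw [← finsum_add_distrib (hfin' m) (hfin' m')]
          exact finsum_congr fun γ => by simp
        map_smul' := fun a m => by
          rw [RingHom.id_apply, smul_finsum]
          exact finsum_congr fun γ => by simp
        isIntertwining' := fun δ => by
          ext m
          simp only [LinearMap.comp_apply, LinearMap.coe_mk, AddHom.coe_mk]
          rw [map_finsum (E.ρ δ) (hfin' m), ← finsum_comp_equiv (Equiv.mulLeft δ)]
          refine finsum_congr fun γ => ?_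
          simp [← Module.End.mul_apply, ← map_mul] }
    refine ⟨Rep.ofHom φ, ?_⟩
    ext m
    change e.hom (∑ᶠ γ, E.ρ γ (s (f.hom (h (ρ γ⁻¹ m))))) = f.hom m
    have h1 := map_finsum e.hom.toLinearMap (hfin' m)
    refine h1.trans ?_
    have h2 : ∀ γ, e.hom.toLinearMap (E.ρ γ (s (f.hom (h (ρ γ⁻¹ m))))) =
        f.hom.toLinearMap (ρ γ (h (ρ γ⁻¹ m))) := by
      intro γ
      refine (Rep.hom_comm_apply e γ _).trans ?_
      rw [hs']
      exact (Rep.hom_comm_apply f γ _).symm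
    rw [finsum_congr h2, ← map_finsum f.hom.toLinearMap, hsum]
    · rfl
    · exact (hfin m).subset fun γ hγ h0 => hγ (by simp [h0])

end Voronoi

namespace Voronoi

open CategoryTheory Equiv

attribute [local instance] arrowAction

namespace VoronoiData

variable {L : Type} {A : Type*} [AddCommGroup A] [LinearOrder A] [IsOrderedAddMonoid A]
  (V : VoronoiData L A) (G : Type) [Group G] [MulAction G L]

/-- A group acting on the lines of a Voronoi family, with finite stabilizers and finitely many
orbits of forms. -/
structure Equivariant : Prop where
  smul_Φ : ∀ (γ : G), ∀ φ ∈ V.Φ, γ • φ ∈ V.Φ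
  smul_R : ∀ (γ : G), ∀ w ∈ V.R, γ • w ∈ V.R
  smul_D : ∀ (γ : G) v x, V.D (γ • v) (γ • x) = V.D v x
  fin : ∀ φ ∈ V.Φ, ∀ ψ, {γ : G | γ • φ = ψ}.Finite
  orbits : ∃ F : Set (L → ℤ), F.Finite ∧ F ⊆ V.Φ ∧ ∀ φ ∈ V.Φ, ∃ γ : G, γ • φ ∈ F

variable {V G}

lemma smul_form (γ : G) (φ : L → ℤ) (x : L) : (γ • φ) x = φ (γ⁻¹ • x) := rfl

lemma range_smul {m : ℕ} (γ : G) (v : Fin m → L) :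
    Set.range (γ • v) = (fun x => γ • x) '' Set.range v := by
  rw [← Set.range_comp]
  rfl

lemma Mins.smul {φ : L → ℤ} {S : Set L} (h : Mins φ S) (γ : G) :
    Mins (γ • φ) ((fun x => γ • x) '' S) := by
  rintro _ ⟨x, hx, rfl⟩
  simpa [smul_form] using h x hx

lemma smul_mins_iff {φ : L → ℤ} {S : Set L} (γ : G) :
    Mins (γ • φ) ((fun x => γ • x) '' S) ↔ Mins φ S := by
  refine ⟨fun h x hx => ?_, fun h => h.smul γ⟩
  simpa [smul_form] using h _ ⟨x, hx, rfl⟩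

namespace Equivariant

variable (E : V.Equivariant G)
include E

lemma smul_Φ_iff (γ : G) {φ : L → ℤ} : γ • φ ∈ V.Φ ↔ φ ∈ V.Φ :=
  ⟨fun h => by simpa using E.smul_Φ γ⁻¹ _ h, E.smul_Φ γ φ⟩

lemma smul_cell (γ : G) {S : Set L} (h : V.Cell S) : V.Cell ((fun x => γ • x) '' S) := by
  obtain ⟨h, φ, hφ, ψ, hψ, hne, h1, h2⟩ := h
  refine ⟨fun w hw => ?_, γ • φ, E.smul_Φ γ φ hφ, γ • ψ, E.smul_Φ γ ψ hψ,
    fun h => hne (smul_left_cancel γ h), h1.smul γ, h2.smul γ⟩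
  obtain ⟨x, hx, hx'⟩ := h _ (E.smul_R γ⁻¹ w hw)
  exact ⟨_, ⟨x, hx, rfl⟩, by simpa [smul_form] using hx'⟩

lemma cell_smul {m : ℕ} (γ : G) {v : Fin m → L} :
    V.Cell (Set.range (γ • v)) ↔ V.Cell (Set.range v) := by
  refine ⟨fun h => ?_, fun h => ?_⟩
  · have := E.smul_cell γ⁻¹ h
    rwa [← range_smul, inv_smul_smul] at this
  · rw [range_smul]
    exact E.smul_cell γ h

lemma Ω_smul (γ : G) (φ : L → ℤ) (v : Fin 9 → L) : V.Ω (γ • φ) (γ • v) = V.Ω φ v := by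
  classical
  have h1 : (∑ᶠ x ∈ {x | (γ • φ) x = 2}, V.D (γ • v) x) = ∑ᶠ x ∈ {x | φ x = 2}, V.D v x := by
    rw [← finsum_comp_equiv (MulAction.toPerm γ)]
    refine finsum_congr fun x => ?_
    simp [smul_form, E.smul_D]
  rw [Ω, Ω, h1, range_smul, smul_mins_iff, E.smul_Φ_iff]

lemma bd₀_tr (γ : G) (z : (Fin 9 → L) → ℂ) : V.bd₀ (tr γ z) = tr γ (V.bd₀ z) := by
  funext φ
  rw [tr_apply, bd₀, bd₀, ← finsum_comp_equiv (MulAction.toPerm γ)]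
  refine finsum_congr fun v => ?_
  have := E.Ω_smul γ (γ⁻¹ • φ) v
  rw [smul_inv_smul] at this
  simp [this]

lemma cbd_tr {m : ℕ} (γ : G) (f : (Fin m → L) → ℂ) : V.cbd (tr γ f) = tr γ (V.cbd f) := by
  funext v
  have h : V.Cell (Set.range v) ↔ V.Cell (Set.range (γ⁻¹ • v)) := (E.cell_smul γ⁻¹).symm
  rw [tr_apply, cbd, cbd]
  split_ifs with h1 h2 h2
  · rfl
  · exact absurd (h.1 h1) h2
  · exact absurd (h.2 h2) h1
  · rfl

end Equivariant

lemma tr_alt {m : ℕ} (γ : G) {f : (Fin m → L) → ℂ} (hf : Alt f) : Alt (tr γ f) :=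
  fun v σ => hf (γ⁻¹ • v) σ

lemma tr_support {X : Type} [MulAction G X] (γ : G) {f : X → ℂ} (hf : f.support.Finite) :
    (tr γ f).support.Finite := by
  refine (hf.image (γ • ·)).subset fun x hx => ⟨γ⁻¹ • x, hx, by simp⟩

lemma Equivariant.tr_mem (E : V.Equivariant G) {m : ℕ} (γ : G) {f} (hf : f ∈ V.chains m) :
    tr γ f ∈ V.chains m :=
  ⟨tr_alt γ hf.1, tr_support γ hf.2.1, fun _ hv => (E.cell_smul γ⁻¹).1 (hf.2.2 _ hv)⟩

variable (V) in
/-- Finitely supported functions on the forms. -/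
def forms : Submodule ℂ ((L → ℤ) → ℂ) where
  carrier := {f | f.support.Finite ∧ ∀ φ, f φ ≠ 0 → φ ∈ V.Φ}
  zero_mem' := ⟨by simp, fun _ h => absurd rfl h⟩
  add_mem' := by
    rintro f g ⟨h2, h3⟩ ⟨h2', h3'⟩
    refine ⟨(h2.union h2').subset (Function.support_add f g), fun v hv => ?_⟩
    by_cases h : f v = 0
    · exact h3' v (by simpa [h] using hv)
    · exact h3 v h
  smul_mem' := by
    rintro a f ⟨h2, h3⟩
    refine ⟨h2.subset (Function.support_const_smul_subset a f), fun v hv => ?_⟩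
    exact h3 v (by simp at hv; exact hv.2)

lemma Equivariant.tr_mem_forms (E : V.Equivariant G) (γ : G) {f} (hf : f ∈ V.forms) :
    tr γ f ∈ V.forms :=
  ⟨tr_support γ hf.1, fun _ hφ => (E.smul_Φ_iff γ⁻¹).1 (hf.2 _ hφ)⟩

lemma Equivariant.proper_forms (E : V.Equivariant G) : ∃ F, Proper G V.Φ F := by
  obtain ⟨F, h1, h2, h3⟩ := E.orbits
  refine ⟨F, h1, E.smul_Φ, fun φ hφ ψ => ?_, fun φ hφ => ?_⟩
  · refine ((E.fin φ hφ ψ).image (·⁻¹)).subset fun γ hγ => ⟨γ⁻¹, hγ, inv_inv γ⟩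
  · obtain ⟨γ, hγ⟩ := h3 φ hφ
    exact ⟨γ⁻¹, by simpa using hγ⟩

lemma finite_mins {φ : L → ℤ} (hφ : φ ∈ V.Φ) : {x | φ x = 2}.Finite := by
  obtain ⟨c⟩ := V.chart φ hφ
  refine (Set.finite_range c.pt).subset fun x hx => ?_
  obtain ⟨b, j, h⟩ := (c.mem x).1 hx
  exact ⟨(b, j), h⟩

lemma Equivariant.proper_cells (E : V.Equivariant G) (m : ℕ) :
    ∃ F, Proper G {v : Fin m → L | V.Cell (Set.range v)} F ∧ ∀ v ∈ F, ∀ σ : Perm (Fin m), v ∘ σ ∈ F := by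
  obtain ⟨F, h1, h2, h3⟩ := E.orbits
  refine ⟨⋃ φ ∈ F, {v | Mins φ (Set.range v)}, ⟨?_, ?_, ?_, ?_⟩, ?_⟩
  · refine h1.biUnion fun φ hφ => ?_
    refine (Set.Finite.pi' fun _ : Fin m => finite_mins (h2 hφ)).subset fun v hv i => ?_
    exact hv _ ⟨i, rfl⟩
  · exact fun γ v hv => (E.cell_smul γ).2 hv
  · intro v hv y
    obtain ⟨hs, φ, hφ, -, -, -, hm, -⟩ := hv
    by_cases hy : V.Spans (Set.range y)
    · refine ((V.fin _ hy).biUnion fun ψ _ => (E.fin φ hφ ψ).image (·⁻¹)).subset fun γ hγ => ?_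
      simp only [Set.mem_iUnion]
      refine ⟨γ⁻¹ • φ, ⟨E.smul_Φ _ _ hφ, ?_⟩, γ⁻¹, rfl, inv_inv γ⟩
      have := hm.smul γ⁻¹
      rw [← range_smul, hγ] at this
      exact this
    · convert Set.finite_empty
      refine Set.eq_empty_of_forall_notMem fun γ hγ => hy ?_
      rw [← show γ⁻¹ • v = y from hγ, range_smul]
      intro w hw
      obtain ⟨x, hx, hx'⟩ := hs _ (E.smul_R γ w hw)
      exact ⟨_, ⟨x, hx, rfl⟩, by simpa [smul_form] using hx'⟩
  · intro v hv
    obtain ⟨-, φ, hφ, -, -, -, hm, -⟩ := hv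
    obtain ⟨γ, hγ⟩ := h3 φ hφ
    refine ⟨γ⁻¹, ?_⟩
    simp only [Set.mem_iUnion]
    refine ⟨_, hγ, ?_⟩
    have := hm.smul γ
    rw [← range_smul] at this
    simpa using this
  · intro v hv σ
    simp only [Set.mem_iUnion] at hv ⊢
    obtain ⟨φ, hφ, h⟩ := hv
    refine ⟨φ, hφ, ?_⟩
    have : Set.range (v ∘ σ) = Set.range v := σ.surjective.range_comp v
    rwa [Set.mem_ofPred_eq, this]

end VoronoiData

section

variable {X G : Type} [Group G] [MulAction G X]

lemma finsum_pointwise {ι : Type*} {f : ι → X → ℂ} (h : f.support.Finite) (x : X) :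
    (∑ᶠ i, f i) x = ∑ᶠ i, f i x :=
  map_finsum (LinearMap.proj x : (X → ℂ) →ₗ[ℂ] ℂ) h

/-- Multiplication by a function preserving a space of functions. -/
def mulBy (M : Submodule ℂ (X → ℂ)) (w : X → ℂ) (hw : ∀ m ∈ M, w * m ∈ M) : M →ₗ[ℂ] M :=
  (LinearMap.mulLeft ℂ w).restrict hw

namespace Proper

variable {S F : Set X} (h : Proper G S F) (M : Submodule ℂ (X → ℂ))
  (hM : ∀ (γ : G), ∀ m ∈ M, tr γ m ∈ M) (hw : ∀ m ∈ M, wt G F * m ∈ M)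
  (hfin : ∀ m ∈ M, m.support.Finite) (hS : ∀ m ∈ M, ∀ x, m x ≠ 0 → x ∈ S)
include h hfin hS

lemma finite_mulBy (m : M) : {γ | mulBy M _ hw (trRep M hM γ⁻¹ m) ≠ 0}.Finite :=
  (h.fin_tr (hfin m m.2) (hS m m.2)).subset fun _ hγ h0 => hγ (Subtype.ext h0)

lemma sum_mulBy (m : M) : ∑ᶠ γ, trRep M hM γ (mulBy M _ hw (trRep M hM γ⁻¹ m)) = m := by
  have hf' : {γ | trRep M hM γ (mulBy M _ hw (trRep M hM γ⁻¹ m)) ≠ 0}.Finite :=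
    (h.finite_mulBy M hM hw hfin hS m).subset fun γ hγ h0 => hγ (by simp [h0])
  refine Subtype.ext ?_
  have := map_finsum M.subtype hf'
  refine this.trans ?_
  funext x
  rw [finsum_pointwise (hf'.subset fun γ hγ h0 => hγ (by simp [h0]))]
  have h2 : ∀ γ : G, (M.subtype (trRep M hM γ (mulBy M _ hw (trRep M hM γ⁻¹ m)))) x =
      wt G F (γ⁻¹ • x) * (m : X → ℂ) x := by
    intro γ
    change wt G F (γ⁻¹ • x) * (m : X → ℂ) (γ⁻¹⁻¹ • γ⁻¹ • x) = _
    simp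
  rw [finsum_congr h2]
  by_cases hx : (m : X → ℂ) x = 0
  · simp [hx]
  · rw [← finsum_mul, h.sum_wt (hS m m.2 x hx), one_mul]

include hw in
lemma projective : Projective (Rep.of (trRep M hM)) :=
  projective_of_average _ (mulBy M _ hw) (h.finite_mulBy M hM hw hfin hS)
    (h.sum_mulBy M hM hw hfin hS)

end Proper

end

namespace VoronoiData

variable {L : Type} {A : Type*} [AddCommGroup A] [LinearOrder A] [IsOrderedAddMonoid A]
  {V : VoronoiData L A} {G : Type} [Group G] [MulAction G L]

lemma wt_perm {m : ℕ} {F : Set (Fin m → L)} (hF : ∀ v ∈ F, ∀ σ : Perm (Fin m), v ∘ σ ∈ F)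
    (v : Fin m → L) (σ : Perm (Fin m)) : wt G F (v ∘ σ) = wt G F v := by
  have h : ∀ u : Fin m → L, u ∘ σ ∈ F ↔ u ∈ F := fun u =>
    ⟨fun h => by
      have := hF _ h σ⁻¹
      rwa [Function.comp_assoc, ← Perm.coe_mul, mul_inv_cancel, Perm.coe_one,
        Function.comp_id] at this, fun h => hF u h σ⟩
  have h' : ∀ γ : G, γ • (v ∘ σ) = (γ • v) ∘ σ := fun γ => rfl
  simp only [wt, h, h']
  split_ifs with h1 h2 h2
  · rfl
  · exact absurd ((h v).1 h1) h2
  · exact absurd ((h v).2 h2) h1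
  · rfl

lemma Equivariant.wt_mul_mem {m : ℕ} {F : Set (Fin m → L)}
    (hF : ∀ v ∈ F, ∀ σ : Perm (Fin m), v ∘ σ ∈ F) {f} (hf : f ∈ V.chains m) :
    wt G F * f ∈ V.chains m := by
  refine ⟨fun v σ => ?_, hf.2.1.subset fun v hv h => hv (by simp [h]),
    fun v hv => hf.2.2 v fun h => hv (by simp [h])⟩
  simp only [Pi.mul_apply, wt_perm hF, hf.1 v σ]
  ring

lemma Equivariant.projective_chains (E : V.Equivariant G) (m : ℕ) :
    Projective (Rep.of (trRep (V.chains m) fun γ _ hf => E.tr_mem γ hf)) := by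
  obtain ⟨F, hF, hσ⟩ := E.proper_cells m
  exact hF.projective _ _ (fun f hf => wt_mul_mem hσ hf) (fun f hf => hf.2.1) fun f hf => hf.2.2

lemma Equivariant.projective_forms (E : V.Equivariant G) :
    Projective (Rep.of (trRep V.forms fun γ _ hf => E.tr_mem_forms γ hf)) := by
  obtain ⟨F, hF⟩ := E.proper_forms
  exact hF.projective _ _ (fun f hf => ⟨hf.1.subset fun v hv h => hv (by simp [h]),
    fun v hv => hf.2 v fun h => hv (by simp [h])⟩) (fun f hf => hf.1) fun f hf => hf.2

end VoronoiData

end Voronoi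

namespace Voronoi

open CategoryTheory

universe u

lemma finrank_homology {K : CochainComplex (ModuleCat.{0} ℂ) ℕ} (n : ℕ) 
    [FiniteDimensional ℂ (K.X (n + 1))] :
    Module.finrank ℂ (K.homology (n + 1)) + Module.finrank ℂ (LinearMap.range (K.d n (n + 1)).hom) =
      Module.finrank ℂ (LinearMap.ker (K.d (n + 1) (n + 2)).hom) := by
  have h2 : FiniteDimensional ℂ (K.sc' n (n + 1) (n + 2)).X₂ := ‹_›
  have h3 : FiniteDimensional ℂ (LinearMap.ker (K.sc' n (n + 1) (n + 2)).g.hom) := inferInstance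
  have e := ((ShortComplex.homologyMapIso (K.isoSc' n (n + 1) (n + 2) (by simp) (by simp))) ≪≫ 
    (K.sc' n (n + 1) (n + 2)).moduleCatHomologyIso).toLinearEquiv
  rw [show K.homology (n + 1) = (K.sc (n + 1)).homology from rfl, e.finrank_eq]
  refine Eq.trans ?_ (Submodule.finrank_quotient_add_finrank
    (LinearMap.range (K.sc' n (n + 1) (n + 2)).moduleCatToCycles))
  congr 1
  have h : LinearMap.range (K.sc' n (n + 1) (n + 2)).f.hom =
      (LinearMap.range (K.sc' n (n + 1) (n + 2)).moduleCatToCycles).map (Submodule.subtype _) := by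
    rw [← LinearMap.range_comp]
    rfl
  refine (congrArg (fun M : Submodule ℂ (K.sc' n (n + 1) (n + 2)).X₂ => Module.finrank ℂ M) h).trans ?_
  exact Submodule.finrank_map_subtype_eq _ _

section

variable {G : Type} [Group G] {X : ℕ → Rep.{0} ℂ G} {d : ∀ n, X (n + 1) ⟶ X n}
  (sq : ∀ n, d (n + 1) ≫ d n = 0) {Z : Rep.{0} ℂ G} {ε : X 0 ⟶ Z} (hε : d 0 ≫ ε = 0)
  (hsurj : Function.Surjective ε.hom) (h0 : ∀ x, ε.hom x = 0 → ∃ y, (d 0).hom y = x)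
  (h : ∀ n x, (d n).hom x = 0 → ∃ y, (d (n + 1)).hom y = x)

lemma chainComplex_of_d (n : ℕ) : (ChainComplex.of X d sq).d (n + 1) n = d n :=
  ChainComplex.of_d X d n

include hsurj h0 h in
lemma quasiIso_of_exact : QuasiIso (((ChainComplex.of X d sq).toSingle₀Equiv Z).symm
    ⟨ε, by rw [chainComplex_of_d sq]; exact hε⟩) where
  quasiIsoAt m := by
    cases m with
    | zero =>
      rw [ChainComplex.quasiIsoAt₀_iff, ShortComplex.quasiIso_iff_of_zeros' _ rfl rfl rfl]
      constructor
      · apply (forget₂ _ (ModuleCat ℂ)).reflects_exact_of_faithful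
        rw [ShortComplex.moduleCat_exact_iff]
        intro x hx
        obtain ⟨y, hy⟩ := h0 x hx
        exact ⟨y, by
          refine Eq.trans ?_ hy
          change ((ChainComplex.of X d sq).d 1 0).hom y = _
          rw [chainComplex_of_d sq]⟩
      · rw [Rep.epi_iff_surjective]
        exact hsurj
    | succ m =>
      rw [quasiIsoAt_iff_exactAt' (hL := ChainComplex.exactAt_succ_single_obj ..),
          HomologicalComplex.exactAt_iff' _ (m + 2) (m + 1) m (by simp) (by simp)]
      apply (forget₂ _ (ModuleCat ℂ)).reflects_exact_of_faithful
      rw [ShortComplex.moduleCat_exact_iff]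
      intro x hx
      obtain ⟨y, hy⟩ := h m x (by
        refine Eq.trans ?_ hx
        change _ = ((ChainComplex.of X d sq).d (m + 1) m).hom x
        rw [chainComplex_of_d sq])
      exact ⟨y, by
        refine Eq.trans ?_ hy
        change ((ChainComplex.of X d sq).d (m + 2) (m + 1)).hom y = _
        rw [chainComplex_of_d sq]⟩

include sq hε hsurj h0 h in
lemma finrank_groupCohomology (hp : ∀ n, Projective (X n)) (A : Rep.{0} ℂ G) (n : ℕ) 
    (hfin : FiniteDimensional ℂ (X (n + 1) ⟶ A)) (hZ : Z = Rep.trivial ℂ G ℂ) :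
    Module.finrank ℂ (groupCohomology A (n + 1)) +
      Module.finrank ℂ (LinearMap.range (Linear.leftComp ℂ A (d n))) =
      Module.finrank ℂ (LinearMap.ker (Linear.leftComp ℂ A (d (n + 1)))) := by
  subst hZ
  let P : ProjectiveResolution (Rep.trivial ℂ G ℂ) :=
    { complex := ChainComplex.of X d sq
      projective := hp
      π := _
      quasiIso := quasiIso_of_exact sq hε hsurj h0 h }
  rw [(groupCohomologyIso A (n + 1) P).toLinearEquiv.finrank_eq]
  have : FiniteDimensional ℂ ((P.complex.linearYonedaObj ℂ A).X (n + 1)) := hfin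
  have key := finrank_homology (K := P.complex.linearYonedaObj ℂ A) n
  have e : ∀ n, ((P.complex.linearYonedaObj ℂ A).d n (n + 1)).hom = Linear.leftComp ℂ A (d n) := by
    intro n
    have : P.complex.d (n + 1) n = d n := chainComplex_of_d sq n
    rw [← this]
    rfl
  rw [e, e (n + 1)] at key
  exact key

end

end Voronoi

namespace Voronoi

open CategoryTheory Equiv

attribute [local instance] arrowAction

section Conjugate

variable {K M N M' N' : Type*} [Field K] [AddCommGroup M] [Module K M] [AddCommGroup N]
  [Module K N] [AddCommGroup M'] [Module K M'] [AddCommGroup N'] [Module K N']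
  {f : M →ₗ[K] N} {f' : M' →ₗ[K] N'}

lemma finrank_range_eq_of_conj (e : M ≃ₗ[K] M') (e' : N ≃ₗ[K] N') (h : ∀ x, f' (e x) = e' (f x)) :
    Module.finrank K (LinearMap.range f') = Module.finrank K (LinearMap.range f) := by
  have h1 : f' ∘ₗ e.toLinearMap = e'.toLinearMap ∘ₗ f := LinearMap.ext h
  rw [← LinearEquiv.finrank_map_eq e' (LinearMap.range f), ← LinearMap.range_comp, ← h1,
    LinearMap.range_comp_of_range_eq_top _ e.range]

lemma finrank_ker_eq_of_conj (e : M ≃ₗ[K] M') (e' : N ≃ₗ[K] N') (h : ∀ x, f' (e x) = e' (f x)) :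
    Module.finrank K (LinearMap.ker f') = Module.finrank K (LinearMap.ker f) := by
  have h1 : LinearMap.ker f' = (LinearMap.ker f).map e.toLinearMap := by
    ext y
    obtain ⟨x, rfl⟩ := e.surjective y
    simp [h]
  rw [h1]
  exact LinearEquiv.finrank_map_eq e (LinearMap.ker f)

end Conjugate

namespace VoronoiData

variable {L : Type} {A : Type*} [AddCommGroup A] [LinearOrder A] [IsOrderedAddMonoid A]
  {V : VoronoiData L A} {G : Type} [Group G] [MulAction G L]

variable (V G) in
/-- Invariant alternating functions on cells with `m` lines. -/
def inv (m : ℕ) : Submodule ℂ ((Fin m → L) → ℂ) where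
  carrier := {f | Alt f ∧ (∀ γ : G, tr γ f = f) ∧ ∀ v, f v ≠ 0 → V.Cell (Set.range v)}
  zero_mem' := ⟨fun v σ => by simp, by simp, fun _ h => absurd rfl h⟩
  add_mem' := by
    rintro f g ⟨h1, h2, h3⟩ ⟨h1', h2', h3'⟩
    refine ⟨fun v σ => ?_, fun γ => by rw [map_add, h2, h2'], fun v hv => ?_⟩
    · simp only [Pi.add_apply, h1 v σ, h1' v σ, mul_add]
    · by_cases h : f v = 0
      · exact h3' v (by simpa [h] using hv)
      · exact h3 v h
  smul_mem' := by
    rintro a f ⟨h1, h2, h3⟩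
    refine ⟨fun v σ => ?_, fun γ => by rw [map_smul, h2], fun v hv => ?_⟩
    · simp only [Pi.smul_apply, smul_eq_mul, h1 v σ]; ring
    · exact h3 v (by simp at hv; exact hv.2)

namespace Equivariant

variable (E : V.Equivariant G)

/-- The representation on chains. -/
abbrev C (m : ℕ) : Rep.{0} ℂ G := Rep.of (trRep (V.chains m) fun γ _ hf => E.tr_mem γ hf)

/-- The representation on functions of forms. -/
abbrev P : Rep.{0} ℂ G := Rep.of (trRep V.forms fun γ _ hf => E.tr_mem_forms γ hf)

/-- The boundary map of cells as a map of representations. -/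
noncomputable def cbdHom (m : ℕ) : E.C m ⟶ E.C (m + 1) := Rep.ofHom
  { toFun := fun f : V.chains m => (⟨V.cbd f.1, V.cbd_mem f.2⟩ : V.chains (m + 1))
    map_add' := fun f g => Subtype.ext (V.cbd_add f.1 g.1)
    map_smul' := fun a f => Subtype.ext (V.cbd_smul a f.1)
    isIntertwining' := fun γ => LinearMap.ext fun f => Subtype.ext (E.cbd_tr γ f.1) }

lemma cbdHom_apply {m : ℕ} (f : V.chains m) : ((E.cbdHom m).hom f).1 = V.cbd f.1 := rfl

/-- The boundary map to forms as a map of representations. -/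
noncomputable def bd₀Hom : E.C 9 ⟶ E.P := Rep.ofHom
  { toFun := fun f : V.chains 9 =>
      (⟨V.bd₀ f.1, finite_bd₀_support f.2, fun _ => mem_of_bd₀_ne⟩ : V.forms)
    map_add' := fun f g => Subtype.ext (bd₀_add f.2.2.1 g.2.2.1)
    map_smul' := fun a f => Subtype.ext (bd₀_smul a f.1)
    isIntertwining' := fun γ => LinearMap.ext fun f => Subtype.ext (E.bd₀_tr γ f.1) }

lemma bd₀Hom_apply (f : V.chains 9) : (E.bd₀Hom.hom f).1 = V.bd₀ f.1 := rfl

/-- The augmentation. -/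
noncomputable def aug : E.P ⟶ Rep.trivial ℂ G ℂ := Rep.ofHom
  { toFun := fun f => ∑ᶠ φ, f.1 φ
    map_add' := fun f g => finsum_add_distrib f.2.1 g.2.1
    map_smul' := fun a f => (smul_finsum a f.1).symm
    isIntertwining' := fun γ => LinearMap.ext fun f =>
      finsum_comp_equiv (MulAction.toPerm γ⁻¹) (f := f.1) }

lemma aug_apply (f : V.forms) : E.aug.hom f = ∑ᶠ φ, f.1 φ := rfl

/-- The terms of the Voronoi resolution. -/
noncomputable def X : ℕ → Rep.{0} ℂ G
  | 0 => E.P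
  | 1 => E.C 9
  | 2 => E.C 8
  | 3 => E.C 7
  | 4 => E.C 6
  | 5 => E.C 5
  | 6 => E.C 4
  | _ + 7 => E.C 3

/-- The differentials of the Voronoi resolution. -/
noncomputable def d : ∀ n, E.X (n + 1) ⟶ E.X n
  | 0 => E.bd₀Hom
  | 1 => E.cbdHom 8
  | 2 => E.cbdHom 7
  | 3 => E.cbdHom 6
  | 4 => E.cbdHom 5
  | 5 => E.cbdHom 4
  | 6 => E.cbdHom 3
  | _ + 7 => 0

lemma cbdHom_comp (m : ℕ) : E.cbdHom m ≫ E.cbdHom (m + 1) = 0 := by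
  ext f
  exact congrFun (V.cbd_cbd (Subtype.property f).2.2) _

lemma cbdHom_exact {m : ℕ} (hm : m < 8) (x : V.chains (m + 1)) (hx : (E.cbdHom (m + 1)).hom x = 0) :
    ∃ y, (E.cbdHom m).hom y = x := by
  obtain ⟨y, hy, h⟩ := exact_chains hm x.2 (congrArg Subtype.val hx)
  exact ⟨⟨y, hy⟩, Subtype.ext h⟩

lemma d_comp (n : ℕ) : E.d (n + 1) ≫ E.d n = 0 := by
  match n with
  | 0 =>
    ext f
    exact Subtype.ext (bd₀_cbd f.2)
  | 1 => exact E.cbdHom_comp 7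
  | 2 => exact E.cbdHom_comp 6
  | 3 => exact E.cbdHom_comp 5
  | 4 => exact E.cbdHom_comp 4
  | 5 => exact E.cbdHom_comp 3
  | n + 6 => exact Limits.zero_comp

lemma d_exact (h3 : ∀ v : Fin 3 → L, ¬ V.Cell (Set.range v)) (n : ℕ) (x : E.X (n + 1))
    (hx : (E.d n).hom x = 0) : ∃ y, (E.d (n + 1)).hom y = x := by
  match n with
  | 0 =>
    obtain ⟨y, hy, h⟩ := exact_facets (V := V) x.2 (congrArg Subtype.val hx)
    exact ⟨⟨y, hy⟩, Subtype.ext h⟩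
  | 1 => exact E.cbdHom_exact (by norm_num) x hx
  | 2 => exact E.cbdHom_exact (by norm_num) x hx
  | 3 => exact E.cbdHom_exact (by norm_num) x hx
  | 4 => exact E.cbdHom_exact (by norm_num) x hx
  | 5 => exact E.cbdHom_exact (by norm_num) x hx
  | n + 6 =>
    refine ⟨0, Subtype.ext ?_⟩
    funext v
    by_contra h
    exact h3 v (x.2.2.2 v (Ne.symm h))

lemma d_zero_exact (x : E.X 0) (hx : E.aug.hom x = 0) : ∃ y, (E.d 0).hom y = x := by
  obtain ⟨y, hy, h⟩ := exact_forms (V := V) x.2.1 x.2.2 hx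
  exact ⟨⟨y, hy⟩, Subtype.ext h⟩

lemma aug_surjective : Function.Surjective E.aug.hom := by
  classical
  intro a
  obtain ⟨φ, hφ⟩ := V.nonempty
  refine ⟨⟨Pi.single φ a, (Set.finite_singleton φ).subset ?_, fun ψ hψ => ?_⟩, ?_⟩
  · intro ψ hψ
    by_contra h
    exact hψ (Pi.single_eq_of_ne (M := fun _ => ℂ) h a)
  · by_contra h
    exact hψ (Pi.single_eq_of_ne (M := fun _ => ℂ) (fun h' : ψ = φ => h (by rw [h']; exact hφ)) a)
  · refine (finsum_eq_single _ φ fun ψ hψ => Pi.single_eq_of_ne (M := fun _ => ℂ) hψ a).trans ?_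
    exact Pi.single_eq_same (M := fun _ => ℂ) φ a

lemma X_projective (n : ℕ) : Projective (E.X n) := by
  match n with
  | 0 => exact E.projective_forms
  | 1 => exact E.projective_chains 9
  | 2 => exact E.projective_chains 8
  | 3 => exact E.projective_chains 7
  | 4 => exact E.projective_chains 6
  | 5 => exact E.projective_chains 5
  | 6 => exact E.projective_chains 4
  | n + 7 => exact E.projective_chains 3

include E in
lemma finite_orbit_support {m : ℕ} {f} (hf : f ∈ V.chains m) (v : Fin m → L) :
    {γ : G | f (γ⁻¹ • v) ≠ 0}.Finite := by
  obtain ⟨F, hF, -⟩ := E.proper_cells m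
  by_cases hv : V.Cell (Set.range v)
  · exact hF.fin_set hv hf.2.1
  · convert Set.finite_empty
    exact Set.eq_empty_of_forall_notMem fun γ hγ => hv ((E.cell_smul γ⁻¹).1 (hf.2.2 _ hγ))

/-- Summation over the group. -/
noncomputable def avg (m : ℕ) : V.chains m →ₗ[ℂ] V.inv G m where
  toFun f := ⟨fun v => ∑ᶠ γ : G, f.1 (γ⁻¹ • v), by
    refine ⟨fun v σ => ?_, fun γ => ?_, fun v hv => ?_⟩
    · rw [← smul_eq_mul, smul_finsum]
      exact finsum_congr fun γ => (f.2.1 (γ⁻¹ • v) σ).trans (smul_eq_mul _ _).symm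
    · funext v
      rw [tr_apply, ← finsum_comp_equiv (Equiv.mulLeft γ⁻¹)]
      exact finsum_congr fun δ => by simp [smul_smul]
    · obtain ⟨γ, hγ⟩ := exists_ne_zero_of_finsum_ne_zero hv
      exact (E.cell_smul γ⁻¹).1 (f.2.2.2 _ hγ)⟩
  map_add' f g := Subtype.ext (funext fun v =>
    finsum_add_distrib (E.finite_orbit_support f.2 v) (E.finite_orbit_support g.2 v))
  map_smul' a f := Subtype.ext (funext fun v => (smul_finsum a _).symm)

lemma avg_apply {m : ℕ} (f : V.chains m) (v : Fin m → L) :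
    (E.avg m f).1 v = ∑ᶠ γ : G, f.1 (γ⁻¹ • v) := rfl

lemma avg_tr {m : ℕ} (γ : G) (f : V.chains m) (h : tr γ f.1 ∈ V.chains m) :
    E.avg m ⟨tr γ f.1, h⟩ = E.avg m f := by
  refine Subtype.ext (funext fun v => ?_)
  rw [avg_apply, avg_apply, ← finsum_comp_equiv (Equiv.mulRight γ) (f := fun δ => f.1 (δ⁻¹ • v))]
  refine finsum_congr fun δ => ?_
  simp [smul_smul]

/-- The boundary map of invariant functions. -/
noncomputable def cbdInv (m : ℕ) : V.inv G m →ₗ[ℂ] V.inv G (m + 1) where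
  toFun f := ⟨V.cbd f.1, V.cbd_alt f.2.1, fun γ => by rw [← E.cbd_tr, f.2.2.1], fun v hv => by
    rw [cbd] at hv
    split_ifs at hv with h
    · exact h
    · exact absurd rfl hv⟩
  map_add' f g := Subtype.ext (V.cbd_add f.1 g.1)
  map_smul' a f := Subtype.ext (V.cbd_smul a f.1)

lemma cbdInv_apply {m : ℕ} (f : V.inv G m) : (E.cbdInv m f).1 = V.cbd f.1 := rfl

lemma cbd_avg {m : ℕ} (f : V.chains m) :
    E.avg (m + 1) ((E.cbdHom m).hom f) = E.cbdInv m (E.avg m f) := by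
  refine Subtype.ext (funext fun v => ?_)
  rw [avg_apply, cbdInv_apply, cbdHom_apply]
  by_cases hv : V.Cell (Set.range v)
  · have h1 : V.cbd (E.avg m f).1 v = bd (E.avg m f).1 v := if_pos hv
    have h2 : ∀ γ : G, V.cbd f.1 (γ⁻¹ • v) = bd f.1 (γ⁻¹ • v) := fun γ =>
      if_pos ((E.cell_smul γ⁻¹).2 hv)
    rw [h1, finsum_congr h2]
    simp only [bd, avg_apply]
    rw [finsum_sum_comm]
    · exact Finset.sum_congr rfl fun i _ => (mul_finsum _ _).symm
    · exact fun i _ => (E.finite_orbit_support f.2 (v ∘ i.succAbove)).subset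
        fun γ hγ h0 => hγ (by
          change _ * f.1 (γ⁻¹ • (v ∘ i.succAbove)) = 0
          rw [h0, mul_zero])
  · rw [cbd, if_neg hv]
    have h2 : ∀ γ : G, V.cbd f.1 (γ⁻¹ • v) = 0 := fun γ =>
      if_neg (fun h => hv ((E.cell_smul γ⁻¹).1 h))
    simp [h2]

/-- Functionals on invariant functions define equivariant functionals on chains. -/
noncomputable def dualMap (m : ℕ) :
    Module.Dual ℂ (V.inv G m) →ₗ[ℂ] (E.C m ⟶ Rep.trivial ℂ G ℂ) where
  toFun l := Rep.ofHom
    { toLinearMap := l ∘ₗ E.avg m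
      isIntertwining' := fun γ => LinearMap.ext fun f => congrArg l (E.avg_tr γ f _) }
  map_add' _ _ := rfl
  map_smul' _ _ := rfl

lemma dualMap_apply {m : ℕ} (l : Module.Dual ℂ (V.inv G m)) (f : V.chains m) :
    (E.dualMap m l).hom f = l (E.avg m f) := rfl

lemma wt_mul_inv_mem {m : ℕ} {F : Set (Fin m → L)} (hF : F.Finite)
    (hσ : ∀ v ∈ F, ∀ σ : Perm (Fin m), v ∘ σ ∈ F) {f} (hf : f ∈ V.inv G m) :
    wt G F * f ∈ V.chains m := by
  refine ⟨fun v σ => ?_, hF.subset fun v hv => ?_, fun v hv => hf.2.2 v fun h => hv (by simp [h])⟩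
  · simp only [Pi.mul_apply, wt_perm hσ, hf.1 v σ]
    ring
  · by_contra h
    exact hv (by simp [wt, h])

lemma avg_wt {m : ℕ} {F : Set (Fin m → L)} (hF : Proper G {v : Fin m → L | V.Cell (Set.range v)} F)
    (f : V.inv G m) (h : wt G F * f.1 ∈ V.chains m) : E.avg m ⟨wt G F * f.1, h⟩ = f := by
  refine Subtype.ext (funext fun v => ?_)
  rw [avg_apply]
  have h2 : ∀ γ : G, (wt G F * f.1) (γ⁻¹ • v) = wt G F (γ⁻¹ • v) * f.1 v := fun γ => by
    rw [Pi.mul_apply]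
    congr 1
    exact congrFun (f.2.2.1 γ) v
  rw [finsum_congr h2, ← finsum_mul]
  by_cases hv : f.1 v = 0
  · simp [hv]
  · rw [hF.sum_wt (f.2.2.2 v hv), one_mul]

lemma dualMap_bijective (m : ℕ) : Function.Bijective (E.dualMap m) := by
  obtain ⟨F, hF, hσ⟩ := E.proper_cells m
  have hmem := fun f : V.inv G m => wt_mul_inv_mem hF.finite hσ f.2
  constructor
  · rw [injective_iff_map_eq_zero]
    intro l hl
    ext f
    have : (E.dualMap m l).hom ⟨_, hmem f⟩ = 0 := by rw [hl]; rfl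
    rwa [dualMap_apply, E.avg_wt hF] at this
  · intro φ
    let w : V.inv G m →ₗ[ℂ] V.chains m :=
      { toFun := fun f => ⟨wt G F * f.1, hmem f⟩
        map_add' := fun f g => Subtype.ext (mul_add _ _ _)
        map_smul' := fun a f => Subtype.ext (mul_smul_comm _ _ _) }
    refine ⟨φ.hom.toLinearMap ∘ₗ w, ?_⟩
    ext f
    change φ.hom (w (E.avg m f)) = φ.hom f
    have hM : ∀ (γ : G), ∀ f ∈ V.chains m, tr γ f ∈ V.chains m := fun γ _ hf => E.tr_mem γ hf
    have hw : ∀ f ∈ V.chains m, wt G F * f ∈ V.chains m := fun f hf => wt_mul_mem hσ hf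
    have h1 := hF.finite_mulBy (V.chains m) hM hw (fun f hf => hf.2.1) (fun f hf => hf.2.2) f
    have h2 := hF.sum_mulBy (V.chains m) hM hw (fun f hf => hf.2.1) (fun f hf => hf.2.2) f
    have h3 : w (E.avg m f) = ∑ᶠ γ, mulBy (V.chains m) _ hw (trRep _ hM γ⁻¹ f) := by
      refine Subtype.ext (Eq.trans ?_ (map_finsum (V.chains m).subtype h1).symm)
      funext v
      rw [finsum_pointwise (h1.subset fun γ hγ h0 => hγ (by simp [h0]))]
      change wt G F v * ∑ᶠ γ : G, f.1 (γ⁻¹ • v) = ∑ᶠ γ : G, wt G F v * f.1 (γ⁻¹⁻¹ • v)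
      rw [← mul_finsum, ← finsum_comp_equiv (Equiv.inv G)]
      rfl
    have h4 : ∀ γ, φ.hom.toLinearMap (trRep _ hM γ (mulBy _ _ hw (trRep _ hM γ⁻¹ f))) =
        φ.hom.toLinearMap (mulBy _ _ hw (trRep _ hM γ⁻¹ f)) := fun γ => Rep.hom_comm_apply φ γ _
    rw [h3]
    refine (map_finsum φ.hom.toLinearMap h1).trans ?_
    rw [← finsum_congr h4, ← map_finsum φ.hom.toLinearMap (h1.subset fun γ hγ h0 => hγ (by
      rw [h0, map_zero])), h2]
    rfl

variable (V G) in
lemma finiteDimensional_inv (E : V.Equivariant G) (m : ℕ) : FiniteDimensional ℂ (V.inv G m) := by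
  obtain ⟨F, hF, -⟩ := E.proper_cells m
  have := hF.finite.to_subtype
  refine Module.Finite.of_injective
    ((LinearMap.funLeft ℂ ℂ (Subtype.val : F → _)) ∘ₗ (V.inv G m).subtype) ?_
  rw [injective_iff_map_eq_zero]
  intro f hf
  refine Subtype.ext (funext fun v => ?_)
  by_contra h
  obtain ⟨γ, hγ⟩ := hF.cover v (f.2.2.2 v h)
  have h1 := congrFun hf ⟨_, hγ⟩
  exact h (Eq.trans (congrFun (f.2.2.1 γ) v).symm h1)

lemma leftComp_dualMap (m : ℕ) (l : Module.Dual ℂ (V.inv G (m + 1))) :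
    Linear.leftComp ℂ (Rep.trivial ℂ G ℂ) (E.cbdHom m) (E.dualMap (m + 1) l) =
      E.dualMap m ((E.cbdInv m).dualMap l) := by
  ext f
  exact congrArg l (E.cbd_avg f)

/-- The fifth cohomology as the homology of the complex of invariant chains. -/
theorem finrank_H5 (h3 : ∀ v : Fin 3 → L, ¬ V.Cell (Set.range v)) :
    Module.finrank ℂ (groupCohomology (Rep.trivial ℂ G ℂ) 5) +
      Module.finrank ℂ (LinearMap.range (E.cbdInv 4)) =
      Module.finrank ℂ (LinearMap.ker (E.cbdInv 5)) := by
  have i4 := finiteDimensional_inv V G E 4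
  have i5 := finiteDimensional_inv V G E 5
  have i6 := finiteDimensional_inv V G E 6
  let e := fun m => LinearEquiv.ofBijective _ (E.dualMap_bijective m)
  have hfin : FiniteDimensional ℂ (E.C 5 ⟶ Rep.trivial ℂ G ℂ) :=
    Module.Finite.equiv (e 5)
  have key := finrank_groupCohomology E.d_comp (ε := E.aug) (by
    ext f
    exact finsum_bd₀ f.2) E.aug_surjective E.d_zero_exact (E.d_exact h3) E.X_projective
    (Rep.trivial ℂ G ℂ) 4 hfin rfl
  have r5 : Module.finrank ℂ (LinearMap.range (Linear.leftComp ℂ (Rep.trivial ℂ G ℂ) (E.d 4))) =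
      Module.finrank ℂ (LinearMap.range (E.cbdInv 5)) :=
    (finrank_range_eq_of_conj (e 6) (e 5) (E.leftComp_dualMap 5)).trans
      (LinearMap.finrank_range_dualMap_eq_finrank_range _)
  have r4 : Module.finrank ℂ (LinearMap.ker (Linear.leftComp ℂ (Rep.trivial ℂ G ℂ) (E.d 5))) =
      Module.finrank ℂ (LinearMap.ker (E.cbdInv 4).dualMap) :=
    finrank_ker_eq_of_conj (e 5) (e 4) (E.leftComp_dualMap 4)
  have d5 := LinearMap.finrank_range_add_finrank_ker (E.cbdInv 5)
  have d4 : _ = Module.finrank ℂ (Module.Dual ℂ (V.inv G 5)) :=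
    LinearMap.finrank_range_add_finrank_ker (E.cbdInv 4).dualMap
  rw [LinearMap.finrank_range_dualMap_eq_finrank_range, Subspace.dual_finrank_eq] at d4
  rw [r5] at key
  have key' : Module.finrank ℂ (groupCohomology (Rep.trivial ℂ G ℂ) 5) +
      Module.finrank ℂ (LinearMap.range (E.cbdInv 5)) =
      Module.finrank ℂ (LinearMap.ker (E.cbdInv 4).dualMap) := key.trans r4
  omega

end Equivariant

end VoronoiData

end Voronoi

namespace Voronoi

open Matrix

/-- Integer vectors of length four. -/
abbrev Vec := Fin 4 → ℤ

/-- Identification of opposite vectors. -/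
def lineSetoid : Setoid Vec where
  r v w := v = w ∨ v = -w
  iseqv := ⟨fun _ => Or.inl rfl, by
    rintro v w (h | h)
    · exact Or.inl h.symm
    · exact Or.inr (by rw [h, neg_neg]), by
    rintro u v w (rfl | rfl) (rfl | rfl)
    · exact Or.inl rfl
    · exact Or.inr rfl
    · exact Or.inr rfl
    · exact Or.inl (neg_neg _)⟩

/-- Integer vectors up to sign. -/
def Line := Quotient lineSetoid

namespace Line

/-- The line through a vector. -/
def mk (v : Vec) : Line := Quotient.mk lineSetoid v

lemma mk_eq {v w : Vec} : mk v = mk w ↔ v = w ∨ v = -w := Quotient.eq (r := lineSetoid)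

lemma mk_neg (v : Vec) : mk (-v) = mk v := mk_eq.2 (Or.inr rfl)

lemma mk_units (ε : ℤˣ) (v : Vec) : mk (ε • v) = mk v := by
  rcases Int.units_eq_one_or ε with rfl | rfl
  · simp
  · simp [mk_neg]

lemma exists_mk (x : Line) : ∃ v, mk v = x := Quotient.exists_rep x

/-- Functions of lines from even functions of vectors. -/
def lift {α : Type*} (f : Vec → α) (h : ∀ v, f (-v) = f v) : Line → α :=
  Quotient.lift f fun a b hab => by
    rcases hab with rfl | rfl
    · rfl
    · exact h b

@[simp] lemma lift_mk {α : Type*} (f : Vec → α) (h) (v : Vec) : lift f h (mk v) = f v := rfl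

instance : MulAction (Matrix (Fin 4) (Fin 4) ℤ) Line where
  smul g := lift (fun v => mk (g *ᵥ v)) fun v => by rw [mulVec_neg, mk_neg]
  one_smul x := by
    obtain ⟨v, rfl⟩ := exists_mk x
    exact congrArg mk (one_mulVec v)
  mul_smul g h x := by
    obtain ⟨v, rfl⟩ := exists_mk x
    exact congrArg mk (mulVec_mulVec v g h).symm

lemma smul_mk (g : Matrix (Fin 4) (Fin 4) ℤ) (v : Vec) : g • mk v = mk (g *ᵥ v) := rfl

lemma gl_smul_mk (g : GL (Fin 4) ℤ) (v : Vec) : g • mk v = mk (g.1 *ᵥ v) := rfl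

end Line

/-- The index pairs of the quadratic monomials. -/
def pair : Fin 10 → Fin 4 × Fin 4 :=
  ![(0, 0), (1, 1), (2, 2), (3, 3), (0, 1), (0, 2), (0, 3), (1, 2), (1, 3), (2, 3)]

section Square

variable {K : Type*} [CommRing K]

/-- The quadratic monomials of a vector. -/
def mono (v : Fin 4 → K) : Fin 10 → K := fun k => v (pair k).1 * v (pair k).2

lemma mono_neg (v : Fin 4 → K) : mono (-v) = mono v := by
  funext k
  simp [mono]

/-- The action of a matrix on quadratic monomials. -/
def sq (g : Matrix (Fin 4) (Fin 4) K) : Matrix (Fin 10) (Fin 10) K := Matrix.of fun k l =>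
  if (pair l).1 = (pair l).2 then g (pair k).1 (pair l).1 * g (pair k).2 (pair l).1
  else g (pair k).1 (pair l).1 * g (pair k).2 (pair l).2 +
    g (pair k).1 (pair l).2 * g (pair k).2 (pair l).1

lemma sum_ten (f : Fin 10 → K) : ∑ i, f i =
    f 0 + f 1 + f 2 + f 3 + f 4 + f 5 + f 6 + f 7 + f 8 + f 9 := by
  rw [Fin.sum_univ_castSucc, Fin.sum_univ_castSucc, Fin.sum_univ_eight]
  rfl

lemma sq_mulVec (g : Matrix (Fin 4) (Fin 4) K) (v : Fin 4 → K) :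
    sq g *ᵥ mono v = mono (g *ᵥ v) := by
  funext k
  simp only [mulVec, dotProduct, sum_ten, mono, sq, of_apply, Fin.sum_univ_four]
  generalize (pair k).1 = i
  generalize (pair k).2 = j
  simp [pair]
  ring

lemma eq_zero_of_mono (m : Fin 10 → K) (h : ∀ v : Fin 4 → K, m ⬝ᵥ mono v = 0) : m = 0 := by
  have h0 := h ![1, 0, 0, 0]
  have h1 := h ![0, 1, 0, 0]
  have h2 := h ![0, 0, 1, 0]
  have h3 := h ![0, 0, 0, 1]
  have h4 := h ![1, 1, 0, 0]
  have h5 := h ![1, 0, 1, 0]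
  have h6 := h ![1, 0, 0, 1]
  have h7 := h ![0, 1, 1, 0]
  have h8 := h ![0, 1, 0, 1]
  have h9 := h ![0, 0, 1, 1]
  simp [dotProduct, sum_ten, mono, pair] at h0 h1 h2 h3 h4 h5 h6 h7 h8 h9
  simp only [h0, h1, h2, h3, zero_add, add_zero] at h4 h5 h6 h7 h8 h9
  funext k
  fin_cases k <;> assumption

lemma sq_mul (g h : Matrix (Fin 4) (Fin 4) K) : sq (g * h) = sq g * sq h := by
  rw [← sub_eq_zero]
  ext k l
  refine congrFun (eq_zero_of_mono (fun l => (sq (g * h) - sq g * sq h) k l) fun v => ?_) l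
  change ((sq (g * h) - sq g * sq h) *ᵥ mono v) k = 0
  rw [sub_mulVec, sq_mulVec, ← mulVec_mulVec, ← mulVec_mulVec, sq_mulVec, sq_mulVec, sub_self]
  rfl

lemma sq_diagonal (d : Fin 4 → K) : sq (diagonal d) = diagonal (mono d) := by
  ext k l
  fin_cases k <;> fin_cases l <;> simp [sq, pair, mono, diagonal]

lemma det_sq_diagonal (d : Fin 4 → K) : (sq (diagonal d)).det = (diagonal d).det ^ 5 := by
  rw [sq_diagonal, det_diagonal, det_diagonal, Fin.prod_univ_four, Fin.prod_univ_castSucc,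
    Fin.prod_univ_castSucc, Fin.prod_univ_eight]
  simp [mono, pair]
  ring

end Square

lemma sq_map {K K' : Type*} [CommRing K] [CommRing K'] (f : K →+* K') (g : Matrix (Fin 4) (Fin 4) K) :
    sq (g.map f) = (sq g).map f := by
  ext k l
  simp only [sq, of_apply, map_apply]
  split_ifs <;> simp

lemma det_sq_rat (g : Matrix (Fin 4) (Fin 4) ℚ) (hg : g.det ≠ 0) : (sq g).det = g.det ^ 5 := by
  refine diagonal_transvection_induction_of_det_ne_zero (fun g => (sq g).det = g.det ^ 5) g hg ?_ ?_ ?_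
  · exact fun d _ => det_sq_diagonal d
  · intro t
    rw [TransvectionStruct.det, one_pow]
    obtain ⟨i, j, hij, c⟩ := t
    simp only [TransvectionStruct.toMatrix_mk]
    let d : Fin 4 → ℚ := Function.update 1 i 2
    let d' : Fin 4 → ℚ := Function.update 1 i (1 / 2)
    have h0 : diagonal d * diagonal d' = 1 := by
      rw [diagonal_mul_diagonal, ← diagonal_one]
      congr 1
      funext k
      by_cases hk : k = i <;> simp [d, d', hk, Function.update_of_ne]
    have h1 : transvection i j c * transvection i j (-c) = 1 := by
      rw [transvection_mul_transvection_same i j hij]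
      simp
    have h2 : transvection i j c =
        diagonal d * transvection i j c * (diagonal d' * transvection i j (-c)) := by
      have h : diagonal d * transvection i j c * diagonal d' = transvection i j (2 * c) := by
        rw [transvection, mul_add, add_mul, mul_one, h0, transvection]
        congr 1
        ext a b
        rw [mul_diagonal, diagonal_mul, single_apply, single_apply]
        split_ifs with hab
        · rw [← hab.1, ← hab.2]
          simp [d, d', Function.update_of_ne hij.symm]
        · simp
      rw [← mul_assoc, h, transvection_mul_transvection_same i j hij]
      congr 1
      ring
    have h3 := congrArg (fun M => (sq M).det) h2
    have h4 := congrArg (fun M => (sq M).det) h0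
    have h5 := congrArg (fun M => (sq M).det) h1
    have h6 : (sq (1 : Matrix (Fin 4) (Fin 4) ℚ)).det = 1 := by
      rw [← diagonal_one, det_sq_diagonal, diagonal_one, det_one, one_pow]
    simp only [sq_mul, det_mul, h6] at h3 h4 h5
    linear_combination h3 + (sq (transvection i j c)).det * (sq (transvection i j (-c))).det * h4 + h5
  · intro A B _ _ ihA ihB
    rw [sq_mul, det_mul, ihA, ihB, det_mul, mul_pow]

lemma det_sq_int (g : Matrix (Fin 4) (Fin 4) ℤ) (hg : g.det ≠ 0) : (sq g).det = g.det ^ 5 := by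
  have h := det_sq_rat (g.map (Int.castRingHom ℚ)) (by
    rw [← RingHom.mapMatrix_apply, ← RingHom.map_det]
    simpa using hg)
  rw [sq_map, ← RingHom.mapMatrix_apply, ← RingHom.map_det, ← RingHom.mapMatrix_apply,
    ← RingHom.map_det, ← map_pow] at h
  exact Int.cast_injective (α := ℚ) (by simpa using h)

/-- The quadratic form with given coefficients. -/
def form : (Fin 10 → ℤ) →+ (Line → ℤ) where
  toFun m := Line.lift (fun v => m ⬝ᵥ mono v) fun v => by rw [mono_neg]
  map_zero' := by
    funext x
    obtain ⟨v, rfl⟩ := x.exists_mk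
    exact zero_dotProduct _
  map_add' m m' := by
    funext x
    obtain ⟨v, rfl⟩ := x.exists_mk
    exact add_dotProduct _ _ _

@[simp] lemma form_mk (m : Fin 10 → ℤ) (v : Vec) : form m (Line.mk v) = m ⬝ᵥ mono v := rfl

lemma form_injective : Function.Injective form := by
  refine (injective_iff_map_eq_zero form).2 fun m h => eq_zero_of_mono m fun v => ?_
  rw [← form_mk, h]
  rfl

lemma form_smul (m : Fin 10 → ℤ) (g : Matrix (Fin 4) (Fin 4) ℤ) (x : Line) :
    form m (g • x) = form (m ᵥ* sq g) x := by
  obtain ⟨v, rfl⟩ := x.exists_mk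
  rw [Line.smul_mk, form_mk, form_mk, ← sq_mulVec, dotProduct_mulVec]

/-- Coefficients of the two perfect forms, of types A and D. -/
def root : Fin 2 → Fin 10 → ℤ :=
  ![![2, 2, 2, 2, 2, 2, 2, 2, 2, 2], ![2, 2, 2, 2, 0, 2, 2, 2, 2, 2]]

/-- The determinant of a four by four matrix, expanded. -/
def det4 (M : Matrix (Fin 4) (Fin 4) ℤ) : ℤ :=
  M 0 0 * (M 1 1 * (M 2 2 * M 3 3 - M 2 3 * M 3 2) - M 1 2 * (M 2 1 * M 3 3 - M 2 3 * M 3 1)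
    + M 1 3 * (M 2 1 * M 3 2 - M 2 2 * M 3 1))
  - M 0 1 * (M 1 0 * (M 2 2 * M 3 3 - M 2 3 * M 3 2) - M 1 2 * (M 2 0 * M 3 3 - M 2 3 * M 3 0)
    + M 1 3 * (M 2 0 * M 3 2 - M 2 2 * M 3 0))
  + M 0 2 * (M 1 0 * (M 2 1 * M 3 3 - M 2 3 * M 3 1) - M 1 1 * (M 2 0 * M 3 3 - M 2 3 * M 3 0)
    + M 1 3 * (M 2 0 * M 3 1 - M 2 1 * M 3 0))
  - M 0 3 * (M 1 0 * (M 2 1 * M 3 2 - M 2 2 * M 3 1) - M 1 1 * (M 2 0 * M 3 2 - M 2 2 * M 3 0)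
    + M 1 2 * (M 2 0 * M 3 1 - M 2 1 * M 3 0))

lemma det4_eq (M : Matrix (Fin 4) (Fin 4) ℤ) : M.det = det4 M := by
  rw [det_succ_row_zero, Fin.sum_univ_four]
  simp only [det_fin_three, submatrix_apply, det4]
  simp [Fin.succAbove, Fin.lt_def]
  ring

/-- An integral matrix of determinant `± 1` as an invertible matrix. -/
noncomputable def toGL (g : Matrix (Fin 4) (Fin 4) ℤ) (h : IsUnit (det4 g)) : GL (Fin 4) ℤ :=
  GeneralLinearGroup.mk'' g (by rwa [det4_eq])

/-- All integral forms equivalent to one of the two root forms. -/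
def Perfect : Set (Line → ℤ) := {φ | ∃ k, ∃ g : GL (Fin 4) ℤ, φ = form (root k ᵥ* sq g.1)}

section Action

attribute [local instance] arrowAction

lemma gl_smul_form (g : GL (Fin 4) ℤ) (m : Fin 10 → ℤ) : g • form m = form (m ᵥ* sq g⁻¹.1) := by
  funext x
  exact form_smul m g⁻¹.1 x

lemma gl_smul_perfect (g : GL (Fin 4) ℤ) {φ : Line → ℤ} (h : φ ∈ Perfect) : g • φ ∈ Perfect := by
  obtain ⟨k, h, rfl⟩ := h
  refine ⟨k, h * g⁻¹, ?_⟩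
  rw [gl_smul_form, vecMul_vecMul, ← sq_mul]
  rfl

lemma gl_smul_range (g : GL (Fin 4) ℤ) {q : Line → ℤ} (h : q ∈ form.range) :
    g • q ∈ form.range := by
  obtain ⟨m, rfl⟩ := h
  exact ⟨_, (gl_smul_form g m).symm⟩

lemma gl_smul_add (g : GL (Fin 4) ℤ) (q q' : Line → ℤ) : g • (q + q') = g • q + g • q' := rfl

/-- Transport of charts along the linear group. -/
def Chart.transport {φ : Line → ℤ} (c : Chart form.range Perfect φ) (g : GL (Fin 4) ℤ) :
    Chart form.range Perfect (g • φ) where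
  B := c.B
  n := c.n
  r b j := g • c.r b j
  r_inj b j b' j' h := c.r_inj b j b' j' (smul_left_cancel g h)
  mem x := by
    change φ (g⁻¹ • x) = 2 ↔ _
    rw [c.mem]
    simp only [eq_inv_smul_iff]
  bal q hq b b' := by
    have := c.bal _ (gl_smul_range g⁻¹ hq) b b'
    change ∑ j, q (g⁻¹⁻¹ • c.r b j) = ∑ j, q (g⁻¹⁻¹ • c.r b' j) at this
    rwa [inv_inv] at this
  perfect q hq h := by
    refine smul_left_cancel g⁻¹ ?_
    rw [c.perfect _ (gl_smul_range g⁻¹ hq) fun b j => ?_]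
    · rfl
    · change q (g⁻¹⁻¹ • c.r b j) = 0
      rw [inv_inv, h]
  card := c.card
  e s := g • c.e s
  e_mem s := gl_smul_range g (c.e_mem s)
  e_form s := by
    rw [← gl_smul_add]
    exact gl_smul_perfect g (c.e_form s)
  e_val s b j := by
    change c.e s (g⁻¹ • g • c.r b j) = _
    rw [inv_smul_smul, c.e_val]

end Action

/-- A matrix with entries between `-2` and `2`, from its encoding. -/
def decode (n : ℕ) : Matrix (Fin 4) (Fin 4) ℤ :=
  Matrix.of fun i j => ((n / 2 / 5 ^ (4 * i.1 + j.1) % 5 : ℕ) : ℤ) - 2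

/-- The form with an encoded root form and substitution. -/
def coded (n : ℕ) : Fin 10 → ℤ := root (Fin.ofNat 2 n) ᵥ* sq (decode n)

lemma coded_perfect {n : ℕ} (h : det4 (decode n) = 1 ∨ det4 (decode n) = -1) :
    form (coded n) ∈ Perfect :=
  ⟨_, toGL (decode n) (Int.isUnit_iff.2 h), rfl⟩

/-- The minimal vectors of the root form of type A. -/
def rootsA : Fin 1 → Fin 10 → Vec := fun _ =>
  ![![1, 0, 0, 0], ![0, 1, 0, 0], ![0, 0, 1, 0], ![0, 0, 0, 1], ![1, -1, 0, 0],
    ![1, 0, -1, 0], ![1, 0, 0, -1], ![0, 1, -1, 0], ![0, 1, 0, -1], ![0, 0, 1, -1]]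

/-- The minimal vectors of the root form of type D, in orthogonal frames. -/
def rootsD : Fin 3 → Fin 4 → Vec :=
  ![![![0, 0, 0, 1], ![0, 1, -1, 0], ![1, 0, -1, 0], ![1, 1, 0, -1]],
    ![![0, 0, 1, -1], ![0, 1, 0, 0], ![1, 0, 0, 0], ![1, 1, -1, -1]],
    ![![0, 0, 1, 0], ![0, 1, 0, -1], ![1, 0, 0, -1], ![1, 1, -1, 0]]]

/-- Encoded Voronoi neighbours of the root form of type A. -/
def codesA : List ℕ := [226216021823, 164892584063, 213481678175, 15361522175, 226216801823, 225727740575, 225728521823,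
    162451177823, 164888677823, 201294178175]

/-- Encoded Voronoi neighbours of the root form of type D. -/
def codesD : List ℕ := [
    201533632873, 216182384122, 214232389114, 214212921562, 78755822184, 15357610935, 76907259624,
    89209959062, 76805827176, 78854139624, 15360740927, 91166204062, 76786359624, 226197108374,
    228153353374, 15361522175, 215946446924, 201298073175, 140384140364, 214009796822, 215923073175,
    226216759382, 150755696822, 150654459062, 140384172812, 150752576822, 154658821822, 162940239071,
    226197296822, 150654452822, 162939457823, 164896295614, 213990201924, 140377890372, 201294958175,
    215966046814, 140377927812, 150755701814, 154661946814, 164893364063, 213969958175, 154658826814,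
    228173014366, 154560704062, 228153546814, 164889457823, 154560702814, 228173015614, 165306796562,
    165259921622, 167216171614, 201294178175, 165259959062, 150658359062, 165380864063, 167337695614,
    167216204062, 165377739071, 154561484062, 228661295614, 213481678175, 167333795614, 228173795614,
    155048984062]

/-- Charts from explicit tables. -/
def chartOfTable (m : Fin 10 → ℤ) {B n : ℕ} (r : Fin B → Fin n → Vec) (t : (Fin B → Fin n) → ℕ)
    (r_inj : ∀ b j b' j', r b j = r b' j' ∨ r b j = - r b' j' → b = b' ∧ j = j')
    (val : ∀ b j, m ⬝ᵥ mono (r b j) = 2)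
    (mem : ∀ v, m ⬝ᵥ mono v = 2 → ∃ b j, r b j = v ∨ r b j = -v)
    (bal : ∀ k, ∀ b b', ∑ j, mono (r b j) k = ∑ j, mono (r b' j) k)
    (perfect : ∀ q : Fin 10 → ℤ, (∀ b j, q ⬝ᵥ mono (r b j) = 0) → q = 0)
    (card : B * (n - 1) = 9)
    (det : ∀ s, det4 (decode (t s)) = 1 ∨ det4 (decode (t s)) = -1)
    (e_val : ∀ s b j, (coded (t s) - m) ⬝ᵥ mono (r b j) = if s b = j then 2 else 0) :
    Chart form.range Perfect (form m) where
  B := B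
  n := n
  r b j := Line.mk (r b j)
  r_inj b j b' j' h := r_inj b j b' j' (Line.mk_eq.1 h)
  mem x := by
    obtain ⟨v, rfl⟩ := x.exists_mk
    constructor
    · intro h
      obtain ⟨b, j, h⟩ := mem v h
      exact ⟨b, j, Line.mk_eq.2 h⟩
    · rintro ⟨b, j, h⟩
      rw [← h, form_mk, val]
  bal := by
    rintro _ ⟨q, rfl⟩ b b'
    simp only [form_mk, dotProduct]
    rw [Finset.sum_comm, Finset.sum_comm (γ := Fin n)]
    refine Finset.sum_congr rfl fun k _ => ?_
    rw [← Finset.mul_sum, ← Finset.mul_sum, bal]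
  perfect := by
    rintro _ ⟨q, rfl⟩ h
    rw [perfect q h, map_zero]
  card := card
  e s := form (coded (t s) - m)
  e_mem s := ⟨_, rfl⟩
  e_form s := by
    rw [← map_add, add_sub_cancel]
    exact coded_perfect (det s)
  e_val := e_val

lemma root_zero_dot (v : Vec) : root 0 ⬝ᵥ mono v =
    v 0 ^ 2 + v 1 ^ 2 + v 2 ^ 2 + v 3 ^ 2 + (v 0 + v 1 + v 2 + v 3) ^ 2 := by
  simp [dotProduct, sum_ten, mono, pair, root]
  ring

lemma root_one_dot (v : Vec) : root 1 ⬝ᵥ mono v =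
    (v 0 - v 1) ^ 2 + v 2 ^ 2 + v 3 ^ 2 + (v 0 + v 1 + v 2 + v 3) ^ 2 := by
  simp [dotProduct, sum_ten, mono, pair, root]
  ring

lemma abs_le_one_of_sq {a : ℤ} (h : a ^ 2 ≤ 2) : -1 ≤ a ∧ a ≤ 1 := by
  constructor <;> nlinarith

lemma forall_fin_one {α : Type*} {P : (Fin 1 → α) → Prop} : (∀ s, P s) ↔ ∀ a, P ![a] := by
  refine ⟨fun h a => h _, fun h s => ?_⟩
  have := h (s 0)
  rwa [show ![s 0] = s from List.ofFn_inj.1 rfl] at this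

lemma forall_fin_three {α : Type*} {P : (Fin 3 → α) → Prop} :
    (∀ s, P s) ↔ ∀ a b c, P ![a, b, c] := by
  refine ⟨fun h a b c => h _, fun h s => ?_⟩
  have := h (s 0) (s 1) (s 2)
  rwa [show ![s 0, s 1, s 2] = s from List.ofFn_inj.1 rfl] at this

lemma forall_fin_four {α : Type*} {P : (Fin 4 → α) → Prop} :
    (∀ s, P s) ↔ ∀ a b c d, P ![a, b, c, d] := by
  refine ⟨fun h a b c d => h _, fun h s => ?_⟩
  have := h (s 0) (s 1) (s 2) (s 3)
  rwa [show ![s 0, s 1, s 2, s 3] = s from List.ofFn_inj.1 rfl] at this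

lemma rootsA_mem (v : Vec) (h : root 0 ⬝ᵥ mono v = 2) :
    ∃ b j, rootsA b j = v ∨ rootsA b j = -v := by
  revert v
  rw [forall_fin_four]
  intro a b c d h
  have hr := h
  rw [root_zero_dot] at h
  simp at h
  obtain ⟨ha, ha'⟩ := abs_le_one_of_sq (a := a) (by nlinarith)
  obtain ⟨hb, hb'⟩ := abs_le_one_of_sq (a := b) (by nlinarith)
  obtain ⟨hc, hc'⟩ := abs_le_one_of_sq (a := c) (by nlinarith)
  obtain ⟨hd, hd'⟩ := abs_le_one_of_sq (a := d) (by nlinarith)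
  have key : ∀ a ∈ Finset.Icc (-1 : ℤ) 1, ∀ b ∈ Finset.Icc (-1 : ℤ) 1,
      ∀ c ∈ Finset.Icc (-1 : ℤ) 1, ∀ d ∈ Finset.Icc (-1 : ℤ) 1,
      root 0 ⬝ᵥ mono ![a, b, c, d] = 2 →
      ∃ i j, rootsA i j = ![a, b, c, d] ∨ rootsA i j = -![a, b, c, d] := by
    decide +kernel
  simp only [Finset.mem_Icc] at key
  exact key a ⟨ha, ha'⟩ b ⟨hb, hb'⟩ c ⟨hc, hc'⟩ d ⟨hd, hd'⟩ hr

lemma rootsD_mem (v : Vec) (h : root 1 ⬝ᵥ mono v = 2) :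
    ∃ b j, rootsD b j = v ∨ rootsD b j = -v := by
  revert v
  rw [forall_fin_four]
  intro a b c d h
  have hr := h
  rw [root_one_dot] at h
  simp at h
  have hab := abs_le_one_of_sq (a := a - b) (by nlinarith)
  have hs := abs_le_one_of_sq (a := a + b + c + d) (by nlinarith)
  obtain ⟨hc, hc'⟩ := abs_le_one_of_sq (a := c) (by nlinarith)
  obtain ⟨hd, hd'⟩ := abs_le_one_of_sq (a := d) (by nlinarith)
  have key : ∀ a ∈ Finset.Icc (-2 : ℤ) 2, ∀ b ∈ Finset.Icc (-2 : ℤ) 2,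
      ∀ c ∈ Finset.Icc (-1 : ℤ) 1, ∀ d ∈ Finset.Icc (-1 : ℤ) 1,
      root 1 ⬝ᵥ mono ![a, b, c, d] = 2 →
      ∃ i j, rootsD i j = ![a, b, c, d] ∨ rootsD i j = -![a, b, c, d] := by
    decide +kernel
  simp only [Finset.mem_Icc] at key
  exact key a (by omega) b (by omega) c ⟨hc, hc'⟩ d ⟨hd, hd'⟩ hr

lemma rootsA_perfect (q : Fin 10 → ℤ) (h : ∀ b j, q ⬝ᵥ mono (rootsA b j) = 0) : q = 0 := by
  have h0 := fun j => h 0 j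
  simp [Fin.forall_fin_succ, dotProduct, sum_ten, mono, pair, rootsA] at h0
  funext k
  fin_cases k <;> simp <;> omega

lemma rootsD_perfect (q : Fin 10 → ℤ) (h : ∀ b j, q ⬝ᵥ mono (rootsD b j) = 0) : q = 0 := by
  simp [Fin.forall_fin_succ, dotProduct, sum_ten, mono, pair, rootsD] at h
  funext k
  fin_cases k <;> simp <;> omega

/-- The chart of the root form of type A. -/
def chartA : Chart form.range Perfect (form (root 0)) :=
  chartOfTable (root 0) rootsA (fun s => codesA.getD (s 0).1 0) (by decide +kernel)
    (by decide +kernel) rootsA_mem (by decide +kernel) rootsA_perfect rfl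
    (forall_fin_one.2 (by decide +kernel)) (forall_fin_one.2 (by decide +kernel))

/-- The chart of the root form of type D. -/
def chartD : Chart form.range Perfect (form (root 1)) :=
  chartOfTable (root 1) rootsD (fun s => codesD.getD (16 * (s 0).1 + 4 * (s 1).1 + (s 2).1) 0)
    (by decide +kernel) (by decide +kernel) rootsD_mem (by decide +kernel) rootsD_perfect rfl
    (forall_fin_three.2 (by decide +kernel)) (forall_fin_three.2 (by decide +kernel))

lemma nonempty_chart {φ : Line → ℤ} (h : φ ∈ Perfect) : Nonempty (Chart form.range Perfect φ) := by
  obtain ⟨k, g, rfl⟩ := h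
  have h := gl_smul_form g⁻¹ (root k)
  rw [inv_inv] at h
  rw [← h]
  obtain rfl | rfl : k = 0 ∨ k = 1 := by omega
  · exact ⟨chartA.transport g⁻¹⟩
  · exact ⟨chartD.transport g⁻¹⟩

lemma form_smul_root (k : Fin 2) (g : Matrix (Fin 4) (Fin 4) ℤ) (v : Vec) :
    form (root k ᵥ* sq g) (Line.mk v) = root k ⬝ᵥ mono (g *ᵥ v) := by
  rw [← form_smul, Line.smul_mk, form_mk]

lemma root_even (k : Fin 2) (v : Vec) : Even (root k ⬝ᵥ mono v) := by
  obtain rfl | rfl : k = 0 ∨ k = 1 := by omega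
  · rw [root_zero_dot]
    refine ⟨v 0 ^ 2 + v 1 ^ 2 + v 2 ^ 2 + v 3 ^ 2 + v 0 * v 1 + v 0 * v 2 + v 0 * v 3 + v 1 * v 2 +
      v 1 * v 3 + v 2 * v 3, by ring⟩
  · rw [root_one_dot]
    refine ⟨v 0 ^ 2 + v 1 ^ 2 + v 2 ^ 2 + v 3 ^ 2 + v 0 * v 2 + v 0 * v 3 + v 1 * v 2 +
      v 1 * v 3 + v 2 * v 3, by ring⟩

lemma root_nonneg (k : Fin 2) (v : Vec) : 0 ≤ root k ⬝ᵥ mono v := by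
  obtain rfl | rfl : k = 0 ∨ k = 1 := by omega
  · rw [root_zero_dot]
    positivity
  · rw [root_one_dot]
    positivity

lemma root_definite (k : Fin 2) (v : Vec) (h : root k ⬝ᵥ mono v = 0) : v = 0 := by
  revert v
  rw [forall_fin_four]
  intro a b c d h
  obtain rfl | rfl : k = 0 ∨ k = 1 := by omega
  · rw [root_zero_dot] at h
    simp at h
    have h0 : a = 0 := by nlinarith
    have h1 : b = 0 := by nlinarith
    have h2 : c = 0 := by nlinarith
    have h3 : d = 0 := by nlinarith
    simp [h0, h1, h2, h3]
  · rw [root_one_dot] at h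
    simp at h
    have h0 : a - b = 0 := by nlinarith
    have h1 : c = 0 := by nlinarith
    have h2 : d = 0 := by nlinarith
    have h3 : a + b + c + d = 0 := by nlinarith
    have h4 : a = 0 := by omega
    have h5 : b = 0 := by omega
    simp [h1, h2, h4, h5]

lemma gl_mulVec_eq_zero (g : GL (Fin 4) ℤ) {v : Vec} (h : g.1 *ᵥ v = 0) : v = 0 := by
  have h1 : (g⁻¹.1 * g.1) *ᵥ v = v := by
    rw [← Units.val_mul, inv_mul_cancel, Units.val_one, one_mulVec]
  rw [← h1, ← mulVec_mulVec, h, mulVec_zero]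

section Perfect

variable {φ : Line → ℤ} (hφ : φ ∈ Perfect)
include hφ

lemma perfect_mem : φ ∈ form.range := by
  obtain ⟨k, g, rfl⟩ := hφ
  exact ⟨_, rfl⟩

lemma perfect_nonneg (x : Line) : 0 ≤ φ x := by
  obtain ⟨k, g, rfl⟩ := hφ
  obtain ⟨v, rfl⟩ := x.exists_mk
  rw [form_smul_root]
  exact root_nonneg _ _

lemma perfect_definite {v : Vec} (h : φ (Line.mk v) = 0) : v = 0 := by
  obtain ⟨k, g, rfl⟩ := hφ
  rw [form_smul_root] at h
  exact gl_mulVec_eq_zero g (root_definite _ _ h)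

lemma two_le_perfect {v : Vec} (hv : v ≠ 0) : 2 ≤ φ (Line.mk v) := by
  have h0 := perfect_nonneg hφ (Line.mk v)
  have h1 := mt (perfect_definite hφ) hv
  have h2 : Even (φ (Line.mk v)) := by
    obtain ⟨k, g, rfl⟩ := hφ
    rw [form_smul_root]
    exact root_even _ _
  obtain ⟨r, hr⟩ := h2
  omega

end Perfect

lemma form_zero (m : Fin 10 → ℤ) : form m (Line.mk 0) = 0 := by
  rw [form_mk, show mono (0 : Vec) = 0 from funext fun k => by simp [mono], dotProduct_zero]

/-- Squares of linear forms. -/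
def squareCoeff (w : Vec) : Fin 10 → ℤ :=
  fun k => if (pair k).1 = (pair k).2 then mono w k else 2 * mono w k

lemma squareCoeff_dot (w v : Vec) : squareCoeff w ⬝ᵥ mono v = (w ⬝ᵥ v) ^ 2 := by
  simp [squareCoeff, dotProduct, sum_ten, mono, pair, Fin.sum_univ_four]
  ring

/-- Squares of nonzero linear forms. -/
def Squares : Set (Line → ℤ) := {q | ∃ w : Vec, w ≠ 0 ∧ q = form (squareCoeff w)}

/-- The values of a function at the minimal vectors of the first root form, in lexicographic
order. -/
def lexValue : (Line → ℤ) →+ Lex (Fin 10 → ℤ) where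
  toFun q := toLex fun j => q (Line.mk (rootsA 0 j))
  map_zero' := rfl
  map_add' _ _ := rfl

lemma lexValue_apply (q : Line → ℤ) (j : Fin 10) :
    ofLex (lexValue q) j = q (Line.mk (rootsA 0 j)) := rfl

lemma lexValue_injective {q : Line → ℤ} (hq : q ∈ form.range) (h : lexValue q = 0) : q = 0 := by
  refine chartA.perfect q hq fun b j => ?_
  obtain rfl : b = (0 : Fin 1) := Subsingleton.elim (α := Fin 1) b 0
  exact congrFun (congrArg ofLex h) j

lemma lexValue_pos {q : Line → ℤ} (hq : q ∈ form.range) (h : ∀ x, 0 ≤ q x) (h0 : q ≠ 0) :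
    0 < lexValue q := by
  refine lt_of_le_of_ne ?_ fun h' => h0 (lexValue_injective hq h'.symm)
  exact Pi.toLex_monotone (a := 0) (b := fun j => q (Line.mk (rootsA 0 j))) fun j => h _

lemma lexValue_wf : WellFounded fun φ ψ : Perfect => lexValue φ < lexValue ψ := by
  let f : Perfect → Lex (Fin 10 → ℕ) := fun φ => toLex fun j => (φ.1 (Line.mk (rootsA 0 j))).toNat
  refine Subrelation.wf (r := InvImage (· < ·) f) ?_ (InvImage.wf f wellFounded_lt)
  rintro ⟨φ, hφ⟩ ⟨ψ, hψ⟩ ⟨i, h1, h2⟩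
  refine ⟨i, fun j hj => ?_, ?_⟩
  · exact congrArg Int.toNat (h1 j hj)
  · have h3 := perfect_nonneg hφ (Line.mk (rootsA 0 i))
    change φ (Line.mk (rootsA 0 i)) < ψ (Line.mk (rootsA 0 i)) at h2
    change (φ (Line.mk (rootsA 0 i))).toNat < (ψ (Line.mk (rootsA 0 i))).toNat
    omega

lemma exists_orthogonal (x y z : Vec) :
    ∃ w : Vec, w ≠ 0 ∧ w ⬝ᵥ x = 0 ∧ w ⬝ᵥ y = 0 ∧ w ⬝ᵥ z = 0 := by
  obtain ⟨w, hw, h⟩ := exists_mulVec_eq_zero_iff.2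
    (det_eq_zero_of_row_eq_zero (A := Matrix.of ![x, y, z, 0]) 3 fun j => rfl)
  refine ⟨w, hw, ?_, ?_, ?_⟩
  · rw [dotProduct_comm]
    exact congrFun h 0
  · rw [dotProduct_comm]
    exact congrFun h 1
  · rw [dotProduct_comm]
    exact congrFun h 2

lemma exists_independent {S : Set Line} (h : ∀ w ∈ Squares, ∃ x ∈ S, w x ≠ 0) :
    ∃ V : Matrix (Fin 4) (Fin 4) ℤ, V.det ≠ 0 ∧ ∀ i, Line.mk (fun k => V k i) ∈ S := by
  have h' : ∀ w : Vec, w ≠ 0 → ∃ v, Line.mk v ∈ S ∧ w ⬝ᵥ v ≠ 0 := by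
    intro w hw
    obtain ⟨x, hx, h⟩ := h _ ⟨w, hw, rfl⟩
    obtain ⟨v, rfl⟩ := x.exists_mk
    rw [form_mk, squareCoeff_dot] at h
    exact ⟨v, hx, fun h0 => h (by rw [h0]; rfl)⟩
  obtain ⟨w0, hw0, -⟩ := exists_orthogonal 0 0 0
  obtain ⟨x0, hx0, h0⟩ := h' w0 hw0
  obtain ⟨w1, hw1, h10, -⟩ := exists_orthogonal x0 0 0
  obtain ⟨x1, hx1, h1⟩ := h' w1 hw1
  obtain ⟨w2, hw2, h20, h21, -⟩ := exists_orthogonal x0 x1 0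
  obtain ⟨x2, hx2, h2⟩ := h' w2 hw2
  obtain ⟨w3, hw3, h30, h31, h32⟩ := exists_orthogonal x0 x1 x2
  obtain ⟨x3, hx3, h3⟩ := h' w3 hw3
  refine ⟨(Matrix.of ![x0, x1, x2, x3])ᵀ, fun hdet => ?_, ?_⟩
  · obtain ⟨c, hc, h⟩ := exists_mulVec_eq_zero_iff.2 hdet
    have key : ∀ w : Vec, c 0 * (w ⬝ᵥ x0) + c 1 * (w ⬝ᵥ x1) + c 2 * (w ⬝ᵥ x2) +
        c 3 * (w ⬝ᵥ x3) = 0 := by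
      intro w
      have := congrArg (fun u => w ⬝ᵥ u) h
      simp [dotProduct, mulVec, Fin.sum_univ_four] at this ⊢
      linear_combination this
    have k3 : c 3 = 0 := by simpa [h30, h31, h32, h3] using key w3
    have k2 : c 2 = 0 := by simpa [h20, h21, h2, k3] using key w2
    have k1 : c 1 = 0 := by simpa [h10, h1, k2, k3] using key w1
    have k0 : c 0 = 0 := by simpa [h0, k1, k2, k3] using key w0
    refine hc (funext fun i => ?_)
    fin_cases i <;> assumption
  · intro i
    fin_cases i <;> assumption

/-- The test vectors `v` and `v + w` for pairs of distinct coordinate vectors. -/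
def testVec (k : Fin 10) : Vec :=
  if (pair k).1 = (pair k).2 then Pi.single (pair k).1 1
  else Pi.single (pair k).1 1 + Pi.single (pair k).2 1

lemma eq_zero_of_testVec (m : Fin 10 → ℤ) (h : ∀ k, m ⬝ᵥ mono (testVec k) = 0) : m = 0 := by
  simp [Fin.forall_fin_succ, dotProduct, sum_ten, mono, pair, testVec] at h
  funext k
  fin_cases k <;> simp <;> omega

lemma eq_zero_of_testVec_mulVec (V : Matrix (Fin 4) (Fin 4) ℤ) (hV : V.det ≠ 0) (m : Fin 10 → ℤ)
    (h : ∀ k, m ⬝ᵥ mono (V *ᵥ testVec k) = 0) : m = 0 := by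
  have h1 : m ᵥ* sq V = 0 := eq_zero_of_testVec _ fun k => by
    rw [← dotProduct_mulVec, sq_mulVec, h]
  by_contra hm
  have := exists_vecMul_eq_zero_iff.1 ⟨m, hm, h1⟩
  rw [det_sq_int V hV] at this
  exact hV (pow_eq_zero_iff (by norm_num) |>.1 this)

lemma form_parallelogram (m : Fin 10 → ℤ) (v w : Vec) :
    m ⬝ᵥ mono (v + w) + m ⬝ᵥ mono (v - w) = 2 * (m ⬝ᵥ mono v) + 2 * (m ⬝ᵥ mono w) := by
  simp [dotProduct, sum_ten, mono, pair]
  ring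

lemma perfect_le {φ : Line → ℤ} (hφ : φ ∈ Perfect) (V : Matrix (Fin 4) (Fin 4) ℤ)
    (h : ∀ i, φ (Line.mk (fun k => V k i)) = 2) (k : Fin 10) :
    φ (Line.mk (V *ᵥ testVec k)) ≤ 8 := by
  have hs : ∀ i, V *ᵥ Pi.single i 1 = fun k => V k i := fun i => by
    rw [mulVec_single_one]
    rfl
  rw [testVec]
  split_ifs
  · rw [hs, h]
    norm_num
  · rw [mulVec_add]
    have h0 := fun x => perfect_nonneg hφ x
    obtain ⟨m, rfl⟩ := perfect_mem hφ
    have h1 := form_parallelogram m (V *ᵥ Pi.single (pair k).1 1) (V *ᵥ Pi.single (pair k).2 1)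
    have h2 := h (pair k).1
    have h3 := h (pair k).2
    have h4 := h0 (Line.mk (V *ᵥ Pi.single (pair k).1 1 - V *ᵥ Pi.single (pair k).2 1))
    rw [← hs, form_mk] at h2 h3
    rw [form_mk] at h4 ⊢
    omega

lemma finite_perfect {S : Set Line} (h : ∀ w ∈ Squares, ∃ x ∈ S, w x ≠ 0) :
    {φ | φ ∈ Perfect ∧ ∀ x ∈ S, φ x = 2}.Finite := by
  obtain ⟨V, hV, hS⟩ := exists_independent h
  refine Set.Finite.of_finite_image (f := fun φ k => φ (Line.mk (V *ᵥ testVec k)))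
    ((Set.Finite.pi (ι := Fin 10) fun _ => Set.finite_Icc (0 : ℤ) 8).subset ?_) ?_
  · rintro _ ⟨φ, ⟨hφ, h2⟩, rfl⟩ k -
    exact ⟨perfect_nonneg hφ _, perfect_le hφ V (fun i => h2 _ (hS i)) k⟩
  · rintro φ ⟨hφ, -⟩ ψ ⟨hψ, -⟩ heq
    obtain ⟨m, rfl⟩ := perfect_mem hφ
    obtain ⟨m', rfl⟩ := perfect_mem hψ
    refine congrArg form (sub_eq_zero.1 (eq_zero_of_testVec_mulVec V hV (m - m') fun k => ?_))
    rw [sub_dotProduct, sub_eq_zero]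
    exact congrFun heq k

/-- The quadratic monomials as a function of lines. -/
def monoLine : Line → Fin 10 → ℤ := Line.lift mono mono_neg

lemma form_apply (m : Fin 10 → ℤ) (x : Line) : form m x = m ⬝ᵥ monoLine x := by
  obtain ⟨v, rfl⟩ := x.exists_mk
  rfl

/-- The determinant of ten lines in the space of quadratic forms. -/
def facetForm (v : Fin 9 → Line) (x : Line) : ℤ :=
  det (Matrix.of fun i : Fin 10 => monoLine ((Fin.cons x v : Fin 10 → Line) i))

lemma facetForm_eq (v : Fin 9 → Line) (x : Line) : facetForm v x = ∑ k : Fin 10,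
    (-1) ^ (k : ℕ) * monoLine x k *
      det (Matrix.of fun (i j : Fin 9) => monoLine (v i) (k.succAbove j)) := by
  rw [facetForm, det_succ_row_zero]
  refine Finset.sum_congr rfl fun k _ => ?_
  congr 1

lemma facetForm_mem (v : Fin 9 → Line) : facetForm v ∈ form.range := by
  refine ⟨fun k => (-1) ^ (k : ℕ) *
      det (Matrix.of fun (i j : Fin 9) => monoLine (v i) (k.succAbove j)), funext fun x => ?_⟩
  rw [form_apply, facetForm_eq, dotProduct]
  refine Finset.sum_congr rfl fun k _ => ?_
  ring

lemma facetForm_perm (v : Fin 9 → Line) (σ : Equiv.Perm (Fin 9)) (x : Line) :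
    facetForm (v ∘ σ) x = (Equiv.Perm.sign σ : ℤ) * facetForm v x := by
  rw [facetForm_eq, facetForm_eq, Finset.mul_sum]
  refine Finset.sum_congr rfl fun k _ => ?_
  rw [show (Matrix.of fun (i j : Fin 9) => monoLine ((v ∘ σ) i) (k.succAbove j)) =
    (Matrix.of fun (i j : Fin 9) => monoLine (v i) (k.succAbove j)).submatrix σ id from rfl,
    det_permute]
  push_cast
  ring

lemma facetForm_self (v : Fin 9 → Line) (i : Fin 9) : facetForm v (v i) = 0 := by
  refine det_zero_of_row_eq (i := 0) (j := i.succ) (Fin.succ_ne_zero i).symm ?_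
  rfl

lemma facetForm_swap (u : Fin 8 → Line) (a b : Line) :
    facetForm (Fin.cons a u : Fin 9 → Line) b = - facetForm (Fin.cons b u : Fin 9 → Line) a := by
  have h := det_permute (Equiv.swap (0 : Fin 10) 1) (Matrix.of fun i : Fin 10 =>
    monoLine ((Fin.cons a (Fin.cons b u : Fin 9 → Line) : Fin 10 → Line) i))
  rw [Equiv.Perm.sign_swap (by decide)] at h
  simp only [Units.val_neg, Units.val_one, Int.cast_neg, Int.cast_one, neg_mul, one_mul] at h
  rw [facetForm, facetForm, ← h]
  congr 1
  ext i j
  refine congrArg (fun y => monoLine y j) ?_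
  refine Fin.cases ?_ (fun i => Fin.cases ?_ (fun i => ?_) i) i
  · rw [Equiv.swap_apply_left]
    rfl
  · rw [show Fin.succ (0 : Fin 9) = (1 : Fin 10) from rfl, Equiv.swap_apply_right]
    rfl
  · rw [Equiv.swap_apply_of_ne_of_ne (a := (0 : Fin 10)) (b := 1) (Fin.succ_ne_zero _)
      fun h => Fin.succ_ne_zero i (Fin.succ_injective _ h)]
    rfl

lemma facetForm_ne {φ : Line → ℤ} (c : Chart form.range Perfect φ) (s : Fin c.B → Fin c.n)
    (v : Fin 9 → Line) (h : c.IsFacet s v) : facetForm v ≠ 0 := by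
  intro h0
  let b₀ : Fin c.B := ⟨0, c.B_pos⟩
  obtain ⟨m, hm, h1⟩ := exists_mulVec_eq_zero_iff.2 (congrFun h0 (c.r b₀ (s b₀)))
  refine hm (form_injective ?_)
  rw [map_zero]
  have h2 : ∀ i : Fin 9, form m (v i) = 0 := fun i => by
    rw [form_apply, dotProduct_comm]
    exact congrFun h1 i.succ
  have h3 : form m (c.r b₀ (s b₀)) = 0 := by
    rw [form_apply, dotProduct_comm]
    exact congrFun h1 0
  have h4 : ∀ b, ∀ j ≠ s b, form m (c.r b j) = 0 := fun b j hj => by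
    obtain ⟨i, hi⟩ := h.mem_range hj
    rw [← hi, h2]
  have h5 : ∀ b, ∑ j, form m (c.r b j) = form m (c.r b (s b)) := fun b =>
    Finset.sum_eq_single _ (fun j _ hj => h4 b j hj) (by simp)
  refine c.perfect _ ⟨m, rfl⟩ fun b j => ?_
  by_cases hj : j = s b
  · rw [hj, ← h5, c.bal _ ⟨m, rfl⟩ b b₀, h5, h3]
  · exact h4 b j hj

/-- The perfect forms in four variables. -/
def quaternary : VoronoiData Line (Lex (Fin 10 → ℤ)) where
  Q := form.range
  Φ := Perfect
  Φ_sub _ h := perfect_mem h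
  R := Squares
  R_sub := by
    rintro _ ⟨w, -, rfl⟩
    exact ⟨_, rfl⟩
  R_nonneg := by
    rintro _ ⟨w, -, rfl⟩ x
    obtain ⟨v, rfl⟩ := x.exists_mk
    rw [form_mk, squareCoeff_dot]
    positivity
  α := lexValue
  α_inj _ h := lexValue_injective h
  R_pos := by
    rintro _ ⟨w, hw, rfl⟩
    refine lexValue_pos ⟨_, rfl⟩ (fun x => ?_) fun h => ?_
    · obtain ⟨v, rfl⟩ := x.exists_mk
      rw [form_mk, squareCoeff_dot]
      positivity
    · have := congrFun h (Line.mk w)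
      rw [form_mk, squareCoeff_dot] at this
      exact hw (dotProduct_self_eq_zero.1 (pow_eq_zero_iff (by norm_num) |>.1 this))
  two_le φ hφ ψ hψ x h := by
    obtain ⟨v, rfl⟩ := x.exists_mk
    refine two_le_perfect hψ ?_
    rintro rfl
    obtain ⟨m, rfl⟩ := perfect_mem hφ
    rw [form_zero] at h
    norm_num at h
  wf := lexValue_wf
  fin _ h := finite_perfect h
  nonempty := ⟨_, 0, 1, rfl⟩
  chart _ h := nonempty_chart h
  D := facetForm
  D_mem := facetForm_mem
  D_self := facetForm_self
  D_perm := facetForm_perm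
  D_swap := facetForm_swap
  D_ne _ _ c s v hv h := facetForm_ne c s v ⟨hv, h⟩

attribute [local instance] arrowAction

lemma monoLine_smul (g : Matrix (Fin 4) (Fin 4) ℤ) (x : Line) :
    monoLine (g • x) = sq g *ᵥ monoLine x := by
  obtain ⟨v, rfl⟩ := x.exists_mk
  exact (sq_mulVec g v).symm

lemma facetForm_smul (g : GL (Fin 4) ℤ) (v : Fin 9 → Line) (x : Line) :
    facetForm (fun i => g • v i) (g • x) = g.1.det ^ 5 * facetForm v x := by
  have hg : g.1.det ≠ 0 := by
    intro h
    have := congrArg det (Units.mul_inv g)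
    rw [det_mul, h, zero_mul, det_one] at this
    exact zero_ne_one this
  rw [← det_sq_int g.1 hg, ← det_transpose (sq g.1), mul_comm, facetForm, facetForm, ← det_mul]
  congr 1
  ext i j
  rw [mul_apply]
  change monoLine ((Fin.cons (g • x) fun i => g • v i : Fin 10 → Line) i) j =
    ∑ k, monoLine ((Fin.cons x v : Fin 10 → Line) i) k * sq g.1 j k
  have h : (Fin.cons (g • x) fun i => g • v i : Fin 10 → Line) i =
      g.1 • (Fin.cons x v : Fin 10 → Line) i := by
    refine Fin.cases ?_ (fun i => ?_) i <;> rfl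
  rw [h, monoLine_smul, mulVec, dotProduct]
  exact Finset.sum_congr rfl fun k _ => mul_comm _ _

lemma root_bound {k : Fin 2} {u : Vec} {c : ℤ} (h : root k ⬝ᵥ mono u ≤ c) (i : Fin 4) :
    u i ∈ Set.Icc (-(2 * c)) (2 * c) := by
  have hsq : ∀ a : ℤ, a ^ 2 ≤ c → -c ≤ a ∧ a ≤ c := fun a ha => by
    constructor <;> nlinarith [Int.le_self_sq a, Int.le_self_sq (-a)]
  revert u
  rw [forall_fin_four]
  intro a0 a1 a2 a3 h
  obtain rfl | rfl : k = 0 ∨ k = 1 := by omega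
  · rw [root_zero_dot] at h
    simp at h
    have h0 := hsq a0 (by nlinarith)
    have h1 := hsq a1 (by nlinarith)
    have h2 := hsq a2 (by nlinarith)
    have h3 := hsq a3 (by nlinarith)
    fin_cases i <;> simp <;> omega
  · rw [root_one_dot] at h
    simp at h
    have h0 := hsq (a0 - a1) (by nlinarith)
    have h1 := hsq (a0 + a1 + a2 + a3) (by nlinarith)
    have h2 := hsq a2 (by nlinarith)
    have h3 := hsq a3 (by nlinarith)
    fin_cases i <;> simp <;> omega

lemma finite_sublevel {φ : Line → ℤ} (hφ : φ ∈ Perfect) (c : ℤ) :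
    {v : Vec | φ (Line.mk v) ≤ c}.Finite := by
  obtain ⟨k, g, rfl⟩ := hφ
  refine Set.Finite.of_finite_image (f := fun v => g.1 *ᵥ v)
    ((Set.Finite.pi (ι := Fin 4) fun _ => Set.finite_Icc (-(2 * c)) (2 * c)).subset ?_) ?_
  · rintro _ ⟨v, hv, rfl⟩ i -
    rw [Set.mem_ofPred_eq, form_smul_root] at hv
    exact root_bound hv i
  · intro v _ w _ h
    refine sub_eq_zero.1 (gl_mulVec_eq_zero g ?_)
    rw [mulVec_sub, sub_eq_zero]
    exact h

lemma finite_isometries {φ : Line → ℤ} (hφ : φ ∈ Perfect) (ψ : Line → ℤ) :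
    {g : GL (Fin 4) ℤ | g • φ = ψ}.Finite := by
  by_cases hψ : ψ ∈ Perfect
  · refine Set.Finite.of_finite_image (f := fun g i => g.1 *ᵥ Pi.single i 1)
      ((Set.Finite.pi (ι := Fin 4) fun i => finite_sublevel hψ
        (φ (Line.mk (Pi.single i 1)))).subset ?_) ?_
    · rintro _ ⟨g, hg, rfl⟩ i -
      rw [Set.mem_ofPred_eq, ← Line.gl_smul_mk, ← (show g • φ = ψ from hg)]
      change φ (g⁻¹ • g • _) ≤ _
      rw [inv_smul_smul]
    · intro g _ h _ heq
      refine Units.ext (Matrix.ext_of_mulVec_single fun i => congrFun heq i)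
  · refine Set.Finite.subset Set.finite_empty ?_
    rintro g rfl
    exact hψ (gl_smul_perfect g hφ)

/-- The congruence subgroup as a group of invertible matrices. -/
noncomputable def gammaHom (N : ℕ) : Gamma0 N →* GL (Fin 4) ℤ :=
  SpecialLinearGroup.toGL.comp (Gamma0 N).subtype

lemma gammaHom_injective (N : ℕ) : Function.Injective (gammaHom N) := fun _ _ h =>
  Subtype.ext (Subtype.ext (congrArg (fun g : GL (Fin 4) ℤ => g.1) h))

noncomputable instance (N : ℕ) : MulAction (Gamma0 N) Line := MulAction.compHom Line (gammaHom N)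

lemma gamma_smul (N : ℕ) (γ : Gamma0 N) (x : Line) : γ • x = gammaHom N γ • x := rfl

lemma gamma_smul_form (N : ℕ) (γ : Gamma0 N) (φ : Line → ℤ) : γ • φ = gammaHom N γ • φ := by
  funext x
  change φ (gammaHom N γ⁻¹ • x) = φ ((gammaHom N γ)⁻¹ • x)
  rw [map_inv]

lemma gammaHom_det (N : ℕ) (γ : Gamma0 N) : (gammaHom N γ).1.det = 1 := γ.1.2

lemma exists_gammaHom {N : ℕ} (g : GL (Fin 4) ℤ) (h : g.1.det = 1)
    (h' : ∀ j : Fin 4, j ≠ 3 → (N : ℤ) ∣ g.1 3 j) : ∃ γ, gammaHom N γ = g :=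
  ⟨⟨⟨g.1, h⟩, h'⟩, Units.ext rfl⟩

lemma gl_smul_square (g : GL (Fin 4) ℤ) {q : Line → ℤ} (h : q ∈ Squares) : g • q ∈ Squares := by
  obtain ⟨w, hw, rfl⟩ := h
  refine ⟨w ᵥ* g⁻¹.1, fun h => hw ?_, ?_⟩
  · have := congrArg (fun u => u ᵥ* g.1) h
    simp only [vecMul_vecMul, zero_vecMul] at this
    rwa [← Units.val_mul, inv_mul_cancel, Units.val_one, vecMul_one] at this
  · funext x
    obtain ⟨v, rfl⟩ := x.exists_mk
    change form _ (g⁻¹ • Line.mk v) = _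
    rw [Line.gl_smul_mk, form_mk, form_mk, squareCoeff_dot, squareCoeff_dot, dotProduct_mulVec]

lemma quaternary_orbits (N : ℕ) [NeZero N] : ∃ F : Set (Line → ℤ), F.Finite ∧ F ⊆ Perfect ∧
    ∀ φ ∈ Perfect, ∃ γ : Gamma0 N, γ • φ ∈ F := by
  let ι : GL (Fin 4) ℤ → Matrix (Fin 4) (Fin 4) (ZMod N) × ℤˣ := fun g =>
    (g.1.map (Int.castRingHom (ZMod N)), GeneralLinearGroup.det g)
  let f : Fin 2 × Matrix (Fin 4) (Fin 4) (ZMod N) × ℤˣ → Line → ℤ := fun c =>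
    form (root c.1 ᵥ* sq (Function.invFun ι c.2).1)
  refine ⟨Set.range f, Set.finite_range f, ?_, ?_⟩
  · rintro _ ⟨c, rfl⟩
    exact ⟨_, _, rfl⟩
  · rintro _ ⟨k, g, rfl⟩
    set g' := Function.invFun ι (ι g) with hg'
    have h : ι g' = ι g := Function.invFun_eq ⟨g, rfl⟩
    have h1 : g'.1.map (Int.castRingHom (ZMod N)) = g.1.map (Int.castRingHom (ZMod N)) :=
      congrArg Prod.fst h
    have h2 : GeneralLinearGroup.det g' = GeneralLinearGroup.det g := congrArg Prod.snd h
    obtain ⟨γ, hγ⟩ := exists_gammaHom (N := N) (g'⁻¹ * g) (by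
      have : GeneralLinearGroup.det (g'⁻¹ * g) = 1 := by
        rw [map_mul, map_inv, h2, inv_mul_cancel]
      exact congrArg Units.val this) fun j hj => by
        have h3 : (g'⁻¹ * g).1.map (Int.castRingHom (ZMod N)) = 1 := by
          rw [Units.val_mul, Matrix.map_mul, ← h1, ← Matrix.map_mul, ← Units.val_mul,
            inv_mul_cancel, Units.val_one]
          simp
        have h4 := congrFun (congrFun h3 3) j
        rw [map_apply, one_apply_ne hj.symm] at h4
        exact (ZMod.intCast_zmod_eq_zero_iff_dvd _ N).1 h4
    refine ⟨γ, (k, ι g), ?_⟩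
    rw [gamma_smul_form, hγ, gl_smul_form, vecMul_vecMul, ← sq_mul, ← Units.val_mul]
    simp [f, ← hg']

lemma facetForm_gamma_smul (N : ℕ) (γ : Gamma0 N) (v : Fin 9 → Line) (x : Line) :
    facetForm (γ • v) (γ • x) = facetForm v x := by
  have h := facetForm_smul (gammaHom N γ) v x
  rwa [gammaHom_det, one_pow, one_mul] at h

lemma quaternary_equivariant (N : ℕ) [NeZero N] : quaternary.Equivariant (Gamma0 N) where
  smul_Φ γ φ h := by
    rw [gamma_smul_form]
    exact gl_smul_perfect _ h
  smul_R γ w h := by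
    rw [gamma_smul_form]
    exact gl_smul_square _ h
  smul_D γ v x := facetForm_gamma_smul N γ v x
  fin φ hφ ψ := by
    refine ((finite_isometries hφ ψ).preimage (gammaHom_injective N).injOn).subset ?_
    rintro γ rfl
    exact (gamma_smul_form N γ φ).symm
  orbits := quaternary_orbits N

lemma not_cell_three (v : Fin 3 → Line) : ¬ quaternary.Cell (Set.range v) := by
  rintro ⟨h, -⟩
  choose u hu using fun i => (v i).exists_mk
  obtain ⟨w, hw, h0, h1, h2⟩ := exists_orthogonal (u 0) (u 1) (u 2)
  obtain ⟨_, ⟨i, rfl⟩, hx⟩ := h _ ⟨w, hw, rfl⟩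
  apply hx
  rw [← hu, form_mk, squareCoeff_dot]
  fin_cases i <;> simp [h0, h1, h2]

end Voronoi

namespace Voronoi

open Matrix Finset

lemma pow_sum_count {m : ℕ} (hm : m < 8) (a : Fin m → ℕ) (d : ℕ) :
    (∑ i, 8 ^ a i) / 8 ^ d % 8 = #{i | a i = d} := by
  have key : ∀ s : Finset (Fin m), ∃ q r, ∑ i ∈ s, 8 ^ a i = q * 8 ^ (d + 1) + #{i ∈ s | a i = d} * 8 ^ d + r ∧
      r + #{i ∈ s | a i < d} ≤ #{i ∈ s | a i < d} * 8 ^ d / 8 + #{i ∈ s | a i < d} := by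
    intro s
    induction s using Finset.induction with
    | empty => exact ⟨0, 0, by simp, by simp⟩
    | insert x s hx ih =>
      obtain ⟨q, r, h, h'⟩ := ih
      rw [sum_insert hx, h, filter_insert, filter_insert]
      rcases lt_trichotomy (a x) d with hlt | heq | hgt
      · have hd : 8 ^ d = 8 ^ (a x) * 8 * 8 ^ (d - a x - 1) := by
          rw [← pow_succ, ← pow_add]; congr 1; omega
        have h2 : 1 ≤ 8 ^ (d - a x - 1) := Nat.one_le_pow _ _ (by norm_num)
        refine ⟨q, r + 8 ^ a x, ?_, ?_⟩
        · rw [if_neg hlt.ne]; ring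
        · rw [if_pos hlt, card_insert_of_notMem (by simp [hx])]
          have h3 : 8 ^ d / 8 = 8 ^ a x * 8 ^ (d - a x - 1) := by
            rw [hd]; apply Nat.div_eq_of_eq_mul_right (by norm_num); ring
          have h4 : 8 ∣ 8 ^ d := by rw [hd]; exact ⟨8 ^ a x * 8 ^ (d - a x - 1), by ring⟩
          rw [Nat.mul_div_assoc _ h4, h3] at h' ⊢
          nlinarith [Nat.one_le_pow (a x) 8 (by norm_num)]
      · refine ⟨q, r, ?_, ?_⟩
        · rw [if_pos heq, card_insert_of_notMem (by simp [hx]), heq]; ring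
        · rw [if_neg heq.not_lt]; exact h'
      · refine ⟨q + 8 ^ (a x - d - 1), r, ?_, ?_⟩
        · have : 8 ^ a x = 8 ^ (a x - d - 1) * 8 ^ (d + 1) := by rw [← pow_add]; congr 1; omega
          rw [if_neg hgt.ne', this]; ring
        · rw [if_neg (by omega)]; exact h'
  obtain ⟨q, r, h, h'⟩ := key univ
  have hc : #{i | a i = d} < 8 := ((card_filter_le _ _).trans (by simp)).trans_lt hm
  have hr : r < 8 ^ d := by
    have h1 : #{i | a i < d} < 8 := ((card_filter_le _ _).trans (by simp)).trans_lt hm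
    rcases d with _ | d
    · simp at h'; simp [h']
    · have : #{i | a i < d + 1} * 8 ^ (d + 1) / 8 = #{i | a i < d + 1} * 8 ^ d := by
        rw [pow_succ, ← mul_assoc]; simp
      rw [this] at h'
      have : r ≤ #{i | a i < d + 1} * 8 ^ d := by omega
      have h3 : 0 < 8 ^ d := by positivity
      calc r ≤ _ := this
        _ ≤ 7 * 8 ^ d := Nat.mul_le_mul_right _ (by omega)
        _ < 8 ^ (d + 1) := by rw [pow_succ]; omega
  have h5 : ∑ i, 8 ^ a i = r + 8 ^ d * (#{i | a i = d} + 8 * q) := by rw [h]; ring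
  rw [h5, Nat.add_mul_div_left _ _ (by positivity), Nat.div_eq_of_lt hr]
  omega

lemma exists_perm_of_pow_sum {m : ℕ} (hm : m < 8) (a b : Fin m → ℕ) (h : ∑ i, 8 ^ a i = ∑ i, 8 ^ b i) :
    ∃ π : Equiv.Perm (Fin m), ∀ i, b (π i) = a i := by
  have hc : ∀ d, Nonempty ({i // a i = d} ≃ {i // b i = d}) := fun d => by
    rw [← Fintype.card_eq, Fintype.card_subtype, Fintype.card_subtype, ← pow_sum_count hm a d,
      ← pow_sum_count hm b d, h]
  exact ⟨Equiv.ofFiberEquiv fun d => (hc d).some, Equiv.ofFiberEquiv_map _⟩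

/-- The digit attached to a vector with circuit coefficient `c` and level `x`. -/
def dig (c : ℤ) (x : ZMod 18) : ℕ :=
  if c = 0 then 18 + min x.val (-x).val else ((c : ZMod 18) * x).val

def sgn (c : ℤ) (x : ZMod 18) : ℤ :=
  if c = 0 then (if x = 0 ∨ x = 9 then 0 else if x.val < 9 then 1 else -1) else c

lemma dig_mul (ε : ℤˣ) (c : ℤ) (x : ZMod 18) : dig (ε * c) ((ε : ℤ) * x) = dig c x := by
  rcases Int.units_eq_one_or ε with rfl | rfl <;> simp [dig, min_comm]

lemma sgn_mul (ε : ℤˣ) (c : ℤ) (x : ZMod 18) : sgn (ε * c) ((ε : ℤ) * x) = ε * sgn c x := by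
  rcases Int.units_eq_one_or ε with rfl | rfl
  · simp
  · by_cases hc : c = 0
    · subst hc
      revert x; decide +kernel
    · simp [sgn, hc]

def Small (c : ℤ) : Prop := c = 0 ∨ c = 1 ∨ c = -1

lemma exists_of_dig_eq {c c' : ℤ} (hc : Small c) (hc' : Small c') {x x' : ZMod 18}
    (h : dig c x = dig c' x') : ∃ ε : ℤˣ, c' = ε * c ∧ x' = (ε : ℤ) * x := by
  rcases hc with rfl | rfl | rfl <;> rcases hc' with rfl | rfl | rfl <;> revert x x' <;> decide +kernel

variable {m : ℕ}

/-- The key of a symbol, recording the multiset of its digits. -/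
def key (c : Fin m → ℤ) (l : Fin m → ZMod 18) : ℕ := ∑ i, 8 ^ dig (c i) (l i)

/-- The weight by which a symbol is twisted; `b` selects the character of the determinant. -/
def weight (b : Bool) (c : Fin m → ℤ) (l : Fin m → ZMod 18) : ℤ :=
  if b then det (vandermonde fun i => (dig (c i) (l i) : ℤ)) else ∏ i, sgn (c i) (l i)

def twist (b : Bool) (π : Equiv.Perm (Fin m)) (ε : Fin m → ℤˣ) : ℤˣ :=
  if b then Equiv.Perm.sign π else ∏ i, ε i

lemma exists_match (hm : m < 8) {c c' : Fin m → ℤ} {l l' : Fin m → ZMod 18} (hc : ∀ i, Small (c i))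
    (hc' : ∀ i, Small (c' i)) (h : key c l = key c' l') :
    ∃ (π : Equiv.Perm (Fin m)) (ε : Fin m → ℤˣ), ∀ i, c' (π i) = ε i * c i ∧ l' (π i) = (ε i : ℤ) * l i := by
  obtain ⟨π, hπ⟩ := exists_perm_of_pow_sum hm _ _ h
  choose ε hε using fun i => exists_of_dig_eq (hc i) (hc' (π i)) (hπ i).symm
  exact ⟨π, ε, hε⟩

lemma weight_match (b : Bool) {c c' : Fin m → ℤ} {l l' : Fin m → ZMod 18} {π : Equiv.Perm (Fin m)}
    {ε : Fin m → ℤˣ} (h : ∀ i, c' (π i) = ε i * c i ∧ l' (π i) = (ε i : ℤ) * l i) :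
    weight b c' l' = twist b π ε * weight b c l := by
  cases b
  · simp only [weight, twist, Bool.false_eq_true, if_false]
    rw [← Equiv.prod_comp π, Units.coe_prod, ← Finset.prod_mul_distrib]
    exact Finset.prod_congr rfl fun i _ => by rw [(h i).1, (h i).2, sgn_mul]
  · simp only [weight, twist, if_true]
    have : (vandermonde fun i => (dig (c i) (l i) : ℤ)) =
        (vandermonde fun i => (dig (c' i) (l' i) : ℤ)).submatrix π id := by
      ext i j
      simp [vandermonde_apply, (h i).1, (h i).2, dig_mul]
    rw [this, det_permute]
    rcases Int.units_eq_one_or (Equiv.Perm.sign π) with h | h <;> simp [h]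

lemma key_match {c c' : Fin m → ℤ} {l l' : Fin m → ZMod 18} {π : Equiv.Perm (Fin m)}
    {ε : Fin m → ℤˣ} (h : ∀ i, c' (π i) = ε i * c i ∧ l' (π i) = (ε i : ℤ) * l i) :
    key c' l' = key c l := by
  rw [key, ← Equiv.sum_comp π]
  exact Finset.sum_congr rfl fun i _ => by rw [(h i).1, (h i).2, dig_mul]

end Voronoi

namespace Voronoi

open Matrix Finset

/-- The image of a tuple of vectors under a matrix. -/
def act {m : ℕ} (h : Matrix (Fin 4) (Fin 4) ℤ) (t : Fin m → Vec) : Fin m → Vec := fun i => h *ᵥ t i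

lemma of_act (h : Matrix (Fin 4) (Fin 4) ℤ) (t : Fin 4 → Vec) :
    (of (act h t)).det = h.det * (of t).det := by
  have : of (act h t) = of t * hᵀ := by
    ext i j
    simp [act, mul_apply, mulVec, dotProduct, mul_comm]
  rw [this, det_mul, det_transpose, mul_comm]

/-- The signed maximal minors of a tuple of five vectors. -/
def circ (t : Fin 5 → Vec) (i : Fin 5) : ℤ := (-1) ^ (i : ℕ) * (of (t ∘ i.succAbove)).det

lemma circ_act (h : Matrix (Fin 4) (Fin 4) ℤ) (t : Fin 5 → Vec) (i : Fin 5) :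
    circ (act h t) i = h.det * circ t i := by
  have := of_act h (t ∘ i.succAbove)
  rw [circ, circ, show act h t ∘ i.succAbove = act h (t ∘ i.succAbove) from rfl, this]
  ring

lemma circ_eq (t : Fin 5 → Vec) (i : Fin 5) :
    circ t i = (of fun j => (Fin.cons (if j = i then 1 else 0) (t j) : Fin 5 → ℤ)).det := by
  rw [det_succ_column_zero, Finset.sum_eq_single i]
  · simp only [circ, of_apply, Fin.cons_zero, if_true, mul_one]
    rfl
  · intro j _ hj
    simp [hj]
  · simp

lemma sum_circ (t : Fin 5 → Vec) : ∑ i, circ t i • t i = 0 := by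
  ext k
  have h : (of fun j => (Fin.cons (t j k) (t j) : Fin 5 → ℤ)).det = 0 :=
    det_zero_of_column_eq (Fin.succ_ne_zero k).symm fun j => by simp
  rw [det_succ_column_zero] at h
  rw [Finset.sum_apply, Pi.zero_apply, ← h]
  refine Finset.sum_congr rfl fun i _ => ?_
  simp only [circ, of_apply, Fin.cons_zero, Pi.smul_apply, smul_eq_mul]
  rw [show (submatrix (of fun j => (Fin.cons (t j k) (t j) : Fin 5 → ℤ)) i.succAbove Fin.succ) =
    of (t ∘ i.succAbove) from rfl]
  ring

lemma det_permute_int {n : ℕ} (π : Equiv.Perm (Fin n)) (M : Matrix (Fin n) (Fin n) ℤ) :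
    (M.submatrix π id).det = (Equiv.Perm.sign π : ℤ) * M.det := by
  simpa using det_permute π M

lemma circ_perm (t : Fin 5 → Vec) (π : Equiv.Perm (Fin 5)) (i : Fin 5) :
    circ (t ∘ π) i = Equiv.Perm.sign π * circ t (π i) := by
  rw [circ_eq, circ_eq, ← det_permute_int]
  congr 1
  ext j k
  simp [Function.comp]

lemma circ_flip (t : Fin 5 → Vec) (ε : Fin 5 → ℤˣ) (i : Fin 5) :
    circ (fun j => ε j • t j) i = (∏ j, (ε j : ℤ)) * (ε i * circ t i) := by
  have h1 : (ε i : ℤ) * circ t i =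
      (of fun j => (Fin.cons (if j = i then (ε i : ℤ) else 0) (t j) : Fin 5 → ℤ)).det := by
    rw [circ_eq, ← smul_eq_mul, det_succ_column_zero, det_succ_column_zero, smul_sum]
    refine Finset.sum_congr rfl fun j _ => ?_
    by_cases hj : j = i
    · simp only [of_apply, Fin.cons_zero, hj, if_true, smul_eq_mul]
      rw [show (submatrix (of fun j => (Fin.cons (if j = i then (ε i : ℤ) else 0) (t j) : Fin 5 → ℤ))
        i.succAbove Fin.succ) = submatrix (of fun j => (Fin.cons (if j = i then 1 else 0) (t j) : Fin 5 → ℤ))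
        i.succAbove Fin.succ from rfl]
      ring
    · simp [hj]
  rw [h1, circ_eq, ← det_mul_column]
  congr 1
  ext j k
  refine Fin.cases ?_ (fun k => ?_) k
  · by_cases hj : j = i
    · subst hj; simp [← Units.val_mul, Int.units_mul_self]
    · simp [hj]
  · simp [Units.smul_def]

lemma det_perm_flip (t : Fin 4 → Vec) (π : Equiv.Perm (Fin 4)) (ε : Fin 4 → ℤˣ) :
    (of fun i => ε i • t (π i)).det = (∏ j, (ε j : ℤ)) * (Equiv.Perm.sign π * (of t).det) := by
  rw [← det_permute_int, ← det_mul_column]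
  congr 1

/-- The class of a vector modulo `18`, paired with a covector. -/
def lev (x : Fin 4 → ZMod 18) (w : Vec) : ZMod 18 := ∑ k, x k * (w k : ZMod 18)

def lastCovector : Fin 4 → ZMod 18 := Pi.single 3 1

lemma lev_last (w : Vec) : lev lastCovector w = (w 3 : ZMod 18) := by
  simp [lev, lastCovector, Pi.single_apply]

lemma lev_units (x) (ε : ℤˣ) (w : Vec) : lev x (ε • w) = (ε : ℤ) * lev x w := by
  simp only [lev, Finset.mul_sum, Pi.smul_apply, Units.smul_def, smul_eq_mul, Int.cast_mul]
  exact Finset.sum_congr rfl fun _ _ => by ring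

lemma lev_zsmul (x) (a : ℤ) (w : Vec) : lev x (a • w) = a * lev x w := by
  simp only [lev, Finset.mul_sum, Pi.smul_apply, smul_eq_mul, Int.cast_mul]
  exact Finset.sum_congr rfl fun _ _ => by ring

lemma lev_add (x) (v w : Vec) : lev x (v + w) = lev x v + lev x w := by
  simp [lev, mul_add, Finset.sum_add_distrib]

lemma lev_mulVec (x) (h : Matrix (Fin 4) (Fin 4) ℤ) (w : Vec) :
    lev x (h *ᵥ w) = lev (x ᵥ* h.map (Int.cast : ℤ → ZMod 18)) w := by
  have : ∀ (y : Fin 4 → ZMod 18) (w : Vec), lev y w = y ⬝ᵥ fun k => (w k : ZMod 18) := fun _ _ => rfl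
  rw [this, this, ← dotProduct_mulVec]
  congr 1
  ext k
  simp [mulVec, dotProduct]

lemma lev_ext {t : Fin 4 → Vec} (ht : IsUnit (of t).det) {x y : Fin 4 → ZMod 18}
    (h : ∀ i, lev x (t i) = lev y (t i)) : x = y := by
  have hu : IsUnit ((of t).map (Int.cast : ℤ → ZMod 18)) := by
    rw [isUnit_iff_isUnit_det]
    have := ht.map (Int.castRingHom (ZMod 18))
    rwa [RingHom.map_det] at this
  refine mulVec_injective_of_isUnit hu ?_
  ext i
  have := h i
  simp only [lev] at this
  simpa [mulVec, dotProduct, mul_comm] using this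

/-- The combinatorial data attached to tuples of a fixed length. -/
structure Frame (m : ℕ) where
  circ : (Fin m → Vec) → Fin m → ℤ
  orient : (Fin m → Vec) → ℤ
  Good : (Fin m → Vec) → Prop
  small : ∀ t, Good t → ∀ i, Small (circ t i)
  span : ∀ t, Good t → ∃ σ : Fin 4 → Fin m, IsUnit (of (t ∘ σ)).det
  orient_ne : ∀ t, Good t → orient t ≠ 0
  geom : ∀ t t', Good t → Good t' → ∀ (π : Equiv.Perm (Fin m)) (ε : Fin m → ℤˣ),
    (∀ i, circ t' (π i) = ε i * circ t i) → ∃ (h : Matrix (Fin 4) (Fin 4) ℤ) (δ : ℤˣ), h.det = δ ∧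
      (∀ i, h *ᵥ t i = ε i • t' (π i)) ∧
      orient t' * ((Equiv.Perm.sign π * ∏ i, ε i : ℤˣ) : ℤ) = δ * orient t
  circ_act : ∀ t (h : Matrix (Fin 4) (Fin 4) ℤ) i, circ (act h t) i = h.det * circ t i
  circ_sym : ∀ t (π : Equiv.Perm (Fin m)) (ε : Fin m → ℤˣ) i, circ (fun i => ε i • t (π i)) i =
    ((Equiv.Perm.sign π * ∏ i, ε i : ℤˣ) : ℤ) * (ε i * circ t (π i))
  orient_act : ∀ t (h : Matrix (Fin 4) (Fin 4) ℤ) (δ : ℤˣ), h.det = δ →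
    (δ : ℤ) ^ m * orient (act h t) = δ * orient t
  orient_sym : ∀ t (π : Equiv.Perm (Fin m)) (ε : Fin m → ℤˣ),
    ((Equiv.Perm.sign π * ∏ i, ε i : ℤˣ) : ℤ) ^ m * orient (fun i => ε i • t (π i)) =
      ((Equiv.Perm.sign π * ∏ i, ε i : ℤˣ) : ℤ) * orient t
  good_act : ∀ t (h : Matrix (Fin 4) (Fin 4) ℤ), IsUnit h.det → Good t → Good (act h t)

lemma small_mul {δ c : ℤ} (hδ : IsUnit δ) (hc : Small c) : Small (δ * c) := by
  rcases Int.isUnit_iff.1 hδ with rfl | rfl <;> rcases hc with rfl | rfl | rfl <;> simp [Small]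

lemma exists_gl_of_circ {t s : Fin 5 → Vec} (ht : ∀ i, Small (circ t i)) (h0 : ∃ i, circ t i ≠ 0) (δ : ℤˣ)
    (h : ∀ i, circ s i = δ * circ t i) : ∃ g : Matrix (Fin 4) (Fin 4) ℤ, g.det = δ ∧ ∀ i, g *ᵥ t i = s i := by
  obtain ⟨i, hi⟩ := h0
  have hu : ∀ c : ℤ, Small c → c ≠ 0 → c * c = 1 := by rintro _ (rfl | rfl | rfl) <;> simp
  have hii := hu _ (ht i) hi
  have hd : IsUnit (of (t ∘ i.succAbove)).det := by
    have : circ t i * ((-1) ^ (i : ℕ) * (of (t ∘ i.succAbove)).det) = 1 := hii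
    exact IsUnit.of_mul_eq_one (circ t i * (-1) ^ (i : ℕ)) (by
      rw [mul_comm, mul_assoc]; exact this)
  set B := of (t ∘ i.succAbove)
  have key : ∀ j, ((B⁻¹ * of (s ∘ i.succAbove))ᵀ) *ᵥ t (i.succAbove j) = s (i.succAbove j) := by
    intro j
    have : (of (t ∘ i.succAbove) * (B⁻¹ * of (s ∘ i.succAbove))) j = s (i.succAbove j) := by
      rw [← Matrix.mul_assoc, mul_nonsing_inv _ hd, Matrix.one_mul]; rfl
    rw [← this, mulVec_transpose]
    rfl
  set g := (B⁻¹ * of (s ∘ i.succAbove))ᵀ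
  have hall : ∀ j, g *ᵥ t j = s j := by
    intro j
    rcases Fin.eq_self_or_eq_succAbove i j with rfl | ⟨j, rfl⟩
    · have h1 : g *ᵥ (∑ k, circ t k • t k) = 0 := by rw [sum_circ, mulVec_zero]
      have h2 : ∑ k, circ t k • s k = 0 := by
        have := sum_circ s
        simp only [h, mul_smul, ← smul_sum] at this
        rcases Int.units_eq_one_or δ with rfl | rfl <;> simpa using this
      rw [mulVec_sum, Fin.sum_univ_succAbove _ j] at h1
      rw [Fin.sum_univ_succAbove _ j] at h2
      simp only [mulVec_smul, key] at h1
      have h3 : circ t j • (g *ᵥ t j) = circ t j • s j := by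
        rw [eq_neg_of_add_eq_zero_left h1, eq_neg_of_add_eq_zero_left h2]
      have := congrArg (circ t j • ·) h3
      simp only [smul_smul, hii, one_smul] at this
      exact this
    · exact key j
  refine ⟨g, ?_, hall⟩
  have h1 := circ_act g t i
  rw [show act g t = s from funext hall, h] at h1
  have := congrArg (· * circ t i) h1
  simpa [mul_assoc, hii] using this.symm

lemma circ_sym (t : Fin 5 → Vec) (π : Equiv.Perm (Fin 5)) (ε : Fin 5 → ℤˣ) (i : Fin 5) :
    circ (fun i => ε i • t (π i)) i =
      ((Equiv.Perm.sign π * ∏ i, ε i : ℤˣ) : ℤ) * (ε i * circ t (π i)) := by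
  have h1 := circ_flip (t ∘ π) ε i
  rw [circ_perm] at h1
  simp only [Function.comp] at h1
  rw [h1]
  push_cast
  ring

def frameFive : Frame 5 where
  circ := circ
  orient _ := 1
  Good t := (∀ i, Small (circ t i)) ∧ ∃ i, circ t i ≠ 0
  small _ h := h.1
  span := fun t ⟨h, i, hi⟩ => ⟨i.succAbove, by
    rcases h i with h | h | h
    · exact absurd h hi
    all_goals
      rw [circ] at h
      rcases neg_one_pow_eq_or ℤ (i : ℕ) with h' | h' <;> rw [h'] at h <;> rw [Int.isUnit_iff] <;> omega⟩
  orient_ne _ _ := one_ne_zero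
  geom t t' ht ht' π ε h := by
    have hs : ∀ i, circ (fun i => ε i • t' (π i)) i = ((Equiv.Perm.sign π * ∏ i, ε i : ℤˣ) : ℤ) * circ t i := by
      intro i
      rw [circ_sym, h i]
      rcases Int.units_eq_one_or (ε i) with h | h <;> simp [h]
    obtain ⟨g, hg, hg'⟩ := exists_gl_of_circ ht.1 ht.2 _ hs
    exact ⟨g, _, hg, hg', by simp⟩
  circ_act t h i := Voronoi.circ_act h t i
  circ_sym := Voronoi.circ_sym
  orient_act _ _ δ _ := by rcases Int.units_eq_one_or δ with h | h <;> simp [h]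
  orient_sym _ π ε := by
    rcases Int.units_eq_one_or (Equiv.Perm.sign π * ∏ i, ε i) with h | h <;> rw [h] <;> simp
  good_act t h hh ht := by
    refine ⟨fun i => ?_, ht.2.imp fun i hi => ?_⟩ <;> rw [Voronoi.circ_act]
    · exact small_mul hh (ht.1 i)
    · exact mul_ne_zero hh.ne_zero hi

def frameFour : Frame 4 where
  circ _ _ := 0
  orient t := (of t).det
  Good t := IsUnit (of t).det
  small _ _ _ := Or.inl rfl
  span t ht := ⟨id, ht⟩
  orient_ne _ ht := ht.ne_zero
  geom t t' ht ht' π ε _ := by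
    have h1 := det_perm_flip t' π ε
    have hs : IsUnit (of fun i => ε i • t' (π i)).det := by
      rw [h1, ← Units.coe_prod]
      exact (Units.isUnit _).mul ((Units.isUnit _).mul ht')
    have h2 : ((of t)⁻¹ * (of fun i => ε i • t' (π i)))ᵀ.det * (of t).det =
        (of fun i => ε i • t' (π i)).det := by
      rw [det_transpose, det_mul, mul_comm, ← mul_assoc, ← det_mul, mul_nonsing_inv _ ht, det_one, one_mul]
    have h3 : IsUnit ((of t)⁻¹ * (of fun i => ε i • t' (π i)))ᵀ.det := by
      rw [← h2] at hs
      exact isUnit_of_mul_isUnit_left hs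
    refine ⟨((of t)⁻¹ * (of fun i => ε i • t' (π i)))ᵀ, h3.unit, rfl, fun i => ?_, ?_⟩
    · have : (of t * ((of t)⁻¹ * (of fun i => ε i • t' (π i)))) i = ε i • t' (π i) := by
        rw [← Matrix.mul_assoc, mul_nonsing_inv _ ht, Matrix.one_mul]; rfl
      rw [← this, mulVec_transpose]
      rfl
    · push_cast
      rw [IsUnit.unit_spec, h2, h1]
      ring
  circ_act _ _ _ := by simp
  circ_sym _ _ _ _ := by simp
  orient_act t h δ hδ := by
    rw [of_act, hδ]
    rcases Int.units_eq_one_or δ with h | h <;> simp [h]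
  orient_sym t π ε := by
    rw [det_perm_flip, ← Units.coe_prod]
    rcases Int.units_eq_one_or (Equiv.Perm.sign π) with h | h <;>
      rcases Int.units_eq_one_or (∏ i, ε i) with h' | h' <;> rw [h, h'] <;> simp
  good_act t h hh ht := by rw [of_act]; exact hh.mul ht

variable {m : ℕ}

/-- Functions of tuples of vectors with a prescribed behaviour under symmetries. -/
structure Twisted (b : Bool) (F : (Fin m → Vec) → ℂ) : Prop where
  sym : ∀ t (π : Equiv.Perm (Fin m)) (ε : Fin m → ℤˣ),
    F (fun i => ε i • t (π i)) = ((Equiv.Perm.sign π : ℤ) : ℂ) * F t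
  gl : ∀ t (h : Matrix (Fin 4) (Fin 4) ℤ) (δ : ℤˣ), h.det = δ → (∀ j, j ≠ 3 → (18 : ℤ) ∣ h 3 j) →
    F (act h t) = (if b then 1 else ((δ : ℤ) : ℂ)) * F t

def Compat (h : Matrix (Fin 4) (Fin 4) ℤ) (u : (ZMod 18)ˣ) (x : Fin 4 → ZMod 18) : Prop :=
  ∀ w, lev lastCovector (h *ᵥ w) = u * lev x w

lemma Compat.dvd {h : Matrix (Fin 4) (Fin 4) ℤ} {u} (hc : Compat h u lastCovector) (j : Fin 4) (hj : j ≠ 3) :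
    (18 : ℤ) ∣ h 3 j := by
  have := hc (Pi.single j 1)
  rw [lev_last, lev_last, mulVec_single_one, Pi.single_eq_of_ne hj.symm] at this
  simp only [Int.cast_zero, mul_zero, col_apply] at this
  exact (ZMod.intCast_zmod_eq_zero_iff_dvd _ 18).1 this

def levs (x : Fin 4 → ZMod 18) (u : (ZMod 18)ˣ) (s : Fin m → Vec) : Fin m → ZMod 18 := fun i => u * lev x (s i)

lemma Frame.match_gl (R : Frame m) {s t : Fin m → Vec} (hs : R.Good s) (ht : R.Good t) {x} {u u' : (ZMod 18)ˣ}
    {π : Equiv.Perm (Fin m)} {ε : Fin m → ℤˣ} (h : ∀ i, R.circ t (π i) = ε i * R.circ s i ∧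
      levs lastCovector u' t (π i) = (ε i : ℤ) * levs x u s i) :
    ∃ (g : Matrix (Fin 4) (Fin 4) ℤ) (δ : ℤˣ), g.det = δ ∧ (∀ i, g *ᵥ s i = ε i • t (π i)) ∧
      R.orient t * ((Equiv.Perm.sign π * ∏ i, ε i : ℤˣ) : ℤ) = δ * R.orient s ∧ Compat g (u'⁻¹ * u) x := by
  obtain ⟨g, δ, h1, h2, h3⟩ := R.geom s t hs ht π ε fun i => (h i).1
  refine ⟨g, δ, h1, h2, h3, fun w => ?_⟩
  obtain ⟨σ, hσ⟩ := R.span s hs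
  have : lastCovector ᵥ* g.map (Int.cast : ℤ → ZMod 18) = ((u'⁻¹ * u : (ZMod 18)ˣ) : ZMod 18) • x := by
    refine lev_ext hσ fun i => ?_
    have h4 : lev lastCovector (g *ᵥ s (σ i)) = ((u'⁻¹ * u : (ZMod 18)ˣ) : ZMod 18) * lev x (s (σ i)) := by
      have h5 := (h (σ i)).2
      simp only [levs] at h5
      rw [h2, lev_units, Units.val_mul, mul_assoc]
      have h6 := congrArg (fun y => ((u'⁻¹ : (ZMod 18)ˣ) : ZMod 18) * ((ε (σ i) : ℤ) * y)) h5
      have h7 : (((ε (σ i) : ℤ) : ZMod 18) * (ε (σ i) : ℤ)) = 1 := by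
        rw [← Int.cast_mul, ← Units.val_mul, Int.units_mul_self]; simp
      calc _ = ((u'⁻¹ : (ZMod 18)ˣ) : ZMod 18) * ((ε (σ i) : ℤ) * (u' * lev lastCovector (t (π (σ i))))) := by
            rw [mul_left_comm _ ((ε (σ i) : ℤ) : ZMod 18), Units.inv_mul_cancel_left]
        _ = _ := by rw [h6, ← mul_assoc ((ε (σ i) : ℤ) : ZMod 18), h7, one_mul]
    rw [lev_mulVec] at h4
    rw [Function.comp, h4]
    simp [lev, Finset.mul_sum, mul_assoc]
  rw [lev_mulVec, this]
  simp [lev, Finset.mul_sum, mul_assoc]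

lemma twist_sign_mul (b : Bool) (π : Equiv.Perm (Fin m)) (ε : Fin m → ℤˣ) :
    (if b then 1 else Equiv.Perm.sign π * ∏ i, ε i) * twist b π ε = Equiv.Perm.sign π := by
  cases b <;> simp [twist, mul_assoc, Int.units_mul_self]

lemma Frame.zero_of_match (R : Frame m) {b : Bool} {F : (Fin m → Vec) → ℂ} (hF : Twisted b F) {t : Fin m → Vec}
    (ht : R.Good t) {u u' : (ZMod 18)ˣ} {π : Equiv.Perm (Fin m)} {ε : Fin m → ℤˣ}
    (h : ∀ i, R.circ t (π i) = ε i * R.circ t i ∧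
      levs lastCovector u' t (π i) = (ε i : ℤ) * levs lastCovector u t i)
    (hπ : twist b π ε = -1) : F t = 0 := by
  obtain ⟨g, δ, h1, h2, h3, h4⟩ := R.match_gl ht ht h
  have h5 := hF.gl t g δ h1 h4.dvd
  rw [show act g t = fun i => ε i • t (π i) from funext h2, hF.sym] at h5
  have hδ : δ = Equiv.Perm.sign π * ∏ i, ε i := by
    rw [mul_comm] at h3
    exact (Units.ext (mul_right_cancel₀ (R.orient_ne t ht) h3)).symm
  have h6 := twist_sign_mul b π ε
  rw [hπ, ← hδ] at h6
  have h7 : (if b then 1 else ((δ : ℤ) : ℂ)) = -((Equiv.Perm.sign π : ℤ) : ℂ) := by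
    rw [← h6]; cases b <;> simp
  rw [h7, neg_mul] at h5
  have h8 := self_eq_neg.1 h5
  rcases Int.units_eq_one_or (Equiv.Perm.sign π) with h | h <;> simpa [h] using h8

lemma Frame.zero_of_weight_ne (R : Frame m) (hm : m < 8) {b : Bool} {F : (Fin m → Vec) → ℂ} (hF : Twisted b F)
    {t : Fin m → Vec} (ht : R.Good t) {u u' : (ZMod 18)ˣ}
    (h : key (R.circ t) (levs lastCovector u t) = key (R.circ t) (levs lastCovector u' t))
    (hw : weight b (R.circ t) (levs lastCovector u t) ≠ weight b (R.circ t) (levs lastCovector u' t)) :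
    F t = 0 := by
  obtain ⟨π, ε, hπ⟩ := exists_match hm (R.small t ht) (R.small t ht) h
  refine R.zero_of_match hF ht hπ ?_
  rcases Int.units_eq_one_or (twist b π ε) with h | h
  · have := weight_match b hπ
    rw [h] at this
    simp at this
    exact absurd this.symm hw
  · exact h

lemma Frame.zero_of_weight_zero (R : Frame m) {b : Bool} {F : (Fin m → Vec) → ℂ} (hF : Twisted b F)
    {t : Fin m → Vec} (ht : R.Good t) {u : (ZMod 18)ˣ}
    (hw : weight b (R.circ t) (levs lastCovector u t) = 0) : F t = 0 := by
  cases b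
  · simp only [weight, Bool.false_eq_true, if_false, Finset.prod_eq_zero_iff, mem_univ, true_and] at hw
    obtain ⟨i, hi⟩ := hw
    refine R.zero_of_match hF ht (u := u) (u' := u) (π := 1) (ε := Function.update 1 i (-1)) (fun j => ?_) ?_
    · by_cases hj : j = i
      · subst hj
        have hc : R.circ t j = 0 := by
          by_contra hc
          simp [sgn, hc] at hi
        rw [hc] at hi
        simp only [Equiv.Perm.coe_one, id, Function.update_self, hc, mul_zero, true_and]
        generalize levs lastCovector u t j = y at hi ⊢
        revert y; decide +kernel
      · simp [Function.update_of_ne hj]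
    · simp [twist, Finset.prod_update_of_mem]
  · simp only [weight, if_true] at hw
    obtain ⟨i, j, hij, hne⟩ := (det_vandermonde_eq_zero_iff).1 hw
    rw [Nat.cast_inj] at hij
    obtain ⟨ε, h1, h2⟩ := exists_of_dig_eq (R.small t ht i) (R.small t ht j) hij
    refine R.zero_of_match hF ht (u := u) (u' := u) (π := Equiv.swap i j)
      (ε := fun k => if k = i ∨ k = j then ε else 1) (fun k => ?_) (by simp [twist, Equiv.Perm.sign_swap hne])
    have hε : (ε : ℤ) * ε = 1 := by rw [← Units.val_mul, Int.units_mul_self]; rfl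
    by_cases hki : k = i
    · subst hki
      simp [h1, h2]
    · by_cases hkj : k = j
      · subst hkj
        have hε' : ((ε : ℤ) : ZMod 18) * (ε : ℤ) = 1 := by rw [← Int.cast_mul, hε, Int.cast_one]
        simp [h1, h2, ← mul_assoc, hε, hε']
      · simp [hki, hkj, Equiv.swap_apply_of_ne_of_ne hki hkj]

/-- Vanishing at all tuples with a given key. -/
def Frame.Zero (R : Frame m) (F : (Fin m → Vec) → ℂ) (K : ℕ) : Prop :=
  ∀ t, R.Good t → ∀ u, key (R.circ t) (levs lastCovector u t) = K → F t = 0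

def Vanish (F : (Fin m → Vec) → ℂ) (s : Fin m → Vec) (x : Fin 4 → ZMod 18) : Prop :=
  ∀ (g : Matrix (Fin 4) (Fin 4) ℤ) (δ : ℤˣ) (u : (ZMod 18)ˣ), g.det = δ → Compat g u x → F (act g s) = 0

lemma Frame.zero_of_vanish (R : Frame m) (hm : m < 8) {b : Bool} {F : (Fin m → Vec) → ℂ} (hF : Twisted b F)
    {s : Fin m → Vec} (hs : R.Good s) {x} (h : Vanish F s x) (u) : R.Zero F (key (R.circ s) (levs x u s)) := by
  intro t ht u' hK
  obtain ⟨π, ε, hπ⟩ := exists_match hm (R.small s hs) (R.small t ht) hK.symm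
  obtain ⟨g, δ, h1, h2, -, h4⟩ := R.match_gl hs ht hπ
  have h5 := h g δ _ h1 h4
  rw [show act g s = fun i => ε i • t (π i) from funext h2, hF.sym] at h5
  rcases Int.units_eq_one_or (Equiv.Perm.sign π) with h | h <;> simpa [h] using h5

lemma Frame.symbol_act (R : Frame m) {s : Fin m → Vec} {x} {g : Matrix (Fin 4) (Fin 4) ℤ} {δ : ℤˣ}
    {v : (ZMod 18)ˣ} (h : g.det = δ) (h' : Compat g v x) (u) :
    ∃ u', (∀ i, R.circ (act g s) i = δ * R.circ s i) ∧
      ∀ i, levs lastCovector u' (act g s) i = (δ : ℤ) * levs x u s i := by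
  refine ⟨Units.map (Int.castRingHom (ZMod 18)) δ * u * v⁻¹, fun i => by rw [R.circ_act, h], fun i => ?_⟩
  simp only [levs, act]
  rw [h']
  simp [mul_assoc]

lemma Frame.key_act (R : Frame m) {s : Fin m → Vec} {x} {g : Matrix (Fin 4) (Fin 4) ℤ} {δ : ℤˣ}
    {v : (ZMod 18)ˣ} (h : g.det = δ) (h' : Compat g v x) (u) : ∃ u',
      key (R.circ (act g s)) (levs lastCovector u' (act g s)) = key (R.circ s) (levs x u s) ∧
      ∀ b, weight b (R.circ (act g s)) (levs lastCovector u' (act g s)) =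
        twist b (1 : Equiv.Perm (Fin m)) (fun _ => δ) * weight b (R.circ s) (levs x u s) := by
  obtain ⟨u', h1, h2⟩ := R.symbol_act h h' u
  refine ⟨u', key_match (π := 1) (ε := fun _ => δ) fun i => ⟨h1 i, h2 i⟩, fun b =>
    weight_match b fun i => ⟨h1 i, h2 i⟩⟩

lemma Frame.vanish_of_zero (R : Frame m) {F : (Fin m → Vec) → ℂ} {s : Fin m → Vec} (hs : R.Good s) {x u}
    (h : R.Zero F (key (R.circ s) (levs x u s))) : Vanish F s x := by
  intro g δ v hg hv
  obtain ⟨u', h1, -⟩ := R.key_act (s := s) hg hv u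
  exact h _ (R.good_act s g (hg ▸ δ.isUnit) hs) u' h1

lemma Frame.vanish_of_weight (R : Frame m) (hm : m < 8) {b : Bool} {F : (Fin m → Vec) → ℂ} (hF : Twisted b F)
    {s : Fin m → Vec} (hs : R.Good s) {x u u'}
    (h : key (R.circ s) (levs x u s) = key (R.circ s) (levs x u' s))
    (hw : weight b (R.circ s) (levs x u s) ≠ weight b (R.circ s) (levs x u' s) ∨
      weight b (R.circ s) (levs x u s) = 0) : Vanish F s x := by
  intro g δ v hg hv
  obtain ⟨v₁, h1, h1'⟩ := R.key_act (s := s) hg hv u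
  obtain ⟨v₂, h2, h2'⟩ := R.key_act (s := s) hg hv u'
  have hgood := R.good_act s g (hg ▸ δ.isUnit) hs
  rcases hw with hw | hw
  · refine R.zero_of_weight_ne hm hF hgood (u := v₁) (u' := v₂) (by rw [h1, h2, h]) ?_
    rw [h1', h2']
    exact fun h => hw (mul_left_cancel₀ (Units.ne_zero _) h)
  · exact R.zero_of_weight_zero hF hgood (u := v₁) (by rw [h1', hw, mul_zero])

def Closed (F : (Fin m → Vec) → ℂ) (s : Fin (m + 1) → Vec) (x : Fin 4 → ZMod 18) : Prop :=
  ∀ (g : Matrix (Fin 4) (Fin 4) ℤ) (δ : ℤˣ) (u : (ZMod 18)ˣ), g.det = δ → Compat g u x → bd F (act g s) = 0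

lemma Closed.vanish {F : (Fin m → Vec) → ℂ} {s : Fin (m + 1) → Vec} {x} (h : Closed F s x) (i : Fin (m + 1))
    (hj : ∀ j, j ≠ i → Vanish F (s ∘ j.succAbove) x) : Vanish F (s ∘ i.succAbove) x := by
  intro g δ u hg hu
  have := h g δ u hg hu
  rw [bd, Finset.sum_eq_single i (fun j _ hji => ?_) (by simp)] at this
  · exact (mul_eq_zero.1 this).resolve_left (pow_ne_zero _ (by norm_num))
  · rw [show act g s ∘ j.succAbove = act g (s ∘ j.succAbove) from rfl, hj j hji g δ u hg hu, mul_zero]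

end Voronoi

namespace Voronoi

open Matrix Finset

/-- Binary search trees with natural number keys and values. -/
inductive Table
  | nil
  | node (l : Table) (k d : ℕ) (r : Table)

namespace Table

def Mem (K D : ℕ) : Table → Prop
  | nil => False
  | node l k d r => (K = k ∧ D = d) ∨ l.Mem K D ∨ r.Mem K D

/-- The successor of the value at a key, or zero. -/
noncomputable def find (K : ℕ) (t : Table) : ℕ :=
  Table.rec 0 (fun _ k d _ a b => bif Nat.beq K k then d + 1 else bif Nat.ble K k then a else b) t

noncomputable def all (p : ℕ → ℕ → Bool) (t : Table) : Bool :=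
  Table.rec true (fun _ k d _ a b => p k d && (a && b)) t

lemma mem_of_find {K D : ℕ} {t : Table} (h : t.find K = D + 1) : t.Mem K D := by
  induction t with
  | nil => exact absurd h (by simp [find])
  | node l k d r hl hr =>
    change (bif Nat.beq K k then d + 1 else bif Nat.ble K k then l.find K else r.find K) = D + 1 at h
    cases h1 : Nat.beq K k with
    | true =>
      rw [h1, cond_true] at h
      exact Or.inl ⟨Nat.eq_of_beq_eq_true h1, by omega⟩
    | false =>
      rw [h1, cond_false] at h
      cases h2 : Nat.ble K k with
      | true =>
        rw [h2, cond_true] at h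
        exact Or.inr (Or.inl (hl h))
      | false =>
        rw [h2, cond_false] at h
        exact Or.inr (Or.inr (hr h))

lemma of_all {p : ℕ → ℕ → Bool} {t : Table} (h : t.all p = true) {K D : ℕ} (hm : t.Mem K D) : p K D = true := by
  induction t with
  | nil => exact hm.elim
  | node l k d r hl hr =>
    change (p k d && (l.all p && r.all p)) = true at h
    simp only [Bool.and_eq_true] at h
    rcases hm with ⟨rfl, rfl⟩ | hm | hm
    · exact h.1
    · exact hl h.2.1 hm
    · exact hr h.2.2 hm

end Table

noncomputable def allLt (n : ℕ) (p : ℕ → Bool) : Bool := Nat.rec true (fun k a => p k && a) n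

lemma of_allLt {n : ℕ} {p : ℕ → Bool} (h : allLt n p = true) {k : ℕ} (hk : k < n) : p k = true := by
  induction n with
  | zero => omega
  | succ n ih =>
    change (p n && allLt n p) = true at h
    rw [Bool.and_eq_true] at h
    rcases (Nat.lt_succ_iff_lt_or_eq.1 hk) with h' | rfl
    · exact ih h.2 h'
    · exact h.1

def un : Fin 6 → (ZMod 18)ˣ :=
  ![⟨1, 1, rfl, rfl⟩, ⟨5, 11, rfl, rfl⟩, ⟨7, 13, rfl, rfl⟩, ⟨11, 5, rfl, rfl⟩, ⟨13, 7, rfl, rfl⟩, ⟨17, 17, rfl, rfl⟩]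

def unval : Fin 6 → ℕ := ![1, 5, 7, 11, 13, 17]

lemma un_val : ∀ i, ((un i : (ZMod 18)ˣ) : ZMod 18).val = unval i := by decide

def digN (u r : ℕ) : ℕ :=
  bif Nat.ble 18 r then 18 + bif Nat.ble (u * (r - 18) % 18) 9 then u * (r - 18) % 18 else 18 - u * (r - 18) % 18
  else u * r % 18

def sgnN (u r : ℕ) : ℤ :=
  bif Nat.ble 18 r then
    bif Nat.beq (u * (r - 18) % 9) 0 then 0 else bif Nat.ble (u * (r - 18) % 18) 9 then 1 else -1
  else 1

/-- The number `r` encodes a vector with coefficient `c` and level `l`. -/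
def Code (c : ℤ) (l : ZMod 18) (r : ℕ) : Prop :=
  r < 36 ∧ ∃ κ : ℤ, κ ≠ 0 ∧ ∀ u : ZMod 18, dig c (u * l) = digN u.val r ∧ sgn c (u * l) = κ * sgnN u.val r

def raw (c : ℤ) (l : ZMod 18) : ℕ := if c = 0 then 18 + l.val else ((c : ZMod 18) * l).val

lemma digN_val : ∀ u y : ZMod 18, (u * y).val = digN u.val y.val := by decide +kernel

lemma sgnN_val (u : ℕ) (y : ZMod 18) : sgnN u y.val = 1 := by
  have : Nat.ble 18 y.val = false := by
    rw [← Bool.not_eq_true, Nat.ble_eq]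
    exact not_le.2 (ZMod.val_lt y)
  simp [sgnN, this]

lemma code_of_ne {c : ℤ} (hc : c ≠ 0) (l : ZMod 18) : Code c l ((c : ZMod 18) * l).val := by
  refine ⟨(ZMod.val_lt _).trans (by norm_num), c, hc, fun u => ⟨?_, ?_⟩⟩
  · rw [dig, if_neg hc, mul_left_comm, digN_val]
  · rw [sgn, if_neg hc, sgnN_val, mul_one]

lemma code_raw (c : ℤ) (l : ZMod 18) : Code c l (raw c l) := by
  by_cases hc : c = 0
  · subst hc
    have h : ∀ u l : ZMod 18, dig 0 (u * l) = digN u.val (18 + l.val) ∧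
        sgn 0 (u * l) = 1 * sgnN u.val (18 + l.val) := by decide +kernel
    exact ⟨by rw [raw, if_pos rfl]; have := ZMod.val_lt l; omega, 1, one_ne_zero, fun u => by
      rw [raw, if_pos rfl]; exact h u l⟩
  · rw [raw, if_neg hc]
    exact code_of_ne hc l

lemma code_dig (c : ℤ) (l : ZMod 18) : Code c l (dig c l) := by
  by_cases hc : c = 0
  · subst hc
    have h : ∀ l : ZMod 18, dig 0 l < 36 ∧ ∃ κ : Fin 2, ∀ u, dig 0 (u * l) = digN u.val (dig 0 l) ∧
        sgn 0 (u * l) = (if κ = 0 then 1 else -1) * sgnN u.val (dig 0 l) := by decide +kernel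
    obtain ⟨h1, κ, h2⟩ := h l
    exact ⟨h1, if κ = 0 then 1 else -1, by split_ifs <;> norm_num, h2⟩
  · rw [dig, if_neg hc]
    exact code_of_ne hc l

def packed : ℕ := (List.range 36).foldr (fun r a => 8 ^ digN 1 r + 2 ^ 84 * (8 ^ digN 5 r + 2 ^ 84 * (8 ^ digN 7 r +
    2 ^ 84 * (8 ^ digN 11 r + 2 ^ 84 * (8 ^ digN 13 r + 2 ^ 84 * (8 ^ digN 17 r + 2 ^ 84 * a)))))) 0

/-- The six multiples of a code, packed in fields of 84 bits. -/
def pack (r : ℕ) : ℕ := (packed >>> (504 * r)) % 2 ^ 504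

lemma pack_eq : ∀ r < 36, pack r = 8 ^ digN 1 r + 2 ^ 84 * (8 ^ digN 5 r + 2 ^ 84 * (8 ^ digN 7 r +
    2 ^ 84 * (8 ^ digN 11 r + 2 ^ 84 * (8 ^ digN 13 r + 2 ^ 84 * 8 ^ digN 17 r)))) := by
  decide +kernel

noncomputable def packSum (rs : List ℕ) : ℕ := List.rec 0 (fun r _ a => pack r + a) rs

def field (N i : ℕ) : ℕ := (N >>> (84 * i)) % 2 ^ 84

def keyN (u : ℕ) (rs : List ℕ) : ℕ := (rs.map fun r => 8 ^ digN u r).sum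

lemma packSum_eq {rs : List ℕ} (h : ∀ r ∈ rs, r < 36) :
    packSum rs = keyN 1 rs + 2 ^ 84 * (keyN 5 rs + 2 ^ 84 * (keyN 7 rs +
    2 ^ 84 * (keyN 11 rs + 2 ^ 84 * (keyN 13 rs + 2 ^ 84 * keyN 17 rs)))) := by
  induction rs with
  | nil => rfl
  | cons r rs ih =>
    change pack r + packSum rs = _
    rw [ih fun s hs => h s (List.mem_cons_of_mem r hs), pack_eq r (h r List.mem_cons_self)]
    simp only [keyN, List.map_cons, List.sum_cons]
    ring

lemma keyN_lt {rs : List ℕ} (h : ∀ r ∈ rs, r < 36) (hl : rs.length < 8) (i : Fin 6) :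
    keyN (unval i) rs < 2 ^ 84 := by
  have h1 : ∀ i : Fin 6, ∀ r < 36, digN (unval i) r ≤ 27 := by decide +kernel
  have h2 : ∀ l : List ℕ, (∀ r ∈ l, r < 36) → keyN (unval i) l ≤ l.length * 8 ^ 27 := by
    intro l hl
    induction l with
    | nil => simp [keyN]
    | cons r l ih =>
      have := ih fun s hs => hl s (List.mem_cons_of_mem r hs)
      have h3 := Nat.pow_le_pow_right (show 8 > 0 by norm_num) (h1 i r (hl r List.mem_cons_self))
      simp only [keyN, List.map_cons, List.sum_cons, List.length_cons] at this ⊢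
      linarith
  have := h2 rs h
  omega

lemma field_packSum {rs : List ℕ} (h : ∀ r ∈ rs, r < 36) (hl : rs.length < 8) (i : Fin 6) :
    field (packSum rs) i = keyN (unval i) rs := by
  have h0 := keyN_lt h hl 0
  have h1 := keyN_lt h hl 1
  have h2 := keyN_lt h hl 2
  have h3 := keyN_lt h hl 3
  have h4 := keyN_lt h hl 4
  have h5 := keyN_lt h hl 5
  have e := packSum_eq h
  have key : ∀ a b n : ℕ, a < 2 ^ 84 → field (a + 2 ^ 84 * b) (n + 1) = field b n := by
    intro a b n ha
    rw [field, field, mul_add, mul_one, add_comm (84 * n), Nat.shiftRight_add, Nat.shiftRight_eq_div_pow _ 84,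
      Nat.add_mul_div_left _ _ (by positivity), Nat.div_eq_of_lt ha, zero_add]
  have key0 : ∀ a b : ℕ, a < 2 ^ 84 → field (a + 2 ^ 84 * b) 0 = a := by
    intro a b ha
    rw [field, mul_zero, Nat.shiftRight_zero, Nat.add_mul_mod_self_left, Nat.mod_eq_of_lt ha]
  have key1 : ∀ a, a < 2 ^ 84 → field a 0 = a := fun a ha => by simpa using key0 a 0 ha
  rw [e]
  fin_cases i
  · exact key0 _ _ h0
  · exact (key _ _ 0 h0).trans (key0 _ _ h1)
  · exact (key _ _ 1 h0).trans ((key _ _ 0 h1).trans (key0 _ _ h2))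
  · exact (key _ _ 2 h0).trans ((key _ _ 1 h1).trans ((key _ _ 0 h2).trans (key0 _ _ h3)))
  · exact (key _ _ 3 h0).trans ((key _ _ 2 h1).trans ((key _ _ 1 h2).trans ((key _ _ 0 h3).trans (key0 _ _ h4))))
  · exact (key _ _ 4 h0).trans ((key _ _ 3 h1).trans ((key _ _ 2 h2).trans ((key _ _ 1 h3).trans
      ((key _ _ 0 h4).trans (key1 _ h5)))))

def minN (a b : ℕ) : ℕ := bif Nat.ble a b then a else b

lemma minN_eq_or (a b : ℕ) : minN a b = a ∨ minN a b = b := by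
  rw [minN]; cases Nat.ble a b <;> simp

/-- The least field of a packed key. -/
def least (N : ℕ) : ℕ :=
  minN (field N 0) (minN (field N 1) (minN (field N 2) (minN (field N 3) (minN (field N 4) (field N 5)))))

lemma exists_least (N : ℕ) : ∃ i : Fin 6, least N = field N i := by
  unfold least
  rcases minN_eq_or (field N 0) _ with h | h <;> rw [h]
  · exact ⟨0, rfl⟩
  rcases minN_eq_or (field N 1) _ with h | h <;> rw [h]
  · exact ⟨1, rfl⟩
  rcases minN_eq_or (field N 2) _ with h | h <;> rw [h]
  · exact ⟨2, rfl⟩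
  rcases minN_eq_or (field N 3) _ with h | h <;> rw [h]
  · exact ⟨3, rfl⟩
  rcases minN_eq_or (field N 4) _ with h | h <;> rw [h]
  · exact ⟨4, rfl⟩
  · exact ⟨5, rfl⟩

noncomputable def canon (rs : List ℕ) : ℕ := least (packSum rs)

def vand : List ℕ → ℤ
  | [] => 1
  | a :: l => (l.map fun b : ℕ => (b : ℤ) - (a : ℤ)).prod * vand l

lemma vand_ofFn {m : ℕ} (f : Fin m → ℕ) : (vandermonde fun i => (f i : ℤ)).det = vand (List.ofFn f) := by
  induction m with
  | zero => simp [vand]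
  | succ m ih =>
    rw [List.ofFn_succ, vand, ← ih, List.map_ofFn, List.prod_ofFn, det_vandermonde, det_vandermonde,
      Fin.prod_univ_succ, Fin.prod_Ioi_zero]
    congr 1
    exact Finset.prod_congr rfl fun i _ => Fin.prod_Ioi_succ (fun j => (f j : ℤ) - (f i.succ : ℤ)) i

def weightN (b : Bool) (u : ℕ) (rs : List ℕ) : ℤ :=
  bif b then vand (rs.map (digN u)) else (rs.map (sgnN u)).prod

/-- Whether the weights of a symbol force vanishing. -/
noncomputable def dead (b : Bool) (rs : List ℕ) : Bool :=
  decide (weightN b 1 rs = 0) || [(1, 5), (2, 7), (3, 11), (4, 13), (5, 17)].any fun p =>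
    Nat.beq (field (packSum rs) p.1) (field (packSum rs) 0) && !decide (weightN b p.2 rs = weightN b 1 rs)

section

variable {m : ℕ} {c : Fin m → ℤ} {l : Fin m → ZMod 18} {rs : Fin m → ℕ}

lemma key_eq_keyN (h : ∀ i, Code (c i) (l i) (rs i)) (u : ZMod 18) :
    key c (fun i => u * l i) = keyN u.val (List.ofFn rs) := by
  rw [key, keyN, List.map_ofFn, List.sum_ofFn]
  refine Finset.sum_congr rfl fun i _ => ?_
  obtain ⟨-, κ, -, h'⟩ := h i
  rw [(h' u).1]
  rfl

lemma field_eq_key (hm : m < 8) (h : ∀ i, Code (c i) (l i) (rs i)) (i : Fin 6) :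
    field (packSum (List.ofFn rs)) i = key c (fun j => (un i : ZMod 18) * l j) := by
  rw [key_eq_keyN h, un_val, field_packSum _ (by simpa using hm)]
  intro r hr
  obtain ⟨j, rfl⟩ := (List.mem_ofFn' _ _).1 hr
  exact (h j).1

lemma exists_canon (hm : m < 8) (h : ∀ i, Code (c i) (l i) (rs i)) :
    ∃ u : (ZMod 18)ˣ, canon (List.ofFn rs) = key c (fun j => (u : ZMod 18) * l j) := by
  obtain ⟨i, hi⟩ := exists_least (packSum (List.ofFn rs))
  exact ⟨un i, hi.trans (field_eq_key hm h i)⟩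

lemma exists_weight (b : Bool) (h : ∀ i, Code (c i) (l i) (rs i)) : ∃ κ : ℤ, κ ≠ 0 ∧ ∀ u : ZMod 18,
    weight b c (fun i => u * l i) = κ * weightN b u.val (List.ofFn rs) := by
  choose h0 κ h1 h2 using h
  cases b
  · refine ⟨∏ i, κ i, Finset.prod_ne_zero_iff.2 fun i _ => h1 i, fun u => ?_⟩
    simp only [weight, Bool.false_eq_true, if_false, weightN, cond_false, List.map_ofFn, List.prod_ofFn,
      ← Finset.prod_mul_distrib]
    exact Finset.prod_congr rfl fun i _ => (h2 i u).2
  · refine ⟨1, one_ne_zero, fun u => ?_⟩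
    simp only [weight, if_true, weightN, cond_true, List.map_ofFn, one_mul]
    rw [← vand_ofFn]
    congr 2
    ext i
    rw [(h2 i u).1]
    rfl

lemma of_dead (hm : m < 8) {b : Bool} (h : ∀ i, Code (c i) (l i) (rs i)) (hd : dead b (List.ofFn rs) = true) :
    ∃ u u' : (ZMod 18)ˣ, key c (fun j => (u : ZMod 18) * l j) = key c (fun j => (u' : ZMod 18) * l j) ∧
      (weight b c (fun j => (u : ZMod 18) * l j) ≠ weight b c (fun j => (u' : ZMod 18) * l j) ∨
        weight b c (fun j => (u : ZMod 18) * l j) = 0) := by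
  obtain ⟨κ, hκ, hw⟩ := exists_weight b h
  have h1 : ∀ i : Fin 6, field (packSum (List.ofFn rs)) i = field (packSum (List.ofFn rs)) 0 →
      weightN b (unval i) (List.ofFn rs) ≠ weightN b 1 (List.ofFn rs) → 
      ∃ u u' : (ZMod 18)ˣ, key c (fun j => (u : ZMod 18) * l j) = key c (fun j => (u' : ZMod 18) * l j) ∧
      (weight b c (fun j => (u : ZMod 18) * l j) ≠ weight b c (fun j => (u' : ZMod 18) * l j) ∨
        weight b c (fun j => (u : ZMod 18) * l j) = 0) := by
    intro i hi hi'
    refine ⟨un i, un 0, ?_, Or.inl ?_⟩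
    · rw [← field_eq_key hm h, ← field_eq_key hm h]
      exact hi
    · rw [hw, hw, un_val, un_val]
      exact fun h => hi' (mul_left_cancel₀ hκ h)
  simp only [dead, Bool.or_eq_true, decide_eq_true_eq, List.any_cons, List.any_nil, Bool.and_eq_true,
    Bool.not_eq_true', decide_eq_false_iff_not, Nat.beq_eq, Bool.false_eq_true, or_false] at hd
  rcases hd with hd | hd | hd | hd | hd | hd
  · exact ⟨un 0, un 0, rfl, Or.inr (by rw [hw, un_val]; exact mul_eq_zero_of_right _ hd)⟩
  · exact h1 1 hd.1 hd.2
  · exact h1 2 hd.1 hd.2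
  · exact h1 3 hd.1 hd.2
  · exact h1 4 hd.1 hd.2
  · exact h1 5 hd.1 hd.2

end

/-- The linear function `z + a₀ X₀ + a₁ X₁ + a₂ X₂ + a₃ X₃` of the base 18 digits of a number `X`. -/
structure Entry where
  (z a₀ a₁ a₂ a₃ : ℕ)
  deriving DecidableEq

def Entry.eval (X : ℕ) (e : Entry) : ℕ :=
  e.z + (e.a₀ * (X % 18) + e.a₁ * (X / 18 % 18) + e.a₂ * (X / 324 % 18) + e.a₃ * (X / 5832 % 18)) % 18

def covec (X : ℕ) : Fin 4 → ZMod 18 := ![(X : ℕ), (X / 18 : ℕ), (X / 324 : ℕ), (X / 5832 : ℕ)]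

def residue (a : ℤ) : ℕ := (a % 18).toNat

def enc (c : ℤ) (w : Vec) : Entry :=
  if c = 0 then ⟨18, residue (w 0), residue (w 1), residue (w 2), residue (w 3)⟩
  else ⟨0, residue (c * w 0), residue (c * w 1), residue (c * w 2), residue (c * w 3)⟩

lemma residue_cast (a : ℤ) : ((residue a : ℕ) : ZMod 18) = a := by
  have h : ((a % 18).toNat : ℤ) = a % 18 := Int.toNat_of_nonneg (Int.emod_nonneg _ (by norm_num))
  rw [residue, ← Int.cast_natCast, h]
  exact ZMod.intCast_mod a 18

lemma eval_enc (X : ℕ) (c : ℤ) (w : Vec) : (enc c w).eval X = raw c (lev (covec X) w) := by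
  have h (a : ℕ) : ((a % 18 : ℕ) : ZMod 18) = a := ZMod.natCast_mod a 18
  have hv (a : ℕ) : a % 18 = (a : ZMod 18).val := (ZMod.val_natCast 18 a).symm
  by_cases hc : c = 0 <;> simp only [enc, raw, hc, if_true, if_false, Entry.eval, zero_add]
  · rw [hv]
    congr 2
    push_cast
    simp only [h, residue_cast, lev, covec, Fin.sum_univ_four, Matrix.cons_val]
    ring
  · rw [hv]
    congr 1
    push_cast
    simp only [h, residue_cast, lev, covec, Fin.sum_univ_four, Matrix.cons_val]
    push_cast
    ring

/-- Tuples contained in a hyperplane. -/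
def Flat {m : ℕ} (t : Fin m → Vec) : Prop := ∃ w : Vec, w ≠ 0 ∧ ∀ i, t i ⬝ᵥ w = 0

lemma Flat.act {m : ℕ} {t : Fin m → Vec} (ht : Flat t) {g : Matrix (Fin 4) (Fin 4) ℤ} (hg : IsUnit g.det) :
    Flat (act g t) := by
  obtain ⟨w, hw, h⟩ := ht
  refine ⟨(g⁻¹)ᵀ *ᵥ w, fun h0 => hw ?_, fun i => ?_⟩
  · have := congrArg (gᵀ *ᵥ ·) h0
    simpa [← transpose_mul, nonsing_inv_mul _ hg] using this
  · rw [Voronoi.act, dotProduct_mulVec, vecMul_transpose, mulVec_mulVec, nonsing_inv_mul _ hg, one_mulVec, h]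

variable {m : ℕ}

/-- The codes of the facets of a tuple, as functions of the covector giving the levels. -/
def Coded (R : Frame m) (s : Fin (m + 1) → Vec) (P : ℕ → List Entry) : Prop :=
  ∀ j : Fin (m + 1), (P j = [] ∧ Flat (s ∘ j.succAbove)) ∨ (R.Good (s ∘ j.succAbove) ∧
    P j = List.ofFn fun i => enc (R.circ (s ∘ j.succAbove) i) (s (j.succAbove i)))

def codes (X : ℕ) (l : List Entry) : List ℕ := l.map (Entry.eval X)

lemma codes_ofFn (R : Frame m) (t : Fin m → Vec) (X : ℕ) :
    ∃ rs : Fin m → ℕ, codes X (List.ofFn fun i => enc (R.circ t i) (t i)) = List.ofFn rs ∧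
      ∀ i, Code (R.circ t i) (lev (covec X) (t i)) (rs i) := by
  refine ⟨fun i => raw (R.circ t i) (lev (covec X) (t i)), ?_, fun i => code_raw _ _⟩
  rw [codes, List.map_ofFn]
  congr 1
  ext i
  exact eval_enc _ _ _

/-- The values of the table encode templates, covectors and facets. -/
noncomputable def stepOK (m : ℕ) (b : Bool) (T : Table) (P : ℕ → ℕ → List Entry) (ok : ℕ → ℕ → Bool)
    (K D : ℕ) : Bool :=
  Nat.ble D 2519423 || (ok (D / 6 % 4) (D / 24 % 104976) && (Nat.ble (D % 6) m &&
    allLt (m + 1) fun j =>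
      bif Nat.beq j (D % 6) then Nat.beq (canon (codes (D / 24 % 104976) (P (D / 6 % 4) j))) K
      else (P (D / 6 % 4) j).isEmpty ||
        ((fun f => Nat.ble 1 f && Nat.ble f D) (T.find (canon (codes (D / 24 % 104976) (P (D / 6 % 4) j)))) ||
          dead b (codes (D / 24 % 104976) (P (D / 6 % 4) j)))))

variable {R : Frame m} {b : Bool} {F : (Fin m → Vec) → ℂ}

lemma vanish_of_flat (hflat : ∀ t, Flat t → F t = 0) {s : Fin m → Vec} (hs : Flat s) {x} : Vanish F s x :=
  fun _ δ _ hg _ => hflat _ (hs.act (hg ▸ δ.isUnit))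

lemma zero_of_step (hm : m < 8) (hF : Twisted b F) (hflat : ∀ t, Flat t → F t = 0) {T : Table}
    {P : ℕ → ℕ → List Entry} {ok : ℕ → ℕ → Bool} {S : ℕ → Fin (m + 1) → Vec}
    (hS : ∀ τ X, ok τ X = true → Coded R (S τ) (P τ) ∧ Closed F (S τ) (covec X))
    (hT : T.all (stepOK m b T P ok) = true)
    (hres : ∀ K D, T.Mem K D → D ≤ 2519423 → R.Zero F K) (D K : ℕ) (h : T.Mem K D) : R.Zero F K := by
  induction D using Nat.strong_induction_on generalizing K with
  | _ D ih =>
  have h1 := Table.of_all hT h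
  simp only [stepOK, Bool.or_eq_true, Bool.and_eq_true, Nat.ble_eq] at h1
  rcases h1 with h1 | ⟨hok, hi, h1⟩
  · exact hres K D h h1
  obtain ⟨hP, hcl⟩ := hS _ _ hok
  set X := D / 24 % 104976
  set τ := D / 6 % 4
  have h2 : ∀ j : Fin (m + 1), (j : ℕ) ≠ D % 6 → Vanish F (S τ ∘ j.succAbove) (covec X) := by
    intro j hj
    have h3 := of_allLt h1 j.2
    have hj' : Nat.beq (j : ℕ) (D % 6) = false := by
      rw [← Bool.not_eq_true, Nat.beq_eq]; exact hj
    rw [hj', cond_false] at h3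
    rcases hP j with ⟨-, h4⟩ | ⟨hg, h4⟩
    · exact vanish_of_flat hflat h4
    obtain ⟨rs, h5, h6⟩ := codes_ofFn R (S τ ∘ j.succAbove) X
    simp only [Function.comp] at h5 h4
    rw [h4, h5] at h3
    simp only [Bool.or_eq_true, Bool.and_eq_true, Nat.ble_eq] at h3
    rcases h3 with h3 | ⟨h3, h3'⟩ | h3
    · obtain ⟨σ, -⟩ := R.span _ hg
      rw [List.isEmpty_iff, List.ofFn_eq_nil_iff] at h3
      subst h3
      exact (σ 0).elim0
    · obtain ⟨d, hd⟩ : ∃ d, T.find (canon (List.ofFn rs)) = d + 1 := ⟨_, (Nat.succ_pred_eq_of_pos h3).symm⟩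
      rw [hd] at h3'
      obtain ⟨u, hu⟩ := exists_canon hm h6
      have := ih d h3' _ (Table.mem_of_find hd)
      rw [hu] at this
      exact R.vanish_of_zero hg this
    · obtain ⟨u, u', h7, h8⟩ := of_dead hm h6 h3
      exact R.vanish_of_weight hm hF hg h7 h8
  have hi' : D % 6 < m + 1 := Nat.lt_succ_of_le hi
  set i : Fin (m + 1) := ⟨D % 6, hi'⟩
  have h3 : Vanish F (S τ ∘ i.succAbove) (covec X) :=
    hcl.vanish i fun j hj => h2 j fun h => hj (Fin.ext h)
  have h4 := of_allLt h1 hi'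
  have hii : Nat.beq (D % 6) (D % 6) = true := by rw [Nat.beq_eq]
  rw [hii, cond_true, Nat.beq_eq] at h4
  rcases hP i with ⟨h5, -⟩ | ⟨hg, h5⟩
  · have h6 : P τ (D % 6) = [] := h5
    rw [h6] at h4
    intro t ht u hu
    rw [← h4] at hu
    obtain ⟨σ, -⟩ := R.span _ ht
    have h7 : key (R.circ t) (levs lastCovector u t) ≠ 0 := by
      rw [key]
      exact (Finset.sum_pos (fun _ _ => by positivity) ⟨σ 0, mem_univ _⟩).ne'
    exact absurd hu h7
  · obtain ⟨rs, h6, h7⟩ := codes_ofFn R (S τ ∘ i.succAbove) X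
    simp only [Function.comp] at h6 h5
    have h8 : P τ (D % 6) = _ := h5
    rw [h8, h6] at h4
    obtain ⟨u, hu⟩ := exists_canon hm h7
    rw [hu] at h4
    rw [← h4]
    exact R.zero_of_vanish hm hF hg h3 u

end Voronoi

namespace Voronoi

open Matrix Finset

section

open Table

local notation:max "§" k:max d:max => node nil k d nil

def tableFiveEven : Table :=
  node (node (node (node (node (node (node (node (node § 0x49048 16565504 0x49201 0 nil) 0x208248 33749168 (node §
  0x209041 11205656 0x240241 20366648 nil)) 0x241009 13468472 (node (node § 0x1001248 1 0x1008241 3321224 nil)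
  0x1200049 5118368 § 0x8001241 31501448)) 0x8008209 23981624 (node (node (node § 0x8040049 23631704 0x40001209 2 nil)
  0x40008049 12931928 (node § 0x41248000 15965024 0x48241000 18028688 nil)) 0x49009000 6307232 (node (node §
  0x49040200 2803328 0x49200040 3192080 nil) 0x201241000 2794208 § 0x208209000 3960176))) 0x208240200 2663360 (node
  (node (node (node § 0x209008200 25726928 0x209040040 18789440 nil) 0x209200008 6330128 (node § 0x240049000 16090304
  0x240208200 26205584 nil)) 0x240240040 6470096 (node (node § 0x241001200 10638896 0x241008040 3672032 nil)
  0x241040008 6029888 § 0x241200001 3079736)) 0x248001040 21323552 (node (node (node § 0x248008008 11098544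
  0x248040001 3 nil) 0x1000000249 4 § 0x1001209000 16851488) 0x1001240200 13315160 (node (node § 0x1008049000 6308960
  0x1008208200 15305840 nil) 0x1009001200 8842664 § 0x1040048200 8399408)))) 0x1040201200 28569920 (node (node (node
  (node (node § 0x1040240008 6168992 0x1041008008 3641792 nil) 0x1200201040 2795072 (node § 0x1200208008 6617840
  0x1200240001 3359672 nil)) 0x1201000240 30927800 (node (node § 0x1240000048 13766144 0x1240000201 10110128 nil)
  0x8001208200 2793776 § 0x8001240040 16549088)) 0x8008201200 31509248 (node (node (node § 0x8008240008 18464144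
  0x8040041200 13733312 nil) 0x8040201040 19083200 § 0x8040208008 3501392) 0x8041000240 3095744 (node (node §
  0x8041001008 6191888 0x8041008001 2799800 nil) 0x8048001001 2538464 § 0x8200009200 28245488))) 0x8200200240 34207088
  (node (node (node (node § 0x8200208001 3219704 0x8240000041 5 nil) 0x9000200208 31059968 (node § 0x9000201001
  3958424 0x40001048200 15460016 nil)) 0x40001208040 15304952 (node (node § 0x40009000240 36541208 0x40040009200
  3982640 nil) 0x40041000208 11199200 § 0x48000009001 3639608)) 0x200000248200 3383888 (node (node (node §
  0x200001041200 3383912 0x200001201040 28197560 nil) 0x200001208008 33748736 § 0x200008009200 6307664) 0x200040200208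
  30655184 (node (node § 0x200041000201 2940200 0x200200200201 2939768 nil) 0x208000200009 33748280 § 0x40000000049200
  20645714))))) 0x40000000209040 11516690 (node (node (node (node (node (node § 0x40000000240240 21905426
  0x40000000241008 6 nil) 0x40000000248001 2558746 (node § 0x40000001008240 28118450 0x40000001200048 7 nil))
  0x40000001200201 2621386 (node (node § 0x40000008001240 31540322 0x40000008008208 23981618 nil) 0x40000008009001
  2574730 § 0x40000008040048 22465319)) 0x40000040001208 29759186 (node (node (node § 0x40000040008048 11096786
  0x40000040008201 2682722 nil) 0x40000040200009 2574298 § 0x40000241200000 3079730) 0x40000248040000 2560954 (node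
  (node § 0x40001000000248 2654266 0x40001200240000 3359666 nil) 0x40001240000200 8095250 § 0x40008041008000
  2799794))) 0x40008048001000 8 (node (node (node (node § 0x40008200208000 3219698 0x40008240000040 8204114 nil)
  0x40009000201000 5840210 (node § 0x40048000009000 3639602 0x40200041000200 2940194 nil)) 0x40200200200200 2939762
  (node (node § 0x40208000200008 28196210 0x200000000049200 34495658 nil) 0x200000000209040 14192090 §
  0x200000000240240 31983578)) 0x200000000241008 11819978 (node (node (node § 0x200000000248001 11773316
  0x200000001008240 31672538 nil) 0x200000001009008 14036138 § 0x200000001040208 17858914) 0x200000001041001 4261274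
  (node (node § 0x200000001200048 6479169 0x200000001200201 31376601 nil) 0x200000008001240 25677705 §
  0x200000008008208 14223646)))) 0x200000008009001 7760889 (node (node (node (node (node § 0x200000008040048 2795530
  0x200000008040201 9 nil) 0x200000008200041 24424869 (node § 0x200000009000009 10 0x200000040001208 30288873 nil))
  0x200000040008048 4119586 (node (node § 0x200000040008201 30715226 0x200000040040041 11695977 nil) 0x200000040200009
  5140377 § 0x200000200001048 2715595)) 0x200000200001201 26205146 (node (node (node § 0x200000200008041 11
  0x200000200040009 12 nil) 0x200000241200000 3642218 § 0x200000248040000 10709313) 0x200001000000248 13 (node (node §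
  0x200001000001041 10793541 0x200001000008009 5124825 nil) 0x200001041040000 3641786 § 0x200001048008000 16224658)))
  0x200001200240000 3501818 (node (node (node (node § 0x200001201008000 14 0x200001208001000 15 nil) 0x200001240000200
  33702506 (node § 0x200008000000241 26197786 0x200008000001009 16 nil)) 0x200008041008000 3641354 (node (node §
  0x200008048001000 10280769 0x200008200208000 3501386 nil) 0x200008201001000 13710842 § 0x200008208000200 31338602))
  0x200008240000040 13398938 (node (node (node § 0x200009000048000 3361418 0x200009000201000 15903674 nil)
  0x200009001000200 28392801 § 0x200009008000040 6067051) 0x200009040000008 8344106 (node (node § 0x200040000000209 17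
  0x200040041001000 3640922 nil) 0x200040048000200 30485865 § 0x200040200201000 3500954)))))) 0x200040201000200 18
  (node (node (node (node (node (node (node § 0x200040208000040 20801690 0x200040240000008 10723562 nil)
  0x200041000041000 3360986 (node § 0x200041000200200 28686986 0x200041001000040 19 nil)) 0x200041008000008 20 (node
  (node § 0x200048000009000 3221018 0x200048000040200 33585866 nil) 0x200048000200040 13422266 § 0x200048001000008
  7648161)) 0x200200000000049 5047497 (node (node (node § 0x200200041000200 3640490 0x200200048000040 21 nil)
  0x200200200200200 3500522 (node § 0x200200201000040 33251066 0x200200208000008 10575818 nil)) 0x200201000040200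
  3360554 (node (node § 0x200201000200040 28243322 0x200201001000008 17855026 nil) 0x200208000008200 3220586 §
  0x200208000040040 26199106))) 0x200208000200008 33577226 (node (node (node (node § 0x200240000001200 3080618
  0x200240000008040 31462146 nil) 0x200240000040008 12637353 (node § 0x201000041000040 3640058 0x201000048000008
  6291242 nil)) 0x201000200200040 3500090 (node (node § 0x201000201000008 10428074 0x201001000040040 3360122 nil)
  0x201001000200008 8530730 § 0x201008000008040 3220154)) 0x201008000040008 12986378 (node (node (node §
  0x201040000001040 3080186 0x201040000008008 10770218 nil) 0x201200000000240 2940218 § 0x201200000001008 29860748)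
  0x208000041000008 3639626 (node (node § 0x208000200200008 3499658 0x208001000040008 3359690 nil) 0x208008000008008
  3219722 § 0x208040000001008 3079754)))) 0x208200000000208 2939786 (node (node (node (node (node § 0x209000000000048
  2799818 0x240000000248000 11656661 nil) 0x240000001041000 22 (node § 0x240000001200200 24129365 0x240000008009000
  8857301 nil)) 0x240000008040200 3825821 (node (node § 0x240000008200040 23989397 0x240000009000008 3786941 nil)
  0x240000040008200 21314459 § 0x240000040040040 10420277)) 0x240000040200008 6166369 (node (node (node §
  0x240000200001200 23 0x240000200008040 7892669 nil) 0x240000200040008 3507005 § 0x240001000001040 10404725)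
  0x240001000008008 5886433 (node (node § 0x240008000000240 8281877 0x240008000001008 3227069 nil) 0x240040000000208
  3087101 § 0x240200000000048 5466529))) 0x1000000000049200 34200177 (node (node (node (node § 0x1000000000209040
  9448754 0x1000000000240240 16719314 nil) 0x1000000000241008 16695554 (node § 0x1000000000248001 6772946
  0x1000000001008240 29153138 nil)) 0x1000000001009008 16563362 (node (node § 0x1000000001040208 18013570
  0x1000000001200048 3981794 nil) 0x1000000001200201 8227449 § 0x1000000008001240 24)) 0x1000000008008208 29020514
  (node (node (node § 0x1000000008009001 26936505 0x1000000008040048 25 nil) 0x1000000008040201 26 §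
  0x1000000008200041 5101497) 0x1000000009000009 6633801 (node (node § 0x1000000040001208 31392194 0x1000000040008048
  27 nil) 0x1000000040008201 8134138 § 0x1000000040200009 8709562))))) 0x1000000200001048 2926834 (node (node (node
  (node (node (node § 0x1000000200001201 28530585 0x1000000200008041 5070393 nil) 0x1000000200040009 28 (node §
  0x1000000241200000 3642242 0x1000000248040000 16417785 nil)) 0x1000001000000248 2794233 (node (node §
  0x1000001000008009 14043897 0x1000001048008000 18594626 nil) 0x1000001200240000 3501842 § 0x1000001201008000 29))
  0x1000001208001000 13539794 (node (node (node § 0x1000001240000200 30413289 0x1000008000000241 5148153 nil)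
  0x1000008000001009 4113945 § 0x1000008041008000 3641378) 0x1000008048001000 20958098 (node (node §
  0x1000008200208000 3501410 0x1000008201001000 18430898 nil) 0x1000008208000200 33858050 § 0x1000008240000040
  8360114))) 0x1000009000048000 3361442 (node (node (node (node § 0x1000009000201000 10304097 0x1000009001000200
  26012066 nil) 0x1000009008000040 3889774 (node § 0x1000009040000008 15902402 0x1000040000000209 30 nil))
  0x1000040048000200 33759129 (node (node § 0x1000040200201000 3500978 0x1000040201000200 23344898 nil)
  0x1000040208000040 6143954 § 0x1000040240000008 18289634)) 0x1000041000200200 13770034 (node (node (node §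
  0x1000041008000008 17964322 0x1000048000009000 3221042 nil) 0x1000048000040200 32410818 § 0x1000048000200040
  3344594) 0x1000048001000008 19395105 (node (node § 0x1000200000000049 5054841 0x1000200041000200 3640514 nil)
  0x1000200048000040 3982665 § 0x1000200200200200 3500546)))) 0x1000200201000040 30301377 (node (node (node (node
  (node § 0x1000200208000008 30746786 0x1000201000040200 3360578 nil) 0x1000201000200040 18002794 (node §
  0x1000201001000008 21323121 0x1000208000008200 3220610 nil)) 0x1000208000040040 31 (node (node § 0x1000208000200008
  30762338 0x1000240000001200 3080642 nil) 0x1000240000008040 30926066 § 0x1000240000040008 26354218))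
  0x1001000048000008 32 (node (node (node § 0x1001000200200040 3500114 0x1001000201000008 11190146 nil)
  0x1001001000200008 8530754 § 0x1001008000008040 3220178) 0x1001008000040008 15451394 (node (node §
  0x1001040000008008 10770242 0x1001200000000240 2940242 nil) 0x1001200000001008 28118498 § 0x1008000041000008
  3639650))) 0x1008000200200008 3499682 (node (node (node (node § 0x1008001000040008 3359714 0x1008008000008008
  3219746 nil) 0x1008040000001008 3079778 (node § 0x1008200000000208 2939810 0x1009000000000048 2799842 nil))
  0x1040000000248000 33 (node (node § 0x1040000001200200 31656529 0x1040000008009000 25544593 nil) 0x1040000008040200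
  3802517 § 0x1040000008200040 6314113)) 0x1040000009000008 6291217 (node (node (node § 0x1040000040008200 26337365
  0x1040000040200008 9020595 nil) 0x1040000200001200 28717201 § 0x1040000200008040 6034177) 0x1040000200040008 2713877
  (node (node § 0x1040001000008008 9152787 0x1040008000000240 5754241 nil) 0x1040008000001008 5769845 §
  0x1040040000000208 28297297))))))) 0x1040200000000048 5474305 (node (node (node (node (node (node (node (node §
  0x1200000000248000 13391171 0x1200000001041000 3157949 nil) 0x1200000001200200 30739421 (node § 0x1200000008009000
  18445565 0x1200000008040200 20669501 nil)) 0x1200000008200040 18950597 (node (node § 0x1200000009000008 3771845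
  0x1200000040008200 26337797 nil) 0x1200000040040040 10420325 § 0x1200000040200008 7924204)) 0x1200000200001200
  25674655 (node (node (node § 0x1200000200008040 11073049 0x1200000200040008 6026449 nil) 0x1200001000001040 13452505
  (node § 0x1200001000008008 12924172 0x1200008000000240 25917893 nil)) 0x1200008000001008 8265937 (node (node §
  0x1200040000000208 28585035 0x1200200000000048 2932009 nil) 0x8000000000049200 18126362 § 0x8000000000209040
  30708322))) 0x8000000000240240 19386074 (node (node (node (node § 0x8000000000241008 27244545 0x8000000000248001
  12783818 nil) 0x8000000001008240 25599098 (node § 0x8000000001041001 29611881 0x8000000001200048 29763105 nil))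
  0x8000000001200201 5062617 (node (node § 0x8000000008001240 16423850 0x8000000008008208 16423418 nil)
  0x8000000008009001 3786986 § 0x8000000008040048 19393850)) 0x8000000040001208 32278682 (node (node (node §
  0x8000000040008048 34 0x8000000040008201 2682794 nil) 0x8000000040200009 28188442 § 0x8000000241200000 3079802)
  0x8000000248040000 12918585 (node (node § 0x8000001000000248 5158113 0x8000001041040000 3360170 nil)
  0x8000001200240000 3359738 § 0x8000001240000200 12622209)))) 0x8000008041008000 2799866 (node (node (node (node
  (node § 0x8000008048001000 5521867 0x8000008200208000 3219770 nil) 0x8000008240000040 28189762 (node §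
  0x8000009000201000 31034522 0x8000040041001000 3080234 nil)) 0x8000041001000040 34651641 (node (node §
  0x8000048000009000 3639674 0x8000200041000200 2940266 nil) 0x8000200200200200 2939834 § 0x8000208000200008
  33235130)) 0x8040000000248000 10552468 (node (node (node § 0x8040000001041000 28398385 0x8040000001200200 5622049
  nil) 0x8040000008009000 35 § 0x8040000040008200 36) 0x8040000040200008 25925617 (node (node § 0x8200000000248000
  31019789 0x8200000001041000 31975421 nil) 0x8200000001200200 34175545 § 0x8200000008009000 34043785)))
  0x8200000008040200 3477197 (node (node (node (node § 0x8200000008200040 29759643 0x8200000009000008 37 nil)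
  0x8200000040008200 31392601 (node § 0x8200000040040040 38 0x8200000040200008 31360681 nil)) 0x8200000200001200
  28716793 (node (node § 0x8200000200008040 28733209 0x8200000200040008 16104169 nil) 0x8200001000001040 25879037 §
  0x8200001000008008 15964201)) 0x8200008000000240 28436857 (node (node (node § 0x8200008000001008 30940777
  0x8200040000000208 5622073 nil) 0x8200200000000048 5466601 § 0x9000000000248000 34331953) 0x9000000001041000
  33702533 (node (node § 0x9000000001200200 30552409 0x9000000008009000 34043809 nil) 0x9000000008040200 39 §
  0x9000000008200040 6314185))))) 0x9000000009000008 7916476 (node (node (node (node (node (node § 0x9000000040008200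
  23819243 0x9000000040040040 40 nil) 0x9000000040200008 31252249 (node § 0x9000000200001200 20833253
  0x9000000200008040 31228489 nil)) 0x9000000200040008 28188484 (node (node § 0x9000001000001040 3982252
  0x9000001000008008 26027185 nil) 0x9000008000000240 8281489 § 0x9000008000001008 28422150)) 0x9000040000000208
  25777945 (node (node (node § 0x9000200000000048 5474377 0x40200000000248000 14176105 nil) 0x40200000001041000
  3469853 § 0x40200000001200200 30964516) 0x40200000008009000 3834481 (node (node § 0x40200000008040200 13554481
  0x40200000008200040 18741917 nil) 0x40200000009000008 18266284 § 0x40200000040008200 41))) 0x40200000040040040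
  14339835 (node (node (node (node § 0x40200000040200008 7737169 0x40200000200001200 23344876 nil) 0x40200000200008040
  11096809 (node § 0x40200000200040008 14191659 0x40200001000001040 13468057 nil)) 0x40200001000008008 9136849 (node
  (node § 0x40200008000000240 33071785 0x40200008000001008 5769817 nil) 0x40200040000000208 5209945 §
  0x40200200000000048 28398412)) 0x41000000000248000 11252356 (node (node (node § 0x41000000001200200 33903844
  0x41000000008009000 15622899 nil) 0x41000000008040200 6346129 § 0x41000000008200040 2877603) 0x41000000009000008
  18495255 (node (node § 0x41000000040008200 42 0x41000000040200008 19075012 nil) 0x41000000200001200 21168059 §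
  0x41000000200008040 43)))) 0x41000000200040008 13711299 (node (node (node (node (node § 0x41000001000008008 11020801
  0x41000008000000240 30552385 nil) 0x41000008000001008 44 (node § 0x41000040000000208 26353780 0x41000200000000048
  25358887 nil)) 0x200200000000248000 3462509 (node (node § 0x200200000001041000 10420297 0x200200000001200200 45 nil)
  0x200200000008009000 8880649 § 0x200200000008040200 16402643)) 0x200200000008200040 18742349 (node (node (node §
  0x200200000009000008 17014348 0x200200000040008200 31236652 nil) 0x200200000040040040 16283401 §
  0x200200000040200008 6153005) 0x200200000200001200 33227737 (node (node § 0x200200000200008040 7894835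
  0x200200000200040008 6065737 nil) 0x200200001000001040 46 § 0x200200001000008008 5233273))) 0x200200008000000240
  25871211 (node (node (node (node § 0x200200008000001008 5217721 0x200200040000000208 30404598 nil)
  0x200200200000000048 26789644 (node § 0x240000000000248000 47 0x240000000001041000 12939289 nil))
  0x240000000001200200 28725028 (node (node § 0x240000000008009000 6360793 0x240000000008040200 19386481 nil)
  0x240000000008200040 11400097 § 0x240000000009000008 5669617)) 0x240000000040008200 21120075 (node (node (node §
  0x240000000040040040 16283836 0x240000000040200008 11983273 nil) 0x240000000200001200 28717252 §
  0x240000000200008040 10746891) 0x240000000200040008 48 (node (node § 0x240000001000001040 49 0x240000001000008008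
  3694060 nil) 0x240000008000000240 33903820 § 0x240000008000001008 7760473)))))) 0x240000040000000208 31687638 (node
  (node (node (node (node (node (node § 0x240000200000000048 20973649 0x1000000000000049200 18126434 nil)
  0x1000000000000209040 3958562 (node § 0x1000000000000240240 19067330 0x1000000000000241008 14510926 nil))
  0x1000000000000248001 5085945 (node (node § 0x1000000000001008240 18040898 0x1000000000001200048 14059586 nil)
  0x1000000000001200201 13312658 § 0x1000000000008001240 13883673)) 0x1000000000008008208 13904066 (node (node (node §
  0x1000000000008009001 21423026 0x1000000000008040048 8866410 nil) 0x1000000000040001208 50 § 0x1000000000040008048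
  16135778) 0x1000000000040008201 5575833 (node (node § 0x1000000000040200009 7753113 0x1000000000241200000 3079874
  nil) 0x1000000000248040000 5087265 § 0x1000000001000000248 5092017))) 0x1000000001200240000 3359810 (node (node
  (node (node § 0x1000000001240000200 12691761 0x1000000008041008000 2799938 nil) 0x1000000008048001000 12940161 (node
  § 0x1000000008200208000 3219842 0x1000000008240000040 13337612 nil)) 0x1000000009000201000 8359778 (node (node §
  0x1000000048000009000 3639746 0x1000000200041000200 2940338 nil) 0x1000000200200200200 2939906 §
  0x1000000208000200008 20638082)) 0x1000040000000248000 5225473 (node (node (node § 0x1000040000001200200 51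
  0x1000040000008009000 18267127 nil) 0x1000040000040008200 5902420 § 0x1000040000040200008 8437396)
  0x1000200000000248000 9292777 (node (node § 0x1000200000001041000 6485209 0x1000200000001200200 18927363 nil)
  0x1000200000008009000 52 § 0x1000200000008040200 53)))) 0x1000200000008200040 13703933 (node (node (node (node (node
  § 0x1000200000009000008 54 0x1000200000040008200 19533893 nil) 0x1000200000040040040 11524609 (node §
  0x1000200000040200008 55 0x1000200000200001200 17162070 nil)) 0x1000200000200008040 13594639 (node (node §
  0x1000200000200040008 6065305 0x1000200001000001040 12923737 nil) 0x1000200001000008008 7744921 §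
  0x1000200008000000240 15435798)) 0x1000200008000001008 10956844 (node (node (node § 0x1000200040000000208 13151843
  0x1000200200000000048 8421868 nil) 0x1001000000000248000 9144625 § 0x1001000000001200200 13748548)
  0x1001000000008009000 5848465 (node (node § 0x1001000000008040200 3477217 0x1001000000008200040 8813694 nil)
  0x1001000000009000008 14354980 § 0x1001000000040008200 15599569))) 0x1001000000040200008 56 (node (node (node (node
  § 0x1001000000200001200 19682069 0x1001000000200008040 11812660 nil) 0x1001000000200040008 6065329 (node §
  0x1001000001000008008 15303217 0x1001000008000000240 10615155 nil)) 0x1001000008000001008 12827838 (node (node §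
  0x1001000040000000208 15987940 0x1001000200000000048 8421892 nil) 0x1008000000000248000 57 § 0x1008000000001041000
  16423923)) 0x1008000000001200200 13181622 (node (node (node § 0x1008000000008009000 16416145 0x1008000000040008200
  8421916 nil) 0x1008000000040200008 19681635 § 0x200000000000000049200 15607082) 0x200000000000000209040 58 (node
  (node § 0x200000000000000240240 16571306 0x200000000000000241008 13476716 nil) 0x200000000000000248001 21454426 §
  0x200000000000001008240 22994282))))) 0x200000000000001041001 24028291 (node (node (node (node (node (node §
  0x200000000000001200048 11540234 0x200000000000001200201 8126138 nil) 0x200000000000008001240 12123866 (node §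
  0x200000000000008008208 11369162 0x200000000000008009001 5109273 nil)) 0x200000000000008040048 13880810 (node (node
  § 0x200000000000040001208 16268042 0x200000000000040008048 18803018 nil) 0x200000000000040008201 59 §
  0x200000000000040200009 3514970)) 0x200000000000241200000 3079946 (node (node (node § 0x200000000000248040000
  5110593 0x200000000001000000248 18890553 nil) 0x200000000001041040000 3360314 § 0x200000000001200240000 3359882)
  0x200000000001240000200 13134314 (node (node § 0x200000000008041008000 2800010 0x200000000008048001000 5109729 nil)
  0x200000000008200208000 3219914 § 0x200000000008240000040 17963210))) 0x200000000009000201000 17978762 (node (node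
  (node (node § 0x200000000040041001000 3080378 0x200000000041001000040 60 nil) 0x200000000048000009000 3639818 (node
  § 0x200000000200041000200 2940410 0x200000000200200200200 2939978 nil)) 0x200000000208000200008 20638154 (node (node
  § 0x200000040000000248000 20816787 0x200000040000001041000 24432625 nil) 0x200000040000001200200 5995731 §
  0x200000040000008009000 5248801)) 0x200000040000040008200 23958292 (node (node (node § 0x200000040000040200008 61
  0x200000200000000248000 19215149 nil) 0x200000200000001041000 15754829 § 0x200000200000001200200 62)
  0x200000200000008009000 8880841 (node (node § 0x200000200000008040200 5528761 0x200000200000008200040 10428269 nil)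
  0x200000200000009000008 5248825 § 0x200000200000040008200 14495117)))) 0x200000200000040040040 6796681 (node (node
  (node (node (node § 0x200000200000040200008 6166585 0x200000200000200001200 18594171 nil) 0x200000200000200008040 63
  (node § 0x200000200000200040008 13851675 0x200000200001000001040 15801485 nil)) 0x200000200001000008008 10739115
  (node (node § 0x200000200008000000240 22356653 0x200000200008000001008 5746681 nil) 0x200000200040000000208 64 §
  0x200000200200000000048 20423699)) 0x200001000000000248000 10863985 (node (node (node § 0x200001000000001041000
  5677565 0x200001000000001200200 13896795 nil) 0x200001000000008009000 65 § 0x200001000000008040200 5528785)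
  0x200001000000008200040 7908241 (node (node § 0x200001000000009000008 7768273 0x200001000000040008200 66 nil)
  0x200001000000040040040 3982395 § 0x200001000000040200008 8997484))) 0x200001000000200001200 9604273 (node (node
  (node (node § 0x200001000000200008040 67 0x200001000000200040008 16431339 nil) 0x200001000001000001040 68 (node §
  0x200001000001000008008 16711275 0x200001000008000000240 9770574 nil)) 0x200001000008000001008 19378443 (node (node
  § 0x200001000040000000208 21026955 0x200001000200000000048 20571467 nil) 0x200008000000000248000 13904139 §
  0x200008000000001041000 13904571)) 0x200008000000001200200 10661113 (node (node (node § 0x200008000000008009000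
  5248873 0x200008000000040008200 21438940 nil) 0x200008000000040200008 8289865 § 0x201000000000000248000 10739235)
  0x201000000000001041000 8196481 (node (node § 0x201000000000001200200 8515299 0x201000000000008009000 13258729 nil)
  0x201000000000040008200 11361316 § 0x201000000000040200008 3841924)))))))

def tableFiveOdd : Table :=
  node (node (node (node (node (node (node (node (node § 0x3400 23148344 0x9600 13065008 § 0xa240 24122480) 0xb008
  14492768 (node § 0x10440 23147456 0x11080 21631136 § 0x11208 15618560)) 0x12001 7768664 (node (node § 0x18048
  28746176 0x18201 27744368 § 0x41440 35778728) 0x42208 21911072 (node § 0x48280 20651360 0x48408 23144000 § 0x49048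
  24585152))) 0x49201 0 (node (node (node § 0x50010 21184448 0x50041 15358040 § 0x80248 24429632) 0x81010 22221248
  (node § 0x88009 5228072 0x200640 14794304 § 0x201280 16717160)) 0x201408 30647408 (node (node § 0x202048 38608736
  0x202201 32581880 § 0x208248 1) 0x208401 20216336 (node § 0x209010 25972736 0x209041 18802808 nil)))) 0x210009 2
  (node (node (node (node § 0x240088 21588368 0x240210 21907184 § 0x240241 7769528) 0x241009 3 (node § 0x248002
  3367016 0x400050 9030128 § 0x400209 7729784)) 0x401002 2807144 (node (node § 0x1000480 35841368 0x1001248 4 §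
  0x1001401 35840456) 0x1008088 38795360 (node § 0x1008210 16561616 0x1008241 33320600 nil))) 0x1040050 12438176 (node
  (node (node § 0x1200018 8190320 0x1200049 17986328 § 0x1200202 3087080) 0x1800000 33343088 (node § 0x2440000
  25821536 0x3208000 40708256 § 0x80002c0 18956648)) 0x8000448 11406152 (node (node § 0x8001088 37624208 0x8001210
  19700528 § 0x8001241 5366744) 0x8002009 7634336 (node § 0x8008050 23976464 0x8008209 2707352 nil))))) 0x8009002
  3786920 (node (node (node (node (node § 0x8040018 7546640 0x8040049 5 § 0x8200011 5111024) 0x9280000 16844576 (node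
  § 0x9408000 4402112 0xa048000 7781240 § 0xa201000 30856064)) 0x10248000 3370928 (node (node § 0x10401000 2811056
  0x11041000 3378728 § 0x11200200 3090992) 0x12000040 3098792 (node § 0x18009000 3790832 0x40000288 37623776 nil)))
  0x40000410 14793440 (node (node (node § 0x40001050 27250592 0x40001209 23196248 § 0x40008018 6) 0x40008049 25529048
  (node § 0x40008202 2947112 0x40040011 7 § 0x4020000a 3227048)) 0x41248000 38796224 (node (node § 0x41401000 30793856
  0x42010000 5195288 § 0x42200200 3088832) 0x48088000 23633888 (node § 0x48241000 16859264 0x49009000 8 nil))))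
  0x49040200 6322808 (node (node (node (node § 0x49200040 8189048 0x4a000008 6309824 § 0x50008200 2951024) 0x50200008
  3230960 (node § 0x51000001 2803256 0x80050000 30064640 § 0x81008200 38072624)) 0x81200008 13159184 (node (node §
  0x88001200 8827112 0x88040008 16371968 § 0xc0008008 41457344) 0x200000250 31377488 (node § 0x200000281 9 0x200200003
  2659400 nil))) 0x2002c0000 2664728 (node (node (node § 0x200448000 11065712 0x200601000 32923184 § 0x201088000
  28647680) 0x201210000 25894976 (node § 0x201241000 25521296 0x201400200 3087536 § 0x202200040 20371424)) 0x208050000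
  10 (node (node § 0x208209000 3834032 0x208240200 2663360 § 0x208400040 3787376) 0x209008200 30716096 (node §
  0x209040040 16232456 0x209200008 3818480 nil)))))) 0x210200001 2663288 (node (node (node (node (node (node §
  0x240018000 20885936 0x240049000 29325056 § 0x240080200 23609264) 0x240202000 32894264 (node § 0x240208200 31236656
  0x240240040 20367104 § 0x240400008 30390368)) 0x241001200 33313712 (node (node § 0x241008040 11 0x241040008 10927040
  § 0x241200001 3220136) 0x248000400 12 (node § 0x248001040 23990720 0x248008008 26193056 § 0x248040001 5624648)))
  0x280000240 25817648 (node (node (node § 0x280001008 13 0x280008001 33002216 § 0x400048200 20647472) 0x400080040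
  8494880 (node § 0x400201200 33180656 0x400208040 6166832 § 0x400240008 30390800)) 0x400400001 2659832 (node (node §
  0x408000240 14 0x440000080 25780928 § 0x440000208 29627888) 0x440001001 25599032 (node § 0x1000000218 24885824
  0x1000000249 22727984 nil)))) 0x1000288000 5228216 (node (node (node (node § 0x1000441000 15406880 0x1001209000
  29145344 § 0x1001240200 20725664) 0x1001400040 21035840 (node § 0x1002008200 33064880 0x1002200008 15748160 §
  0x1008049000 2732120)) 0x1008208200 23983808 (node (node § 0x1009001200 11362088 0x1040048200 23515952 §
  0x1040201200 34798496) 0x1040240008 13307360 (node § 0x1041000400 17918576 0x1041008008 21913664 nil))) 0x1080000208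
  18882752 (node (node (node § 0x1200010200 28445936 0x1200200400 13460720 § 0x1200201040 10292864) 0x1200208008
  23657216 (node § 0x1200240001 2661992 0x1201000240 26937392 § 0x1240000048 26223320)) 0x1240000201 22769456 (node
  (node § 0x2000009200 17848592 0x2000200240 16083392 § 0x8000281000 25399064) 0x8000409000 8997296 (node §
  0x8001202000 33429920 0x8001208200 28695200 nil))))) 0x8001240040 26774528 (node (node (node (node (node §
  0x8001400008 26813408 0x8008201200 11238512 § 0x8008240008 23952272) 0x804000a000 17846816 (node § 0x8040041200
  13243880 0x8040201040 23305568 § 0x8040208008 25529072)) 0x8041000240 35840480 (node (node § 0x8041001008 15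
  0x8041008001 7838648 § 0x8048001001 12668000) 0x8200009200 18795056 (node § 0x8200200240 3974000 0x8200208001
  11057912 nil))) 0x8240000010 29285312 (node (node (node § 0x8240000041 25296224 0x9000200208 34356560 § 0x9000201001
  16555544) 0x40001011000 15407744 (node § 0x40001048200 13247768 0x40001208040 24565280 § 0x40002008008 17986784))
  0x40009000240 36541208 (node (node § 0x40040009200 21323120 0x40041000208 23796320 § 0x40200008400 23142272)
  0x48000009001 9028376 (node § 0x200000248200 28562576 0x200000401200 28134464 nil)))) 0x200001041200 36431912 (node
  (node (node (node § 0x200001200400 3104000 0x200001201040 33080432 § 0x200001208008 31820720) 0x200002000240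
  35840936 (node § 0x200008009200 11346512 0x200040008400 15589616 § 0x200040200208 25903184)) 0x200041000201 15537320
  (node (node § 0x200200200201 16 0x208000200009 33748280 § 0x440001000040 38267048) 0x200000000012000 14488442 (node
  § 0x200000000018200 11508081 0x200000000043000 19426223 nil))) 0x200000000049200 22046282 (node (node (node §
  0x200000000050040 26975855 0x200000000080400 24402410 § 0x200000000081040 26936954) 0x200000000088008 17693025 (node
  § 0x2000000000c0001 17 0x200000000202200 35980906 § 0x200000000208400 31820714)) 0x200000000209040 24565274 (node
  (node § 0x200000000210008 22716753 0x200000000240240 19553218 § 0x200000000241008 25234017) 0x200000000248001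
  19222713 (node § 0x200000000400080 19246490 0x200000000400208 12642513 nil))))))) 0x200000000401001 18 (node (node
  (node (node (node (node (node § 0x200000001001400 20965450 0x200000001002040 31680314 § 0x200000001008240 28703002)
  0x200000001009008 22045418 (node § 0x200000001010001 8662906 0x200000001040080 19 § 0x200000001040208 20))
  0x200000001041001 21 (node (node § 0x200000001200048 19246058 0x200000001200201 19237850 § 0x200000002000010
  3989546) 0x200000002000041 18912105 (node § 0x200000008000600 13904810 0x200000008001240 31540346 §
  0x200000008002008 10182729))) 0x200000008008080 39083066 (node (node (node § 0x200000008008208 16743070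
  0x200000008009001 8188154 § 0x200000008040048 2655561) 0x200000008040201 22 (node § 0x200000008200010 23
  0x200000008200041 12947066 § 0x200000009000009 6306362)) 0x200000040000440 24 (node (node § 0x200000040001080
  36423674 0x200000040001208 16354703 § 0x200000040002001 10887274) 0x200000040008048 27099818 (node §
  0x200000040008201 25 0x200000040040010 11404833 nil)))) 0x200000040040041 7776874 (node (node (node (node §
  0x200000040200009 8849529 0x200000088200000 12107682 § 0x2000000c0040000 18742810) 0x200000200000280 33764282 (node
  § 0x200000200000408 24868106 0x200000200001048 29766986 § 0x200000200001201 28562121)) 0x200000200008010 28735378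
  (node (node § 0x200000200008041 16057881 0x200000200040009 12823066 § 0x200000248040000 26) 0x200000280008000
  26440586 (node § 0x200000401040000 8369602 0x200000408008000 23765642 nil))) 0x200000440001000 26492001 (node (node
  (node § 0x200000600000200 18786417 0x2000010000000c0 40577818 § 0x200001000000248 29914730) 0x200001000000401
  23141402 (node § 0x200001000001010 17770785 0x200001000001041 25520858 § 0x200001000008009 16143418))
  0x200001048008000 6146962 (node (node § 0x200001080001000 18928569 0x200001201008000 21851010 § 0x200001208001000
  23617466) 0x200001240000200 26486385 (node § 0x200001400000040 28803194 0x200002000208000 21042306 nil)))))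
  0x200002001001000 16051418 (node (node (node (node (node § 0x200002008000200 15609071 0x200002040000040 23035151 §
  0x200002200000008 16050122) 0x200008000000088 35359233 (node § 0x200008000000210 30948938 0x200008000000241 26151141
  § 0x200008000001009 5093721)) 0x200008048001000 16252290 (node (node § 0x200008080000200 18912129 0x200008201001000
  28508570 § 0x200008208000200 31027562) 0x200008240000040 25530369 (node § 0x200008400000008 22778961
  0x200009000201000 24255970 nil))) 0x200009001000200 26301058 (node (node (node § 0x200009008000040 26075577
  0x200009040000008 11401809 § 0x200010000041000 9278543) 0x200010000200200 31818130 (node § 0x200010001000040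
  18741922 0x200010008000008 3328586 § 0x200040000000050 33336170)) 0x200040000000081 32348613 (node (node §
  0x200040000000209 20326490 0x200040048000200 20968042 § 0x200040080000040 25848314) 0x200040201000200 28563033 (node
  § 0x200040208000040 27 0x200040240000008 21447105 nil)))) 0x200041000200200 28 (node (node (node (node §
  0x200041001000040 23313338 0x200041008000008 5995754 § 0x200048000040200 10911050) 0x200048000200040 23305562 (node
  § 0x200048001000008 29 0x200080000008200 10771082 § 0x200080000040040 29628345)) 0x200080000200008 35499202 (node
  (node § 0x200200000000018 30366609 0x200200000000049 27722313 § 0x200200048000040 30) 0x200200080000008 13841738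
  (node § 0x200200201000040 12099906 0x200200208000008 3017546 nil))) 0x200201000200040 20646170 (node (node (node §
  0x200201001000008 10568042 0x200208000040040 28593705 § 0x200208000200008 31113105) 0x200240000008040 33227738 (node
  § 0x200240000040008 25234473 0x200400000001040 30700538 § 0x200400000008008 8025290)) 0x201000000000011 32636324
  (node (node § 0x201000048000008 6291242 0x201000201000008 17986346 § 0x201001000200008 9308780) 0x201008000040008
  23009642 (node § 0x201040000008008 28040714 0x201200000001008 30536802 nil)))))) 0x202000000000208 33064010 (node
  (node (node (node (node (node § 0x400000000000003 2659406 0x4000000000c0000 4246140 § 0x400000000248000 24409325)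
  0x400000000401000 19207621 (node § 0x400000001010000 5816909 0x400000001041000 20793485 § 0x400000001200200 31))
  0x400000002000040 7916429 (node (node § 0x400000008009000 32 0x400000008040200 3802908 § 0x400000008200040 33)
  0x400000009000008 34 (node § 0x400000010000001 3779580 0x400000040002000 22193165 § 0x400000040008200 15935215)))
  0x400000040040040 11835533 (node (node (node § 0x400000040200008 3841803 0x400000041000001 8880219 §
  0x400000200001200 22204399) 0x400000200008040 10902390 (node § 0x400000200040008 9327343 0x400000200200001 7647727 §
  0x400001000000400 5902428)) 0x400001000001040 18320694 (node (node § 0x400001000008008 31259979 0x400001000040001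
  3359676 § 0x400008000000240 35) 0x400008000001008 30925613 (node § 0x400008000008001 10777980 0x400040000000080
  23250684 nil)))) 0x400040000000208 36 (node (node (node (node § 0x400040000001001 3079740 0x400200000000048 30646543
  § 0x400200000000201 2939766) 0x401000000000010 33188427 (node § 0x401000000000041 5163702 0x408000000000009 37 §
  0x1000000000012000 22046738)) 0x1000000000018200 27901628 (node (node § 0x1000000000049200 22046306
  0x1000000000050040 16851506 § 0x1000000000080400 9309218) 0x1000000000088008 29440418 (node § 0x1000000000202200 38
  0x1000000000208400 18298258 nil))) 0x1000000000209040 19526450 (node (node (node § 0x1000000000210008 24557090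
  0x1000000000240240 16867058 § 0x1000000000241008 18006658) 0x1000000000248001 8857305 (node § 0x1000000000400080
  6649394 0x1000000000400208 13851250 § 0x1000000000401001 16384473)) 0x1000000001001400 36727394 (node (node §
  0x1000000001008240 31089777 0x1000000001009008 24564866 § 0x1000000001010001 39) 0x1000000001040208 7919899 (node §
  0x1000000001200048 18005794 0x1000000001200201 20817226 nil))))) 0x1000000002000010 19106114 (node (node (node (node
  (node § 0x1000000008000600 11385410 0x1000000008001240 17847273 § 0x1000000008002008 28238601) 0x1000000008008080 40
  (node § 0x1000000008008208 29020514 0x1000000008009001 13227026 § 0x1000000008040048 19129869)) 0x1000000008040201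
  2685321 (node (node § 0x1000000008200010 6479602 0x1000000008200041 6314162 § 0x1000000009000009 12807122)
  0x1000000040000440 36431474 (node § 0x1000000040001208 33144802 0x1000000040008048 38934914 nil)))
  0x1000000040008201 31088889 (node (node (node § 0x1000000040040010 12872769 0x1000000040200009 41 §
  0x1000000088200000 42) 0x1000000200000280 16136114 (node § 0x1000000200000408 14790434 0x1000000200001048 36076353 §
  0x1000000200001201 8826633)) 0x1000000200008010 18390690 (node (node § 0x1000000200008041 43 0x1000000200040009 44 §
  0x1000000248040000 11378937) 0x1000000280008000 34323714 (node § 0x1000000401040000 21409954 0x1000000408008000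
  5219889 nil)))) 0x1000000440001000 26284658 (node (node (node (node § 0x1000000600000200 3772690 0x1000001000000248
  37630690 § 0x1000001000000401 45) 0x1000001000001010 25585666 (node § 0x1000001000008009 22861490 0x1000001048008000
  21409538 § 0x1000001201008000 46)) 0x1000001208001000 47 (node (node § 0x1000001240000200 21455337
  0x1000001400000040 10145121 § 0x1000002000208000 16051874) 0x1000002008000200 8516066 (node § 0x1000002200000008
  26511009 0x1000008000000088 41034434 nil))) 0x1000008000000210 30132450 (node (node (node § 0x1000008000000241
  20870834 0x1000008000001009 25373138 § 0x1000008048001000 48) 0x1000008080000200 49 (node § 0x1000008201001000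
  26307986 0x1000008208000200 16222082 § 0x1000008240000040 31027154)) 0x1000008400000008 26283362 (node (node §
  0x1000009000201000 15942578 0x1000009001000200 30920002 § 0x1000009008000040 7592001) 0x1000009040000008 28515074
  (node § 0x1000010000041000 24421857 0x1000010000200200 8383874 nil)))))))) 0x1000010001000040 30919138 (node (node
  (node (node (node (node (node (node § 0x1000010008000008 18414050 0x1000040000000050 35163522 § 0x1000040000000209
  28289542) 0x1000040048000200 33407042 (node § 0x1000040201000200 33702081 0x1000040208000040 15179649 §
  0x1000040240000008 18927693)) 0x1000041000200200 13851706 (node (node § 0x1000041008000008 23312930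
  0x1000048000040200 20786594 § 0x1000048000200040 18266738) 0x1000048001000008 23305154 (node § 0x1000080000008200
  23578605 0x1000080000200008 29620545 § 0x1000200000000018 50))) 0x1000200000000049 35699666 (node (node (node §
  0x1000200048000040 18118986 0x1000200080000008 51 § 0x1000200201000040 21470889) 0x1000200208000008 8873745 (node §
  0x1000201000200040 15607346 0x1000201001000008 10568066 § 0x1000208000040040 25226673)) 0x1000208000200008 30715682
  (node (node § 0x1000240000008040 23150066 0x1000240000040008 31105329 § 0x1000400000001040 35996457)
  0x1000400000008008 28180706 (node § 0x1001000000000011 52 0x1001000048000008 15135585 nil)))) 0x1001000201000008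
  18951009 (node (node (node (node § 0x1001001000200008 18002338 0x1001008000040008 38180642 § 0x1001040000008008
  38368545) 0x1001200000001008 35848689 (node § 0x1002000000000208 37807809 0x1200000000000003 10079023 §
  0x12000000000c0000 26128253)) 0x1200000000248000 29300861 (node (node § 0x1200000000401000 16687781
  0x1200000001010000 53 § 0x1200000001041000 54) 0x1200000001200200 18142301 (node § 0x1200000002000040 17994149
  0x1200000008009000 18935459 nil))) 0x1200000008040200 5995734 (node (node (node § 0x1200000008200040 16391833
  0x1200000009000008 55 § 0x1200000010000001 11338735) 0x1200000040002000 28960878 (node § 0x1200000040008200 28235141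
  0x1200000040040040 17979011 § 0x1200000040200008 17978572)) 0x1200000041000001 10279924 (node (node §
  0x1200000200001200 30762749 0x1200000200008040 38616509 § 0x1200000200040008 6353451) 0x1200000200200001 16430715
  (node § 0x1200001000000400 12271421 0x1200001000001040 35957117 nil))))) 0x1200001000008008 18483990 (node (node
  (node (node (node § 0x1200001000040001 10171907 0x1200008000000240 38514985 § 0x1200008000001008 28102924)
  0x1200008000008001 23678366 (node § 0x1200040000000080 40886233 0x1200040000000208 31104459 § 0x1200040000001001
  28857614)) 0x1200200000000048 33157324 (node (node § 0x1200200000000201 25313503 0x1201000000000010 32908057 §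
  0x1201000000000041 56) 0x1208000000000009 33180219 (node § 0x2000000000248000 9137676 0x2000000000401000 14168748
  nil))) 0x2000000001010000 32115797 (node (node (node § 0x2000000001200200 21578881 0x2000000008009000 5703751 §
  0x2000000008040200 3803340) 0x2000000008200040 3795564 (node § 0x2000000009000008 3787806 0x2000000010000001 3780012
  § 0x2000000040008200 26200830)) 0x2000000040200008 2722523 (node (node § 0x2000000200001200 22201397
  0x2000000200008040 13592497 § 0x2000000200040008 21470019) 0x2000000200200001 8872467 (node § 0x2000001000000400
  18499980 0x2000001000008008 38624309 nil)))) 0x2000008000000240 57 (node (node (node (node § 0x2000008000001008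
  23804094 0x2000008000008001 58 § 0x2000040000000208 34961766) 0x2000200000000048 38226865 (node § 0x2000200000000201
  12623934 0x2001000000000010 2674993 § 0x2008000000000009 7838654)) 0x8000000000012000 14012858 (node (node §
  0x8000000000018200 26064753 0x8000000000043000 21468729 § 0x8000000000049200 10568090) 0x8000000000050040 21467841
  (node § 0x8000000000081040 11385429 0x8000000000088008 21612129 nil))) 0x8000000000202200 32870049 (node (node (node
  § 0x8000000000208400 28180730 0x8000000000209040 20505818 § 0x8000000000210008 31260026) 0x8000000000240240 11827802
  (node § 0x8000000000241008 31827674 0x8000000000248001 21003050 § 0x8000000000400208 28878801)) 0x8000000000401001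
  10622458 (node (node § 0x8000000001001400 36431498 0x8000000001002040 33919850 § 0x8000000001008240 59)
  0x8000000001040080 10592698 (node § 0x8000000001041001 60 0x8000000001200048 61 nil)))))) 0x8000000001200201
  26057817 (node (node (node (node (node (node § 0x8000000002000041 20637955 0x8000000008001240 36571466 §
  0x8000000008002008 18935066) 0x8000000008008208 25685458 (node § 0x8000000008009001 10287722 0x8000000008040048
  7348770 § 0x8000000008200010 8067634)) 0x8000000040001208 36431066 (node (node § 0x8000000040008048 31399994
  0x8000000040008201 25731226 § 0x8000000040040010 11213498) 0x8000000040200009 62 (node § 0x8000000200000280 63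
  0x8000000248040000 6346977 § 0x8000000280008000 35894522))) 0x8000000440001000 33298594 (node (node (node §
  0x8000001000000248 13910001 0x8000001240000200 64 § 0x8000008048001000 8810714) 0x8000008240000040 65 (node §
  0x8000009000201000 21462657 0x8000041001000040 35910506 § 0x8000208000200008 33235130)) 0x8200000000000003 66 (node
  (node § 0x82000000000c0000 21883429 0x8200000000248000 28511167 § 0x8200000000401000 28802742) 0x8200000001010000
  11353467 (node § 0x8200000001041000 20793533 0x8200000001200200 25693235 nil)))) 0x8200000002000040 11493366 (node
  (node (node (node § 0x8200000008009000 16409125 0x8200000008040200 67 § 0x8200000008200040 6314550)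
  0x8200000009000008 68 (node § 0x8200000010000001 3009340 0x8200000040002000 22193213 § 0x8200000040008200 27096799))
  0x8200000040040040 9316157 (node (node § 0x8200000040200008 16718859 0x8200000041000001 16391883 §
  0x8200000200001200 28391501) 0x8200000200008040 31018972 (node § 0x8200000200040008 21609963 0x8200000200200001
  17691731 nil))) 0x8200001000000400 10614749 (node (node (node § 0x8200001000001040 28040765 0x8200001000008008 69 §
  0x8200001000040001 20725647) 0x8200008000000240 29914781 (node § 0x8200008000001008 8267653 0x8200008000008001
  5143855 § 0x8200040000000080 70)) 0x8200040000000208 28296889 (node (node § 0x8200040000001001 18631371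
  0x8200200000000048 28141417 § 0x8200200000000201 26057403) 0x8201000000000010 28001449 (node § 0x8201000000000041
  35707420 0x8208000000000009 23242491 nil))))) 0x9000000000000003 7560030 (node (node (node (node (node §
  0x90000000000c0000 11012165 0x9000000000248000 19215409 § 0x9000000000401000 3612007) 0x9000000001010000 31088955
  (node § 0x9000000001041000 32290302 0x9000000001200200 33469230 § 0x9000000002000040 21400033)) 0x9000000008009000
  18266332 (node (node § 0x9000000008040200 3033966 0x9000000008200040 12955323 § 0x9000000009000008 6362123)
  0x9000000010000001 8819742 (node § 0x9000000040002000 34184236 0x9000000040008200 33189294 nil))) 0x9000000040040040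
  20669524 (node (node (node § 0x9000000040200008 20521372 0x9000000041000001 21010827 § 0x9000000200001200 33282174)
  0x9000000200008040 71 (node § 0x9000000200040008 72 0x9000000200200001 13864683 § 0x9000001000000400 8421457))
  0x9000001000001040 18013566 (node (node § 0x9000001000008008 26028919 0x9000001000040001 73 § 0x9000008000000240
  28436881) 0x9000008000001008 33483937 (node § 0x9000008000008001 20863083 0x9000040000000080 22507687 nil))))
  0x9000040000000208 33305113 (node (node (node (node § 0x9000040000001001 21166323 0x9000200000000048 35708286 §
  0x9000200000000201 74) 0x9001000000000010 35707876 (node § 0x9001000000000041 17699502 0x9008000000000009 25910079 §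
  0x10000000000248000 25428822)) 0x10000000000401000 13461159 (node (node § 0x10000000001041000 36143353
  0x10000000001200200 75 § 0x10000000002000040 35583481) 0x10000000008009000 8425335 (node § 0x10000000040008200
  13461591 0x10000000040200008 23540151 nil))) 0x10000000041000001 15537326 (node (node (node § 0x10000000200200001
  2660694 0x40200000000000003 5041039 § 0x402000000000c0000 14325589) 0x40200000000248000 76 (node §
  0x40200000000401000 39386761 0x40200000001010000 18415325 § 0x40200000001041000 11508505)) 0x40200000001200200
  28352620 (node (node § 0x40200000002000040 21401309 0x40200000008009000 11368537 § 0x40200000008040200 77)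
  0x40200000008200040 16393577 (node § 0x40200000009000008 17855459 0x40200000010000001 6300751 nil)))))))
  0x40200000040002000 8850003 (node (node (node (node (node (node (node § 0x40200000040008200 20965444
  0x40200000040040040 23625701 § 0x40200000040200008 20964580) 0x40200000041000001 8680207 (node § 0x40200000200001200
  36275478 0x40200000200008040 21269573 § 0x40200000200040008 26072977)) 0x40200000200200001 23670591 (node (node §
  0x40200001000000400 8026595 0x40200001000001040 28196691 § 0x40200001000008008 8219692) 0x40200001000040001 7606691
  (node § 0x40200008000000240 30918700 0x40200008000001008 6057553 § 0x40200008000008001 11376315)))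
  0x40200040000000080 33063577 (node (node (node § 0x40200040000000208 78 0x40200040000001001 10190479 §
  0x40200200000000048 30917836) 0x40200200000000201 25219331 (node § 0x40201000000000010 21011211 0x40201000000000041
  38646747 § 0x40208000000000009 79)) 0x41000000000248000 18578645 (node (node § 0x41000000000401000 19206769
  0x41000000001010000 23320705 § 0x41000000001200200 34183780) 0x41000000008009000 16407409 (node §
  0x41000000008040200 8865510 0x41000000008200040 16438513 nil)))) 0x41000000009000008 21014679 (node (node (node
  (node § 0x41000000010000001 10149031 0x41000000040008200 34495683 § 0x41000000040200008 21897699)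
  0x41000000200001200 18112091 (node § 0x41000000200008040 80 0x41000000200040008 17832155 § 0x41000000200200001
  16384083)) 0x41000001000000400 35808961 (node (node § 0x41000001000008008 26641059 0x41000008000000240 21454899 §
  0x41000008000001008 28235571) 0x41000008000008001 21454035 (node § 0x41000040000000208 30404209 0x41000200000000048
  35855620 nil))) 0x41000200000000201 35855188 (node (node (node § 0x41001000000000010 32908902 0x41008000000000009
  21011199 § 0x200200000000000003 3367023) 0x2002000000000c0000 6767749 (node § 0x200200000000248000 20342454
  0x200200000000401000 19207158 § 0x200200000001010000 3795147)) 0x200200000001041000 16549529 (node (node §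
  0x200200000001200200 31812508 0x200200000002000040 18741052 § 0x200200000008009000 81) 0x200200000008040200 18942793
  (node § 0x200200000008200040 21433285 0x200200000009000008 82 nil))))) 0x200200000010000001 3370911 (node (node
  (node (node (node § 0x200200000040002000 18883181 0x200200000040008200 8716921 § 0x200200000040040040 26300188)
  0x200200000040200008 23009209 (node § 0x200200000041000001 83 0x200200000200001200 31968459 § 0x200200000200008040
  26212921)) 0x200200000200040008 84 (node (node § 0x200200000200200001 21889467 0x200200001000000400 85 §
  0x200200001000001040 26051795) 0x200200001000008008 8439155 (node § 0x200200001000040001 5085942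
  0x200200008000000240 28032505 nil))) 0x200200008000001008 86 (node (node (node § 0x200200008000008001 7599347
  0x200200040000000080 35583414 § 0x200200040000000208 87) 0x200200040000001001 5070390 (node § 0x200200200000000048
  28562583 0x200200200000000201 28856763 § 0x200201000000000010 28805363)) 0x200201000000000041 38802268 (node (node §
  0x200208000000000009 31827196 0x240000000000000003 3786927 § 0x2400000000000c0000 4249621) 0x240000000000248000
  11331820 (node § 0x240000000000401000 11959513 0x240000000001010000 3787815 nil)))) 0x240000000001041000 12939289
  (node (node (node (node § 0x240000000001200200 13316003 0x240000000002000040 24091806 § 0x240000000008009000 88)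
  0x240000000008040200 8845237 (node § 0x240000000008200040 18586827 0x240000000009000008 16431126 §
  0x240000000010000001 3790815)) 0x240000000040002000 18741076 (node (node § 0x240000000040008200 3772252
  0x240000000040040040 18494819 § 0x240000000040200008 23952279) 0x240000000041000001 6307215 (node §
  0x240000000200001200 18118105 0x240000000200008040 21409084 nil))) 0x240000000200040008 19370454 (node (node (node §
  0x240000000200200001 3795135 0x240000001000000400 89 § 0x240000001000001040 11819545) 0x240000001000008008 11332252
  (node § 0x240000001000040001 3789519 0x240000008000000240 20328655 § 0x240000008000001008 10279897))
  0x240000008000008001 3787359 (node (node § 0x240000040000000080 13219225 0x240000040000000208 3973974 §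
  0x240000040000001001 90) 0x240000200000000048 21447543 (node § 0x240000200000000201 11346495 0x240001000000000010
  21447111 nil)))))) 0x240001000000000041 8849967 (node (node (node (node (node (node § 0x240008000000000009 3810687
  0x1000000000000012000 16586786 § 0x1000000000000018200 8848689) 0x1000000000000049200 23165282 (node §
  0x1000000000000050040 17688705 0x1000000000000088008 3546306 § 0x1000000000000202200 11035042))
  0x1000000000000208400 25661378 (node (node § 0x1000000000000209040 10428194 0x1000000000000210008 21174498 §
  0x1000000000000240240 21586754) 0x1000000000000241008 91 (node § 0x1000000000000248001 92 0x1000000000000400208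
  21114034 nil))) 0x1000000000000401001 15995683 (node (node (node § 0x1000000000001001400 4503186
  0x1000000000001008240 18919905 § 0x1000000000001200048 10708130) 0x1000000000001200201 8141618 (node §
  0x1000000000008001240 6182802 0x1000000000008002008 16415714 § 0x1000000000008008208 17880945))
  0x1000000000008009001 10287794 (node (node § 0x1000000000008040048 12694353 0x1000000000008200010 6314690 §
  0x1000000000040001208 18595906) 0x1000000000040008048 26361218 (node § 0x1000000000040008201 3507849
  0x1000000000040040010 5135649 nil)))) 0x1000000000040200009 12791961 (node (node (node (node § 0x1000000000200000280
  18880706 0x1000000000248040000 93 § 0x1000000000280008000 28437410) 0x1000000000440001000 25770242 (node §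
  0x1000000001000000248 94 0x1000000001240000200 18523774 § 0x1000000008048001000 13849634)) 0x1000000008240000040
  25521410 (node (node § 0x1000000009000201000 15459266 0x1000000208000200008 26479473 § 0x1000200000000000003 95)
  0x10002000000000c0000 4245721 (node § 0x1000200000000248000 21741721 0x1000200000000401000 23670723 nil)))
  0x1000200000001010000 96 (node (node (node § 0x1000200000001041000 11524057 0x1000200000001200200 18736735 §
  0x1000200000002000040 15474821) 0x1000200000008009000 6332291 (node § 0x1000200000008040200 21112421
  0x1000200000008200040 2885334 § 0x1000200000009000008 7781219)) 0x1000200000010000001 97 (node (node §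
  0x1000200000040002000 19098433 0x1000200000040008200 18157417 § 0x1000200000040040040 13763545)
  0x1000200000040200008 11400195 (node § 0x1000200000041000001 98 0x1000200000200001200 26152444 nil)))))
  0x1000200000200008040 22060950 (node (node (node (node (node § 0x1000200000200040008 13771875 0x1000200000200200001
  15310971 § 0x1000200001000000400 20692517) 0x1000200001000001040 23546309 (node § 0x1000200001000008008 17822617
  0x1000200001000040001 99 § 0x1000200008000000240 27395429)) 0x1000200008000001008 8291843 (node (node §
  0x1000200008000008001 16104244 0x1000200040000000080 22986437 § 0x1000200040000000208 100) 0x1000200040000001001 101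
  (node § 0x1000200200000000048 5466673 0x1000200200000000201 3802491 nil))) 0x1000201000000000010 102 (node (node
  (node § 0x1000201000000000041 21290715 0x1000208000000000009 16104123 § 0x1001000000000248000 6620027)
  0x1001000000000401000 11649318 (node § 0x1001000000001010000 23227491 0x1001000000001200200 11377299 §
  0x1001000000008009000 8849958)) 0x1001000000008040200 6345265 (node (node § 0x1001000000008200040 13383411
  0x1001000000009000008 6294727 § 0x1001000000010000001 7630014) 0x1001000000040008200 23633476 (node §
  0x1001000000040200008 14036260 0x1001000000200001200 9604373 nil)))) 0x1001000000200008040 13538932 (node (node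
  (node (node § 0x1001000000200040008 13623601 0x1001000000200200001 14331220 § 0x1001000001000000400 2986033)
  0x1001000001000008008 21129604 (node § 0x1001000008000000240 11035060 0x1001000008000001008 26168020 §
  0x1001000008000008001 7599803)) 0x1001000040000000208 21128740 (node (node § 0x1001000200000000048 21438915
  0x1001000200000000201 6321939 § 0x1001001000000000010 21291171) 0x1001008000000000009 103 (node §
  0x1008000000000248000 22861513 0x1008000000000401000 8842215 nil))) 0x1008000000001041000 2846089 (node (node (node
  § 0x1008000000001200200 6323655 0x1008000000002000040 11362527 § 0x1008000000008009000 5670006)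
  0x1008000000040008200 8841819 (node § 0x1008000000040200008 21314595 0x1008000000041000001 104 §
  0x1008000000200200001 105)) 0x2000000000000248000 2706193 (node (node § 0x2000000000000401000 12887436
  0x2000000000001200200 19240470 § 0x2000000000008009000 106) 0x2000000000040008200 23538532 (node §
  0x2000000000040200008 10787916 0x2000000000200200001 107 nil))))))))

def tableFourEven : Table :=
  node (node (node (node (node (node § 0x9240000000000000 2947538 0x41240000000000000 8414067 nil) 0x48240000000000000
  3087506 § 0x49040000000000000 5895507) 0x49200000000000000 3087962 (node (node § 0x201240000000000000 5754676
  0x208240000000000000 3368307 nil) 0x209200000000000000 3235706 § 0x240240000000000000 3227474)) 0x241040000000000000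
  8982146 (node (node (node § 0x241200000000000000 3227930 0x248040000000000000 6462292 nil) 0x248200000000000000
  3228362 § 0x249000000000000000 3090554) 0x1001240000000000000 0 (node § 0x1008240000000000000 1
  0x1009040000000000000 2949698 § 0x1009200000000000000 2949722))) 0x1040240000000000000 5609092 (node (node (node
  (node § 0x1041200000000000000 3375674 0x1048200000000000000 3089690 nil) 0x1049000000000000000 3376130 §
  0x1200240000000000000 3367442) 0x1201200000000000000 3367898 (node § 0x1208200000000000000 3368330
  0x1240040000000000000 9137666 § 0x1240200000000000000 3368762)) 0x1241000000000000000 3951962 (node (node (node §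
  0x1248000000000000000 3383023 0x8001240000000000000 8554036 nil) 0x8009200000000000000 3663818 §
  0x8041040000000000000 8562242) 0x8041200000000000000 4533871 (node § 0x8049000000000000000 2950586
  0x8200240000000000000 6617812 § 0x8201200000000000000 3515642)))) 0x8208200000000000000 3243055 (node (node (node
  (node (node § 0x8241000000000000000 3647834 0x9001200000000000000 3507866 nil) 0x9041000000000000000 3655610 §
  0x9200200000000000000 3509162) 0x40041200000000000000 6470524 (node § 0x40049000000000000000 6470980
  0x200001240000000000000 11353396 § 0x200008240000000000000 2)) 0x200009040000000000000 8827058 (node (node (node §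
  0x200009200000000000000 2951018 0x200040240000000000000 8849524 nil) 0x200041040000000000000 11369380 §
  0x200041200000000000000 5898123) 0x200048200000000000000 3090986 (node § 0x200049000000000000000 3663415
  0x200200240000000000000 5890323 § 0x200201200000000000000 5758156))) 0x200208200000000000000 3522991 (node (node
  (node (node § 0x200240040000000000000 3787346 0x200240200000000000000 3811994 nil) 0x200241000000000000000 3788666 §
  0x200248000000000000000 3788234) 0x201000240000000000000 3802898 (node § 0x201001040000000000000 11361602
  0x201001200000000000000 4269487 § 0x201008200000000000000 3803786)) 0x201009000000000000000 3803810 (node (node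
  (node § 0x201040200000000000000 3390799 0x201041000000000000000 3378722 nil) 0x201200200000000000000 3370922 §
  0x201240000000000000000 3789530) 0x208001200000000000000 3795578 (node § 0x208041000000000000000 3787802
  0x208200200000000000000 6621292 § 0x240041000000000000000 6473572))))

def tableFourOdd : Table :=
  node (node (node (node (node (node § 0x800000000000000 2659850 0x1600000000000000 10505835 § 0x2400000000000000
  2799818) 0x3200000000000000 2800250 (node § 0x8600000000000000 9697136 0x9400000000000000 2667247 nil))
  0xa200000000000000 2800682 (node (node § 0xb000000000000000 4879501 0x10400000000000000 2939786 nil)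
  0x11200000000000000 2940218 (node § 0x12000000000000000 2940242 0x18200000000000000 4690256 nil)))
  0x19000000000000000 4690280 (node (node (node § 0x40600000000000000 2661146 0x41400000000000000 2661170 nil)
  0x42200000000000000 2801114 (node § 0x48400000000000000 4731733 0x49200000000000000 4549856 nil))
  0x4a000000000000000 3640514 (node (node § 0x50200000000000000 2941082 0x51000000000000000 2941106 nil)
  0x80400000000000000 3079754 (node § 0x81200000000000000 3080186 0x88200000000000000 4549472 nil))))
  0x89000000000000000 3080642 (node (node (node (node § 0xc0200000000000000 3081050 0x200600000000000000 6074383 §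
  0x201400000000000000 3500954) 0x202200000000000000 2801546 (node § 0x208400000000000000 2947548 0x209200000000000000
  2954911 nil)) 0x210200000000000000 2941514 (node (node § 0x240400000000000000 3810699 0x241200000000000000 3811131
  nil) 0x242000000000000000 3082778 (node § 0x248200000000000000 3811563 0x249000000000000000 3811587 nil)))
  0x250000000000000000 2942810 (node (node (node § 0x280200000000000000 3811995 0x281000000000000000 3640922 nil)
  0x288000000000000000 3640490 (node § 0x2c0000000000000000 3642650 0x400400000000000000 3219722 nil))
  0x401200000000000000 3220154 (node (node § 0x408200000000000000 3258658 0x440200000000000000 3221018 nil)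
  0x441000000000000000 3788667 (node § 0x448000000000000000 3842679 0x480000000000000000 3639626 nil)))))
  0x600200000000000000 3221450 (node (node (node (node (node § 0x640000000000000000 3787371 0x1000600000000000000
  8406316 § 0x1001400000000000000 4269488) 0x1002200000000000000 4269512 (node § 0x1008400000000000000 5887756
  0x1009200000000000000 3803355 nil)) 0x100a000000000000000 3803379 (node (node § 0x1010200000000000000 3803787
  0x1011000000000000000 3803811 nil) 0x1040400000000000000 3390802 (node § 0x1041200000000000000 3390826
  0x1048200000000000000 3804219 nil))) 0x1049000000000000000 3804243 (node (node (node § 0x1080200000000000000 3399034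
  0x1200400000000000000 3827991 nil) 0x1201200000000000000 3399010 (node § 0x1208200000000000000 3804651
  0x1240200000000000000 3812859 nil)) 0x1241000000000000000 3812883 (node (node § 0x1248000000000000000 3805947
  0x1280000000000000000 3797331 nil) 0x1400200000000000000 3258730 (node § 0x1440000000000000000 3789531
  0x2000400000000000000 3359690 nil)))) 0x2001200000000000000 3360122 (node (node (node (node § 0x2008200000000000000
  3805083 0x2009000000000000000 5469266 § 0x2040200000000000000 6812671) 0x2200200000000000000 3361418 (node §
  0x2240000000000000000 3362714 0x3000200000000000000 3361850 nil)) 0x8001400000000000000 3795147 (node (node §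
  0x8002200000000000000 3795579 0x8009200000000000000 3796011 nil) 0x8041200000000000000 3796443 (node §
  0x8042000000000000000 3640058 0x8049000000000000000 3788259 nil))) 0x8081000000000000000 2802842 (node (node (node §
  0x8200400000000000000 3501386 0x8201200000000000000 3796875 nil) 0x8208200000000000000 3539410 (node §
  0x8241000000000000000 3798171 0x8440000000000000000 3500090 nil)) 0x9001200000000000000 3797307 (node (node §
  0x9041000000000000000 3789555 0x9200200000000000000 4131254 nil) 0x10041000000000000000 3787803 (node §
  0x40041200000000000000 3788691 0x40049000000000000000 3671626 nil)))))

end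

def templatesSix : List (Fin 6 → Vec) := [
  ![![1, 0, 0, 0], ![0, 1, 0, 0], ![0, 0, 1, 0], ![0, 0, 0, 1], ![0, 0, 1, -1], ![0, 1, -1, 0]],
  ![![1, 0, 0, 0], ![0, 1, 0, 0], ![0, 0, 1, 0], ![0, 0, 0, 1], ![0, 0, 1, -1], ![1, -1, -1, 0]],
  ![![1, 0, 0, 0], ![0, 1, 0, 0], ![0, 0, 1, 0], ![0, 0, 0, 1], ![0, 0, 1, -1], ![1, -1, 0, 0]],
  ![![1, 0, 0, 0], ![0, 1, 0, 0], ![0, 0, 1, 0], ![0, 0, 0, 1], ![0, 1, -1, -1], ![1, -1, 0, 1]]]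

def templatesFive : List (Fin 5 → Vec) := [
  ![![1, 0, 0, 0], ![0, 1, 0, 0], ![0, 0, 1, 0], ![0, 0, 0, 1], ![0, 0, 1, -1]],
  ![![1, 0, 0, 0], ![0, 1, 0, 0], ![0, 0, 1, 0], ![0, 0, 0, 1], ![0, 1, -1, -1]],
  ![![1, 0, 0, 0], ![0, 1, 0, 0], ![0, 0, 1, 0], ![0, 0, 0, 1], ![1, -1, -1, -1]]]

def minorFive (t : Fin 5 → Vec) (i : Fin 5) : ℤ := (-1) ^ (i : ℕ) * det4 (of (t ∘ i.succAbove))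

def patternsSix : List (List (List Entry)) := templatesSix.map fun s => List.ofFn fun j : Fin 6 =>
  if ∀ i, minorFive (s ∘ j.succAbove) i = 0 then [] else
    List.ofFn fun i => enc (minorFive (s ∘ j.succAbove) i) (s (j.succAbove i))

def patternsFive : List (List (List Entry)) := templatesFive.map fun s => List.ofFn fun j : Fin 5 =>
  if det4 (of (s ∘ j.succAbove)) = 0 then [] else List.ofFn fun i => enc 0 (s (j.succAbove i))

def lookup {α : Type} (P : List (List (List α))) (τ j : ℕ) : List α := (P.getD τ []).getD j []

lemma tableFiveEven_step : tableFiveEven.all (stepOK 5 true tableFiveEven (lookup patternsSix)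
    fun τ _ => Nat.ble τ 3) = true := by
  decide +kernel

lemma tableFiveOdd_step : tableFiveOdd.all (stepOK 5 false tableFiveOdd (lookup patternsSix)
    fun τ _ => Nat.ble τ 3) = true := by
  decide +kernel

lemma tableFourEven_step : tableFourEven.all (stepOK 4 true tableFourEven (lookup patternsFive)
    fun τ _ => Nat.ble τ 2) = true := by
  decide +kernel

instance : DecidablePred Small := fun c => inferInstanceAs (Decidable (c = 0 ∨ c = 1 ∨ c = -1))

lemma circ_det4 (t : Fin 5 → Vec) : circ t = fun i : Fin 5 => (-1) ^ (i : ℕ) * det4 (of (t ∘ i.succAbove)) := by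
  ext i
  rw [circ, det4_eq]

/-- A computable witness that a tuple lies in a hyperplane. -/
def FlatWitness {m : ℕ} (t : Fin m → Vec) : Prop :=
  ∃ w : Fin 4 → Fin 3, (∃ k, w k ≠ 1) ∧ ∀ i, t i ⬝ᵥ (fun k => ((w k : ℕ) : ℤ) - 1) = 0

instance {m : ℕ} (t : Fin m → Vec) : Decidable (FlatWitness t) := by
  unfold FlatWitness; infer_instance

lemma FlatWitness.flat {m : ℕ} {t : Fin m → Vec} (h : FlatWitness t) : Flat t := by
  obtain ⟨w, ⟨k, hk⟩, h⟩ := h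
  refine ⟨_, fun h0 => hk ?_, h⟩
  have := congrFun h0 k
  simp only [Pi.zero_apply] at this
  ext
  change (w k : ℕ) = 1
  omega

def templateSix (τ : ℕ) : Fin 6 → Vec := templatesSix.getD τ 0

def templateFive (τ : ℕ) : Fin 5 → Vec := templatesFive.getD τ 0

lemma coded_six {τ : ℕ} (hτ : τ ≤ 3) : Coded frameFive (templateSix τ) (lookup patternsSix τ) := by
  have h : ∀ τ : Fin 4, ∀ j : Fin 6,
      (lookup patternsSix τ j = [] ∧ FlatWitness (templateSix τ ∘ j.succAbove)) ∨
      (((∀ i : Fin 5, Small ((-1) ^ (i : ℕ) * det4 (of ((templateSix τ ∘ j.succAbove) ∘ i.succAbove)))) ∧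
        ∃ i : Fin 5, (-1) ^ (i : ℕ) * det4 (of ((templateSix τ ∘ j.succAbove) ∘ i.succAbove)) ≠ 0) ∧
      lookup patternsSix τ j = List.ofFn fun i : Fin 5 => enc ((-1) ^ (i : ℕ) *
        det4 (of ((templateSix τ ∘ j.succAbove) ∘ i.succAbove))) (templateSix τ (j.succAbove i))) := by
    decide +kernel
  intro j
  rcases h ⟨τ, by omega⟩ j with ⟨h1, h2⟩ | h
  · exact Or.inl ⟨h1, h2.flat⟩
  · right
    simp only [frameFive, circ_det4]
    exact h

lemma coded_five {τ : ℕ} (hτ : τ ≤ 2) : Coded frameFour (templateFive τ) (lookup patternsFive τ) := by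
  have h : ∀ τ : Fin 3, ∀ j : Fin 5,
      (lookup patternsFive τ j = [] ∧ FlatWitness (templateFive τ ∘ j.succAbove)) ∨
      ((det4 (of (templateFive τ ∘ j.succAbove)) = 1 ∨ det4 (of (templateFive τ ∘ j.succAbove)) = -1) ∧
      lookup patternsFive τ j = List.ofFn fun i : Fin 4 => enc 0 (templateFive τ (j.succAbove i))) := by
    decide +kernel
  intro j
  rcases h ⟨τ, by omega⟩ j with ⟨h1, h2⟩ | ⟨h1, h2⟩
  · exact Or.inl ⟨h1, h2.flat⟩
  · refine Or.inr ⟨?_, h2⟩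
    change IsUnit (of _).det
    rw [det4_eq, Int.isUnit_iff]
    exact h1

/-- A symbol is covered if it is not primitive, lies in the table, or vanishes by symmetry. -/
noncomputable def covered (T : Table) (b : Bool) (rs : List ℕ) : Bool :=
  rs.all (fun r => Nat.beq (r % 2) 0) || rs.all (fun r => Nat.beq (r % 3) 0) ||
    Nat.ble 1 (T.find (canon rs)) || dead b rs

noncomputable def coverFour (T : Table) (b : Bool) : Bool :=
  allLt 10 fun d₃ => allLt (d₃ + 1) fun d₂ => allLt (d₂ + 1) fun d₁ => allLt (d₁ + 1) fun d₀ =>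
    covered T b [d₀ + 18, d₁ + 18, d₂ + 18, d₃ + 18]

noncomputable def coverFive (T : Table) (b : Bool) : Bool :=
  allLt 18 fun d₂ => allLt (d₂ + 1) fun d₁ => allLt (d₁ + 1) fun d₀ =>
    (!Nat.beq ((d₀ + d₁ + d₂) % 18) 0 ||
      allLt 10 fun d₄ => allLt (d₄ + 1) fun d₃ => covered T b [d₀, d₁, d₂, d₃ + 18, d₄ + 18]) &&
    ((Nat.blt ((54 - (d₀ + d₁ + d₂)) % 18) d₂ ||
      allLt 10 fun d₄ => covered T b [d₀, d₁, d₂, (54 - (d₀ + d₁ + d₂)) % 18, d₄ + 18]) &&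
    allLt 18 fun d₃ => Nat.blt d₃ d₂ || Nat.blt ((72 - (d₀ + d₁ + d₂ + d₃)) % 18) d₃ ||
      covered T b [d₀, d₁, d₂, d₃, (72 - (d₀ + d₁ + d₂ + d₃)) % 18])

lemma of_coverFour {T : Table} {b : Bool} (h : coverFour T b = true) {d : Fin 4 → ℕ} (hd : Monotone d)
    (h18 : ∀ i, 18 ≤ d i) (h28 : ∀ i, d i < 28) : covered T b (List.ofFn d) = true := by
  have h01 := hd (show (0 : Fin 4) ≤ 1 by decide)
  have h12 := hd (show (1 : Fin 4) ≤ 2 by decide)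
  have h23 := hd (show (2 : Fin 4) ≤ 3 by decide)
  have := of_allLt (of_allLt (of_allLt (of_allLt h (k := d 3 - 18) (by have := h28 3; omega)) (k := d 2 - 18)
    (by omega)) (k := d 1 - 18) (by omega)) (k := d 0 - 18) (by omega)
  simp only [Nat.sub_add_cancel (h18 _)] at this
  simpa [List.ofFn_succ] using this

lemma of_coverFive {T : Table} {b : Bool} (h : coverFive T b = true) {d : Fin 5 → ℕ} (hd : Monotone d)
    (h28 : ∀ i, d i < 28) (h2 : d 2 < 18) (hs : 18 ∣ ∑ i, if d i < 18 then d i else 0) :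
    covered T b (List.ofFn d) = true := by
  have h01 := hd (show (0 : Fin 5) ≤ 1 by decide)
  have h12 := hd (show (1 : Fin 5) ≤ 2 by decide)
  have h23 := hd (show (2 : Fin 5) ≤ 3 by decide)
  have h34 := hd (show (3 : Fin 5) ≤ 4 by decide)
  have h3' := h28 3
  have h4' := h28 4
  have := of_allLt (of_allLt (of_allLt h h2) (k := d 1) (by omega)) (k := d 0) (by omega)
  simp only [Bool.and_eq_true, Bool.or_eq_true, Bool.not_eq_true', Nat.blt_eq] at this
  obtain ⟨hA, hB, hC⟩ := this
  have hl : List.ofFn d = [d 0, d 1, d 2, d 3, d 4] := by simp [List.ofFn_succ]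
  rw [hl]
  simp only [Fin.sum_univ_five, if_pos h2, if_pos (show d 0 < 18 by omega), if_pos (show d 1 < 18 by omega)] at hs
  by_cases h3 : d 3 < 18
  · by_cases h4 : d 4 < 18
    · rw [if_pos h3, if_pos h4] at hs
      have := of_allLt hC h3
      simp only [Bool.or_eq_true, Nat.blt_eq] at this
      have h5 : (72 - (d 0 + d 1 + d 2 + d 3)) % 18 = d 4 := by omega
      rw [h5] at this
      rcases this with (h | h) | h
      · omega
      · omega
      · exact h
    · rw [if_pos h3, if_neg h4] at hs
      have h5 : (54 - (d 0 + d 1 + d 2)) % 18 = d 3 := by omega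
      rw [h5] at hB
      rcases hB with h | h
      · omega
      · have := of_allLt h (k := d 4 - 18) (by omega)
        rwa [Nat.sub_add_cancel (by omega)] at this
  · rw [if_neg h3, if_neg (show ¬ d 4 < 18 by omega)] at hs
    rcases hA with h | h
    · rw [← Bool.not_eq_true, Nat.beq_eq] at h
      omega
    · have := of_allLt (of_allLt h (k := d 4 - 18) (by omega)) (k := d 3 - 18) (by omega)
      rwa [Nat.sub_add_cancel (by omega), Nat.sub_add_cancel (by omega)] at this

variable {m : ℕ}

lemma dig_lt (c : ℤ) (l : ZMod 18) : dig c l < 28 := by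
  by_cases hc : c = 0
  · subst hc; revert l; decide +kernel
  · rw [dig, if_neg hc]
    exact (ZMod.val_lt _).trans (by norm_num)

lemma dig_lt_iff (c : ℤ) (l : ZMod 18) : dig c l < 18 ↔ c ≠ 0 := by
  by_cases hc : c = 0
  · simp [dig, hc]
  · simp only [dig, hc, if_false, ne_eq, not_false_eq_true, iff_true]
    exact ZMod.val_lt _

lemma weight_perm (b : Bool) (σ : Equiv.Perm (Fin m)) :
    ∃ η : ℤˣ, ∀ (c : Fin m → ℤ) (l : Fin m → ZMod 18), weight b (c ∘ σ) (l ∘ σ) = η * weight b c l := by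
  refine ⟨(twist b σ 1)⁻¹, fun c l => ?_⟩
  rw [weight_match b (c := c ∘ σ) (l := l ∘ σ) (c' := c) (l' := l) (π := σ) (ε := 1) (fun i => by simp),
    ← mul_assoc, ← Units.val_mul, inv_mul_cancel, Units.val_one, one_mul]

lemma key_perm (c : Fin m → ℤ) (l : Fin m → ZMod 18) (σ : Equiv.Perm (Fin m)) : key (c ∘ σ) (l ∘ σ) = key c l :=
  Equiv.sum_comp σ fun i => 8 ^ dig (c i) (l i)

noncomputable def Frame.digit (R : Frame m) (t : Fin m → Vec) (i : Fin m) : ℕ :=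
  dig (R.circ t i) (lev lastCovector (t i))

lemma Frame.digit_lt (R : Frame m) (t : Fin m → Vec) (i : Fin m) : R.digit t i < 28 := dig_lt _ _

lemma Frame.digit_lt_iff (R : Frame m) (t : Fin m → Vec) (i : Fin m) : R.digit t i < 18 ↔ R.circ t i ≠ 0 :=
  dig_lt_iff _ _

lemma Frame.not_all_dvd (R : Frame m) {t : Fin m → Vec} (ht : R.Good t) :
    ¬ (∀ i, R.digit t i % 2 = 0) ∧ ¬ (∀ i, R.digit t i % 3 = 0) := by
  have key : ∀ a : ZMod 18, (∀ i, a * lev lastCovector (t i) = 0) → a = 0 := by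
    intro a ha
    obtain ⟨σ, hσ⟩ := R.span t ht
    have := lev_ext hσ (x := a • lastCovector) (y := 0) fun i => by
      have := ha (σ i)
      simp only [lev, Finset.mul_sum, Pi.smul_apply, smul_eq_mul, mul_assoc, Pi.zero_apply, zero_mul,
        Finset.sum_const_zero, Function.comp] at this ⊢
      exact this
    simpa [lastCovector] using congrFun this 3
  have h2 : ∀ c, Small c → ∀ l, dig c l % 2 = 0 → 9 * l = 0 := by
    rintro _ (rfl | rfl | rfl) <;> decide +kernel
  have h3 : ∀ c, Small c → ∀ l, dig c l % 3 = 0 → 6 * l = 0 := by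
    rintro _ (rfl | rfl | rfl) <;> decide +kernel
  exact ⟨fun h => absurd (key 9 fun i => h2 _ (R.small t ht i) _ (h i)) (by decide),
    fun h => absurd (key 6 fun i => h3 _ (R.small t ht i) _ (h i)) (by decide)⟩

lemma Frame.zero_of_covered (R : Frame m) (hm : m < 8) {b : Bool} {F : (Fin m → Vec) → ℂ} (hF : Twisted b F)
    {T : Table} (hT : ∀ D K, T.Mem K D → R.Zero F K) {t : Fin m → Vec} (ht : R.Good t) (σ : Equiv.Perm (Fin m))
    (h : covered T b (List.ofFn (R.digit t ∘ σ)) = true) : F t = 0 := by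
  have hc : ∀ i, Code ((R.circ t ∘ σ) i) (((fun i => lev lastCovector (t i)) ∘ σ) i) ((R.digit t ∘ σ) i) :=
    fun i => code_dig _ _
  have hkey (u : (ZMod 18)ˣ) : key (R.circ t ∘ σ)
      (fun j => (u : ZMod 18) * ((fun i => lev lastCovector (t i)) ∘ σ) j) =
      key (R.circ t) (levs lastCovector u t) := key_perm (R.circ t) (levs lastCovector u t) σ
  obtain ⟨h2, h3⟩ := R.not_all_dvd ht
  simp only [covered, Bool.or_eq_true, List.all_eq_true, List.mem_ofFn, Function.comp, Nat.beq_eq,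
    forall_exists_index, forall_apply_eq_imp_iff, Nat.ble_eq] at h
  rcases h with ((h | h) | h) | h
  · exact absurd (fun i => by simpa using h (σ.symm i)) h2
  · exact absurd (fun i => by simpa using h (σ.symm i)) h3
  · obtain ⟨d, hd⟩ : ∃ d, T.find (canon (List.ofFn (R.digit t ∘ σ))) = d + 1 :=
      ⟨_, (Nat.succ_pred_eq_of_pos h).symm⟩
    obtain ⟨u, hu⟩ := exists_canon hm hc
    exact hT d _ (Table.mem_of_find hd) t ht u (by rw [hu, hkey])
  · obtain ⟨u, u', h4, h5⟩ := of_dead hm hc h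
    rw [hkey, hkey] at h4
    obtain ⟨η, hη⟩ := weight_perm b σ
    have hw (u : (ZMod 18)ˣ) : weight b (R.circ t ∘ σ)
        (fun j => (u : ZMod 18) * ((fun i => lev lastCovector (t i)) ∘ σ) j) =
        η * weight b (R.circ t) (levs lastCovector u t) := hη (R.circ t) (levs lastCovector u t)
    rw [hw, hw] at h5
    rcases h5 with h5 | h5
    · exact R.zero_of_weight_ne hm hF ht h4 fun h => h5 (by rw [h])
    · exact R.zero_of_weight_zero hF ht ((mul_eq_zero.1 h5).resolve_left (Units.ne_zero η))

lemma zero_of_coverFour {b : Bool} {F : (Fin 4 → Vec) → ℂ} (hF : Twisted b F) {T : Table}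
    (hT : ∀ D K, T.Mem K D → frameFour.Zero F K) (hc : coverFour T b = true) {t : Fin 4 → Vec}
    (ht : frameFour.Good t) : F t = 0 := by
  refine frameFour.zero_of_covered (by norm_num) hF hT ht (Tuple.sort (frameFour.digit t)) ?_
  refine of_coverFour hc (Tuple.monotone_sort _) (fun i => not_lt.1 fun h => ?_)
    fun i => frameFour.digit_lt t (Tuple.sort (frameFour.digit t) i)
  exact (frameFour.digit_lt_iff t (Tuple.sort (frameFour.digit t) i)).1 h rfl

lemma Twisted.zero_of_eq {b : Bool} {F : (Fin m → Vec) → ℂ} (hF : Twisted b F) {t : Fin m → Vec} {i j : Fin m}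
    (hij : i ≠ j) {ε : ℤˣ} (h : t i = ε • t j) : F t = 0 := by
  have := hF.sym t (Equiv.swap i j) (fun k => if k = i ∨ k = j then ε else 1)
  have h' : t j = ε • t i := by rw [h, ← mul_smul, Int.units_mul_self, one_smul]
  rw [show (fun k => (if k = i ∨ k = j then ε else 1) • t (Equiv.swap i j k)) = t from ?_] at this
  · rw [Equiv.Perm.sign_swap hij] at this
    simpa [self_eq_neg] using this
  · ext1 k
    by_cases hi : k = i
    · subst hi; simp [h]
    · by_cases hj : k = j
      · subst hj; simp [h']
      · simp [hi, hj, Equiv.swap_apply_of_ne_of_ne]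

lemma zero_of_coverFive {b : Bool} {F : (Fin 5 → Vec) → ℂ} (hF : Twisted b F) (h0 : ∀ t i, t i = 0 → F t = 0)
    {T : Table} (hT : ∀ D K, T.Mem K D → frameFive.Zero F K) (hc : coverFive T b = true) {t : Fin 5 → Vec}
    (ht : frameFive.Good t) : F t = 0 := by
  set σ := Tuple.sort (frameFive.digit t)
  have hmono : Monotone (frameFive.digit t ∘ σ) := Tuple.monotone_sort _
  have hcirc : ∀ i, ¬ frameFive.digit t i < 18 → circ t i = 0 := fun i hi => by
    by_contra h; exact hi ((dig_lt_iff _ _).2 h)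
  have hsum := sum_circ t
  by_cases h2 : frameFive.digit t (σ 2) < 18
  · refine frameFive.zero_of_covered (by norm_num) hF hT ht σ (of_coverFive hc hmono
      (fun i => frameFive.digit_lt t (σ i)) h2 ?_)
    simp only [Function.comp]
    rw [Equiv.sum_comp σ fun i => if frameFive.digit t i < 18 then frameFive.digit t i else 0,
      ← ZMod.natCast_eq_zero_iff]
    have h3 := congrArg (lev lastCovector) hsum
    rw [lev_last, lev_last, Finset.sum_apply] at h3
    simp only [Pi.smul_apply, smul_eq_mul, Int.cast_sum, Int.cast_mul, Pi.zero_apply, Int.cast_zero] at h3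
    rw [Nat.cast_sum, ← h3]
    refine Finset.sum_congr rfl fun i _ => ?_
    by_cases hi : frameFive.digit t i < 18
    · rw [if_pos hi]
      have : circ t i ≠ 0 := (dig_lt_iff _ _).1 hi
      simp only [Frame.digit, dig, frameFive, if_neg this, lev_last]
      exact ZMod.natCast_zmod_val _
    · rw [if_neg hi, hcirc i hi]; simp
  · have h3 : ∀ i, 2 ≤ i → circ t (σ i) = 0 := fun i hi => hcirc _ fun h => h2 (lt_of_le_of_lt (hmono hi) h)
    rw [← Equiv.sum_comp σ, Fin.sum_univ_five, h3 2 le_rfl, h3 3 (by decide), h3 4 (by decide)] at hsum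
    simp only [zero_smul, add_zero] at hsum
    obtain ⟨i, hi⟩ := ht.2
    have hi' : circ t (σ 0) ≠ 0 ∨ circ t (σ 1) ≠ 0 := by
      obtain ⟨k, rfl⟩ := σ.surjective i
      fin_cases k
      · exact Or.inl hi
      · exact Or.inr hi
      · exact absurd (h3 2 le_rfl) hi
      · exact absurd (h3 3 (by decide)) hi
      · exact absurd (h3 4 (by decide)) hi
    have hne : σ 0 ≠ σ 1 := fun h => by simpa using σ.injective h
    rcases ht.1 (σ 0) with h4 | h4 | h4 <;> rcases ht.1 (σ 1) with h5 | h5 | h5 <;> rw [h4, h5] at hsum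
    · exact absurd hi' (by simp [h4, h5])
    · exact h0 t (σ 1) (by simpa using hsum)
    · exact h0 t (σ 1) (by simpa using hsum)
    · exact h0 t (σ 0) (by simpa using hsum)
    · exact hF.zero_of_eq hne (ε := -1) (by simpa [Units.smul_def] using eq_neg_of_add_eq_zero_left hsum)
    · exact hF.zero_of_eq hne (ε := 1) (by simpa [Units.smul_def, add_neg_eq_zero] using hsum)
    · exact h0 t (σ 0) (by simpa using hsum)
    · exact hF.zero_of_eq hne (ε := 1) (by simpa [Units.smul_def, neg_add_eq_zero, eq_comm] using hsum)
    · exact hF.zero_of_eq hne (ε := -1) (by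
        simp only [neg_smul, one_smul, Units.smul_def, Units.val_neg, Units.val_one] at hsum ⊢
        rw [eq_comm, neg_eq_iff_add_eq_zero, ← neg_eq_zero, neg_add, add_comm]; exact hsum)

end Voronoi

namespace Voronoi

lemma coverFour_even : coverFour tableFourEven true = true := by decide +kernel

lemma coverFour_odd : coverFour tableFourOdd false = true := by decide +kernel

lemma coverFive_even : coverFive tableFiveEven true = true := by decide +kernel

lemma coverFive_odd : coverFive tableFiveOdd false = true := by decide +kernel

end Voronoi

namespace Voronoi

open Matrix Finset

/-- Tuples of vectors whose lines form a cell. -/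
def IsCell {m : ℕ} (t : Fin m → Vec) : Prop := quaternary.Cell (Set.range (Line.mk ∘ t))

section Action

attribute [local instance] arrowAction

variable {m : ℕ} {t : Fin m → Vec}

lemma IsCell.act {g : Matrix (Fin 4) (Fin 4) ℤ} (hg : IsUnit g.det) (ht : IsCell t) : IsCell (act g t) := by
  obtain ⟨h, φ, hφ, ψ, hψ, hne, h1, h2⟩ := ht
  let γ : GL (Fin 4) ℤ := GeneralLinearGroup.mk'' g hg
  have hγ (i) : γ⁻¹ • (Line.mk ∘ Voronoi.act g t) i = Line.mk (t i) :=
    inv_smul_smul γ (Line.mk (t i))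
  have hm {χ : Line → ℤ} (h : VoronoiData.Mins χ (Set.range (Line.mk ∘ t))) :
      VoronoiData.Mins (γ • χ) (Set.range (Line.mk ∘ Voronoi.act g t)) := by
    rintro _ ⟨i, rfl⟩
    change χ (γ⁻¹ • _) = 2
    rw [hγ]
    exact h _ ⟨i, rfl⟩
  refine ⟨fun w hw => ?_, _, gl_smul_perfect γ hφ, _, gl_smul_perfect γ hψ,
    fun h => hne (smul_left_cancel γ h), hm h1, hm h2⟩
  obtain ⟨_, ⟨i, rfl⟩, hx⟩ := h _ (gl_smul_square γ⁻¹ hw)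
  refine ⟨_, ⟨i, rfl⟩, ?_⟩
  change w ((γ⁻¹)⁻¹ • _) ≠ 0 at hx
  rwa [inv_inv] at hx

end Action

variable {m : ℕ} {t : Fin m → Vec}

lemma IsCell.congr {m' : ℕ} {t' : Fin m' → Vec} (ht : IsCell t)
    (h : Set.range (Line.mk ∘ t) = Set.range (Line.mk ∘ t')) : IsCell t' := by
  rwa [IsCell, ← h]

lemma IsCell.sym (ht : IsCell t) (π : Equiv.Perm (Fin m)) (ε : Fin m → ℤˣ) :
    IsCell fun i => ε i • t (π i) := by
  refine ht.congr ?_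
  rw [← π.surjective.range_comp]
  congr 1
  funext i
  exact (Line.mk_units _ _).symm

lemma spans_iff : quaternary.Spans (Set.range (Line.mk ∘ t)) ↔ ¬ Flat t := by
  have h (w : Vec) (i : Fin m) : form (squareCoeff w) (Line.mk (t i)) ≠ 0 ↔ t i ⬝ᵥ w ≠ 0 := by
    rw [form_mk, squareCoeff_dot, dotProduct_comm]
    exact (pow_ne_zero_iff two_ne_zero)
  refine ⟨fun hs ⟨w, hw, hf⟩ => ?_, ?_⟩
  · obtain ⟨_, ⟨i, rfl⟩, hi⟩ := hs _ ⟨w, hw, rfl⟩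
    exact (h w i).1 hi (hf i)
  · rintro hf _ ⟨w, hw, rfl⟩
    by_contra! hc
    refine hf ⟨w, hw, fun i => ?_⟩
    by_contra hi
    exact (h w i).2 hi (hc _ ⟨i, rfl⟩)

lemma IsCell.not_flat (ht : IsCell t) : ¬ Flat t := spans_iff.1 ht.1

lemma IsCell.comp {m' : ℕ} (ht : IsCell t) (σ : Fin m' → Fin m) (h : ¬ Flat (t ∘ σ)) : IsCell (t ∘ σ) :=
  VoronoiData.Cell.subset quaternary ht (Set.range_comp_subset_range σ (Line.mk ∘ t)) (spans_iff.2 h)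

lemma exists_det_ne (h : ¬ Flat t) : ∃ σ : Fin 4 → Fin m, (of (t ∘ σ)).det ≠ 0 := by
  obtain ⟨V, hV, hm⟩ := exists_independent (spans_iff.2 h)
  choose σ hσ using hm
  refine ⟨σ, fun h0 => hV ?_⟩
  have : ∀ i, ∃ ε : ℤˣ, V.col i = ε • t (σ i) := fun i => by
    rcases Line.mk_eq.1 (hσ i) with h | h
    · exact ⟨1, by rw [one_smul, h]; rfl⟩
    · exact ⟨-1, by rw [Units.neg_smul, one_smul, h, neg_neg]; rfl⟩
  choose ε hε using this
  have h1 := det_perm_flip (t ∘ σ) 1 ε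
  rw [h0, mul_zero, mul_zero] at h1
  rw [← det_transpose, ← h1]
  congr 1
  ext i j
  exact congrFun (hε i) j

lemma not_flat_of_det {σ : Fin 4 → Fin m} (h : (of (t ∘ σ)).det ≠ 0) : ¬ Flat t := by
  rintro ⟨w, hw, hf⟩
  refine h (exists_mulVec_eq_zero_iff.1 ⟨w, hw, ?_⟩)
  ext i
  exact hf (σ i)

lemma sort_four {n : ℕ} {P : (Fin 4 → Fin n) → Prop} (hinv : ∀ σ (π : Equiv.Perm (Fin 4)), P (σ ∘ π) → P σ)
    (h0 : ∀ σ, ¬ Function.Injective σ → P σ) (hs : ∀ a b, a < b → ∀ c, b < c → ∀ d, c < d → P ![a, b, c, d])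
    (σ : Fin 4 → Fin n) : P σ := by
  by_cases h : Function.Injective σ
  · refine hinv σ (Tuple.sort σ) ?_
    have hm : StrictMono (σ ∘ Tuple.sort σ) :=
      (Tuple.monotone_sort σ).strictMono_of_injective (h.comp (Tuple.sort σ).injective)
    generalize σ ∘ Tuple.sort σ = ρ at hm ⊢
    rw [show ρ = ![ρ 0, ρ 1, ρ 2, ρ 3] by ext i; fin_cases i <;> rfl]
    exact hs _ _ (hm (by decide)) _ (hm (by decide)) _ (hm (by decide))
  · exact h0 σ h

lemma det_of_not_injective (r : Fin m → Vec) {σ : Fin 4 → Fin m} (h : ¬ Function.Injective σ) :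
    (of (r ∘ σ)).det = 0 := by
  simp only [Function.Injective, not_forall] at h
  obtain ⟨i, j, hij, hne⟩ := h
  refine det_zero_of_row_eq hne ?_
  exact congrArg r hij

lemma minors {n : ℕ} (r : Fin n → Vec) (Q : Set (Fin n) → Prop)
    (h : ∀ a b, a < b → ∀ c, b < c → ∀ d, c < d → Small (det4 (of (r ∘ ![a, b, c, d]))) ∨
      Q (Set.range ![a, b, c, d])) (σ : Fin 4 → Fin n) : Small (of (r ∘ σ)).det ∨ Q (Set.range σ) := by
  refine sort_four (P := fun σ => Small (of (r ∘ σ)).det ∨ Q (Set.range σ)) (fun σ π hσ => ?_)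
    (fun σ hσ => Or.inl (Or.inl (det_of_not_injective r hσ))) (by simpa only [det4_eq] using h) σ
  rw [π.surjective.range_comp] at hσ
  refine hσ.imp_left fun h1 => ?_
  have h2 := det_permute_int π (of (r ∘ σ))
  change (of (r ∘ σ ∘ π)).det = _ at h2
  rw [h2] at h1
  rcases Int.units_eq_one_or (Equiv.Perm.sign π) with h | h <;> rw [h] at h1
  · simpa using h1
  · simp only [Small] at h1 ⊢
    push_cast at h1
    omega

lemma minorA (σ : Fin 4 → Fin 10) : Small (of (rootsA 0 ∘ σ)).det :=
  (minors (rootsA 0) (fun _ => False) (by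
    have : ∀ a b, a < b → ∀ c, b < c → ∀ d, c < d → Small (det4 (of (rootsA 0 ∘ ![a, b, c, d]))) := by
      decide +kernel
    exact fun a b hb c hc d hd => Or.inl (this a b hb c hc d hd)) σ).resolve_right id

lemma minorD (σ : Fin 4 → Fin (3 * 4)) : Small (of ((fun i : Fin (3 * 4) => rootsD i.divNat i.modNat) ∘ σ)).det ∨
    ∃ b : Fin 3, ∀ j : Fin 4, finProdFinEquiv (b, j) ∈ Set.range σ :=
  minors _ (fun S => ∃ b : Fin 3, ∀ j : Fin 4, finProdFinEquiv (b, j) ∈ S) (by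
    simp only [Set.mem_range]
    decide +kernel) σ

lemma small_of_units {t s : Fin 4 → Vec} {g : Matrix (Fin 4) (Fin 4) ℤ} (hg : IsUnit g.det) {ε : Fin 4 → ℤˣ}
    (h : ∀ i, g *ᵥ t i = ε i • s i) (hs : Small (of s).det) : Small (of t).det := by
  have h1 := of_act g t
  have h2 := det_perm_flip s 1 ε
  rw [show act g t = fun i => ε i • s ((1 : Equiv.Perm (Fin 4)) i) from funext h, h2, Equiv.Perm.sign_one,
    Units.val_one, one_mul] at h1
  have h3 : Small (g.det * (of t).det) := by
    rw [← h1]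
    exact small_mul (by rw [← Units.coe_prod]; exact Units.isUnit _) hs
  rcases Int.isUnit_iff.1 hg with h | h <;> rw [h] at h3 <;> simp only [Small] at h3 ⊢ <;> omega

lemma root_one_perfect : form (root 1) ∈ Perfect := by
  have h : root 1 = coded 213642584377 := by decide +kernel
  rw [h]
  exact coded_perfect (by decide +kernel)

/-- Every simplex in a cell is degenerate or unimodular. -/
lemma IsCell.small (ht : IsCell t) (σ : Fin 4 → Fin m) : Small (of (t ∘ σ)).det := by
  obtain ⟨-, _, ⟨k, g, rfl⟩, _, -, -, hφ, -⟩ := id ht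
  have hg : IsUnit (g : Matrix (Fin 4) (Fin 4) ℤ).det := ⟨GeneralLinearGroup.det g, rfl⟩
  have hr (i : Fin m) : root k ⬝ᵥ mono ((g : Matrix (Fin 4) (Fin 4) ℤ) *ᵥ t i) = 2 := by
    rw [← form_smul_root]
    exact hφ _ ⟨i, rfl⟩
  have he {v w : Vec} (h : w = v ∨ w = -v) : ∃ ε : ℤˣ, v = ε • w := by
    rcases h with h | h
    · exact ⟨1, by rw [one_smul, h]⟩
    · exact ⟨-1, by rw [Units.neg_smul, one_smul, h, neg_neg]⟩
  fin_cases k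
  · choose b j hj using fun i => rootsA_mem _ (hr i)
    choose ε hε using fun i => he (hj i)
    refine small_of_units hg (ε := ε ∘ σ) (s := rootsA 0 ∘ j ∘ σ) (fun i => ?_) (minorA _)
    rw [Function.comp_apply, hε, Fin.fin_one_eq_zero (b (σ i))]
    rfl
  · choose b j hj using fun i => rootsD_mem _ (hr i)
    choose ε hε using fun i => he (hj i)
    have hm : VoronoiData.Mins (form (root 1)) (Set.range (Line.mk ∘ Voronoi.act g.1 t)) := by
      rintro _ ⟨i, rfl⟩
      exact (form_mk _ _).trans (hr i)
    obtain ⟨-, s, hs⟩ := (VoronoiData.cell_iff root_one_perfect chartD hm).1 (ht.act hg)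
    rcases minorD (fun i => finProdFinEquiv (b (σ i), j (σ i))) with h | ⟨c, hc⟩
    · refine small_of_units hg (ε := ε ∘ σ) (fun i => ?_) h
      have := congrArg (fun p : Fin 3 × Fin 4 => rootsD p.1 p.2)
        (finProdFinEquiv.symm_apply_apply (b (σ i), j (σ i)))
      rw [Function.comp_apply, hε]
      exact congrArg _ this.symm
    · obtain ⟨i, hi⟩ := hc (s c)
      obtain ⟨h1, h2⟩ : b (σ i) = c ∧ j (σ i) = s c := Prod.ext_iff.1 (finProdFinEquiv.injective hi)
      refine absurd ⟨σ i, ?_⟩ (hs c)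
      change Line.mk (_ *ᵥ _) = Line.mk (rootsD c (s c))
      rw [hε, Line.mk_units, h1, h2]

lemma IsCell.good_four {t : Fin 4 → Vec} (ht : IsCell t) : frameFour.Good t := by
  obtain ⟨σ, hσ⟩ := exists_det_ne ht.not_flat
  have hi : Function.Injective σ := by
    by_contra h
    exact hσ (det_of_not_injective t h)
  have h2 := det_permute_int (Equiv.ofBijective σ (Finite.injective_iff_bijective.1 hi)) (of t)
  change (of (t ∘ σ)).det = _ at h2
  have h3 := ht.small id
  change IsUnit (of t).det
  rw [Int.isUnit_iff]
  refine h3.resolve_left fun h => hσ ?_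
  rw [h2]
  exact mul_eq_zero_of_right _ h

lemma IsCell.good_five {t : Fin 5 → Vec} (ht : IsCell t) : frameFive.Good t := by
  refine ⟨fun i => ?_, ?_⟩
  · exact small_mul ((isUnit_one.neg).pow _) (ht.small _)
  · obtain ⟨σ, hσ⟩ := exists_det_ne ht.not_flat
    have hi : Function.Injective σ := by
      by_contra h
      exact hσ (det_of_not_injective t h)
    obtain ⟨i, hi'⟩ : ∃ i, ∀ k, σ k ≠ i := by
      by_contra! h
      have := Fintype.card_le_of_surjective σ h
      simp at this
    choose τ hτ using fun k => Fin.exists_succAbove_eq (hi' k)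
    have hτi : Function.Injective τ := fun a b h => hi (by rw [← hτ, ← hτ, h])
    have h2 := det_permute_int (Equiv.ofBijective τ (Finite.injective_iff_bijective.1 hτi))
      (of (t ∘ i.succAbove))
    have h4 : (of (t ∘ i.succAbove)).submatrix (Equiv.ofBijective τ (Finite.injective_iff_bijective.1 hτi)) id =
        of (t ∘ σ) := by
      ext k l
      exact congrFun (congrArg t (hτ k)) l
    refine ⟨i, fun h => hσ ?_⟩
    rw [← h4, h2]
    have : (of (t ∘ i.succAbove)).det = 0 := by
      rcases neg_one_pow_eq_or ℤ (i : ℕ) with h' | h' <;> simpa [frameFive, circ, h'] using h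
    rw [this, mul_zero]

lemma IsCell.ne_zero (ht : IsCell t) (i : Fin m) : t i ≠ 0 := by
  intro h0
  obtain ⟨_, φ, _, _, _, _, h, _⟩ := ht
  obtain ⟨k, g, rfl⟩ := ‹φ ∈ _›
  have := h _ ⟨i, rfl⟩
  rw [Function.comp_apply, form_smul_root, h0, mulVec_zero] at this
  revert this
  fin_cases k <;> decide +kernel

end Voronoi

namespace Voronoi

open Matrix Finset

attribute [local instance] arrowAction

variable {m : ℕ}

lemma isCell_of_codes {t : Fin m → Vec} {n n' : ℕ} (h : det4 (decode n) = 1 ∨ det4 (decode n) = -1)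
    (h' : det4 (decode n') = 1 ∨ det4 (decode n') = -1) (hne : coded n ≠ coded n')
    (ht : ∀ i, coded n ⬝ᵥ mono (t i) = 2 ∧ coded n' ⬝ᵥ mono (t i) = 2) (hf : ¬ Flat t) : IsCell t := by
  refine ⟨spans_iff.2 hf, _, coded_perfect h, _, coded_perfect h', fun h => hne (form_injective h), ?_, ?_⟩
  · rintro _ ⟨i, rfl⟩
    exact (ht i).1
  · rintro _ ⟨i, rfl⟩
    exact (ht i).2

def codesSix : List (ℕ × ℕ) := [(76318553385, 76396522175), (76431647135, 78853703385),
  (76396522175, 76431647135), (76981678175, 76982451925)]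

def codesFive : List (ℕ × ℕ) := [(76318553385, 76396522175), (76981678175, 76982451925),
  (78935578165, 78951178175)]

lemma isCell_six {τ : ℕ} (hτ : τ ≤ 3) : IsCell (templateSix τ) := by
  have h : ∀ τ : Fin 4, det4 (of (templateSix τ ∘ ![0, 1, 2, 3])) ≠ 0 ∧
      (fun n n' => (det4 (decode n) = 1 ∨ det4 (decode n) = -1) ∧ (det4 (decode n') = 1 ∨ det4 (decode n') = -1) ∧
        coded n ≠ coded n' ∧ ∀ i, coded n ⬝ᵥ mono (templateSix τ i) = 2 ∧
          coded n' ⬝ᵥ mono (templateSix τ i) = 2) (codesSix.getD τ 0).1 (codesSix.getD τ 0).2 := by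
    decide +kernel
  obtain ⟨h0, h1, h2, h3, h4⟩ := h ⟨τ, by omega⟩
  exact isCell_of_codes h1 h2 h3 h4 (not_flat_of_det (by rwa [det4_eq]))

lemma isCell_five {τ : ℕ} (hτ : τ ≤ 2) : IsCell (templateFive τ) := by
  have h : ∀ τ : Fin 3, det4 (of (templateFive τ ∘ ![0, 1, 2, 3])) ≠ 0 ∧
      (fun n n' => (det4 (decode n) = 1 ∨ det4 (decode n) = -1) ∧ (det4 (decode n') = 1 ∨ det4 (decode n') = -1) ∧
        coded n ≠ coded n' ∧ ∀ i, coded n ⬝ᵥ mono (templateFive τ i) = 2 ∧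
          coded n' ⬝ᵥ mono (templateFive τ i) = 2) (codesFive.getD τ 0).1 (codesFive.getD τ 0).2 := by
    decide +kernel
  obtain ⟨h0, h1, h2, h3, h4⟩ := h ⟨τ, by omega⟩
  exact isCell_of_codes h1 h2 h3 h4 (not_flat_of_det (by rwa [det4_eq]))

/-- Invariant alternating functions on the cells. -/
noncomputable abbrev Cochain (m : ℕ) : Submodule ℂ ((Fin m → Line) → ℂ) := quaternary.inv (Gamma0 18) m

lemma inv_gl (f : Cochain m) {h : Matrix (Fin 4) (Fin 4) ℤ} (hd : h.det = 1)
    (hl : ∀ j, j ≠ 3 → (18 : ℤ) ∣ h 3 j) (t : Fin m → Vec) : f.1 (Line.mk ∘ act h t) = f.1 (Line.mk ∘ t) := by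
  obtain ⟨γ, hγ⟩ := exists_gammaHom (N := 18) (GeneralLinearGroup.mk'' h (by rw [hd]; exact isUnit_one)) hd hl
  have h1 : γ • (Line.mk ∘ t) = Line.mk ∘ act h t := by
    funext i
    change γ • Line.mk (t i) = _
    rw [gamma_smul, hγ]
    rfl
  have h2 := congrFun (f.2.2.1 γ) (γ • (Line.mk ∘ t))
  rwa [tr_apply, inv_smul_smul, h1, eq_comm] at h2

lemma inv_support (f : Cochain m) {t : Fin m → Vec} (h : ¬ IsCell t) : f.1 (Line.mk ∘ t) = 0 := by
  by_contra h0
  exact h (f.2.2.2 _ h0)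

def reflection : Matrix (Fin 4) (Fin 4) ℤ := diagonal ![-1, 1, 1, 1]

lemma reflection_det : reflection.det = -1 := by rw [det4_eq]; decide +kernel

lemma reflection_sq : reflection * reflection = 1 := by decide +kernel

lemma act_act (g h : Matrix (Fin 4) (Fin 4) ℤ) (t : Fin m → Vec) : act g (act h t) = act (g * h) t :=
  funext fun i => mulVec_mulVec (t i) g h

lemma act_one (t : Fin m → Vec) : act 1 t = t := funext fun i => one_mulVec (t i)

/-- The components of functions of lines under the reflection. -/
def part (b : Bool) : ((Fin m → Line) → ℂ) →ₗ[ℂ] (Fin m → Vec) → ℂ where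
  toFun f t := f (Line.mk ∘ t) + (if b then 1 else -1) * f (Line.mk ∘ act reflection t)
  map_add' f g := funext fun t => by simp only [Pi.add_apply]; ring
  map_smul' a f := funext fun t => by simp only [Pi.smul_apply, smul_eq_mul, RingHom.id_apply]; ring

lemma part_apply (b : Bool) (f : (Fin m → Line) → ℂ) (t) :
    part b f t = f (Line.mk ∘ t) + (if b then 1 else -1) * f (Line.mk ∘ act reflection t) := rfl

lemma part_twisted (b : Bool) (f : Cochain m) : Twisted b (part b f.1) := by
  have hs (t : Fin m → Vec) (π : Equiv.Perm (Fin m)) (ε : Fin m → ℤˣ) :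
      f.1 (Line.mk ∘ fun i => ε i • t (π i)) = ((Equiv.Perm.sign π : ℤ) : ℂ) * f.1 (Line.mk ∘ t) := by
    rw [← f.2.1 (Line.mk ∘ t) π]
    exact congrArg f.1 (funext fun i => Line.mk_units _ _)
  refine ⟨fun t π ε => ?_, fun t h δ hd hl => ?_⟩
  · have : (act reflection fun i => ε i • t (π i)) = fun i => ε i • act reflection t (π i) :=
      funext fun i => by
        rcases Int.units_eq_one_or (ε i) with h | h <;> simp [act, h, mulVec_neg]
    rw [part_apply, part_apply, this, hs, hs]
    ring
  · have hr (j : Fin 4) (hj : j ≠ 3) : (18 : ℤ) ∣ (reflection * h) 3 j := by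
      simpa [reflection, diagonal_mul] using hl j hj
    have hr' {h : Matrix (Fin 4) (Fin 4) ℤ} (hl : ∀ j : Fin 4, j ≠ 3 → (18 : ℤ) ∣ h 3 j) (j : Fin 4) (hj : j ≠ 3) :
        (18 : ℤ) ∣ (h * reflection) 3 j := by
      rw [reflection, mul_diagonal]
      exact (hl j hj).mul_right _
    have h1 : act h t = act (h * reflection) (act reflection t) := by
      rw [act_act, Matrix.mul_assoc, reflection_sq, Matrix.mul_one]
    have h2 : act reflection (act h t) = act (reflection * h * reflection) (act reflection t) := by
      rw [act_act, act_act, Matrix.mul_assoc _ reflection, reflection_sq, Matrix.mul_one]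
    rcases Int.units_eq_one_or δ with rfl | rfl
    · rw [part_apply, part_apply, h2, inv_gl f hd hl,
        inv_gl f (by rw [det_mul, det_mul, reflection_det, hd]; norm_num) (hr' hr)]
      simp
    · rw [part_apply, part_apply, act_act, h1, inv_gl f (by rw [det_mul, reflection_det, hd]; norm_num) (hr' hl),
        inv_gl f (by rw [det_mul, reflection_det, hd]; norm_num) hr]
      cases b <;> simp [add_comm]

lemma isCell_reflection {t : Fin m → Vec} : IsCell (act reflection t) ↔ IsCell t := by
  have hu : IsUnit reflection.det := by rw [reflection_det]; exact isUnit_one.neg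
  refine ⟨fun h => ?_, IsCell.act hu⟩
  have := h.act hu
  rwa [act_act, reflection_sq, act_one] at this

lemma part_support (b : Bool) (f : Cochain m) {t : Fin m → Vec} (h : ¬ IsCell t) : part b f.1 t = 0 := by
  rw [part_apply, inv_support f h, inv_support f (isCell_reflection.not.2 h)]
  simp

lemma bd_part (b : Bool) (f : (Fin m → Line) → ℂ) (t : Fin (m + 1) → Vec) :
    bd (part b f) t = part b (bd f) t := by
  simp only [bd, part_apply, mul_add, Finset.sum_add_distrib, Finset.mul_sum]
  congr 1
  exact Finset.sum_congr rfl fun i _ => mul_left_comm _ _ _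

lemma part_closed (b : Bool) {f : (Fin m → Line) → ℂ} (hf : quaternary.cbd f = 0) {s : Fin (m + 1) → Vec}
    (hs : IsCell s) (x) : Closed (part b f) s x := by
  intro g δ u hg _
  have h (t : Fin (m + 1) → Vec) (ht : IsCell t) : bd f (Line.mk ∘ t) = 0 :=
    (if_pos ht).symm.trans (congrFun hf (Line.mk ∘ t))
  have hg := hs.act (g := g) (by rw [hg]; exact δ.isUnit)
  rw [bd_part, part_apply, h _ hg, h _ (isCell_reflection.2 hg)]
  simp

lemma eq_zero_of_part {f : (Fin m → Line) → ℂ} (h : ∀ b, part b f = 0) : f = 0 := by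
  funext L
  choose t ht using fun i => (L i).exists_mk
  have h1 := congrFun (h true) t
  have h2 := congrFun (h false) t
  rw [part_apply] at h1 h2
  rw [show L = Line.mk ∘ t from funext fun i => (ht i).symm]
  have h3 : f (Line.mk ∘ t) * 2 = 0 := by
    have := congrArg₂ (· + ·) h1 h2
    simpa [mul_two, ← add_assoc, add_right_comm] using this
  simpa using h3

lemma Frame.zero_of_gl (R : Frame m) (hm : m < 8) {b : Bool} {F : (Fin m → Vec) → ℂ} (hF : Twisted b F)
    {t₀ : Fin m → Vec} (h₀ : R.Good t₀) {u : (ZMod 18)ˣ} (h : F t₀ = 0) :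
    R.Zero F (key (R.circ t₀) (levs lastCovector u t₀)) := by
  refine R.zero_of_vanish hm hF h₀ (fun g δ u hg hu => ?_) u
  rw [hF.gl t₀ g δ hg hu.dvd, h, mul_zero]

open Classical in
/-- A tuple with a given key. -/
noncomputable def Frame.pick (R : Frame m) (K : ℕ) : Fin m → Vec :=
  if h : ∃ t, R.Good t ∧ ∃ u, key (R.circ t) (levs lastCovector u t) = K then h.choose else 0

lemma Frame.zero_of_pick (R : Frame m) (hm : m < 8) {b : Bool} {F : (Fin m → Vec) → ℂ} (hF : Twisted b F) {K : ℕ}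
    (h : F (R.pick K) = 0) : R.Zero F K := by
  intro t ht u hu
  have hex : ∃ t, R.Good t ∧ ∃ u, key (R.circ t) (levs lastCovector u t) = K := ⟨t, ht, u, hu⟩
  obtain ⟨h1, u', h2⟩ := hex.choose_spec
  rw [Frame.pick, dif_pos hex] at h
  exact R.zero_of_gl hm hF h1 h t ht u (hu.trans h2.symm)

/-- The keys with values satisfying a predicate. -/
noncomputable def Table.keys (p : ℕ → Bool) (T : Table) : List ℕ :=
  Table.rec [] (fun _ k d _ a b => bif p d then k :: (a ++ b) else a ++ b) T

lemma Table.mem_keys {p : ℕ → Bool} {K D : ℕ} (hp : p D = true) {T : Table} (h : T.Mem K D) : K ∈ T.keys p := by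
  induction T with
  | nil => exact h.elim
  | node l k d r hl hr =>
    change K ∈ bif p d then k :: (l.keys p ++ r.keys p) else l.keys p ++ r.keys p
    rcases h with ⟨rfl, rfl⟩ | h | h
    · rw [hp]; exact List.mem_cons_self
    · cases p d <;> simp [hl h]
    · cases p d <;> simp [hr h]

lemma finrank_le_of_keys (R : Frame m) (hm : m < 8) (M : Submodule ℂ (Cochain m)) (k : Bool → List ℕ)
    (h : ∀ f ∈ M, ∀ b, (∀ K ∈ k b, R.Zero (part b f.1) K) → part b f.1 = 0) :
    Module.finrank ℂ M ≤ (k true).length + (k false).length := by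
  let ev (b : Bool) : M →ₗ[ℂ] Fin (k b).length → ℂ :=
    LinearMap.pi fun i => LinearMap.proj (R.pick ((k b).get i)) ∘ₗ part b ∘ₗ (Cochain m).subtype ∘ₗ M.subtype
  have h1 := LinearMap.finrank_le_finrank_of_injective (f := (ev true).prod (ev false)) ?_
  · simpa using h1
  · refine (injective_iff_map_eq_zero _).2 fun f hf => Subtype.ext (Subtype.ext (eq_zero_of_part fun b => ?_))
    refine h f.1 f.2 b fun K hK => R.zero_of_pick hm (part_twisted b f.1) ?_
    obtain ⟨i, rfl⟩ := List.get_of_mem hK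
    have h2 : ev b f = 0 := by
      cases b
      · exact congrArg Prod.snd hf
      · exact congrArg Prod.fst hf
    exact congrFun h2 i

lemma part_flat (b : Bool) (f : Cochain m) (t : Fin m → Vec) (h : Flat t) : part b f.1 t = 0 :=
  part_support b f fun ht => ht.not_flat h

lemma cbd_eq_zero {M : Cochain m} (h : M ∈ LinearMap.ker ((quaternary_equivariant 18).cbdInv m)) :
    quaternary.cbd M.1 = 0 := congrArg Subtype.val h

/-- The keys of the classes not eliminated by a table. -/
noncomputable def Table.residual (T : Table) : List ℕ := T.keys fun D => Nat.ble D 2519423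

lemma part_five {b : Bool} {T : Table} (hT : T.all (stepOK 5 b T (lookup patternsSix) fun τ _ => Nat.ble τ 3) = true)
    (hc : coverFive T b = true) {f : Cochain 5} (hf : quaternary.cbd f.1 = 0)
    (h : ∀ K ∈ T.residual, frameFive.Zero (part b f.1) K) : part b f.1 = 0 := by
  have hF := part_twisted b f
  funext t
  by_cases ht : IsCell t
  · refine zero_of_coverFive hF (fun t i hi => part_support b f fun h => h.ne_zero i hi) (T := T) ?_ hc ht.good_five
    refine zero_of_step (by norm_num) hF (part_flat b f) (S := templateSix) (fun τ X h => ?_) hT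
      fun K D hK hD => h K (Table.mem_keys (by rwa [Nat.ble_eq]) hK)
    have hτ := (Nat.ble_eq ▸ h : τ ≤ 3)
    exact ⟨coded_six hτ, part_closed b hf (isCell_six hτ) _⟩
  · exact part_support b f ht

lemma part_four {b : Bool} {T : Table} {ok : ℕ → ℕ → Bool} (hT : T.all (stepOK 4 b T (lookup patternsFive) ok) = true)
    (hc : coverFour T b = true) {f : Cochain 4} (hf : ∀ τ X, ok τ X = true → τ ≤ 2 ∧
      Closed (part b f.1) (templateFive τ) (covec X))
    (h : ∀ K ∈ T.residual, frameFour.Zero (part b f.1) K) : part b f.1 = 0 := by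
  have hF := part_twisted b f
  funext t
  by_cases ht : IsCell t
  · refine zero_of_coverFour hF (T := T) ?_ hc ht.good_four
    exact zero_of_step (by norm_num) hF (part_flat b f) (S := templateFive)
      (fun τ X h => ⟨coded_five (hf τ X h).1, (hf τ X h).2⟩) hT
      fun K D hK hD => h K (Table.mem_keys (by rwa [Nat.ble_eq]) hK)
  · exact part_support b f ht

lemma finrank_ker_five : Module.finrank ℂ (LinearMap.ker ((quaternary_equivariant 18).cbdInv 5)) ≤ 177 := by
  refine (finrank_le_of_keys frameFive (by norm_num) _
    (fun b => (if b then tableFiveEven else tableFiveOdd).residual) fun f hf b h => ?_).trans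
    (show tableFiveEven.residual.length + tableFiveOdd.residual.length ≤ 177 by decide +kernel)
  cases b
  · exact part_five tableFiveOdd_step coverFive_odd (cbd_eq_zero hf) h
  · exact part_five tableFiveEven_step coverFive_even (cbd_eq_zero hf) h

end Voronoi

namespace Voronoi

open Matrix Finset

attribute [local instance] arrowAction

variable {m : ℕ}

/-- The sum of a function of keys over the symbols of a tuple. -/
noncomputable def Frame.total (R : Frame m) (b : Bool) (T : ℕ → ℂ) (x : Fin 4 → ZMod 18) (t : Fin m → Vec) : ℂ :=
  ∑ u, weight b (R.circ t) (levs x u t) * T (key (R.circ t) (levs x u t))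

lemma Frame.total_match (R : Frame m) (b : Bool) (T : ℕ → ℂ) {x x' : Fin 4 → ZMod 18} {t t' : Fin m → Vec}
    (π : Equiv.Perm (Fin m)) (ε : Fin m → ℤˣ) (v : (ZMod 18)ˣ) (h : ∀ i, R.circ t' (π i) = ε i * R.circ t i ∧
      v * lev x' (t' (π i)) = (ε i : ℤ) * lev x (t i)) :
    R.total b T x' t' = ((twist b π ε : ℤ) : ℂ) * R.total b T x t := by
  rw [Frame.total, ← Equiv.sum_comp (Equiv.mulLeft v), Frame.total, Finset.mul_sum]
  refine Finset.sum_congr rfl fun u _ => ?_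
  have h' : ∀ i, R.circ t' (π i) = ε i * R.circ t i ∧
      levs x' (v * u) t' (π i) = (ε i : ℤ) * levs x u t i := fun i => ⟨(h i).1, by
    simp only [levs, Units.val_mul, mul_left_comm _ (u : ZMod 18), ← (h i).2]; ring⟩
  rw [Equiv.coe_mulLeft, weight_match b h', key_match h', Int.cast_mul, mul_assoc]

/-- The twisted function of tuples attached to a function of keys. -/
noncomputable def Frame.wave (R : Frame m) (b : Bool) (T : ℕ → ℂ) (x : Fin 4 → ZMod 18) (t : Fin m → Vec) : ℂ :=
  (if b then 1 else (R.orient t : ℂ)) * R.total b T x t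

def unitOf (δ : ℤˣ) : (ZMod 18)ˣ := Units.map (Int.castRingHom (ZMod 18)) δ

lemma Frame.wave_act (R : Frame m) (b : Bool) (T : ℕ → ℂ) {g : Matrix (Fin 4) (Fin 4) ℤ} {δ : ℤˣ}
    (hg : g.det = δ) {v : (ZMod 18)ˣ} {x} (hv : Compat g v x) (t : Fin m → Vec) :
    R.wave b T lastCovector (act g t) = (if b then 1 else ((δ : ℤ) : ℂ)) * R.wave b T x t := by
  rw [Frame.wave, Frame.wave, R.total_match b T (x := x) (t := t) 1 (fun _ => δ) (unitOf δ * v⁻¹)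
    fun i => ⟨by rw [Equiv.Perm.one_apply, R.circ_act, hg], ?_⟩]
  · have h := congrArg (Int.cast : ℤ → ℂ) (R.orient_act t g δ hg)
    push_cast at h
    cases b <;> simp [twist]
    linear_combination h * R.total false T x t
  · rw [Equiv.Perm.one_apply, act, hv, Units.val_mul, mul_assoc, Units.inv_mul_cancel_left]
    rfl

lemma Frame.wave_sym (R : Frame m) (b : Bool) (T : ℕ → ℂ) (x) (t : Fin m → Vec) (π : Equiv.Perm (Fin m))
    (ε : Fin m → ℤˣ) :
    R.wave b T x (fun i => ε i • t (π i)) = ((Equiv.Perm.sign π : ℤ) : ℂ) * R.wave b T x t := by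
  set η : ℤˣ := Equiv.Perm.sign π * ∏ i, ε i with hη
  have hu (a : ℤˣ) : (a : ℂ) * a = 1 := by
    rcases Int.units_eq_one_or a with rfl | rfl <;> simp
  have h := R.total_match b T (x := x) (x' := x) (t := fun i => ε i • t (π i)) (t' := t) π (fun i => η * ε i)
    (unitOf η) fun i => ⟨?_, ?_⟩
  · have h' := congrArg (Int.cast : ℤ → ℂ) (R.orient_sym t π ε)
    rw [← hη] at h'
    push_cast at h'
    rw [Frame.wave, Frame.wave, h]
    cases b
    · have h3 : ((twist false π (fun i => η * ε i) : ℤˣ) : ℂ) = (η : ℂ) ^ m * (∏ i, ε i : ℤˣ) := by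
        simp [twist, Finset.prod_mul_distrib]
      have h4 : (η : ℂ) * (∏ i, ε i : ℤˣ) = (Equiv.Perm.sign π : ℤˣ) := by
        rw [hη, Units.val_mul, Int.cast_mul, mul_assoc, hu, mul_one]
      simp only [Bool.false_eq_true, if_false]
      rw [← mul_assoc, ← h4]
      set S := R.total false T x fun i => ε i • t (π i)
      rw [h3]
      have h5 := hu (∏ i, ε i)
      have h6 := hu (η ^ m)
      push_cast at h6
      linear_combination ((∏ i, ε i : ℤˣ) : ℂ) ^ 2 * (η : ℂ) ^ m * S * h' -
        (R.orient fun i => ε i • t (π i) : ℂ) * S * ((η : ℂ) ^ (2 * m) * h5 + h6)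
    · simp [twist, ← mul_assoc, hu]
  · rw [R.circ_sym, ← hη, Units.val_mul, mul_mul_mul_comm, ← mul_assoc, ← mul_assoc]
    rcases Int.units_eq_one_or η with h | h <;> rcases Int.units_eq_one_or (ε i) with h' | h' <;> simp [h, h']
  · rw [lev_units, Units.val_mul, Int.cast_mul, mul_assoc, ← mul_assoc ((ε i : ℤ) : ZMod 18)]
    rcases Int.units_eq_one_or (ε i) with h' | h' <;> simp [h', unitOf]

lemma compat_last {g : Matrix (Fin 4) (Fin 4) ℤ} (hd : IsUnit g.det) (h : ∀ j, j ≠ 3 → (18 : ℤ) ∣ g 3 j) :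
    ∃ u, Compat g u lastCovector := by
  have hg (j : Fin 4) (hj : j ≠ 3) : (g 3 j : ZMod 18) = 0 := (ZMod.intCast_zmod_eq_zero_iff_dvd _ 18).2 (h j hj)
  have h1 := congrArg (Int.cast : ℤ → ZMod 18) (congrFun (congrFun (mul_nonsing_inv g hd) 3) 3)
  rw [mul_apply, Fin.sum_univ_four] at h1
  push_cast at h1
  rw [hg 0 (by decide), hg 1 (by decide), hg 2 (by decide)] at h1
  refine ⟨Units.mkOfMulEqOne (g 3 3 : ZMod 18) (g⁻¹ 3 3) (by simpa using h1), fun w => ?_⟩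
  rw [lev_last, lev_last, mulVec, dotProduct, Fin.sum_univ_four]
  push_cast
  rw [hg 0 (by decide), hg 1 (by decide), hg 2 (by decide)]
  simp

lemma Frame.wave_twisted (R : Frame m) (b : Bool) (T : ℕ → ℂ) : Twisted b (R.wave b T lastCovector) :=
  ⟨R.wave_sym b T _, fun t _ δ hd hl =>
    R.wave_act b T hd (compat_last (hd ▸ δ.isUnit) hl).choose_spec t⟩

open Classical in
/-- The function of lines on the cells given by a twisted function. -/
noncomputable def descend (F : (Fin m → Vec) → ℂ) (L : Fin m → Line) : ℂ :=
  if quaternary.Cell (Set.range L) then F fun i => (L i).exists_mk.choose else 0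

lemma descend_mk {F : (Fin m → Vec) → ℂ} {b : Bool} (hF : Twisted b F) {t : Fin m → Vec} (ht : IsCell t) :
    descend F (Line.mk ∘ t) = F t := by
  have h (i : Fin m) : ∃ ε : ℤˣ, (Line.mk (t i)).exists_mk.choose = ε • t i := by
    rcases Line.mk_eq.1 (Line.mk (t i)).exists_mk.choose_spec with h | h
    · exact ⟨1, by rwa [one_smul]⟩
    · exact ⟨-1, by simpa using h⟩
  choose ε h using h
  rw [descend, if_pos (show quaternary.Cell _ from ht), show (fun i => ((Line.mk ∘ t) i).exists_mk.choose) = _ from funext h]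
  simpa using hF.sym t 1 ε

lemma descend_support {F : (Fin m → Vec) → ℂ} {t : Fin m → Vec} (ht : ¬ IsCell t) :
    descend F (Line.mk ∘ t) = 0 := if_neg ht

/-- The cochain of a twisted function. -/
noncomputable def cochain {F : (Fin m → Vec) → ℂ} {b : Bool} (hF : Twisted b F) : Cochain m :=
  ⟨descend F, by
    have hex (L : Fin m → Line) : ∃ t, L = Line.mk ∘ t := ⟨_, funext fun i => (L i).exists_mk.choose_spec.symm⟩
    refine ⟨fun L π => ?_, fun γ => funext fun L => ?_, fun L h => ?_⟩
    · obtain ⟨t, rfl⟩ := hex L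
      by_cases ht : IsCell t
      · have h := ht.sym π 1
        have h' := hF.sym t π 1
        simp only [Pi.one_apply, one_smul] at h h'
        rw [Function.comp_assoc, descend_mk hF ht, ← h']
        exact descend_mk hF h
      · rw [descend_support ht, Function.comp_assoc, descend_support, mul_zero]
        exact fun h => ht (by simpa [Function.comp_def] using h.sym π⁻¹ 1)
    · obtain ⟨t, rfl⟩ := hex L
      set g := (gammaHom 18 γ⁻¹).1
      have hg : g.det = ((1 : ℤˣ) : ℤ) := gammaHom_det 18 γ⁻¹
      have h1 : γ⁻¹ • (Line.mk ∘ t) = Line.mk ∘ act g t := rfl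
      have h2 := (quaternary_equivariant 18).cell_smul γ⁻¹ (v := Line.mk ∘ t)
      rw [tr_apply, h1]
      rw [h1] at h2
      by_cases ht : IsCell t
      · rw [descend_mk hF ht, descend_mk hF (h2.2 ht), hF.gl t g 1 hg (γ⁻¹).2]
        simp
      · rw [descend_support ht, descend_support (mt h2.1 ht)]
    · by_contra h'
      exact h (if_neg h')⟩

lemma part_cochain {F : (Fin m → Vec) → ℂ} {b : Bool} (hF : Twisted b F) (b' : Bool) {t : Fin m → Vec}
    (ht : IsCell t) : part b' (cochain hF).1 t = if b' = b then 2 * F t else 0 := by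
  change part b' (descend F) t = _
  rw [part_apply, descend_mk hF ht, descend_mk hF (isCell_reflection.2 ht), hF.gl t _ (-1) (by
    rw [reflection_det]; rfl) fun j hj => by simp [reflection, diagonal_apply_ne' _ hj]]
  cases b <;> cases b' <;> simp <;> ring

end Voronoi

namespace Voronoi

open Matrix Finset

variable {m : ℕ}

lemma exists_compat (l : Fin 4 → ℤ) {a b : ℤ} (h : IsCoprime (l 2 + a * l 0 + b * l 1) (l 3)) :
    ∃ g : Matrix (Fin 4) (Fin 4) ℤ, g.det = 1 ∧ Compat g 1 fun i => l i := by
  obtain ⟨p, q, h⟩ := h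
  refine ⟨!![1, 0, -a, 0; 0, 1, -b, 0; 0, 0, q, -p; l 0, l 1, l 2, l 3], ?_, fun w => ?_⟩
  · rw [det4_eq]
    refine Eq.trans ?_ h
    simp [det4]
    ring
  · rw [lev_last]
    simp [mulVec, dotProduct, Fin.sum_univ_four, lev]

def Primitive (X : ℕ) : Prop :=
  ∃ a b k : Fin 7, Nat.gcd (X / 324 + a * X + b * (X / 18)) (X / 5832 + 18 * k) = 1

instance (X : ℕ) : Decidable (Primitive X) := by unfold Primitive; infer_instance

lemma Primitive.exists_compat {X : ℕ} (h : Primitive X) :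
    ∃ g : Matrix (Fin 4) (Fin 4) ℤ, g.det = 1 ∧ Compat g 1 (covec X) := by
  obtain ⟨a, b, k, h⟩ := h
  rw [covec]
  generalize X / 18 = y at *
  generalize X / 324 = z at *
  generalize X / 5832 = w at *
  obtain ⟨g, h1, h2⟩ := Voronoi.exists_compat ![(X : ℤ), y, z, w + 18 * k] (a := a) (b := b)
    (by simpa using Nat.isCoprime_iff_coprime.2 h)
  refine ⟨g, h1, ?_⟩
  convert h2 using 1
  have h18 : (18 : ZMod 18) = 0 := rfl
  ext i
  fin_cases i <;> simp [h18]

lemma un_bijective : Function.Bijective un := by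
  refine (Fintype.bijective_iff_injective_and_card un).2 ⟨fun i j h => ?_, ?_⟩
  · have h := congrArg (fun u : (ZMod 18)ˣ => (u : ZMod 18).val) h
    simp only [un_val] at h
    revert i j; decide
  · rw [ZMod.card_units_eq_totient]; rfl

/-- The sum of a function of keys over the multiples of a list of codes. -/
noncomputable def totalN (b : Bool) (V : ℕ → ℤ) (rs : List ℕ) : ℤ :=
  weightN b 1 rs * V (field (packSum rs) 0) + (weightN b 5 rs * V (field (packSum rs) 1) +
  (weightN b 7 rs * V (field (packSum rs) 2) + (weightN b 11 rs * V (field (packSum rs) 3) +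
  (weightN b 13 rs * V (field (packSum rs) 4) + weightN b 17 rs * V (field (packSum rs) 5)))))

lemma Frame.total_eq (R : Frame m) (hm : m < 8) (b : Bool) {x} {t : Fin m → Vec} {rs : Fin m → ℕ}
    (h : ∀ i, Code (R.circ t i) (lev x (t i)) (rs i)) {κ : ℤ} (hw : ∀ u : ZMod 18,
      weight b (R.circ t) (fun i => u * lev x (t i)) = κ * weightN b u.val (List.ofFn rs)) (V : ℕ → ℤ) :
    R.total b (fun K => V K) x t = κ * totalN b V (List.ofFn rs) := by
  have hs (i : Fin 6) : (weight b (R.circ t) (levs x (un i) t) : ℂ) * V (key (R.circ t) (levs x (un i) t)) =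
      ((κ * (weightN b (unval i) (List.ofFn rs) * V (field (packSum (List.ofFn rs)) i)) : ℤ) : ℂ) := by
    rw [field_eq_key hm h, ← un_val, ← mul_assoc, ← hw]
    push_cast
    rfl
  rw [Frame.total, ← un_bijective.sum_comp, Finset.sum_congr rfl fun i _ => hs i, ← Int.cast_sum,
    ← Finset.mul_sum, Int.cast_mul]
  congr 2
  simp only [Fin.sum_univ_succ, Fin.sum_univ_zero, add_zero]
  rfl

lemma Frame.exists_total (R : Frame m) (hm : m < 8) (b : Bool) {x} {t : Fin m → Vec} {rs : Fin m → ℕ}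
    (h : ∀ i, Code (R.circ t i) (lev x (t i)) (rs i)) : ∃ κ : ℤ, κ ≠ 0 ∧ ∀ V : ℕ → ℤ,
      R.total b (fun K => V K) x t = κ * totalN b V (List.ofFn rs) := by
  obtain ⟨κ, hκ, hw⟩ := exists_weight b h
  exact ⟨κ, hκ, R.total_eq hm b h hw⟩

lemma card_le_finrank {ι V : Type*} [Fintype ι] [AddCommGroup V] [Module ℂ V] [FiniteDimensional ℂ V] (f : ι → V)
    (ev : ι → V →ₗ[ℂ] ℂ) (h : ∀ i j, i ≠ j → ev i (f j) = 0) (h' : ∀ i, ev i (f i) ≠ 0) :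
    Fintype.card ι ≤ Module.finrank ℂ V := by
  classical
  refine LinearIndependent.fintype_card_le_finrank (Fintype.linearIndependent_iff.2 fun g hg i => ?_) (b := f)
  have h1 := congrArg (ev i) hg
  rw [map_sum, map_zero, Finset.sum_eq_single i (fun j _ hj => by rw [map_smul, h i j hj.symm, smul_zero])
    (by simp), map_smul] at h1
  exact (smul_eq_zero.1 h1).resolve_right (h' i)

/-- The covector whose digits are given by a key of vectors with trivial coefficients. -/
def digits (K : ℕ) : ℕ :=
  ((List.range 10).flatMap fun d => List.replicate (K >>> (54 + 3 * d) % 8) d).foldl (fun X d => 18 * X + d) 0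

def single (K K' : ℕ) : ℤ := bif Nat.beq K' K then 1 else 0

noncomputable def keyOK (b : Bool) (T : Table) (K : ℕ) : Bool :=
  decide (Primitive (digits K)) && (!Nat.beq (T.find K) 0 &&
    (fun rs => (allLt 6 fun i => Nat.beq (field (packSum rs) i) K || Nat.beq (T.find (field (packSum rs) i)) 0) &&
      !decide (totalN b (single K) rs = 0)) (codes (digits K) (lookup patternsFive 0 4)))

lemma keyOK_even : tableFourEven.all (fun K _ => keyOK true tableFourEven K) = true := by decide +kernel

lemma keyOK_odd : tableFourOdd.all (fun K _ => keyOK false tableFourOdd K) = true := by decide +kernel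

end Voronoi

namespace Voronoi

open Matrix Finset

lemma Table.of_mem_keys {p : ℕ → Bool} {q : ℕ → ℕ → Bool} {T : Table} (h : T.all q = true) {K : ℕ}
    (hK : K ∈ T.keys p) : ∃ D, q K D = true := by
  induction T with
  | nil => exact absurd hK List.not_mem_nil
  | node l k d r hl hr =>
    change (q k d && (l.all q && r.all q)) = true at h
    simp only [Bool.and_eq_true] at h
    change K ∈ bif p d then k :: (l.keys p ++ r.keys p) else l.keys p ++ r.keys p at hK
    rw [cond_eq_ite] at hK
    split_ifs at hK
    · rcases List.mem_cons.1 hK with rfl | hK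
      · exact ⟨d, h.1⟩
      · exact (List.mem_append.1 hK).elim (hl h.2.1) (hr h.2.2)
    · exact (List.mem_append.1 hK).elim (hl h.2.1) (hr h.2.2)

lemma exists_probe {b : Bool} {T : Table} {K : ℕ} (h : keyOK b T K = true) : ∃ t : Fin 4 → Vec, IsCell t ∧
    frameFour.wave b (fun K' => single K K') lastCovector t ≠ 0 ∧
    ∀ K', T.find K' ≠ 0 → K' ≠ K → frameFour.wave b (fun K'' => single K' K'') lastCovector t = 0 := by
  set e : Fin 4 → Vec := templateFive 0 ∘ (Fin.last 4).succAbove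
  have he : (of e).det = 1 := by rw [det4_eq]; decide
  have hc : IsCell e := (isCell_five (by norm_num)).comp _ (not_flat_of_det (σ := id) (by
    change (of e).det ≠ 0
    rw [he]; norm_num))
  have hl : lookup patternsFive 0 4 = List.ofFn fun i => enc (frameFour.circ e i) (e i) := by decide
  simp only [keyOK, Bool.and_eq_true, decide_eq_true_eq, Bool.not_eq_true', decide_eq_false_iff_not] at h
  obtain ⟨hX, -, h1, h2⟩ := h
  obtain ⟨g, hg, hv⟩ := hX.exists_compat
  obtain ⟨rs, h3, h4⟩ := codes_ofFn frameFour e (digits K)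
  rw [hl, h3] at h1 h2
  obtain ⟨κ, hκ, h5⟩ := frameFour.exists_total (by norm_num) b h4
  have hw (V : ℕ → ℤ) : frameFour.wave b (fun K => V K) lastCovector (act g e) = κ * totalN b V (List.ofFn rs) := by
    rw [Frame.wave_act (δ := 1) _ _ _ (by simpa using hg) hv, Frame.wave, h5,
      show frameFour.orient e = 1 from he]
    simp
  refine ⟨act g e, hc.act (by simp [hg]), ?_, fun K' hK hne => ?_⟩
  · rw [hw]
    exact mul_ne_zero (by exact_mod_cast hκ) (by exact_mod_cast h2)
  · have hs (i : ℕ) (hi : i < 6) : single K' (field (packSum (List.ofFn rs)) i) = 0 := by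
      have := of_allLt h1 hi
      rw [single, cond_eq_ite, if_neg]
      intro h
      simp only [Nat.beq_eq, Bool.or_eq_true] at h this
      rw [h] at this
      exact this.elim hne hK
    rw [hw, totalN, hs 0 (by norm_num), hs 1 (by norm_num), hs 2 (by norm_num), hs 3 (by norm_num),
      hs 4 (by norm_num), hs 5 (by norm_num)]
    simp only [mul_zero, add_zero, Int.cast_zero]

lemma le_finrank_inv_four : 171 ≤ Module.finrank ℂ (Cochain 4) := by
  let T (b : Bool) : Table := if b then tableFourEven else tableFourOdd
  let k (b : Bool) : Finset ℕ := ((T b).keys fun _ => true).toFinset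
  have hk (b : Bool) (K : k b) : keyOK b (T b) K = true := by
    have := List.mem_toFinset.1 K.2
    cases b
    · exact (Table.of_mem_keys keyOK_odd this).choose_spec
    · exact (Table.of_mem_keys keyOK_even this).choose_spec
  choose t ht h0 h1 using fun b K => exists_probe (hk b K)
  have : FiniteDimensional ℂ (Cochain 4)  :=
    VoronoiData.Equivariant.finiteDimensional_inv _ _ (quaternary_equivariant 18) 4
  have := card_le_finrank (V := Cochain 4) (ι := Σ b, k b)
    (fun i => cochain (frameFour.wave_twisted i.1 fun K => single i.2 K))
    (fun i => LinearMap.proj (t i.1 i.2) ∘ₗ part i.1 ∘ₗ (Cochain 4).subtype) ?_ ?_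
  · rw [Fintype.card_sigma, Fintype.sum_bool, Fintype.card_coe, Fintype.card_coe] at this
    exact (show 171 ≤ (k true).card + (k false).card by decide +kernel).trans this
  · rintro ⟨b, K⟩ ⟨b', K'⟩ hne
    simp only [LinearMap.comp_apply, Submodule.subtype_apply, LinearMap.proj_apply]
    rw [part_cochain _ _ (ht b K)]
    split_ifs with hb
    · subst hb
      rw [h1 b K K' ?_ fun h => hne (by rw [Subtype.ext h]), mul_zero]
      have := hk b K'
      simp only [keyOK, Bool.and_eq_true, Bool.not_eq_true'] at this
      exact fun h => absurd this.2.1 (by rw [h]; decide)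
    · rfl
  · rintro ⟨b, K⟩
    simp only [LinearMap.comp_apply, Submodule.subtype_apply, LinearMap.proj_apply]
    rw [part_cochain _ _ (ht b K), if_pos rfl]
    exact mul_ne_zero two_ne_zero (h0 b K)

end Voronoi

namespace Voronoi

open Matrix Finset Table

local notation:max "§" k:max d:max => node nil k d nil

/-- Functions of keys giving cocycles, with a symbol for every key. -/
def waves : List Table :=
  [§ 0x1000200000000000003 12355,
  (node nil 0x2000000000c0001 1106630 § 0x10002000000000c0000 19918918),
  (node nil 0x8200000000000003 10813 § 0x9000000000000003 20035),
  (node § 0x8200000010000001 1503811 0x9000000010000001 1513021 (node nil 0x1000200000010000001 1505341 §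
  0x1001000000010000001 1514563)),
  (node (node § 0x200001000000401 553658 0x200002008000200 10506938 (node § 0x1000001000000401 554182
  0x1000002008000200 10507462 § 0x82000000000c0000 19917370)) 0x8200200000000201 508477 (node § 0x90000000000c0000
  19926598 0x9000200000000201 517699 (node nil 0x1000200001000000400 9965638 § 0x1001000001000000400 9974842))),
  (node (node § 0x200000008040201 581318 0x200001000000401 553676 (node § 0x1000000008040201 581818 0x1000001000000401
  554164 § 0x8200000010000001 1503811)) 0x8200001000040001 1006147 (node (node § 0x8200200000000201 508489
  0x9000000010000001 1513021 § 0x9000001000040001 1015357) 0x9000200000000201 517687 (node nil 0x1000200200000000201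
  510019 § 0x1001000200000000201 519229))),
  (node (node (node (node (node § 0x42208 3526982 0x48280 3688250 § 0x50041 178490) 0x81010 3195212 (node § 0x241009
  208710 0xa048000 4590906 § 0x40040011 179526)) 0x48241000 3706182 (node (node § 0x88040008 4068678 0x201088000
  3717428 § 0x209040040 3735866) 0x400080040 3247412 (node § 0x1002008200 4120902 0x1040201200 3521850 (node §
  0x1080000208 3579194 0x1201000240 3706694 § 0x8000281000 4037964)))) 0x8040041200 3540294 (node (node (node §
  0x9000201001 231738 0x40001048200 4756794 § 0x200000000043000 6361798) 0x200000000088008 3926732 (node §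
  0x200000000248001 224966 0x200000001040080 6396614 § 0x2000000c0040000 6362822)) 0x200000200040009 223942 (node
  (node § 0x2000010000000c0 6359738 0x200001000008009 221882 § 0x200001080001000 6399674) 0x200002000208000 3929780
  (node § 0x200002200000008 3928756 0x200041001000040 7336634 (node § 0x200080000040040 6398662 0x1000000000050040
  3209402 § 0x1000000000241008 3752122))))) 0x1000000040040010 3226810 (node (node (node (node § 0x1000000401040000
  3211450 0x1000001000001010 3208390 § 0x1000001201008000 3755206) 0x1000001400000040 3229894 (node §
  0x1000009000201000 4169926 0x1000009040000008 4167878 § 0x1000010000041000 3227834)) 0x1001001000200008 4166854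
  (node (node § 0x1001008000040008 3753146 0x1000000000000050040 3210426 § 0x1000000000000202200 3505350)
  0x1000000000000241008 3754182 (node § 0x1000000000000401001 187590 0x1000000000001008240 3671226 (node §
  0x1000000000008002008 3735750 0x1000000000040001208 3560646 § 0x1000000000040040010 3228870))))
  0x1000000000040200009 215238 (node (node (node § 0x1000000000200000280 4675770 0x1000000008048001000 4500678 §
  0x1000000009000201000 4168902) 0x1000200000000248000 4040262 (node § 0x1000200000002000040 6694470
  0x1000200000040002000 6684742 (node § 0x1000200000200040008 4030534 0x1000200000200200001 215107 §
  0x1000200001000008008 3993670))) 0x1000200008000008001 224835 (node (node § 0x1000200040000000080 6647878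
  0x1000208000000000009 178243 § 0x1001000000000401000 3377210) 0x1001000000001010000 3357754 (node §
  0x1001000000040200008 3874874 0x1001000000200008040 3855418 (node nil 0x1001000008000001008 3836986 §
  0x1001001000000000010 3339322)))))),
  (node (node (node (node (node § 0x49201 241478 0x50041 178508 § 0x80248 3351860) 0x240241 198970 (node § 0x241009
  208692 0x8040049 189242 (node § 0x9280000 4038952 0x40040011 179508 § 0x48088000 3404108))) 0x201088000 3717476
  (node (node § 0x248040001 251206 0x400080040 3247448 § 0x1000000249 187718) 0x1001240200 3541324 (node §
  0x1040240008 3707700 0x1240000201 223034 (node § 0x2000009200 4038452 0x2000200240 3560780 § 0x8000281000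
  4037928)))) 0x9000201001 231756 (node (node (node § 0x200000000088008 3926684 0x200000000248001 224942 §
  0x200000001041001 389818) 0x200000040040041 390842 (node § 0x200000200040009 223918 0x200001000001041 387782 (node
  § 0x200001000008009 221906 0x200002000208000 3929828 § 0x200002001001000 6748888))) 0x200002040000040 6749900
  (node (node § 0x200002200000008 3928804 0x1000000000080400 9567412 (node § 0x1000000000248001 223418
  0x1000000008040201 581818 § 0x1000000200040009 225466)) 0x1000001000000401 554182 (node § 0x1000001000008009
  222406 0x1000002000208000 3928280 (node § 0x1000002008000200 10507468 0x1000002200000008 3930316 §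
  0x8200000010000001 1503811))))) 0x9000000010000001 1513021 (node (node (node (node § 0x402000000000c0000 19917924
  0x40200001000040001 1006650 § 0x1000000000000049200 4344006) 0x1000000000000050040 3210468 (node §
  0x1000000000000240240 3579066 0x1000000000000401001 187572 (node § 0x1000000000001200201 206010
  0x1000000000008009001 252102 § 0x1000000000008040048 3403962))) 0x1000000000040008201 196806 (node (node §
  0x1000000000040040010 3228852 0x1000000000040200009 215220 § 0x1000000000248040000 4519098) 0x1000000001000000248
  3376314 (node § 0x1000000001240000200 4012242 0x1000000009000201000 4168884 (node § 0x1000200000000248000 4040238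
  0x1000200000001041000 7016518 § 0x1000200000010000001 1505341)))) 0x1000200000040040040 7026234 (node (node (node
  § 0x1000200000041000001 390717 0x1000200000200040008 4030510 § 0x1000200000200200001 215095) 0x1000200001000001040
  6979630 (node § 0x1000200001000008008 3993646 0x1000200008000008001 224823 (node § 0x1000200040000001001 380989
  0x1000201000000000041 344125 § 0x1000208000000000009 178231))) 0x1001000000000248000 4021318 (node (node §
  0x1001000000008040200 10472506 0x1001000000200040008 4040762 (node § 0x1001000000200200001 225341
  0x1001000001000000400 9974842 § 0x1001000001000008008 4002862)) 0x1001000008000008001 205885 (node §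
  0x1001000200000000201 519229 0x1001008000000000009 187453 (node nil 0x2000000000001200200 3707956 §
  0x2000000000040200008 3873868)))))),
  (node (node (node (node (node (node § 0x11208 3227468 0x18201 176984 § 0x201408 3512628) 0x202201 194874 (node §
  0x240210 3185466 0x1000480 6336844 § 0x1008210 3184948)) 0x1008241 204102 (node (node § 0x8040018 3166004
  0x40001209 197946 § 0x40008018 3165492) 0x81008200 3337530 (node § 0x88001200 6379322 0x200000250 3174196 (node §
  0x200000281 259910 0x200448000 3208012 § 0x200601000 3161872)))) 0x201400200 3180376 (node (node (node §
  0x208240200 3539782 0x209008200 3715910 § 0x240018000 3163956) 0x240400008 3189556 (node § 0x241001200 3356486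
  0x280000240 4775738 (node § 0x400048200 3218234 0x440000208 3199820 § 0x1000000218 3164486))) 0x1002008200 4120902
  (node (node § 0x1040201200 3521850 0x1080000208 3579194 § 0x1200010200 3209030) 0x1200200400 3512116 (node §
  0x1201000240 3706694 0x8008201200 3549498 (node § 0x8040041200 3540282 0x9000200208 3551038 § 0x40001048200
  4756806))))) 0x40009000240 6545730 (node (node (node (node § 0x40200008400 4286796 0x208000200009 232258 §
  0x440001000040 7429948) 0x200000000018200 3183308 (node § 0x200000000400208 3200716 0x200000001008240 3671738
  (node § 0x200000001040208 3576500 0x200000008008208 3567290 § 0x200000040001208 3558086))) 0x200000040040010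
  3226292 (node (node § 0x200000200000280 4675258 0x200000200000408 3548852 § 0x200000200008010 3217076)
  0x200001000001010 3207884 (node § 0x200008080000200 3505850 0x200040000000050 3189416 (node § 0x200040000000209
  203450 0x200040201000200 3670714 § 0x200200000000018 3180284)))) 0x200200000000049 194246 (node (node (node §
  0x200200080000008 4673210 0x200200201000040 3560134 § 0x200200208000008 3569350) 0x200208000200008 4175546 (node §
  0x200240000008040 3561158 0x200240000040008 4009676 (node § 0x200400000008008 3551948 0x201000000000011 185048 §
  0x201200000001008 3668666))) 0x202000000000208 3502790 (node (node § 0x400000008040200 10460730 0x400000200040008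
  4030004 § 0x400001000000400 9963084) 0x400008000001008 3825228 (node § 0x400040000000208 3659304 0x401000000000010
  3327600 (node § 0x1000000000018200 3181748 0x1000000000202200 3506374 § 0x1000000040001208 3558598))))))
  0x1000000600000200 3183796 (node (node (node (node (node § 0x1000008000000241 204998 0x1000008080000200 3504326 §
  0x1000040201000200 3672262) 0x1000080000008200 4674758 (node § 0x1000200000000018 3180724 0x1000200080000008
  4673722 § 0x1000200201000040 3561658)) 0x1000208000040040 4011194 (node (node § 0x1000208000200008 4176058
  0x1001200000001008 3669178 § 0x1200040000000208 3659834) 0x1200200000000048 3493958 (node § 0x1201000000000010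
  3328040 0x1208000000000009 176204 (node § 0x2000000040008200 3522618 0x2000200000000048 3503174 §
  0x8000000000012000 3245772)))) 0x8000000000018200 3181272 (node (node (node § 0x8000000000050040 3208890
  0x8000000000202200 3503802 § 0x8000000000210008 3218124) 0x8000000000241008 3752634 (node § 0x8000000001008240
  3669702 0x8000000001040080 6397638 (node § 0x8000000002000041 370374 0x8000000040001208 3559098 §
  0x8000000040040010 3227322))) 0x8000000040200009 213690 (node (node § 0x8000000200000280 4674246
  0x8000000280008000 3365562 § 0x8000000440001000 3190476) 0x8000008048001000 4499130 (node § 0x8000009000201000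
  4167354 0x8000041001000040 7337666 (node § 0x8000208000200008 4176574 0x8200000002000040 6666810 §
  0x8200000009000008 4489786))))) 0x8200000040200008 3845702 (node (node (node (node § 0x8200000200008040 3846714
  0x8200000200040008 4011572 § 0x8200000200200001 196157) 0x8200008000001008 3826246 (node § 0x8200008000008001
  197181 0x8200040000000080 6646330 (node § 0x8200040000000208 3660346 0x8200040000001001 362045 §
  0x8200200000000048 3494458))) 0x8201000000000010 3328564 (node (node § 0x8208000000000009 176713
  0x9000000002000040 6665286 § 0x9000000040002000 6667334) 0x9000000040200008 3847238 (node § 0x9000000200200001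
  197699 0x9000008000000240 3679302 (node § 0x9000008000001008 3835462 0x9000008000008001 195651 §
  0x9001000000000041 351811)))) 0x9008000000000009 185923 (node (node (node § 0x40200000200001200 3504710
  0x40200200000000048 3494970 § 0x200200000040008200 3496518) 0x200200008000000240 3662394 (node §
  0x200200040000000208 3661370 0x200200200000000048 3495494 (node § 0x200201000000000010 3329588
  0x200208000000000009 177734 § 0x240000000040008200 3497030))) 0x240000008000000240 3662906 (node (node §
  0x1000000000000018200 3182778 0x1000000000000400208 3201210 § 0x1000200040000000208 3661882) 0x1000200200000000048
  3496006 (node § 0x1000201000000000010 3330100 0x1000208000000000009 178246 (node nil 0x1008000000000401000 3348538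
  § 0x1008000000200200001 196675)))))))]

def starVec (i : ℕ) : Vec := fun k => ((i / 3 ^ (k : ℕ) % 3 : ℕ) : ℤ) - 1

def star (τ i : ℕ) : Fin 6 → Vec := Fin.cons (starVec (41 + i)) (templateFive τ)

/-- The level of a vector with respect to the covector with digits `X`. -/
def levN (X : ℕ) (w : Vec) : ℕ :=
  (residue (w 0) * (X % 18) + residue (w 1) * (X / 18 % 18) + residue (w 2) * (X / 324 % 18) +
    residue (w 3) * (X / 5832 % 18)) % 18

def codeN (d l : ℕ) : ℕ := bif Nat.beq d 0 then 18 + l else bif Nat.beq d 1 then l else (18 - l) % 18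

/-- The codes for levels and coefficients, the latter given by base 4 digits. -/
noncomputable def codesN (M : ℕ) (ls : List ℕ) : List ℕ :=
  List.rec (fun _ => []) (fun l _ a M => codeN (M % 4) l :: a (M / 4)) ls M

def coeffs (cs : List ℤ) : ℕ := cs.foldr (fun c a => (if c = 0 then 0 else if c = 1 then 1 else 2) + 4 * a) 0

def lead (c : ℤ) : ℤ := if c = 0 then 1 else c

noncomputable def Table.term (T : Table) (K : ℕ) (w : ℤ) : ℤ :=
  (fun d : ℕ => (bif Nat.beq d 0 then 0 else w * ((((d - 1) % 128 : ℕ) : ℤ) - 64) : ℤ)) (T.find K)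

noncomputable def totalT (T : Table) (rs : List ℕ) : ℤ :=
  (fun N => T.term (field N 0) (weightN false 1 rs) + (T.term (field N 1) (weightN false 5 rs) +
    (T.term (field N 2) (weightN false 7 rs) + (T.term (field N 3) (weightN false 11 rs) +
    (T.term (field N 4) (weightN false 13 rs) + T.term (field N 5) (weightN false 17 rs))))))
    (packSum rs)

noncomputable def templateLevels (X τ : ℕ) : List ℕ := List.ofFn fun k => levN X (templateFive τ k)

noncomputable def templateCodes (X τ : ℕ) : List ℕ :=
  codesN (coeffs (List.ofFn (minorFive (templateFive τ)))) (templateLevels X τ)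

def starMinors (τ i : ℕ) (j : Fin 6) : List ℤ := List.ofFn (minorFive (star τ i ∘ j.succAbove))

def admissible (τ i : ℕ) : Bool := decide (∀ j k, Small (minorFive (star τ i ∘ Fin.succAbove j) k))

noncomputable def facetSum (T : Table) (τ i : ℕ) (ls : List ℕ) (j : Fin 6) : ℤ :=
  ((starMinors τ i j).map lead).prod * totalT T (codesN (coeffs (starMinors τ i j)) (ls.eraseIdx j))

noncomputable def starSum (T : Table) (τ i : ℕ) (ls : List ℕ) : ℤ :=
  facetSum T τ i ls 0 - facetSum T τ i ls 1 + (facetSum T τ i ls 2 - facetSum T τ i ls 3) +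
    (facetSum T τ i ls 4 - facetSum T τ i ls 5)

noncomputable def cocycleAt (T : Table) (X τ : ℕ) : Bool :=
  (fun tl => allLt 40 fun i => !admissible τ i || decide (starSum T τ i (levN X (starVec (41 + i)) :: tl) = 0))
    (templateLevels X τ)

noncomputable def cocycleOK (T : Table) (K D : ℕ) : Bool :=
  Nat.ble (D / 128 % 4) 2 && allLt 3 fun τ => !Nat.beq (D / 128 % 4) τ ||
    (Nat.beq (canon (templateCodes (D / 512) τ)) K && cocycleAt T (D / 512) τ)

end Voronoi

namespace Voronoi

open Matrix Finset

variable {m : ℕ}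

lemma levN_eq (X : ℕ) (w : Vec) : levN X w = (lev (covec X) w).val := by
  simpa [enc, Entry.eval, raw, levN] using eval_enc X 1 w

lemma codeN_eq {c : ℤ} (hc : Small c) (x : ZMod 18) :
    codeN ((if c = 0 then 0 else if c = 1 then 1 else 2)) x.val = raw c x := by
  have h : ∀ x : ZMod 18, codeN 0 x.val = raw 0 x ∧ codeN 1 x.val = raw 1 x ∧ codeN 2 x.val = raw (-1) x := by
    decide +kernel
  rcases hc with rfl | rfl | rfl
  exacts [(h x).1, (h x).2.1, (h x).2.2]

lemma codesN_eq {c : Fin m → ℤ} (hc : ∀ i, Small (c i)) (X : ℕ) (t : Fin m → Vec) :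
    codesN (coeffs (List.ofFn c)) (List.ofFn fun i => levN X (t i)) =
      List.ofFn fun i => raw (c i) (lev (covec X) (t i)) := by
  induction m with
  | zero => rfl
  | succ m ih =>
    have h4 (d a : ℕ) (hd : d < 4) : (d + 4 * a) % 4 = d ∧ (d + 4 * a) / 4 = a := by omega
    have hd : (if c 0 = 0 then 0 else if c 0 = 1 then 1 else 2) < 4 := by split_ifs <;> norm_num
    simp only [List.ofFn_succ]
    rw [← ih (fun i => hc i.succ), ← codeN_eq (hc 0), ← levN_eq]
    change codeN ((_ + 4 * _) % 4) _ :: codesN ((_ + 4 * _) / 4) _ = _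
    rw [(h4 _ _ hd).1, (h4 _ _ hd).2]
    rfl

/-- The function of keys given by a table. -/
noncomputable def Table.value (T : Table) (K : ℕ) : ℤ :=
  bif Nat.beq (T.find K) 0 then 0 else (((T.find K - 1) % 128 : ℕ) : ℤ) - 64

lemma totalT_eq (T : Table) (rs : List ℕ) : totalT T rs = totalN false T.value rs := by
  have h (K w) : T.term K w = w * T.value K := by
    simp only [Table.term, Table.value]
    cases Nat.beq (T.find K) 0 <;> simp
  simp only [totalT, totalN, h]

lemma Frame.total_codes (R : Frame m) (hm : m < 8) (V : ℕ → ℤ) (x) (t : Fin m → Vec) :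
    R.total false (fun K => V K) x t = ((List.ofFn (R.circ t)).map lead).prod *
      totalN false V (List.ofFn fun i => raw (R.circ t i) (lev x (t i))) := by
  have h (c : ℤ) (l u : ZMod 18) : sgn c (u * l) = lead c * sgnN u.val (raw c l) := by
    by_cases hc : c = 0
    · have h : ∀ u l : ZMod 18, sgn 0 (u * l) = 1 * sgnN u.val (18 + l.val) := by decide +kernel
      rw [hc, h, raw, if_pos rfl, lead, if_pos rfl]
    · rw [raw, if_neg hc, sgnN_val, lead, if_neg hc, sgn, if_neg hc, mul_one]
  refine R.total_eq hm false (fun i => code_raw _ _) (fun u => ?_) V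
  simp only [weight, Bool.false_eq_true, if_false, weightN, cond_false, List.map_ofFn, List.prod_ofFn,
    ← Finset.prod_mul_distrib]
  exact Finset.prod_congr rfl fun i _ => h _ _ _

lemma wave_codes (T : Table) (X : ℕ) {t : Fin 5 → Vec} (ht : ∀ k, Small (minorFive t k)) :
    frameFive.wave false (fun K => T.value K) (covec X) t = (((List.ofFn (minorFive t)).map lead).prod *
      totalT T (codesN (coeffs (List.ofFn (minorFive t))) (List.ofFn fun i => levN X (t i))) : ℤ) := by
  have hc : frameFive.circ t = minorFive t := circ_det4 t
  rw [Frame.wave, frameFive.total_codes (by norm_num), hc, totalT_eq, codesN_eq ht]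
  simp [frameFive]

lemma starLevels (X τ i : ℕ) (j : Fin 6) : (levN X (starVec (41 + i)) :: templateLevels X τ).eraseIdx j =
    List.ofFn fun k => levN X (star τ i (j.succAbove k)) := by
  fin_cases j <;> rfl

lemma bd_star {T : Table} {X τ i : ℕ} (h : cocycleAt T X τ = true) (hi : i < 40) (ha : admissible τ i = true) :
    bd (frameFive.wave false (fun K => T.value K) (covec X)) (star τ i) = 0 := by
  have h1 := of_allLt (n := 40) (p := fun i => !admissible τ i || decide (starSum T τ i
    (levN X (starVec (41 + i)) :: templateLevels X τ) = 0)) h hi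
  rw [ha] at h1
  have h2 : starSum T τ i (levN X (starVec (41 + i)) :: templateLevels X τ) = 0 := by simpa using h1
  have hs := of_decide_eq_true ha
  have hf (j : Fin 6) : frameFive.wave false (fun K => T.value K) (covec X) (star τ i ∘ j.succAbove) =
      facetSum T τ i (levN X (starVec (41 + i)) :: templateLevels X τ) j := by
    rw [wave_codes T X (hs j), facetSum, starLevels]
    rfl
  simp only [bd, hf]
  rw [← Int.cast_zero, ← h2, starSum]
  simp only [Fin.sum_univ_succ, Fin.sum_univ_zero]
  push_cast
  simp
  ring

end Voronoi

namespace Voronoi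

open Matrix Finset

variable {m : ℕ} {b : Bool}

lemma bd_cochain {F : (Fin m → Vec) → ℂ} (hF : Twisted b F) (hflat : ∀ t, Flat t → F t = 0)
    {t : Fin (m + 1) → Vec} (ht : IsCell t) : bd (cochain hF).1 (Line.mk ∘ t) = bd F t := by
  refine Finset.sum_congr rfl fun j _ => congrArg _ ?_
  change descend F (Line.mk ∘ (t ∘ j.succAbove)) = F (t ∘ j.succAbove)
  by_cases hj : Flat (t ∘ j.succAbove)
  · rw [hflat _ hj, descend_support fun h => h.not_flat hj]
  · exact descend_mk hF (ht.comp _ hj)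

/-- The function of tuples attached to a table. -/
noncomputable abbrev waveT (T : Table) : (Fin 5 → Vec) → ℂ :=
  frameFive.wave false (fun K => T.value K) lastCovector

lemma waveT_twisted (T : Table) : Twisted false (waveT T) := frameFive.wave_twisted false _

lemma waveT_flat (T : Table) (t : Fin 5 → Vec) (ht : Flat t) : waveT T t = 0 := by
  have hc (i) : frameFive.circ t i = 0 := by
    obtain ⟨w, hw, h⟩ := ht
    change (-1) ^ (i : ℕ) * (of (t ∘ i.succAbove)).det = 0
    have hd : (of (t ∘ i.succAbove)).det = 0 := exists_mulVec_eq_zero_iff.1 ⟨w, hw, funext fun k => h _⟩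
    rw [hd, mul_zero]
  have h := frameFive.total_match false (fun K => T.value K) (x := lastCovector) (x' := lastCovector) (t := t) (t' := t)
    1 (fun _ => -1) (-1) fun i => ⟨by simp [hc], by simp⟩
  have h' : frameFive.total false (fun K => T.value K) lastCovector t = 0 := by
    have ht : (twist false 1 fun _ : Fin 5 => -1) = -1 := by decide
    rw [ht] at h
    push_cast at h
    linear_combination h / 2
  rw [waveT, Frame.wave, h', mul_zero]

lemma exists_starVec {v : Vec} (h : ∀ k, Small (v k)) (h0 : v ≠ 0) :
    ∃ i < 40, ∃ ε : ℤˣ, starVec (41 + i) = ε • v := by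
  have hd : ∀ w : Fin 4 → Fin 3, (∀ k, w k = 1) ∨ ∃ i : Fin 40,
      (∀ k, starVec (41 + i) k = (w k : ℕ) - 1) ∨ ∀ k, starVec (41 + i) k = -((w k : ℕ) - 1) := by
    decide +kernel
  have hs (k) : ∃ w : Fin 3, v k = (w : ℕ) - 1 := by
    rcases h k with h | h | h <;> rw [h]
    exacts [⟨1, rfl⟩, ⟨2, rfl⟩, ⟨0, rfl⟩]
  choose w hw using hs
  rcases hd w with h | ⟨i, h | h⟩
  · exact absurd (funext fun k => by rw [hw, h]; rfl) h0
  · exact ⟨i, i.2, 1, funext fun k => by rw [h, one_smul, hw]⟩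
  · exact ⟨i, i.2, -1, funext fun k => by rw [h, Units.neg_smul, one_smul, Pi.neg_apply, hw]⟩

lemma IsCell.small_apply {v : Vec} {τ : ℕ} (h : IsCell (Fin.cons v (templateFive τ) : Fin 6 → Vec)) (hτ : τ ≤ 2)
    (k : Fin 4) : Small (v k) := by
  have h1 := h.small fun j => if j = k then 0 else j.castSucc.succ
  have h2 : (of ((Fin.cons v (templateFive τ) : Fin 6 → Vec) ∘ fun j : Fin 4 => if j = k then 0 else j.castSucc.succ)).det
      = v k := by
    rw [det4_eq]
    interval_cases τ <;> fin_cases k <;> simp [det4, templateFive, templatesFive]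
  rwa [h2] at h1

lemma exists_star {t : Fin 6 → Vec} (ht : IsCell t) {i : Fin 6} {τ : ℕ} (hτ : τ ≤ 2) {g : Matrix (Fin 4) (Fin 4) ℤ}
    (hg : IsUnit g.det) {π : Equiv.Perm (Fin 5)} {ε : Fin 5 → ℤˣ}
    (h : ∀ k, g *ᵥ templateFive τ k = ε k • t (i.succAbove (π k))) : ∃ n < 40, admissible τ n = true ∧
      ∃ σ : Equiv.Perm (Fin 6), Line.mk ∘ act g (star τ n) = Line.mk ∘ t ∘ σ := by
  have hσ : Function.Bijective (Fin.cons i (i.succAbove ∘ π) : Fin 6 → Fin 6) :=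
    Finite.injective_iff_bijective.1 (Fin.cons_injective_iff.2 ⟨by
      rintro ⟨k, hk⟩
      exact Fin.succAbove_ne i _ hk, Fin.succAbove_right_injective.comp π.injective⟩)
  have key (v : Vec) (hv : Line.mk (g *ᵥ v) = Line.mk (t i)) :
      Line.mk ∘ act g (Fin.cons v (templateFive τ) : Fin 6 → Vec) = Line.mk ∘ t ∘ Equiv.ofBijective _ hσ := by
    funext k
    refine Fin.cases hv (fun k => ?_) k
    change Line.mk (g *ᵥ templateFive τ k) = Line.mk (t (i.succAbove (π k)))
    rw [h, Line.mk_units]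
  have cell (v : Vec) (hv : Line.mk (g *ᵥ v) = Line.mk (t i)) :
      IsCell (Fin.cons v (templateFive τ) : Fin 6 → Vec) := by
    have h1 : IsCell (act g (Fin.cons v (templateFive τ) : Fin 6 → Vec)) := by
      refine ht.congr ?_
      rw [key v hv, ← Function.comp_assoc, (Equiv.ofBijective _ hσ).surjective.range_comp]
    have h2 := h1.act (g := g⁻¹) (by rw [det_nonsing_inv]; exact hg.ringInverse)
    rwa [act_act, nonsing_inv_mul _ hg, act_one] at h2
  have hv : Line.mk (g *ᵥ (g⁻¹ *ᵥ t i)) = Line.mk (t i) := by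
    rw [mulVec_mulVec, mul_nonsing_inv _ hg, one_mulVec]
  obtain ⟨n, hn, δ, hδ⟩ := exists_starVec ((cell _ hv).small_apply hτ) ((cell _ hv).ne_zero 0)
  have hv' : Line.mk (g *ᵥ starVec (41 + n)) = Line.mk (t i) := by
    rw [hδ, ← hv]
    rcases Int.units_eq_one_or δ with rfl | rfl
    · simp
    · simp [mulVec_neg, Line.mk_neg]
  refine ⟨n, hn, decide_eq_true fun j k => ?_, _, key _ hv'⟩
  have := small_mul ((isUnit_one.neg).pow k) ((cell _ hv').small (j.succAbove ∘ k.succAbove))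
  rwa [det4_eq] at this

lemma wave_cocycle {T : Table} (hT : T.all (cocycleOK T) = true) :
    cochain (waveT_twisted T) ∈ LinearMap.ker ((quaternary_equivariant 18).cbdInv 5) := by
  refine LinearMap.mem_ker.2 (Subtype.ext ?_)
  rw [VoronoiData.Equivariant.cbdInv_apply]
  funext L
  choose t ht using fun i => (L i).exists_mk
  obtain rfl : Line.mk ∘ t = L := funext ht
  rw [VoronoiData.cbd]
  split_ifs with hc
  swap
  · rfl
  have hc : IsCell t := hc
  rw [bd_cochain _ (waveT_flat T) hc]
  change _ = (0 : ℂ)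
  by_contra hne
  obtain ⟨i, -, hi⟩ := Finset.exists_ne_zero_of_sum_ne_zero hne
  replace hi := right_ne_zero_of_mul hi
  have hs : IsCell (t ∘ i.succAbove) := hc.comp _ fun h => hi (waveT_flat T _ h)
  obtain ⟨u', -, hu⟩ := Finset.exists_ne_zero_of_sum_ne_zero (right_ne_zero_of_mul hi)
  replace hu := right_ne_zero_of_mul hu
  have hf : T.find (key (frameFive.circ (t ∘ i.succAbove)) (levs lastCovector u' (t ∘ i.succAbove))) ≠ 0 :=
    fun h => hu (by simp [Table.value, h])
  obtain ⟨D, hD⟩ := Nat.exists_eq_succ_of_ne_zero hf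
  have h1 := Table.of_all hT (Table.mem_of_find hD)
  simp only [cocycleOK, Bool.and_eq_true, Nat.ble_eq] at h1
  obtain ⟨hτ, h1⟩ := h1
  have h2 := of_allLt h1 (Nat.lt_succ_of_le hτ)
  simp only [Nat.beq_refl, Bool.not_true, Bool.false_or, Bool.and_eq_true, Nat.beq_eq] at h2
  set τ := D / 128 % 4
  set X := D / 512
  obtain ⟨h2, h3⟩ := h2
  have hg := (isCell_five hτ).good_five
  have hm : minorFive (templateFive τ) = frameFive.circ (templateFive τ) := (circ_det4 _).symm
  rw [templateCodes, templateLevels, codesN_eq fun k => by rw [hm]; exact hg.1 k] at h2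
  obtain ⟨u, hu⟩ := exists_canon (by norm_num) fun k => code_raw (minorFive (templateFive τ) k)
    (lev (covec X) (templateFive τ k))
  rw [h2, hm] at hu
  obtain ⟨π, ε, hπ⟩ := exists_match (by norm_num) hg.1 hs.good_five.1 hu.symm
  obtain ⟨g, δ, hδ, hgs, -, hgc⟩ := frameFive.match_gl hg hs.good_five hπ
  have hgu : IsUnit g.det := by rw [hδ]; exact δ.isUnit
  obtain ⟨n, hn, ha, σ, hσ⟩ := exists_star hc hτ hgu hgs
  have h4 := bd_star h3 hn ha
  have h5 : bd (waveT T) (act g (star τ n)) = 0 := by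
    have h6 (j : Fin 6) : waveT T (act g (star τ n) ∘ j.succAbove) = _ :=
      frameFive.wave_act false _ hδ hgc (star τ n ∘ j.succAbove)
    simp only [bd, h6, mul_left_comm _ (if _ then _ else _ : ℂ)]
    rw [← Finset.mul_sum]
    exact mul_eq_zero_of_right _ h4
  have h7 : IsCell (act g (star τ n)) := hc.congr (by
    rw [hσ, ← Function.comp_assoc, σ.surjective.range_comp])
  rw [← bd_cochain (waveT_twisted T) (waveT_flat T) h7, hσ, ← Function.comp_assoc,
    bd_alt (cochain (waveT_twisted T)).2.1, bd_cochain (waveT_twisted T) (waveT_flat T) hc] at h5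
  refine hne ((mul_eq_zero.1 h5).resolve_left ?_)
  rcases Int.units_eq_one_or (Equiv.Perm.sign σ) with h | h <;> simp [h]

end Voronoi

namespace Voronoi

open Matrix Finset

set_option maxRecDepth 100000 in
lemma waves_ok : waves.all (fun T => T.all (cocycleOK T)) = true := by decide +kernel

/-- The waves vanish on the template with the given symbol. -/
noncomputable def silent (τ X : ℕ) : Bool :=
  Nat.ble τ 2 && waves.all fun T => decide (totalT T (templateCodes X τ) = 0)

lemma tableFourOdd_step :
    tableFourOdd.all (stepOK 4 false tableFourOdd (lookup patternsFive) silent) = true := by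
  decide +kernel

def pivots : List ℕ := [96, 8645, 84, 11832, 77856, 3984, 24962, 1464, 1376]

lemma pivots_ok : ∀ i : Fin 9, Primitive (pivots.getD i 0 / 4) ∧ pivots.getD i 0 % 4 ≤ 2 ∧
    ∀ j : Fin 9, decide (totalT (waves.getD j .nil) (templateCodes (pivots.getD i 0 / 4) (pivots.getD i 0 % 4)) = 0)
      = decide (i ≠ j) := by
  decide +kernel

lemma finrank_ker_four : Module.finrank ℂ (LinearMap.ker ((quaternary_equivariant 18).cbdInv 4)) ≤ 3 := by
  refine (finrank_le_of_keys frameFour (by norm_num) _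
    (fun b => (if b then tableFourEven else tableFourOdd).residual) fun f hf b h => ?_).trans
    (show tableFourEven.residual.length + tableFourOdd.residual.length ≤ 3 by decide +kernel)
  have hcl (τ X : ℕ) (hτ : τ ≤ 2) : τ ≤ 2 ∧ Closed (part b f.1) (templateFive τ) (covec X) :=
    ⟨hτ, part_closed b (cbd_eq_zero hf) (isCell_five hτ) _⟩
  cases b
  · refine part_four tableFourOdd_step coverFour_odd (fun τ X h => hcl τ X ?_) h
    simp only [silent, Bool.and_eq_true, Nat.ble_eq] at h
    exact h.1
  · exact part_four tableFourEven_step coverFour_even (fun τ X h => hcl τ X (Nat.ble_eq ▸ h)) h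

noncomputable abbrev waveAt (j : Fin 9) : (Fin 5 → Vec) → ℂ := waveT (waves.getD j .nil)

/-- The cocycles attached to the tables. -/
noncomputable def cocycle (j : Fin 9) : Cochain 5 := cochain (waveT_twisted (waves.getD j .nil))

noncomputable def cocycles : (Fin 9 → ℂ) →ₗ[ℂ] Cochain 5 := Fintype.linearCombination ℂ cocycle

lemma getD_mem_waves (j : Fin 9) : waves.getD j .nil ∈ waves := by
  rw [List.getD_eq_getElem _ _ (show (j : ℕ) < waves.length from j.2)]
  exact List.getElem_mem _

lemma cocycle_mem (j : Fin 9) : cocycle j ∈ LinearMap.ker ((quaternary_equivariant 18).cbdInv 5) :=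
  wave_cocycle (List.all_eq_true.1 waves_ok _ (getD_mem_waves j))

lemma cocycles_mem (a : Fin 9 → ℂ) : cocycles a ∈ LinearMap.ker ((quaternary_equivariant 18).cbdInv 5) := by
  rw [cocycles, Fintype.linearCombination_apply]
  exact Submodule.sum_mem _ fun j _ => Submodule.smul_mem _ _ (cocycle_mem j)

lemma part_cocycles (a : Fin 9 → ℂ) {t : Fin 5 → Vec} (ht : IsCell t) :
    part false (cocycles a).1 t = 2 * ∑ j, a j * waveAt j t := by
  have h (j : Fin 9) : part false (cocycle j).1 t = 2 * waveAt j t := (part_cochain _ _ ht).trans (if_pos rfl)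
  have h1 : part false (cocycles a).1 = ∑ j, a j • part false (cocycle j).1 := by
    rw [cocycles, Fintype.linearCombination_apply]
    rw [AddSubmonoidClass.coe_finsetSum, map_sum]
    exact Finset.sum_congr rfl fun j _ => map_smul _ _ _
  rw [h1, Finset.sum_apply, Finset.mul_sum]
  exact Finset.sum_congr rfl fun j _ => by rw [Pi.smul_apply, h, smul_eq_mul]; ring

lemma waveT_template (T : Table) {τ X : ℕ} (hτ : τ ≤ 2) {g : Matrix (Fin 4) (Fin 4) ℤ} {δ : ℤˣ} (hg : g.det = δ)
    {u : (ZMod 18)ˣ} (hu : Compat g u (covec X)) :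
    waveT T (act g (templateFive τ)) = 0 ↔ totalT T (templateCodes X τ) = 0 := by
  have hs (k) : Small (minorFive (templateFive τ) k) := by
    have hm : minorFive (templateFive τ) = frameFive.circ (templateFive τ) := (circ_det4 _).symm
    rw [hm]
    exact (isCell_five hτ).good_five.1 k
  have hl (c : ℤ) : lead c ≠ 0 := by unfold lead; split_ifs <;> simp_all
  have hp : ((List.ofFn (minorFive (templateFive τ))).map lead).prod ≠ 0 :=
    List.prod_ne_zero fun h => by
      obtain ⟨c, -, hc⟩ := List.mem_map.1 h
      exact hl c hc
  have hδ : ((δ : ℤ) : ℂ) ≠ 0 := Int.cast_ne_zero.2 δ.ne_zero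
  rw [waveT, frameFive.wave_act false _ hg hu, wave_codes T X hs]
  change ((δ : ℤ) : ℂ) * ((_ * totalT T (templateCodes X τ) : ℤ) : ℂ) = 0 ↔ _
  rw [mul_eq_zero, or_iff_right hδ, Int.cast_eq_zero, mul_eq_zero, or_iff_right hp]

lemma part_eq_zero_of_cocycles {f : Cochain 4} {a : Fin 9 → ℂ}
    (hf : (quaternary_equivariant 18).cbdInv 4 f = cocycles a) : part false f.1 = 0 := by
  refine part_four tableFourOdd_step coverFour_odd (fun τ X h => ?_)
    (by rw [show tableFourOdd.residual = [] by decide +kernel]; simp)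
  simp only [silent, Bool.and_eq_true, Nat.ble_eq, List.all_eq_true, decide_eq_true_eq] at h
  refine ⟨h.1, fun g δ u hg hu => ?_⟩
  have hc : IsCell (act g (templateFive τ)) := (isCell_five h.1).act (by rw [hg]; exact δ.isUnit)
  have h0 : part false (cocycles a).1 (act g (templateFive τ)) = 0 := by
    rw [part_cocycles a hc]
    simp [fun j => (waveT_template (waves.getD (j : Fin 9) .nil) h.1 hg hu).2 (h.2 _ (getD_mem_waves j))]
  rw [bd_part, ← h0, ← hf, part_apply, part_apply]
  have hb {t : Fin 5 → Vec} (ht : IsCell t) :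
      ((quaternary_equivariant 18).cbdInv 4 f).1 (Line.mk ∘ t) = bd f.1 (Line.mk ∘ t) := by
    rw [VoronoiData.Equivariant.cbdInv_apply]
    exact if_pos ht
  rw [hb hc, hb (isCell_reflection.2 hc)]

lemma eq_zero_of_cocycles_mem {a : Fin 9 → ℂ}
    (h : cocycles a ∈ LinearMap.range ((quaternary_equivariant 18).cbdInv 4)) : a = 0 := by
  obtain ⟨f, hf⟩ := h
  have hp := part_eq_zero_of_cocycles hf
  funext i
  obtain ⟨hX, hτ, h1⟩ := pivots_ok i
  obtain ⟨g, hg, hu⟩ := hX.exists_compat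
  have hg' : g.det = ((1 : ℤˣ) : ℤ) := by simpa using hg
  have hc : IsCell (act g (templateFive (pivots.getD i 0 % 4))) :=
    (isCell_five hτ).act (by rw [hg]; exact isUnit_one)
  have h2 : part false (cocycles a).1 (act g (templateFive (pivots.getD i 0 % 4))) = 0 := by
    have hb {t : Fin 5 → Vec} (ht : IsCell t) : (cocycles a).1 (Line.mk ∘ t) = bd f.1 (Line.mk ∘ t) := by
      rw [← hf, VoronoiData.Equivariant.cbdInv_apply]
      exact if_pos ht
    rw [part_apply, hb hc, hb (isCell_reflection.2 hc), ← part_apply, ← bd_part, hp]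
    simp [bd]
  rw [part_cocycles a hc, Finset.sum_eq_single i] at h2
  · refine (mul_eq_zero.1 ((mul_eq_zero.1 h2).resolve_left two_ne_zero)).resolve_right fun h3 => ?_
    have := h1 i
    rw [decide_eq_true ((waveT_template _ hτ hg' hu).1 h3)] at this
    simp at this
  · intro j _ hj
    have := h1 j
    rw [decide_eq_true (Ne.symm hj), decide_eq_true_eq] at this
    exact mul_eq_zero_of_right _ ((waveT_template _ hτ hg' hu).2 this)
  · simp

lemma finrank_range_add_nine : Module.finrank ℂ (LinearMap.range ((quaternary_equivariant 18).cbdInv 4)) + 9 ≤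
    Module.finrank ℂ (LinearMap.ker ((quaternary_equivariant 18).cbdInv 5)) := by
  have : FiniteDimensional ℂ (Cochain 5) :=
    VoronoiData.Equivariant.finiteDimensional_inv _ _ (quaternary_equivariant 18) 5
  have h1 : Module.finrank ℂ (LinearMap.range cocycles) = 9 := by
    rw [LinearMap.finrank_range_of_inj ((injective_iff_map_eq_zero _).2 fun a ha =>
      eq_zero_of_cocycles_mem (ha ▸ Submodule.zero_mem _))]
    simp
  have h2 := Submodule.finrank_sup_add_finrank_inf_eq (LinearMap.range ((quaternary_equivariant 18).cbdInv 4))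
    (LinearMap.range cocycles)
  have h3 : LinearMap.range ((quaternary_equivariant 18).cbdInv 4) ⊓ LinearMap.range cocycles = ⊥ := by
    refine (Submodule.eq_bot_iff _).2 ?_
    rintro _ ⟨h, a, rfl⟩
    rw [eq_zero_of_cocycles_mem h, map_zero]
  rw [h3, finrank_bot, add_zero, h1] at h2
  rw [← h2]
  refine Submodule.finrank_mono (sup_le ?_ ?_)
  · rintro _ ⟨f, rfl⟩
    refine LinearMap.mem_ker.2 (Subtype.ext ?_)
    rw [VoronoiData.Equivariant.cbdInv_apply, VoronoiData.Equivariant.cbdInv_apply]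
    exact VoronoiData.cbd_cbd _ f.2.2.2
  · rintro _ ⟨a, rfl⟩
    exact cocycles_mem a

end Voronoi

/-- `dim_ℂ H^5(Γ₀(18), ℂ) = 9`. -/
theorem finrank_H5_Gamma0_18 :
    Module.finrank ℂ (groupCohomology (Rep.trivial ℂ (Gamma0 18) ℂ) 5) = 9 := by
  have : FiniteDimensional ℂ (Voronoi.Cochain 4) :=
    Voronoi.VoronoiData.Equivariant.finiteDimensional_inv _ _ (Voronoi.quaternary_equivariant 18) 4
  have h1 := (Voronoi.quaternary_equivariant 18).finrank_H5 Voronoi.not_cell_three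
  have h2 := Voronoi.finrank_ker_five
  have h3 := Voronoi.finrank_ker_four
  have h4 : 171 ≤ Module.finrank ℂ (Voronoi.quaternary.inv (Gamma0 18) 4) := Voronoi.le_finrank_inv_four
  have h5 := Voronoi.finrank_range_add_nine
  have h6 := LinearMap.finrank_range_add_finrank_ker ((Voronoi.quaternary_equivariant 18).cbdInv 4)
  omega
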